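/- Let n ≥ 2. There exist positive constants C_mc, β depending only on n, a positive exponent a depending only on n and f_max, and (for each ρ > 0) a positive constant K depending only on n, f_max, ρ, such that the following holds. Let Ω ⊆ ℝⁿ be a convex open set with B₁ ⊆ Ω ⊆ B_n, and let v ∈ C²(Ω) ∩ C⁰(Ω̄) be a convex function with (det D²v)^{1/n} = f in Ω, v = 0 on ∂Ω, and 1 ≤ f ≤ f_max in Ω for a constant f_max. Fix ρ > 0 and q_in ∈ (0, ρ] with ω_{f|Ω_{ρ−q_in}}(q_in) ≤ C_mc, set Q_in := K q_in^{−a}, and suppose f is Dini continuous, i.e. E₀ := exp(β ∫_0^{q_in} ω_f(q) dq/q) < ∞. Then sup_{Ω_ρ} |D²v| ≤ Q_in E₀. -/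

import Mathlib

open scoped RealInnerProductSpace
open MeasureTheory
noncomputable section

abbrev Euc (n : ℕ) := EuclideanSpace ℝ (Fin n)

/-- Hessian matrix of `u` at `x`. -/
def hessianMatrix {n : ℕ} (u : Euc n → ℝ) (x : Euc n) : Matrix (Fin n) (Fin n) ℝ :=
  Matrix.of fun i j =>
    iteratedFDeriv ℝ 2 u x ![EuclideanSpace.single i 1, EuclideanSpace.single j 1]

/-- Determinant of the Hessian of `u` at `x`. -/
def hessDet {n : ℕ} (u : Euc n → ℝ) (x : Euc n) : ℝ := (hessianMatrix u x).det

/-- Operator norm of a matrix induced by the Euclidean vector norm. -/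
def matOpNorm {n : ℕ} (A : Matrix (Fin n) (Fin n) ℝ) : ℝ :=
  ‖(Matrix.toEuclideanCLM (𝕜 := ℝ) A : Euc n →L[ℝ] Euc n)‖

/-- Modulus of continuity of `f` on `U` at scale `q`. -/
def modCont {n : ℕ} (f : Euc n → ℝ) (U : Set (Euc n)) (q : ℝ) : ℝ :=
  sSup {c : ℝ | ∃ x ∈ U, ∃ y ∈ U, dist x y ≤ q ∧ c = |f x - f y|}

/-- `Ω_ρ`, the points of `Ω` at distance more than `ρ` from the boundary. -/
def innerSet {n : ℕ} (Ω : Set (Euc n)) (ρ : ℝ) : Set (Euc n) :=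
  {x ∈ Ω | ρ < Metric.infDist x (frontier Ω)}

open Filter Topology Set
open Real (exp log norm_eq_abs norm_of_nonneg exp_pos exp_le_exp exp_add sq_sqrt exp_nat_mul add_one_le_exp)
open Metric (ball closedBall isOpen_ball mem_ball ball_subset_closedBall mem_closedBall)
open Finset (mul_sum sum_congr sum_le_sum sum_add_distrib sum_sub_distrib abs_sum_le_sum_abs)

section
variable {n : ℕ} {u v f g w : Euc n → ℝ} {U K Ω : Set (Euc n)} {lam Lam C b c r s t α κ τ : ℝ} {h p x y z : Euc n}
  {A B N S : Euc n →L[ℝ] Euc n} {l : Euc n →L[ℝ] ℝ} {Q : Euc n →L[ℝ] Euc n →L[ℝ] ℝ}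
local notation "FunE" => Euc n → ℝ
local notation "DualE" => Euc n →L[ℝ] ℝ
local notation "EndE" => Euc n →L[ℝ] Euc n
local notation "BilE" => Euc n →L[ℝ] Euc n →L[ℝ] ℝ


/-- Standard basis vector. -/
def bv (i : Fin n) : Euc n := EuclideanSpace.single i 1

/-- Second derivative as a bilinear map. -/
def D2 (u : FunE) (x : Euc n) : BilE :=
  fderiv ℝ (fderiv ℝ u) x

/-- Matrix of a bilinear map. -/
def matB (b : BilE) : Matrix (Fin n) (Fin n) ℝ :=
  Matrix.of fun i j => b (bv i) (bv j)

def lap (u : FunE) (x : Euc n) : ℝ := ∑ i, D2 u x (bv i) (bv i)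

lemma hessianMatrix_eq (u : FunE) (x : Euc n) :
    hessianMatrix u x = matB (D2 u x) := by
  ext i j
  simp [hessianMatrix, matB, D2, iteratedFDeriv_two_apply, bv]

lemma trace_matB (b : BilE) :
    (matB b).trace = ∑ i, b (bv i) (bv i) := by
  simp [Matrix.trace, matB]

lemma vec_eq_sum (x : Euc n) : x = ∑ i, x i • bv i := by
  ext j
  simp [bv, Finset.sum_apply, Pi.single_apply]

lemma bil_expand (b : BilE) (x y : Euc n) :
    b x y = ∑ i, ∑ j, x i * y j * b (bv i) (bv j) := by
  conv_lhs => rw [vec_eq_sum x, vec_eq_sum y]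
  simp only [map_sum, map_smul, _root_.sum_apply, _root_.smul_apply,
    smul_eq_mul, mul_sum]
  refine Finset.sum_comm.trans ?_
  refine sum_congr rfl fun i _ => sum_congr rfl fun j _ => by ring

lemma dot_matB (b : BilE) (x : Euc n) :
    (⇑x : Fin n → ℝ) ⬝ᵥ ((matB b).mulVec (⇑x)) = b x x := by
  rw [bil_expand b x x]
  simp only [dotProduct, Matrix.mulVec, matB, Matrix.of_apply, mul_sum]
  refine sum_congr rfl fun i _ => sum_congr rfl fun j _ => by ring

/-- matrix of a linear map in the standard basis -/
def matL (L : EndE) : Matrix (Fin n) (Fin n) ℝ :=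
  Matrix.of fun i j => L (bv j) i

lemma det_matL (L : EndE) : (matL L).det = L.det := by
  have : matL L = LinearMap.toMatrix (EuclideanSpace.basisFun (Fin n) ℝ).toBasis
      (EuclideanSpace.basisFun (Fin n) ℝ).toBasis (L : Euc n →ₗ[ℝ] Euc n) := by
    ext i j
    simp [matL, LinearMap.toMatrix_apply, bv]
  rw [this, LinearMap.det_toMatrix]

lemma matB_comp (b b' : BilE) (L : EndE)
    (h : ∀ x y, b' x y = b (L x) (L y)) : matB b' = (matL L).transpose * matB b * matL L := by
  ext i j
  simp only [matB, Matrix.of_apply, h, Matrix.mul_apply, Matrix.transpose_apply, matL]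
  rw [bil_expand b]
  rw [Finset.sum_comm]
  refine sum_congr rfl fun k _ => ?_
  rw [Finset.sum_mul]
  refine sum_congr rfl fun l _ => by ring

lemma det_matB_comp (b b' : BilE) (L : EndE)
    (h : ∀ x y, b' x y = b (L x) (L y)) : (matB b').det = L.det ^ 2 * (matB b).det := by
  rw [matB_comp b b' L h, Matrix.det_mul, Matrix.det_mul, Matrix.det_transpose, det_matL]; ring

lemma det_matB_smul (b : BilE) (c : ℝ) :
    (matB (c • b)).det = c ^ n * (matB b).det := by
  have : matB (c • b) = c • matB b := by ext i j; simp [matB]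
  rw [this, Matrix.det_smul]; simp

def SymB (b : BilE) : Prop := ∀ x y, b x y = b y x

lemma posDef_matB (b : BilE) (hs : SymB b)
    (h0 : ∀ x, 0 ≤ b x x) (hd : 0 < (matB b).det) : (matB b).PosDef := by
  have hps : (matB b).PosSemidef := by
    rw [Matrix.posSemidef_iff_dotProduct_mulVec]
    refine ⟨?_, fun x => ?_⟩
    · ext i j; simp [matB, hs (bv i) (bv j)]
    · have := dot_matB b (WithLp.toLp 2 x)
      simp only [star_trivial] at *
      rw [this]; exact h0 _
  rw [hps.posDef_iff_isUnit]
  exact (Matrix.isUnit_iff_isUnit_det _).2 (isUnit_iff_ne_zero.2 hd.ne')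

lemma posDef_matB_apply (b : BilE) (h : (matB b).PosDef)
    (x : Euc n) (hx : x ≠ 0) : 0 < b x x := by
  rw [← dot_matB]
  have := h.dotProduct_mulVec_pos (x := (⇑x : Fin n → ℝ)) (by
    intro h; apply hx; ext i; exact congrFun h i)
  simpa using this

lemma posDef_matB_of_pos (b : BilE) (hs : SymB b)
    (h0 : ∀ x, x ≠ 0 → 0 < b x x) : (matB b).PosDef := by
  rw [Matrix.posDef_iff_dotProduct_mulVec]
  refine ⟨?_, fun x hx => ?_⟩
  · ext i j; simp [matB, hs (bv i) (bv j)]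
  · have := dot_matB b (WithLp.toLp 2 x)
    simp only [star_trivial] at *
    rw [this]; refine h0 _ fun h => hx ?_
    ext i; exact congrArg (fun z : Euc n => z i) h

lemma trace_ge_log_det (A : Matrix (Fin n) (Fin n) ℝ) (h : A.PosDef) :
    n + log A.det ≤ A.trace := by
  have hp := h.eigenvalues_pos
  rw [h.isHermitian.det_eq_prod_eigenvalues, h.isHermitian.trace_eq_sum_eigenvalues]
  simp only [RCLike.ofReal_real_eq_id, id]
  rw [Real.log_prod fun i _ => (hp i).ne']
  have : (n : ℝ) = ∑ i : Fin n, (1 : ℝ) := by simp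
  rw [this, ← sum_add_distrib]
  refine sum_le_sum fun i _ => ?_
  have := Real.log_le_sub_one_of_pos (hp i)
  linarith

lemma log_ge_quad {x η : ℝ} (h : |x - 1| ≤ η) (hη : η ≤ 1 / 2) :
    x - 1 - 2 * η ^ 2 ≤ log x := by
  have h1 := abs_le.1 h
  have hx : 0 < x := by linarith
  have h3 := Real.one_sub_inv_le_log_of_pos hx
  have h2 : (x - 1) ^ 2 ≤ η ^ 2 := by
    rw [← sq_abs]; exact pow_le_pow_left₀ (abs_nonneg _) h 2
  have h4 : x - 1 - (1 - x⁻¹) = (x - 1) ^ 2 / x := by field_simp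
  have h5 : (x - 1) ^ 2 / x ≤ 2 * η ^ 2 := by
    rw [div_le_iff₀ hx]
    nlinarith [sq_nonneg η]
  linarith

lemma trace_le_log_det (b : BilE) (hs : SymB b) {η : ℝ}
    (hη : η ≤ 1 / 2) (h : ∀ x, |b x x - ‖x‖ ^ 2| ≤ η * ‖x‖ ^ 2) :
    (matB b).trace ≤ n + log (matB b).det + 2 * n * η ^ 2 := by
  have hH : (matB b).IsHermitian := by ext i j; simp [matB, hs (bv i) (bv j)]
  have hp : ∀ i, |hH.eigenvalues i - 1| ≤ η := by
    intro i
    have h1 := h (hH.eigenvectorBasis i)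
    have h2 : b (hH.eigenvectorBasis i) (hH.eigenvectorBasis i) = hH.eigenvalues i := by
      rw [← dot_matB, hH.mulVec_eigenvectorBasis]
      have h3 : inner ℝ (hH.eigenvectorBasis i) (hH.eigenvectorBasis i) = (1:ℝ) := by
        rw [real_inner_self_eq_norm_sq, hH.eigenvectorBasis.norm_eq_one]; norm_num
      rw [dotProduct_smul, smul_eq_mul]
      rw [EuclideanSpace.inner_eq_star_dotProduct] at h3
      simp only [star_trivial] at h3
      rw [h3, mul_one]
    rw [h2, hH.eigenvectorBasis.norm_eq_one] at h1
    simpa using h1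
  rw [hH.det_eq_prod_eigenvalues, hH.trace_eq_sum_eigenvalues]
  simp only [RCLike.ofReal_real_eq_id, id]
  rw [Real.log_prod fun i _ => by have := abs_le.1 (hp i); intro h0; rw [h0] at this; linarith]
  have h1 : (n : ℝ) = ∑ i : Fin n, (1 : ℝ) := by simp
  have h2 : 2 * (n:ℝ) * η ^ 2 = ∑ i : Fin n, 2 * η ^ 2 := by simp; ring
  rw [h2, h1, ← sum_add_distrib, ← sum_add_distrib]
  refine sum_le_sum fun i _ => ?_
  have := log_ge_quad (hp i) hη
  linarith

/-! ### Calculus -/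

lemma D2_symm (h : ContDiffAt ℝ 2 u x) : SymB (D2 u x) := by
  intro a b
  exact (h.isSymmSndFDerivAt (by simp)).eq a b

lemma fderiv_comp_affine (x0 : Euc n) (L : EndE) (z : Euc n)
    (h : DifferentiableAt ℝ u (x0 + L z)) :
    fderiv ℝ (fun z => u (x0 + L z)) z = (fderiv ℝ u (x0 + L z)).comp L := by
  have h1 : HasFDerivAt (fun z => x0 + L z) L z := L.hasFDerivAt.const_add x0
  exact (h.hasFDerivAt.comp z h1).fderiv

lemma D2_comp_affine (x0 : Euc n) (L : EndE) (z : Euc n)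
    (h : ContDiffAt ℝ 2 u (x0 + L z)) (a b : Euc n) :
    D2 (fun z => u (x0 + L z)) z a b = D2 u (x0 + L z) (L a) (L b) := by
  have h1 : HasFDerivAt (fun z => x0 + L z) L z := L.hasFDerivAt.const_add x0
  have h2 : ∀ᶠ y in 𝓝 z, DifferentiableAt ℝ u (x0 + L y) := by
    have : ∀ᶠ y in 𝓝 (x0 + L z), ContDiffAt ℝ 2 u y := h.eventually (by simp)
    exact (h1.continuousAt.eventually this).mono fun y hy => hy.differentiableAt (by simp)
  have h3 : fderiv ℝ (fun z => u (x0 + L z)) =ᶠ[𝓝 z]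
      fun y => (fderiv ℝ u (x0 + L y)).comp L :=
    h2.mono fun y hy => fderiv_comp_affine x0 L y hy
  have h4 : DifferentiableAt ℝ (fderiv ℝ u) (x0 + L z) :=
    (h.fderiv_right (m := 1) (by norm_num)).differentiableAt (by simp)
  have h5 := (h4.hasFDerivAt.comp z h1).clm_comp (hasFDerivAt_const L z)
  unfold D2
  rw [h3.fderiv_eq]
  erw [h5.fderiv]
  simp

lemma hessDet_comp_affine (x0 : Euc n) (L : EndE) (z : Euc n)
    (h : ContDiffAt ℝ 2 u (x0 + L z)) :
    hessDet (fun z => u (x0 + L z)) z = L.det ^ 2 * hessDet u (x0 + L z) := by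
  unfold hessDet
  rw [hessianMatrix_eq, hessianMatrix_eq]
  exact det_matB_comp _ _ L (D2_comp_affine x0 L z h)

lemma D2_const_mul (c : ℝ) (z : Euc n) :
    D2 (fun z => c * u z) z = c • D2 u z := by
  unfold D2
  have h3 : fderiv ℝ (fun z => c * u z) = fun y => c • fderiv ℝ u y := by
    exact fderiv_const_smul_field (𝕜 := ℝ) (f := u) c
  rw [h3]
  exact congrFun (fderiv_const_smul_field (𝕜 := ℝ) (f := fderiv ℝ u) c) z

lemma hessDet_const_mul (c : ℝ) (z : Euc n) :
    hessDet (fun z => c * u z) z = c ^ n * hessDet u z := by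
  unfold hessDet
  rw [hessianMatrix_eq, hessianMatrix_eq, D2_const_mul, det_matB_smul]

lemma D2_congr (h : u =ᶠ[𝓝 z] v) : D2 u z = D2 v z := by
  unfold D2; exact (h.fderiv).fderiv_eq

lemma D2_add (hu : ContDiffAt ℝ 2 u z)
    (hv : ContDiffAt ℝ 2 v z) : D2 (fun y => u y + v y) z = D2 u z + D2 v z := by
  have h3 : fderiv ℝ (fun z => u z + v z) =ᶠ[𝓝 z] fun y => fderiv ℝ u y + fderiv ℝ v y := by
    filter_upwards [hu.eventually (by simp), hv.eventually (by simp)] with y h1 h2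
    exact fderiv_fun_add (h1.differentiableAt (by simp)) (h2.differentiableAt (by simp))
  unfold D2
  rw [h3.fderiv_eq]
  exact fderiv_fun_add ((hu.fderiv_right (m := 1) (by norm_num)).differentiableAt (by simp))
    ((hv.fderiv_right (m := 1) (by norm_num)).differentiableAt (by simp))

lemma D2_affine (c : ℝ) (l : DualE) (z : Euc n) :
    D2 (fun y => c + l y) z = 0 := by
  unfold D2
  have : fderiv ℝ (fun y => c + l y) = fun _ => l := by
    funext y; exact (l.hasFDerivAt.const_add c).fderiv
  rw [this]; simp

lemma contDiff_affine (c : ℝ) (l : DualE) {k : WithTop ℕ∞} :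
    ContDiff ℝ k (fun y => c + l y) := contDiff_const.add l.contDiff

lemma D2_add_affine (c : ℝ) (l : DualE)
    (hu : ContDiffAt ℝ 2 u z) : D2 (fun y => u y + (c + l y)) z = D2 u z := by
  rw [D2_add hu (contDiff_affine c l).contDiffAt, D2_affine]
  exact _root_.add_zero (D2 u z)

lemma hasDerivAt_line {x h : Euc n}
    (hu : DifferentiableAt ℝ u (x + t • h)) :
    HasDerivAt (fun s : ℝ => u (x + s • h)) (fderiv ℝ u (x + t • h) h) t := by
  have h1 : HasDerivAt (fun s : ℝ => x + s • h) h t := by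
    simpa using ((hasDerivAt_id t).smul_const h).const_add x
  exact hu.hasFDerivAt.comp_hasDerivAt t h1

lemma hasDerivAt_line2 {x h : Euc n} (k : Euc n)
    (hu : ContDiffAt ℝ 2 u (x + t • h)) :
    HasDerivAt (fun s : ℝ => fderiv ℝ u (x + s • h) k) (D2 u (x + t • h) h k) t := by
  have h1 : HasDerivAt (fun s : ℝ => x + s • h) h t := by
    simpa using ((hasDerivAt_id t).smul_const h).const_add x
  have h4 : DifferentiableAt ℝ (fderiv ℝ u) (x + t • h) :=
    (hu.fderiv_right (m := 1) (by norm_num)).differentiableAt (by simp)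
  have h5 := h4.hasFDerivAt.comp_hasDerivAt t h1
  exact (h5.clm_apply (hasDerivAt_const t k)).congr_deriv (by simp [D2])

/-- tangent plane inequality -/
lemma tangent_le (hc : ConvexOn ℝ U u)
    (hx : x ∈ U) (hz : z ∈ U) (hd : DifferentiableAt ℝ u x) :
    u x + fderiv ℝ u x (z - x) ≤ u z := by
  have h0 : DifferentiableAt ℝ u (x + (0:ℝ) • (z - x)) := by simpa using hd
  have h1 := hasDerivAt_line (x := x) (h := z - x) (t := 0) h0
  have h2 : Tendsto (fun t : ℝ => t⁻¹ • (u (x + t • (z - x)) - u x)) (𝓝[>] 0)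
      (𝓝 (fderiv ℝ u x (z - x))) := by
    have := h1.hasDerivWithinAt (s := Ioi 0)
    rw [hasDerivWithinAt_iff_tendsto_slope' (by simp)] at this
    simpa [slope_fun_def, slope] using this
  have h3 : fderiv ℝ u x (z - x) ≤ u z - u x := by
    refine le_of_tendsto h2 ?_
    filter_upwards [Ioo_mem_nhdsGT (show (0:ℝ) < 1 by norm_num)] with t ht
    have := hc.2 hx hz (sub_nonneg.2 ht.2.le) ht.1.le (by ring)
    have e : x + t • (z - x) = (1 - t) • x + t • z := by module
    rw [e, smul_eq_mul, inv_mul_le_iff₀ ht.1]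
    simp only [smul_eq_mul] at this
    linarith
  linarith

lemma D2_nonneg (hU : IsOpen U) (hc : ConvexOn ℝ U u)
    (hd : ContDiffOn ℝ 2 u U) (hx : x ∈ U) (h : Euc n) : 0 ≤ D2 u x h h := by
  have hcd : ∀ y ∈ U, ContDiffAt ℝ 2 u y := fun y hy => hd.contDiffAt (hU.mem_nhds hy)
  have h1 := hasDerivAt_line2 (x := x) (h := h) h (t := 0) (by simpa using hcd x hx)
  have h2 : Tendsto (fun t : ℝ => t⁻¹ • (fderiv ℝ u (x + t • h) h - fderiv ℝ u x h)) (𝓝[>] 0)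
      (𝓝 (D2 u x h h)) := by
    have := h1.hasDerivWithinAt (s := Ioi 0)
    rw [hasDerivWithinAt_iff_tendsto_slope' (by simp)] at this
    simpa [slope_fun_def, slope] using this
  refine ge_of_tendsto h2 ?_
  have hev : ∀ᶠ t : ℝ in 𝓝[>] 0, x + t • h ∈ U := by
    have : Continuous fun t : ℝ => x + t • h := by fun_prop
    exact nhdsWithin_le_nhds (this.continuousAt.eventually (by simpa using hU.mem_nhds hx))
  filter_upwards [hev, self_mem_nhdsWithin] with t ht ht0
  have ht0 : 0 < t := ht0
  have a1 := tangent_le hc hx ht ((hcd x hx).differentiableAt (by simp))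
  have a2 := tangent_le hc ht hx ((hcd _ ht).differentiableAt (by simp))
  have e1 : x + t • h - x = t • h := by module
  have e2 : x - (x + t • h) = (-t) • h := by module
  rw [e1, map_smul] at a1
  rw [e2, map_smul] at a2
  simp only [smul_eq_mul] at *
  have : 0 ≤ t * (fderiv ℝ u (x + t • h) h - fderiv ℝ u x h) := by linarith
  have := nonneg_of_mul_nonneg_right this ht0
  positivity

/-! ### Gradient map and Alexandrov estimate -/

/-- Riesz map, real-linear. -/
def dualL : (DualE) →L[ℝ] Euc n :=
  LinearMap.toContinuousLinearMap
    { toFun := fun l => ∑ i, l (bv i) • bv i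
      map_add' := by intro a b; simp [add_smul, sum_add_distrib]
      map_smul' := by intro a b; simp [mul_smul, Finset.smul_sum] }

lemma inner_dualL (l : DualE) (y : Euc n) : ⟪dualL l, y⟫ = l y := by
  have h : dualL l = ∑ i, l (bv i) • bv i := rfl
  rw [h, sum_inner]
  conv_rhs => rw [vec_eq_sum y, map_sum]
  refine sum_congr rfl fun i _ => ?_
  rw [inner_smul_left, map_smul]
  simp [bv, EuclideanSpace.inner_single_left, mul_comm]

def grad (u : FunE) (x : Euc n) : Euc n := dualL (fderiv ℝ u x)

lemma inner_grad (u : FunE) (x y : Euc n) : ⟪grad u x, y⟫ = fderiv ℝ u x y :=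
  inner_dualL _ _

def gradL (u : FunE) (x : Euc n) : EndE := dualL.comp (D2 u x)

lemma inner_gradL (u : FunE) (x y z : Euc n) : ⟪gradL u x y, z⟫ = D2 u x y z :=
  inner_dualL _ _

lemma hasFDerivAt_grad (h : ContDiffAt ℝ 2 u x) :
    HasFDerivAt (grad u) (gradL u x) x := by
  have h4 : DifferentiableAt ℝ (fderiv ℝ u) x :=
    (h.fderiv_right (m := 1) (by norm_num)).differentiableAt (by simp)
  exact dualL.hasFDerivAt.comp x h4.hasFDerivAt

lemma det_gradL (u : FunE) (x : Euc n) : (gradL u x).det = hessDet u x := by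
  rw [← det_matL, hessDet, hessianMatrix_eq, ← Matrix.det_transpose]
  congr 1
  ext i j
  have := inner_gradL u x (bv i) (bv j)
  simp only [matL, matB, Matrix.of_apply, Matrix.transpose_apply]
  rw [← this]
  simp [bv, EuclideanSpace.inner_single_right]

/-- Alexandrov estimate. -/
lemma alex_A {Lam : ℝ} (hK : IsOpen K)
    (hb : Bornology.IsBounded K) (hd : ContDiffOn ℝ 2 w K) (hc : ContinuousOn w (closure K))
    (h0 : ∀ z ∈ frontier K, w z = 0) (hL : ∀ z ∈ K, |hessDet w z| ≤ Lam)
    (hz : z ∈ K) :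
    volume {ξ : Euc n | ∀ y ∈ closure K, ⟪ξ, y - z⟫ < - w z} ≤ ENNReal.ofReal Lam * volume K := by
  have hcd : ∀ y ∈ K, ContDiffAt ℝ 2 w y := fun y hy => hd.contDiffAt (hK.mem_nhds hy)
  have hsub : {ξ : Euc n | ∀ y ∈ closure K, ⟪ξ, y - z⟫ < - w z} ⊆ grad w '' K := by
    intro ξ hξ
    have hcomp : IsCompact (closure K) := hb.isCompact_closure
    obtain ⟨y, hy, hmin⟩ := hcomp.exists_isMinOn ⟨z, subset_closure hz⟩
      (f := fun y => w y - ⟪ξ, y⟫) (hc.sub (by fun_prop))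
    have hyK : y ∈ K := by
      by_contra hyK
      have hfr : y ∈ frontier K := by
        rw [frontier, hK.interior_eq]; exact ⟨hy, hyK⟩
      have h1 := hmin (subset_closure hz)
      have h2 := hξ y hy
      simp only [mem_ofPred_eq, h0 y hfr, inner_sub_right] at h1 h2
      linarith
    refine ⟨y, hyK, ?_⟩
    have hloc : IsLocalMin (fun y => w y - ⟪ξ, y⟫) y :=
      Filter.eventually_of_mem (hK.mem_nhds hyK) fun t ht => hmin (subset_closure ht)
    have h1 : HasFDerivAt (fun y => w y - ⟪ξ, y⟫) (fderiv ℝ w y - innerSL ℝ ξ) y :=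
      ((hcd y hyK).differentiableAt (by simp)).hasFDerivAt.sub (innerSL ℝ ξ).hasFDerivAt
    have h2 := hloc.hasFDerivAt_eq_zero h1
    refine ext_inner_right ℝ fun v => ?_
    rw [inner_grad, sub_eq_zero.1 h2]; simp
  refine (measure_mono hsub).trans ?_
  refine (addHaar_image_le_lintegral_abs_det_fderiv volume hK.measurableSet
    (f' := gradL w) fun x hx => (hasFDerivAt_grad (hcd x hx)).hasFDerivWithinAt).trans ?_
  calc _ ≤ ∫⁻ x in K, ENNReal.ofReal Lam := by
        refine setLIntegral_mono' hK.measurableSet fun x hx => ?_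
        rw [det_gradL]; exact ENNReal.ofReal_le_ofReal (hL x hx)
    _ = _ := by simp

/-! ### John-like position -/

/-- linear map with prescribed columns -/
def colMap (p : Fin n → Euc n) : EndE :=
  LinearMap.toContinuousLinearMap
    { toFun := fun c => ∑ i, c i • p i
      map_add' := by intro a b; simp [add_smul, sum_add_distrib]
      map_smul' := by intro a b; simp [mul_smul, Finset.smul_sum] }

lemma colMap_apply (p : Fin n → Euc n) (c : Euc n) : colMap p c = ∑ i, c i • p i := rfl

lemma colMap_bv (p : Fin n → Euc n) (i : Fin n) : colMap p (bv i) = p i := by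
  rw [colMap_apply]
  rw [Finset.sum_eq_single i]
  · simp [bv]
  · intro j _ hj; simp [bv, hj]
  · simp

lemma coord_le_norm (x : Euc n) (i : Fin n) : |x i| ≤ ‖x‖ := by
  have := PiLp.norm_apply_le x i; simpa using this

lemma norm_le_sum_coord (x : Euc n) : ‖x‖ ≤ ∑ i, |x i| := by
  conv_lhs => rw [vec_eq_sum x]
  refine (norm_sum_le _ _).trans (sum_le_sum fun i _ => ?_)
  rw [norm_smul]; simp [bv]

def detM (p : Fin n → Euc n) : Matrix (Fin n) (Fin n) ℝ := Matrix.of fun i j => p i j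

lemma john : ∃ C : ℝ, 1 ≤ C ∧ ∀ K : Set (Euc n), IsOpen K → Convex ℝ K →
    Bornology.IsBounded K → K.Nonempty → ∃ (x0 : Euc n) (T : EndE), T.det ≠ 0 ∧
      (∀ z, ‖z‖ < 1 → x0 + T z ∈ K) ∧ (∀ y ∈ K, ∃ z, ‖z‖ < C ∧ y = x0 + T z) := by
  set r : ℝ := 1 / ((n:ℝ) + 1) ^ 2 with hr
  have hrpos : 0 < r := by positivity
  refine ⟨(2 * n + 1) / r, ?_, ?_⟩
  · rw [le_div_iff₀ hrpos, hr, one_mul, div_le_iff₀ (by positivity)]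
    nlinarith [Nat.cast_nonneg (α := ℝ) n, sq_nonneg ((n:ℝ)), mul_nonneg (Nat.cast_nonneg (α := ℝ) n) (sq_nonneg ((n:ℝ)+1))]
  intro K hK hc hb hne
  have hcomp : IsCompact (closure K) := hb.isCompact_closure
  -- maximize determinant
  set g : (Euc n × (Fin n → Euc n)) → ℝ := fun q => |(detM fun i => q.2 i - q.1).det| with hg
  have hgc : Continuous g := by
    refine continuous_abs.comp (Continuous.matrix_det ?_)
    refine continuous_matrix fun i j => ?_
    simp only [detM, Matrix.of_apply, PiLp.sub_apply]
    fun_prop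
  have hcomp2 : IsCompact (closure K ×ˢ (Set.univ.pi fun _ : Fin n => closure K)) :=
    hcomp.prod (isCompact_univ_pi fun _ => hcomp)
  obtain ⟨a, ha⟩ := hne
  obtain ⟨⟨p0, p⟩, hp, hmax⟩ := hcomp2.exists_isMaxOn
    ⟨(a, fun _ => a), ⟨subset_closure ha, fun _ _ => subset_closure ha⟩⟩ hgc.continuousOn
  have hp0 : p0 ∈ closure K := hp.1
  have hpi : ∀ i, p i ∈ closure K := fun i => hp.2 i (mem_univ i)
  set A := detM fun i => p i - p0 with hA
  have hmax' : ∀ q0 ∈ closure K, ∀ q : Fin n → Euc n, (∀ i, q i ∈ closure K) →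
      |(detM fun i => q i - q0).det| ≤ |A.det| := fun q0 h0 q hq =>
    hmax (show (q0, q) ∈ _ from ⟨h0, fun i _ => hq i⟩)
  have hdet : A.det ≠ 0 := by
    obtain ⟨ε, hε, hball⟩ := Metric.isOpen_iff.1 hK a ha
    have h1 := hmax' a (subset_closure ha) (fun i => a + (ε / 2) • bv i) (fun i =>
      subset_closure (hball (by
        rw [mem_ball, dist_eq_norm, add_sub_cancel_left, norm_smul]
        simp [bv, abs_of_pos hε]; linarith)))
    have h2 : (detM fun i => a + (ε / 2) • bv i - a) = (ε/2) • (1 : Matrix (Fin n) (Fin n) ℝ) := by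
      ext i j
      simp [detM, bv, Matrix.one_apply, Pi.single_apply, eq_comm]
    rw [h2, Matrix.det_smul] at h1
    intro h
    rw [h] at h1
    simp at h1
    exact absurd h1 (by simp [hε.ne'])
  set T := colMap fun i => p i - p0 with hT
  have hTdet : T.det = A.det := by
    rw [← det_matL, ← Matrix.det_transpose]
    congr 1
    ext i j
    simp [matL, hA, detM, hT, colMap_bv]
  -- coefficients
  have hcoef : ∀ y ∈ closure K, ∃ c : Euc n, (∀ i, |c i| ≤ 1) ∧ y = p0 + T c := by
    intro y hy
    set b : Fin n → ℝ := ⇑(y - p0) with hbdef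
    refine ⟨WithLp.toLp 2 ((A.det)⁻¹ • Matrix.cramer A.transpose b), fun i => ?_, ?_⟩
    · simp only [Pi.smul_apply, smul_eq_mul, Matrix.cramer_transpose_apply, abs_mul, abs_inv]
      rw [inv_mul_le_iff₀ (abs_pos.2 hdet), mul_one]
      have h1 := hmax' p0 hp0 (Function.update p i y) (fun j => by
        by_cases h : j = i
        · subst h; simpa using hy
        · simpa [Function.update_of_ne h] using hpi j)
      have e : A.updateRow i b = detM fun j => Function.update p i y j - p0 := ?_
      · rw [e]; exact h1
      ext j k
      by_cases h : j = i
      · subst h; simp [detM, hbdef]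
      · simp [detM, Matrix.updateRow_ne h, Function.update_of_ne h, hA]
    · have h1 := Matrix.mulVec_cramer A.transpose b
      ext j
      have h2 := congrFun h1 j
      simp only [Matrix.mulVec, dotProduct, Matrix.transpose_apply, Matrix.det_transpose,
        Pi.smul_apply, smul_eq_mul] at h2
      simp only [hT, colMap_apply, PiLp.add_apply, WithLp.ofLp_sum, Finset.sum_apply,
        PiLp.smul_apply, Pi.smul_apply, smul_eq_mul]
      have h3 : ∑ x, (A.det)⁻¹ * (Matrix.cramer A.transpose b x) * (p x - p0) j
          = (A.det)⁻¹ * ∑ x, A x j * Matrix.cramer A.transpose b x := by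
        rw [mul_sum]
        refine sum_congr rfl fun x _ => ?_
        simp [hA, detM]; ring
      have h4 : y j = p0 j + (A.det)⁻¹ * ∑ x, A x j * Matrix.cramer A.transpose b x := by
        rw [h2, inv_mul_cancel_left₀ hdet]; simp [hbdef]
      rw [h4, ← h3]
  set m : Euc n := WithLp.toLp 2 fun _ => 1 / ((n:ℝ) + 1) with hm
  have hin : ∀ c : Euc n, (∀ i, 0 ≤ c i) → ∑ i, c i ≤ 1 → p0 + T c ∈ closure K := by
    intro c h1 h2
    have hcc := hc.closure
    have e : p0 + T c = (1 - ∑ i, c i) • p0 + ∑ i, c i • p i := by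
      rw [hT, colMap_apply]
      simp only [smul_sub, sum_sub_distrib, ← Finset.sum_smul]
      module
    rw [e]
    have e2 : (1 - ∑ i, c i) • p0 + ∑ i, c i • p i =
        ∑ i : Option (Fin n), (Option.elim i (1 - ∑ i, c i) fun i => c i) • (Option.elim i p0 p) := by
      rw [Fintype.sum_option]; rfl
    rw [e2]
    refine hcc.sum_mem ?_ ?_ ?_
    · rintro (_ | i) _
      · simpa using h2
      · simpa using h1 i
    · rw [Fintype.sum_option]; simp
    · rintro (_ | i) _
      · simpa using hp0
      · simpa using hpi i
  have hdet' : T.det ≠ 0 := by rw [hTdet]; exact hdet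
  let Te : Euc n ≃L[ℝ] Euc n := T.toContinuousLinearEquivOfDetNeZero hdet'
  have hTe : ∀ z, Te z = T z := fun z => by simp [Te]
  have hsmall : ∀ d : Euc n, ‖d‖ < r → p0 + T (m + d) ∈ K := by
    have hopen : IsOpen ((fun z => p0 + Te z) '' ball m r) := by
      have : (fun z => p0 + Te z) = (Homeomorph.addLeft p0) ∘ Te := rfl
      rw [this, image_comp]
      exact (Homeomorph.addLeft p0).isOpenMap _ (Te.toHomeomorph.isOpenMap _ isOpen_ball)
    have hsub : ((fun z => p0 + Te z) '' ball m r) ⊆ closure K := by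
      rintro _ ⟨z, hz, rfl⟩
      simp only [hTe]
      rw [mem_ball, dist_eq_norm] at hz
      have hco : ∀ i, |z i - 1 / ((n:ℝ) + 1)| < r := fun i => by
        have := (coord_le_norm (z - m) i).trans_lt hz
        simpa [hm] using this
      have hn1 : r ≤ 1 / ((n:ℝ) + 1) := by
        rw [hr]; apply one_div_le_one_div_of_le (by positivity)
        nlinarith [Nat.cast_nonneg (α := ℝ) n]
      refine hin z (fun i => ?_) ?_
      · have := (abs_lt.1 (hco i)).1; linarith
      · calc ∑ i, z i ≤ ∑ i : Fin n, (1 / ((n:ℝ) + 1) + r) :=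
              sum_le_sum fun i _ => by have := (abs_lt.1 (hco i)).2; linarith
          _ = n * (1 / ((n:ℝ) + 1) + r) := by simp; ring
          _ ≤ 1 := by
            rw [hr]
            have hnn : (0:ℝ) ≤ n := Nat.cast_nonneg _
            rw [div_add_div _ _ (by positivity) (by positivity), mul_div_assoc', div_le_one (by positivity)]
            nlinarith [mul_nonneg hnn hnn, mul_nonneg hnn (mul_nonneg hnn hnn)]
    have hint := hc.interior_closure_eq_interior_of_nonempty_interior
      (by rw [hK.interior_eq]; exact ⟨a, ha⟩)
    have h3 := interior_maximal hsub hopen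
    rw [hint, hK.interior_eq] at h3
    intro d hd
    have := h3 ⟨m + d, by simpa [mem_ball, dist_eq_norm] using hd, rfl⟩
    simpa [hTe] using this
  refine ⟨p0 + T m, r • T, ?_, fun z hz => ?_, fun y hy => ?_⟩
  · have : (r • T).det = r ^ n * T.det := by
      change LinearMap.det (r • (T : Euc n →ₗ[ℝ] Euc n)) = _
      rw [LinearMap.det_smul]; simp
    rw [this]; exact mul_ne_zero (by positivity) hdet'
  · have := hsmall (r • z) (by rw [norm_smul, norm_of_nonneg hrpos.le]; nlinarith)
    rw [map_add, map_smul] at this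
    simpa [add_assoc] using this
  · obtain ⟨c, hc1, hc2⟩ := hcoef y (subset_closure hy)
    refine ⟨r⁻¹ • (c - m), ?_, ?_⟩
    · rw [norm_smul, norm_inv, norm_of_nonneg hrpos.le, div_eq_inv_mul]
      refine mul_lt_mul_of_pos_left ?_ (by positivity)
      refine lt_of_le_of_lt (b := 2 * (n:ℝ)) ?_ (by linarith)
      refine (norm_le_sum_coord _).trans ?_
      calc ∑ i, |(c - m) i| ≤ ∑ i : Fin n, (2:ℝ) := by
            refine sum_le_sum fun i _ => ?_
            have h1 := abs_le.1 (hc1 i)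
            have h2 : 0 ≤ 1 / ((n:ℝ) + 1) := by positivity
            have h3 : 1 / ((n:ℝ) + 1) ≤ 1 := by
              rw [div_le_one (by positivity)]; linarith [Nat.cast_nonneg (α := ℝ) n]
            simp only [PiLp.sub_apply, hm]
            rw [abs_le]; constructor <;> linarith
        _ = 2 * (n:ℝ) := by simp; ring
    · rw [hc2]
      simp [smul_smul, hrpos.ne']

/-! ### Maximum principle -/

lemma D2_nonpos_of_localMax (hm : IsLocalMax u x)
    (hu : ContDiffAt ℝ 2 u x) (h : Euc n) : D2 u x h h ≤ 0 := by
  by_contra hcon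
  push Not at hcon
  have h1 := hasDerivAt_line2 (x := x) (h := h) h (t := 0) (by simpa using hu)
  have hd0 : fderiv ℝ u x = 0 := hm.fderiv_eq_zero
  have h2 : Tendsto (fun t : ℝ => t⁻¹ • (fderiv ℝ u (x + t • h) h - fderiv ℝ u x h)) (𝓝[>] 0)
      (𝓝 (D2 u x h h)) := by
    have := h1.hasDerivWithinAt (s := Ioi 0)
    rw [hasDerivWithinAt_iff_tendsto_slope' (by simp)] at this
    simpa [slope_fun_def, slope] using this
  have hpos := h2.eventually (lt_mem_nhds hcon)
  have hcont : Continuous fun t : ℝ => x + t • h := by fun_prop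
  have htend : Tendsto (fun t : ℝ => x + t • h) (𝓝 0) (𝓝 x) := by
    have := hcont.tendsto 0; simpa using this
  have hmax : ∀ᶠ t : ℝ in 𝓝 0, u (x + t • h) ≤ u x := htend.eventually hm
  have hdiff : ∀ᶠ t : ℝ in 𝓝 0, ContDiffAt ℝ 2 u (x + t • h) :=
    htend.eventually (hu.eventually (by simp))
  obtain ⟨ε, hε, hball⟩ := Metric.eventually_nhds_iff.1 (hmax.and hdiff)
  obtain ⟨ε', hε', hpos'⟩ := (nhdsGT_basis (0:ℝ)).eventually_iff.1 hpos
  set t := min ε ε' / 2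
  have ht : 0 < t := by positivity
  have ht1 : t < ε := by have := min_le_left ε ε'; simp only [t]; linarith [lt_min hε hε']
  have ht2 : t < ε' := by have := min_le_right ε ε'; simp only [t]; linarith [lt_min hε hε']
  have hd : ∀ s ∈ Icc 0 t, HasDerivAt (fun s : ℝ => u (x + s • h)) (fderiv ℝ u (x + s • h) h) s := by
    intro s hs
    refine hasDerivAt_line ((hball (y := s) ?_).2.differentiableAt (by simp))
    rw [Real.dist_eq, sub_zero, abs_of_nonneg hs.1]; linarith [hs.2]
  obtain ⟨c, hc, hc2⟩ := exists_hasDerivAt_eq_slope (fun s : ℝ => u (x + s • h)) _ ht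
    (fun s hs => (hd s hs).continuousAt.continuousWithinAt) (fun s hs => hd s ⟨hs.1.le, hs.2.le⟩)
  have h3 := hpos' ⟨hc.1, hc.2.trans ht2⟩
  rw [hd0] at h3
  have h4 := (hball (y := t) (by rw [Real.dist_eq, sub_zero, abs_of_pos ht]; exact ht1)).1
  simp only [ContinuousLinearMap.zero_apply, sub_zero, smul_eq_mul] at h3
  have h5 : 0 < fderiv ℝ u (x + c • h) h := by
    have := hc.1
    by_contra hh
    push Not at hh
    have : c⁻¹ * fderiv ℝ u (x + c • h) h ≤ 0 := mul_nonpos_of_nonneg_of_nonpos (by positivity) hh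
    linarith
  simp only [zero_smul, add_zero, sub_zero] at hc2
  rw [hc2] at h5
  have : (u (x + t • h) - u x) / t ≤ 0 := div_nonpos_of_nonpos_of_nonneg (by linarith) ht.le
  linarith

lemma posDef_hess (hU : IsOpen U) (hc : ConvexOn ℝ U u)
    (hd : ContDiffOn ℝ 2 u U) (hx : x ∈ U) (h0 : 0 < hessDet u x) :
    (matB (D2 u x)).PosDef :=
  posDef_matB _ (D2_symm (hd.contDiffAt (hU.mem_nhds hx))) (D2_nonneg hU hc hd hx)
    (by rw [← hessianMatrix_eq]; exact h0)

lemma lap_ge (hU : IsOpen U) (hc : ConvexOn ℝ U u)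
    (hd : ContDiffOn ℝ 2 u U) (hx : x ∈ U) (h0 : 0 < hessDet u x) :
    n + log (hessDet u x) ≤ lap u x := by
  have := trace_ge_log_det _ (posDef_hess hU hc hd hx h0)
  rwa [trace_matB, ← hessianMatrix_eq] at this

lemma D2_normsq (x a b : Euc n) : D2 (fun y : Euc n => ‖y‖ ^ 2) x a b = 2 * ⟪a, b⟫ := by
  have h : fderiv ℝ (fun y : Euc n => ‖y‖ ^ 2) = fun y => (2:ℝ) • innerSL ℝ y := by
    funext y; rw [fderiv_norm_sq_apply]; ext; simp
  unfold D2
  rw [h]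
  have : HasFDerivAt (fun y : Euc n => (2:ℝ) • innerSL ℝ y) ((2:ℝ) • innerSL ℝ) x :=
    ((innerSL ℝ : BilE).hasFDerivAt).const_smul (2:ℝ)
  rw [this.fderiv]; simp; rfl

lemma inner_bv (i : Fin n) : ⟪(bv i : Euc n), bv i⟫ = 1 := by simp [bv]

lemma norm_bv (i : Fin n) : ‖(bv i : Euc n)‖ = 1 := by simp [bv]

lemma contDiff_normsq {k : WithTop ℕ∞} : ContDiff ℝ k (fun y : Euc n => ‖y‖ ^ 2) :=
  contDiff_norm_sq ℝ

lemma parab_bound (hn : 1 ≤ n) (hd : ContDiffOn ℝ 2 u (ball 0 1))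
    (hc : ConvexOn ℝ (ball 0 1) u) (h1 : ∀ z ∈ ball (0 : Euc n) 1, 1 ≤ hessDet u z)
    (h0 : ∀ z ∈ ball (0 : Euc n) 1, u z ≤ 0) : u 0 ≤ -1 / 8 := by
  have hsub : closedBall (0 : Euc n) (3/4) ⊆ ball 0 1 :=
    Metric.closedBall_subset_ball (by norm_num)
  set F : FunE := fun y => u y + (-1/4) * ‖y‖ ^ 2 with hF
  obtain ⟨y, hy, hmax⟩ := (isCompact_closedBall (0 : Euc n) (3/4)).exists_isMaxOn
    ⟨0, by simp; norm_num⟩ (f := F) ((hd.continuousOn.mono hsub).add (by fun_prop))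
  have hyb := hsub hy
  have hF0 := hmax (show (0 : Euc n) ∈ closedBall 0 (3/4) by simp; norm_num)
  simp only [mem_ofPred_eq, hF, norm_zero] at hF0
  rcases lt_or_ge ‖y‖ (3/4) with hlt | hge
  · exfalso
    have hloc : IsLocalMax F y := by
      refine Filter.eventually_of_mem (isOpen_ball.mem_nhds (x := y)
        (by simpa using hlt : y ∈ ball (0 : Euc n) (3/4))) fun t ht => ?_
      exact hmax (ball_subset_closedBall ht)
    have hu := hd.contDiffAt (isOpen_ball.mem_nhds hyb)
    have hq : ContDiffAt ℝ 2 (fun y : Euc n => (-1/4) * ‖y‖ ^ 2) y :=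
      (contDiff_const.mul contDiff_normsq).contDiffAt
    have hD : ∀ i, D2 u y (bv i) (bv i) ≤ 1 / 2 := by
      intro i
      have := D2_nonpos_of_localMax hloc (hu.add hq) (bv i)
      rw [hF, D2_add hu hq, D2_const_mul] at this
      simp only [_root_.add_apply, _root_.smul_apply, D2_normsq, inner_bv, smul_eq_mul] at this
      linarith
    have hl := lap_ge isOpen_ball hc hd hyb (by linarith [h1 y hyb])
    have hl2 := Real.log_nonneg (h1 y hyb)
    have hl3 : lap u y ≤ ∑ i : Fin n, (1/2 : ℝ) := sum_le_sum fun i _ => hD i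
    simp at hl3
    have : (1:ℝ) ≤ n := by exact_mod_cast hn
    linarith
  · have := h0 y hyb
    nlinarith

/-! ### Convex domains with zero boundary data -/

structure Dom (K : Set (Euc n)) (w : FunE) (lam Lam : ℝ) : Prop where
  op : IsOpen K
  cvx : Convex ℝ K
  bdd : Bornology.IsBounded K
  cw : ConvexOn ℝ K w
  cd : ContDiffOn ℝ 2 w K
  cont : ContinuousOn w (closure K)
  zero : ∀ z ∈ frontier K, w z = 0
  pos : 0 < lam
  det : ∀ z ∈ K, lam ≤ hessDet w z ∧ hessDet w z ≤ Lam

lemma Dom.cda (h : Dom K w lam Lam)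
    (hz : z ∈ K) : ContDiffAt ℝ 2 w z := h.cd.contDiffAt (h.op.mem_nhds hz)

lemma Dom.nonpos (hn : 1 ≤ n)
    (h : Dom K w lam Lam) (hz : z ∈ K) : w z ≤ 0 := by
  obtain ⟨y, hy, hmax⟩ := h.bdd.isCompact_closure.exists_isMaxOn ⟨z, subset_closure hz⟩ h.cont
  by_cases hyK : y ∈ K
  · exfalso
    have hloc : IsLocalMax w y :=
      Filter.eventually_of_mem (h.op.mem_nhds hyK) fun t ht => hmax (subset_closure ht)
    have h1 := D2_nonpos_of_localMax hloc (h.cda hyK) (bv ⟨0, hn⟩)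
    have h2 := posDef_matB_apply _ (posDef_hess h.op h.cw h.cd hyK (h.pos.trans_le (h.det y hyK).1))
      (bv ⟨0, hn⟩) (by simp [bv])
    linarith
  · have := h.zero y (by rw [frontier, h.op.interior_eq]; exact ⟨hy, hyK⟩)
    have h2 := hmax (subset_closure hz)
    simp only [mem_ofPred_eq] at h2
    linarith

def affH (x0 : Euc n) (T : EndE) (hT : T.det ≠ 0) : Euc n ≃ₜ Euc n :=
  (T.toContinuousLinearEquivOfDetNeZero hT).toHomeomorph.trans (Homeomorph.addLeft x0)

lemma affH_apply (x0 : Euc n) (T : EndE) (hT : T.det ≠ 0) (z : Euc n) :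
    affH x0 T hT z = x0 + T z := by simp [affH]

def affA (x0 : Euc n) (T : EndE) : Euc n →ᵃ[ℝ] Euc n :=
  (T : Euc n →ₗ[ℝ] Euc n).toAffineMap + AffineMap.const ℝ _ x0

lemma affA_apply (x0 : Euc n) (T : EndE) (z : Euc n) :
    affA x0 T z = x0 + T z := by simp [affA, add_comm]

lemma convexOn_comp_aff (h : ConvexOn ℝ K w)
    (x0 : Euc n) (T : EndE) :
    ConvexOn ℝ {z | x0 + T z ∈ K} (fun z => w (x0 + T z)) := by
  have := h.comp_affineMap (affA x0 T)
  have e : ⇑(affA x0 T) = fun z => x0 + T z := funext (affA_apply x0 T)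
  rw [e] at this
  exact this

lemma contDiffOn_comp_aff (h : ContDiffOn ℝ 2 w K)
    (x0 : Euc n) (T : EndE) :
    ContDiffOn ℝ 2 (fun z => w (x0 + T z)) {z | x0 + T z ∈ K} :=
  h.comp (contDiff_const.add T.contDiff).contDiffOn fun _ hz => hz

lemma isOpen_aff (h : IsOpen K)
    (x0 : Euc n) (T : EndE) : IsOpen {z | x0 + T z ∈ K} :=
  h.preimage (by fun_prop : Continuous fun z => x0 + T z)

lemma Dom.aff (h : Dom K w lam Lam)
    (x0 : Euc n) (T : EndE) (hT : T.det ≠ 0) :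
    Dom {z | x0 + T z ∈ K} (fun z => w (x0 + T z)) (T.det ^ 2 * lam) (T.det ^ 2 * Lam) ∧
    closure {z | x0 + T z ∈ K} = {z | x0 + T z ∈ closure K} := by
  have e : {z | x0 + T z ∈ K} = affH x0 T hT ⁻¹' K := by
    ext z; simp [affH_apply]
  have ecl : closure {z | x0 + T z ∈ K} = {z | x0 + T z ∈ closure K} := by
    rw [e, ← Homeomorph.preimage_closure]; ext z; simp [affH_apply]
  have efr : frontier {z | x0 + T z ∈ K} = {z | x0 + T z ∈ frontier K} := by
    rw [e, ← Homeomorph.preimage_frontier]; ext z; simp [affH_apply]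
  have hop := isOpen_aff h.op x0 T
  refine ⟨⟨hop, (convexOn_comp_aff h.cw x0 T).1, ?_, convexOn_comp_aff h.cw x0 T,
    contDiffOn_comp_aff h.cd x0 T, ?_, ?_, by have := h.pos; positivity, ?_⟩, ecl⟩
  · have h1 : IsCompact (affH x0 T hT ⁻¹' closure K) :=
      (affH x0 T hT).isCompact_preimage.2 h.bdd.isCompact_closure
    refine h1.isBounded.subset ?_
    rw [e]; exact preimage_mono subset_closure
  · rw [ecl]
    exact h.cont.comp (by fun_prop) fun z hz => hz
  · rw [efr]; intro z hz; exact h.zero _ hz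
  · intro z hz
    rw [hessDet_comp_affine x0 T z (h.cda hz)]
    have := h.det _ hz
    exact ⟨by gcongr; exact this.1, by gcongr; exact this.2⟩

lemma Dom.lower (hn : 1 ≤ n) {lam Lam m : ℝ}
    (h : Dom K w lam Lam) (hb : ball 0 1 ⊆ K) (hm : ∀ z ∈ K, - w z ≤ m) :
    lam ≤ (8 * m) ^ n := by
  set g : ℝ := lam ^ ((n:ℝ)⁻¹) with hg
  have hgpos : 0 < g := Real.rpow_pos_of_pos h.pos _
  have hgn : g ^ n = lam := Real.rpow_inv_natCast_pow h.pos.le (by omega)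
  have := parab_bound hn (u := fun z => g⁻¹ * w z) (contDiffOn_const.mul (h.cd.mono hb))
    (by simpa using (h.cw.subset hb (convex_ball 0 1)).smul (inv_nonneg.2 hgpos.le))
    (fun z hz => by
      rw [hessDet_const_mul, inv_pow, hgn, ← div_eq_inv_mul, le_div_iff₀ h.pos, one_mul]
      exact (h.det z (hb hz)).1)
    (fun z hz => mul_nonpos_of_nonneg_of_nonpos (inv_nonneg.2 hgpos.le) (h.nonpos hn (hb hz)))
  have h0 := hm 0 (hb (by simp))
  rw [← div_eq_inv_mul, div_le_iff₀ hgpos] at this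
  rw [← hgn]
  exact pow_le_pow_left₀ hgpos.le (by linarith) n

lemma chord_normalized (hn : 1 ≤ n) (hC : 1 ≤ C)
    {lam Lam m : ℝ} (h : Dom K w lam Lam) (hb : ball 0 1 ⊆ K) (hb2 : K ⊆ ball 0 C)
    (hm : ∀ z ∈ K, - w z ≤ m) {q p : Euc n} (hκ : 0 < κ) (hκ2 : κ ≤ 1 / 2)
    (hq : q ∉ K) (hp : p ∈ closure K) (hz : (1 - κ) • q + κ • p ∈ K) :
    (- w ((1 - κ) • q + κ • p)) ^ n * lam ≤ 4 * (32 * C ^ 2) ^ n * Lam * κ * m ^ n := by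
  set z := (1 - κ) • q + κ • p with hzdef
  have hlow := h.lower hn hb hm
  have hwz := h.nonpos hn hz
  have hLam : 0 < Lam := h.pos.trans_le ((h.det z hz).1.trans (h.det z hz).2)
  rcases eq_or_lt_of_le (neg_nonneg.2 hwz) with h0 | hh
  · have hm0 : 0 ≤ m := by rw [← h0.symm] at *; linarith [hm z hz]
    rw [← h0, zero_pow (by omega), zero_mul]
    positivity
  set t := - w z with ht
  have hm0 : 0 < m := hh.trans_le (hm z hz)
  obtain ⟨f, hf⟩ := geometric_hahn_banach_open_point h.cvx h.op hq
  set ν := dualL f with hν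
  have hfν : ∀ y, f y = ⟪ν, y⟫ := fun y => (inner_dualL f y).symm
  have hν0 : 0 < ‖ν‖ := by
    rw [norm_pos_iff]
    intro h0
    have := hf z hz
    rw [hfν, hfν, h0] at this; simp at this
  have hcl : closure K ⊆ closedBall 0 C :=
    (closure_mono hb2).trans Metric.closure_ball_subset_closedBall
  have hzn : ‖z‖ < C := by simpa using hb2 hz
  have hpn : ‖p‖ ≤ C := by simpa using hcl hp
  have hfcl : ∀ y ∈ closure K, ⟪ν, y⟫ ≤ ⟪ν, q⟫ := by
    intro y hy
    have : closure K ⊆ {y | ⟪ν, y⟫ ≤ ⟪ν, q⟫} :=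
      closure_minimal (fun y hy => by
        have := (hf y hy).le; rw [hfν, hfν] at this; exact this)
        (isClosed_le (by fun_prop) (by fun_prop))
    exact this hy
  -- gap estimate
  have hgap : ⟪ν, q - z⟫ ≤ 4 * C * κ * ‖ν‖ := by
    have e1 : q - z = κ • (q - p) := by rw [hzdef]; module
    have e2 : z - p = (1 - κ) • (q - p) := by rw [hzdef]; module
    have h1 : ⟪ν, z - p⟫ ≤ ‖ν‖ * (2 * C) :=
      (real_inner_le_norm _ _).trans (by gcongr; exact (norm_sub_le _ _).trans (by linarith))
    rw [e2, inner_smul_right] at h1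
    rw [e1, inner_smul_right]
    have h2 : 0 ≤ ⟪ν, q - p⟫ := by rw [inner_sub_right]; linarith [hfcl p hp]
    have h3 : ⟪ν, q - p⟫ ≤ 4 * C * ‖ν‖ := by nlinarith
    nlinarith
  set J := ⌊1 / (4 * κ)⌋₊ with hJ
  set r := t / (4 * C) with hr
  have hrpos : 0 < r := by positivity
  set ctr : ℕ → Euc n := fun j => ((2 * r * j) / ‖ν‖) • ν with hctr
  have hsub : (⋃ j ∈ Finset.range (J + 1), ball (ctr j) r) ⊆
      {ξ : Euc n | ∀ y ∈ closure K, ⟪ξ, y - z⟫ < - w z} := by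
    intro ξ hξ
    simp only [mem_iUnion, Finset.mem_range] at hξ
    obtain ⟨j, hj, hξ⟩ := hξ
    intro y hy
    have hyn : ‖y‖ ≤ C := by simpa using hcl hy
    have hj' : (j:ℝ) ≤ 1 / (4 * κ) :=
      le_trans (by exact_mod_cast Nat.lt_succ_iff.1 hj) (Nat.floor_le (by positivity))
    have e : ξ = ctr j + (ξ - ctr j) := by abel
    rw [e, inner_add_left]
    have h1 : ⟪ξ - ctr j, y - z⟫ < r * (2 * C) := by
      rw [mem_ball, dist_eq_norm] at hξ
      have hyz : ‖y - z‖ < 2 * C := (norm_sub_le _ _).trans_lt (by linarith)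
      refine (real_inner_le_norm _ _).trans_lt ?_
      refine lt_of_le_of_lt (mul_le_mul_of_nonneg_right hξ.le (norm_nonneg _)) ?_
      exact mul_lt_mul_of_pos_left hyz hrpos
    have h2 : ⟪ctr j, y - z⟫ ≤ t / 2 := by
      simp only [hctr, inner_smul_left]
      have h3 : ⟪ν, y - z⟫ ≤ 4 * C * κ * ‖ν‖ := by
        refine le_trans ?_ hgap
        rw [inner_sub_right, inner_sub_right]; linarith [hfcl y hy]
      have h4 : 0 ≤ 2 * r * j / ‖ν‖ := by positivity
      calc _ = 2 * r * j / ‖ν‖ * ⟪ν, y - z⟫ := by simp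
        _ ≤ 2 * r * j / ‖ν‖ * (4 * C * κ * ‖ν‖) := by gcongr
        _ = 2 * t * (κ * j) := by rw [hr]; field_simp
        _ ≤ 2 * t * (κ * (1 / (4 * κ))) := by gcongr
        _ = t / 2 := by field_simp; norm_num
    have h5 : r * (2 * C) = t / 2 := by rw [hr]; field_simp; norm_num
    linarith
  have hvol := alex_A h.op h.bdd h.cd h.cont h.zero (Lam := Lam)
    (fun z hz => by rw [abs_of_pos (h.pos.trans_le (h.det z hz).1)]; exact (h.det z hz).2) hz
  have hdisj : (↑(Finset.range (J + 1)) : Set ℕ).PairwiseDisjoint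
      fun j => ball (ctr j) r := by
    intro i _ j _ hij
    apply Metric.ball_disjoint_ball
    rw [dist_eq_norm]
    have e : ctr i - ctr j = ((2 * r * ((i:ℝ) - j)) / ‖ν‖) • ν := by
      simp only [hctr]; module
    rw [e, norm_smul, norm_div, norm_norm, div_mul_cancel₀ _ hν0.ne', norm_mul,
      norm_of_nonneg (by positivity : 0 ≤ 2 * r)]
    have h1 : (1:ℝ) ≤ ‖(i:ℝ) - j‖ := by
      rw [norm_eq_abs]
      have : (1:ℤ) ≤ |(i:ℤ) - j| := Int.one_le_abs (by omega)
      exact_mod_cast this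
    nlinarith
  have hmeas : volume (⋃ j ∈ Finset.range (J + 1), ball (ctr j) r) =
      (J + 1 : ℕ) * (ENNReal.ofReal (r ^ n) * volume (ball (0 : Euc n) 1)) := by
    rw [measure_biUnion_finset hdisj fun j _ => measurableSet_ball]
    simp only [Measure.addHaar_ball_of_pos volume _ hrpos]
    simp
  have hKvol : volume K ≤ ENNReal.ofReal (C ^ n) * volume (ball (0 : Euc n) 1) := by
    refine (measure_mono hb2).trans ?_
    rw [Measure.addHaar_ball_of_pos volume _ (by linarith : 0 < C)]; simp
  set V := volume (ball (0 : Euc n) 1) with hV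
  have hV0 : V ≠ 0 := (Metric.measure_ball_pos volume _ one_pos).ne'
  have hVt : V ≠ ⊤ := measure_ball_lt_top.ne
  have hfin : ((J + 1 : ℕ) : ENNReal) * ENNReal.ofReal (r ^ n) * V ≤
      ENNReal.ofReal Lam * ENNReal.ofReal (C ^ n) * V := by
    rw [mul_assoc, mul_assoc, ← hmeas]
    exact (measure_mono hsub).trans (hvol.trans (by gcongr))
  rw [ENNReal.mul_le_mul_iff_left hV0 hVt] at hfin
  have hfin2 : ((J + 1 : ℕ) : ℝ) * r ^ n ≤ Lam * C ^ n := by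
    rw [← ENNReal.ofReal_natCast, ← ENNReal.ofReal_mul (by positivity),
      ← ENNReal.ofReal_mul (by positivity)] at hfin
    exact (ENNReal.ofReal_le_ofReal_iff (by positivity)).1 hfin
  have hJ1 : 1 / (4 * κ) ≤ ((J + 1 : ℕ) : ℝ) := by
    push_cast; exact (Nat.lt_floor_add_one _).le
  have h6 : t ^ n ≤ 4 * κ * Lam * (4 * C ^ 2) ^ n := by
    have h7 : 1 / (4 * κ) * r ^ n ≤ Lam * C ^ n :=
      (mul_le_mul_of_nonneg_right hJ1 (by positivity)).trans hfin2
    rw [hr, div_pow, div_mul_div_comm, one_mul, div_le_iff₀ (by positivity)] at h7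
    calc t ^ n ≤ _ := h7
      _ = _ := by
        have : (4 * C ^ 2) ^ n = C ^ n * (4 * C) ^ n := by rw [← mul_pow]; ring
        rw [this]; ring
  calc t ^ n * lam ≤ (4 * κ * Lam * (4 * C ^ 2) ^ n) * (8 * m) ^ n :=
        mul_le_mul h6 hlow h.pos.le (by positivity)
    _ = _ := by
      have : (32 * C ^ 2) ^ n * m ^ n = (4 * C ^ 2) ^ n * (8 * m) ^ n := by
        rw [← mul_pow, ← mul_pow]; ring
      linear_combination (-4 * κ * Lam) * this

/-- Chord lemma. -/
lemma chord (hn : 1 ≤ n) : ∃ C : ℝ, 1 ≤ C ∧ ∀ (K : Set (Euc n)) (w : FunE)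
    (lam Lam m : ℝ), Dom K w lam Lam → (∀ z ∈ K, - w z ≤ m) → ∀ (q p : Euc n) (κ : ℝ), 0 < κ →
    κ ≤ 1 → q ∉ K → p ∈ closure K → (1 - κ) • q + κ • p ∈ K →
    (- w ((1 - κ) • q + κ • p)) ^ n ≤ C * (Lam / lam) * κ * m ^ n := by
  obtain ⟨C, hC, hJ⟩ := john (n := n)
  refine ⟨4 * (32 * C ^ 2) ^ n, ?_, ?_⟩
  · have : (1:ℝ) ≤ (32 * C ^ 2) ^ n := one_le_pow₀ (by nlinarith)
    linarith
  intro K w lam Lam m h hm q p κ hκ hκ1 hq hp hz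
  have hC32 : (1:ℝ) ≤ (32 * C ^ 2) ^ n := one_le_pow₀ (by nlinarith)
  have hle := (h.det _ hz).1.trans (h.det _ hz).2
  have hlp := h.pos
  rcases lt_or_ge (1 / 2) κ with hk | hk
  · have h1 := pow_le_pow_left₀ (neg_nonneg.2 (h.nonpos hn hz)) (hm _ hz) n
    refine h1.trans ?_
    have hm0 : 0 ≤ m := (neg_nonneg.2 (h.nonpos hn hz)).trans (hm _ hz)
    have h2 : 1 ≤ Lam / lam := by rwa [one_le_div hlp]
    have h3 : 1 ≤ 4 * (32 * C ^ 2) ^ n * (Lam / lam) * κ := by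
      have : 1 * 1 ≤ (32 * C ^ 2) ^ n * (Lam / lam) := mul_le_mul hC32 h2 (by norm_num) (by positivity)
      nlinarith
    exact le_mul_of_one_le_left (by positivity) h3
  · obtain ⟨x0, T, hT, hin, hout⟩ := hJ K h.op h.cvx h.bdd ⟨_, hz⟩
    obtain ⟨hD, hcl⟩ := h.aff x0 T hT
    set Φ := affH x0 T hT
    have hΦ : ∀ z, x0 + T z = Φ z := fun z => (affH_apply x0 T hT z).symm
    have hinv : ∀ y, x0 + T (Φ.symm y) = y := fun y => by rw [hΦ]; simp
    have hcomb : x0 + T ((1 - κ) • Φ.symm q + κ • Φ.symm p) = (1 - κ) • q + κ • p := by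
      have e1 := hinv q
      have e2 := hinv p
      rw [map_add, map_smul, map_smul]
      conv_rhs => rw [← e1, ← e2]
      module
    have := chord_normalized hn hC hD (fun z hz => hin z (by simpa using hz))
      (fun z hz => by
        obtain ⟨z', hz', e⟩ := hout _ hz
        rw [hΦ, hΦ] at e
        rw [Φ.injective e]; simpa using hz')
      (fun z hz => hm _ hz) (q := Φ.symm q) (p := Φ.symm p) hκ hk
      (by simpa only [mem_ofPred_eq, hinv] using hq)
      (by rw [hcl]; simpa only [mem_ofPred_eq, hinv] using hp)
      (by simpa only [mem_ofPred_eq, hcomb] using hz)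
    rw [hcomb] at this
    have hdet : 0 < T.det ^ 2 := by positivity
    have h8 : (-w ((1 - κ) • q + κ • p)) ^ n * lam ≤ 4 * (32 * C ^ 2) ^ n * Lam * κ * m ^ n := by
      refine le_of_mul_le_mul_left ?_ hdet
      linarith
    rw [← le_div_iff₀ hlp] at h8
    refine h8.trans (le_of_eq ?_)
    field_simp

/-- Convex `C²` function on an open convex set with two-sided Hessian determinant bounds. -/
structure Adm (U : Set (Euc n)) (u : FunE) (lam Lam : ℝ) : Prop where
  op : IsOpen U
  cvx : Convex ℝ U
  cw : ConvexOn ℝ U u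
  cd : ContDiffOn ℝ 2 u U
  pos : 0 < lam
  det : ∀ z ∈ U, lam ≤ hessDet u z ∧ hessDet u z ≤ Lam

lemma Adm.cda (h : Adm K w lam Lam)
    (hz : z ∈ K) : ContDiffAt ℝ 2 w z := h.cd.contDiffAt (h.op.mem_nhds hz)

lemma Adm.diff (h : Adm K w lam Lam)
    (hz : z ∈ K) : DifferentiableAt ℝ w z := (h.cda hz).differentiableAt (by norm_num)

lemma Dom.adm (h : Dom K w lam Lam) :
    Adm K w lam Lam := ⟨h.op, h.cvx, h.cw, h.cd, h.pos, h.det⟩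

lemma convexOn_add_aff (h : ConvexOn ℝ K w) (c : ℝ)
    (l : DualE) : ConvexOn ℝ K (fun y => w y + (c + l y)) := by
  refine h.add ⟨h.1, fun x _ y _ a b _ _ hab => le_of_eq ?_⟩
  simp only [map_add, map_smul, smul_eq_mul]
  linear_combination (-c) * hab

lemma hessDet_add_affine (c : ℝ) (l : DualE)
    (hu : ContDiffAt ℝ 2 u z) : hessDet (fun y => u y + (c + l y)) z = hessDet u z := by
  unfold hessDet
  rw [hessianMatrix_eq, hessianMatrix_eq, D2_add_affine c l hu]

lemma Adm.add_aff (h : Adm K w lam Lam)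
    (c : ℝ) (l : DualE) : Adm K (fun y => w y + (c + l y)) lam Lam where
  op := h.op
  cvx := h.cvx
  cw := convexOn_add_aff h.cw c l
  cd := h.cd.add (contDiff_affine c l).contDiffOn
  pos := h.pos
  det := fun z hz => by rw [hessDet_add_affine c l (h.cda hz)]; exact h.det z hz

lemma Adm.mono {K K' : Set (Euc n)} (h : Adm K w lam Lam)
    (ho : IsOpen K') (hc : Convex ℝ K') (hs : K' ⊆ K) : Adm K' w lam Lam :=
  ⟨ho, hc, h.cw.subset hs hc, h.cd.mono hs, h.pos, fun z hz => h.det z (hs hz)⟩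

/-- sublevel sets give `Dom`. -/
lemma Adm.dom (h : Adm K w lam Lam)
    (hb : Bornology.IsBounded {z ∈ K | w z < 0})
    (hcont : ContinuousOn w (closure {z ∈ K | w z < 0}))
    (hfr : ∀ z ∈ closure {z ∈ K | w z < 0}, z ∉ K → 0 ≤ w z) :
    Dom {z ∈ K | w z < 0} w lam Lam := by
  have hop : IsOpen {z ∈ K | w z < 0} := h.cd.continuousOn.isOpen_inter_preimage h.op isOpen_Iio
  have hcv : Convex ℝ {z ∈ K | w z < 0} := h.cw.convex_lt 0
  have h' := h.mono hop hcv (fun z hz => hz.1)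
  refine ⟨hop, hcv, hb, h'.cw, h'.cd, hcont, ?_, h.pos, h'.det⟩
  intro z hz
  have hzc : z ∈ closure {z ∈ K | w z < 0} := frontier_subset_closure hz
  have hz0 : w z ≤ 0 := by
    have : MapsTo w {z ∈ K | w z < 0} (Iic 0) := fun y hy => hy.2.le
    have := this.closure_of_continuousOn hcont hzc
    simpa using this
  refine le_antisymm hz0 ?_
  by_cases hK : z ∈ K
  · by_contra hc
    push Not at hc
    have : z ∈ interior {z ∈ K | w z < 0} := by rw [hop.interior_eq]; exact ⟨hK, hc⟩
    exact hz.2 this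
  · exact hfr z hzc hK

lemma Dom.sub (h : Dom K w lam Lam)
    (c : ℝ) (l : DualE) (hl : ∀ z ∈ frontier K, 0 ≤ c + l z) :
    Dom {z ∈ K | w z + (c + l z) < 0} (fun y => w y + (c + l y)) lam Lam := by
  have hs : {z ∈ K | w z + (c + l z) < 0} ⊆ K := fun z hz => hz.1
  refine (h.adm.add_aff c l).dom (h.bdd.subset hs) ?_ ?_
  · exact (h.cont.add (contDiff_affine (k := 0) c l).continuous.continuousOn).mono (closure_mono hs)
  · intro z hz hzK
    have : z ∈ frontier K := ⟨closure_mono hs hz, by rwa [h.op.interior_eq]⟩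
    rw [h.zero z this]
    simpa using hl z this

/-- Bregman divergence. -/
def Breg (u : FunE) (x z : Euc n) : ℝ := u z - u x - fderiv ℝ u x (z - x)

/-- sections -/
def Sec (U : Set (Euc n)) (u : FunE) (x : Euc n) (t : ℝ) : Set (Euc n) :=
  {z ∈ U | Breg u x z < t}

lemma Sec_mono (h : s ≤ t) :
    Sec U u x s ⊆ Sec U u x t := fun _ hz => ⟨hz.1, hz.2.trans_le h⟩

lemma Sec_sub :
    Sec U u x t ⊆ U := fun _ hz => hz.1

lemma Breg_self (u : FunE) (x : Euc n) : Breg u x x = 0 := by simp [Breg]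

lemma mem_Sec_self (hx : x ∈ U)
    (ht : 0 < t) : x ∈ Sec U u x t := ⟨hx, by rwa [Breg_self]⟩

lemma Adm.Breg_nonneg (h : Adm K w lam Lam)
    (hx : x ∈ K) (hz : z ∈ K) : 0 ≤ Breg w x z := by
  have := tangent_le h.cw hx hz (h.diff hx)
  unfold Breg; linarith

lemma Breg_eq (u : FunE) (x : Euc n) (t : ℝ) : (fun z => Breg u x z - t) =
    fun z => u z + ((- u x + fderiv ℝ u x x - t) + (- fderiv ℝ u x) z) := by
  funext z
  simp [Breg]; ring

lemma Adm.sec_dom (h : Adm U u lam Lam)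
    (hb : Bornology.IsBounded (Sec U u x t)) (hg : closure (Sec U u x t) ⊆ U) :
    Dom (Sec U u x t) (fun z => Breg u x z - t) lam Lam := by
  have h' := h.add_aff (- u x + fderiv ℝ u x x - t) (- fderiv ℝ u x)
  rw [← Breg_eq] at h'
  have e : {z ∈ U | (fun z => Breg u x z - t) z < 0} = Sec U u x t := by
    ext z; simp [Sec]
  have := h'.dom (by rwa [e]) (by rw [e]; exact h'.cd.continuousOn.mono hg)
    (by rw [e]; intro z hz hzU; exact absurd (hg hz) hzU)
  rwa [e] at this

/-- Lemma Sh. -/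
lemma sec_shrink (hn : 1 ≤ n) {Θ : ℝ} (hΘ : 1 ≤ Θ) : ∃ c : ℝ, 0 < c ∧ c < 1 ∧
    ∀ (U : Set (Euc n)) (u : FunE) (lam Lam : ℝ), Adm U u lam Lam → Lam ≤ Θ * lam →
    ∀ (x : Euc n) (t : ℝ), x ∈ U → 0 < t → Bornology.IsBounded (Sec U u x t) →
    closure (Sec U u x t) ⊆ U → ∀ z ∈ Sec U u x (t/2), x + (1 - c)⁻¹ • (z - x) ∈ Sec U u x t := by
  obtain ⟨C, hC, H⟩ := chord hn
  have hp : (1:ℝ) ≤ 2 ^ n := one_le_pow₀ (by norm_num)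
  have hCΘ : 1 ≤ C * Θ := by nlinarith
  refine ⟨(4 * 2 ^ n * (C * Θ))⁻¹, by positivity, ?_, ?_⟩
  · apply inv_lt_one_of_one_lt₀; nlinarith
  intro U u lam Lam h hL x t hx ht hb hg z hz
  set c : ℝ := (4 * 2 ^ n * (C * Θ))⁻¹ with hc
  have hc0 : 0 < c := by positivity
  have hc1 : c < 1 := by apply inv_lt_one_of_one_lt₀; nlinarith
  by_contra hq
  have hD := h.sec_dom hb hg
  have hzt : z ∈ Sec U u x t := Sec_mono (by linarith) hz
  have e : (1 - c) • (x + (1 - c)⁻¹ • (z - x)) + c • x = z := by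
    rw [smul_add, smul_smul, mul_inv_cancel₀ (by linarith : (1 - c) ≠ 0)]
    module
  have := H _ _ lam Lam t hD (fun y hy => by have := h.Breg_nonneg hx hy.1; simp; linarith)
    _ x c hc0 hc1.le hq (subset_closure (mem_Sec_self hx ht)) (by rw [e]; exact hzt)
  rw [e] at this
  have h1 : (t / 2) ^ n ≤ (-(Breg u x z - t)) ^ n :=
    pow_le_pow_left₀ (by linarith) (by have := hz.2; linarith) n
  have h2 : C * (Lam / lam) * c * t ^ n ≤ C * Θ * c * t ^ n := by
    have : Lam / lam ≤ Θ := by rw [div_le_iff₀ h.pos]; exact hL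
    gcongr
  have h3 : (t/2) ^ n = t ^ n * (1 / 2 ^ n) := by rw [div_pow]; ring
  have h4 : C * Θ * c = 1 / 2 ^ n / 4 := by rw [hc]; field_simp
  have htn : 0 < t ^ n := by positivity
  have h5 : (0:ℝ) < 1 / 2 ^ n := by positivity
  rw [h4] at h2
  nlinarith

lemma chord' (hn : 1 ≤ n) : ∃ C : ℝ, 1 ≤ C ∧ ∀ (K : Set (Euc n)) (w : FunE)
    (lam Lam m Θ : ℝ), Dom K w lam Lam → Lam ≤ Θ * lam → (∀ z ∈ K, - w z ≤ m) → ∀ (q p z : Euc n)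
    (κ : ℝ), 0 < κ → κ ≤ 1 → p ∈ closure K → z ∈ K → z = (1 - κ) • q + κ • p → 0 ≤ Θ →
    C * Θ * κ * m ^ n < (- w z) ^ n → q ∈ K := by
  obtain ⟨C, hC, H⟩ := chord hn
  refine ⟨C, hC, ?_⟩
  intro K w lam Lam m Θ h hL hm q p z κ hκ hκ1 hp hz e hΘ hlt
  by_contra hq
  have := H K w lam Lam m h hm q p κ hκ hκ1 hq hp (by rw [← e]; exact hz)
  rw [← e] at this
  have hm0 : 0 ≤ m := by have := h.nonpos hn hz; have := hm z hz; linarith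
  have h2 : C * (Lam / lam) * κ * m ^ n ≤ C * Θ * κ * m ^ n := by
    have : Lam / lam ≤ Θ := by rw [div_le_iff₀ h.pos]; exact hL
    gcongr
  linarith

set_option maxHeartbeats 2000000 in
lemma lemL (hn : 1 ≤ n) {Θ η : ℝ} (hΘ : 1 ≤ Θ) (hη : 0 < η) : ∃ c : ℝ, 0 < c ∧
    ∀ (K : Set (Euc n)) (w : FunE) (lam Lam M h : ℝ), Dom K w lam Lam → Lam ≤ Θ * lam →
    (∀ z ∈ K, - w z ≤ M) → 0 < h → η * M ≤ h → ∀ y ∈ K, h ≤ - w y → ∀ w0 ∈ frontier K,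
    c * h ≤ -(w y + fderiv ℝ w y (w0 - y)) := by
  obtain ⟨C, hC, H⟩ := chord' hn
  -- constants
  have hCΘ : 1 ≤ C * Θ := by nlinarith
  have hηn : 0 < η ^ n := by positivity
  set c1 : ℝ := η ^ n / (2 * (C * Θ)) with hc1
  have hc10 : 0 < c1 := by positivity
  set C1 : ℝ := (1 + c1) / c1 with hC1
  have hC10 : 0 < C1 := by positivity
  set c2 : ℝ := min (1/2) ((η / (2 * C1)) ^ n / (4 * (C * Θ))) with hc2
  have hc20 : 0 < c2 := by positivity
  obtain ⟨k, hk⟩ := exists_nat_gt (2 * (C * Θ) / η ^ n / c2)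
  refine ⟨2⁻¹ ^ k, by positivity, ?_⟩
  intro K w lam Lam M h hD hL hM hh hηM y hy hhy w0 hw0
  have hMpos : 0 < M := lt_of_lt_of_le (hh.trans_le hhy) (hM y hy)
  have hA := hD.adm
  set ℓ : FunE := fun z => -(w y + fderiv ℝ w y (z - y)) with hℓ
  have hℓy : ℓ y = - w y := by simp [hℓ]
  have hℓaff : ∀ (a b : Euc n) (t : ℝ), ℓ ((1 - t) • a + t • b) = (1 - t) * ℓ a + t * ℓ b := by
    intro a b t; simp only [hℓ, map_sub, map_add, map_smul, smul_eq_mul]; ring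
  have hB : ∀ z ∈ K, 0 ≤ w z + ℓ z := by
    intro z hz; have := hA.Breg_nonneg hy hz; simp only [Breg] at this; simp only [hℓ]; linarith
  have hℓc : Continuous ℓ := by simp only [hℓ]; fun_prop
  have hℓ0 : ∀ z ∈ closure K, 0 ≤ ℓ z := by
    intro z hz
    have : MapsTo ℓ K (Ici 0) := fun x hx => by
      have h1 := hB x hx; have h2 := hD.nonpos hn hx; simp only [mem_Ici]; linarith
    have := this.closure hℓc hz
    simpa using this
  have hpow : (η * M) ^ n ≤ h ^ n := pow_le_pow_left₀ (by positivity) hηM n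
  have hpow2 : h ^ n ≤ (- w y) ^ n := pow_le_pow_left₀ hh.le hhy n
  rw [mul_pow] at hpow
  have hMn : 0 < M ^ n := by positivity
  -- (1)
  have h1 : ∀ z ∈ K, ℓ z ≤ C1 * M := by
    intro z hz
    have hqK : y - c1 • (z - y) ∈ K := by
      refine H K w lam Lam M Θ hD hL hM _ z y (c1 / (1 + c1)) (by positivity)
        (by rw [div_le_one (by positivity)]; linarith) (subset_closure hz) hy ?_ (by linarith) ?_
      · have : (1 - c1 / (1 + c1)) = (1 + c1)⁻¹ := by field_simp; ring
        rw [this]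
        have e2 : c1 / (1 + c1) = (1 + c1)⁻¹ * c1 := by field_simp
        rw [e2, mul_smul, ← smul_add]
        have : y - c1 • (z - y) + c1 • z = (1 + c1) • y := by module
        rw [this, smul_smul, inv_mul_cancel₀ (by positivity), one_smul]
      · have e3 : C * Θ * (c1 / (1 + c1)) ≤ η ^ n / 2 := by
          calc C * Θ * (c1 / (1 + c1)) ≤ C * Θ * c1 := by
                gcongr; apply div_le_self hc10.le; linarith
            _ = η ^ n / 2 := by rw [hc1]; field_simp
        nlinarith [mul_pos hηn hMn]
    have h2 := hℓ0 _ (subset_closure hqK)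
    have h3 : ℓ (y - c1 • (z - y)) = (1 + c1) * ℓ y - c1 * ℓ z := by
      have := hℓaff y z (-c1)
      rw [show (1 - -c1) • y + (-c1) • z = y - c1 • (z - y) by module] at this
      rw [this]; ring
    rw [h3, hℓy] at h2
    have h4 := hM y hy
    rw [hC1, div_mul_eq_mul_div, le_div_iff₀ hc10]
    nlinarith
  by_contra hcon
  push Not at hcon
  set τ : ℝ := ℓ w0 with hτ
  change τ < 2⁻¹ ^ k * h at hcon
  have hw0c : w0 ∈ closure K := frontier_subset_closure hw0
  have hw0K : w0 ∉ K := by have := hw0.2; rwa [hD.op.interior_eq] at this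
  have hτ0 : 0 ≤ τ := hℓ0 _ hw0c
  set g : ℝ → Euc n := fun σ => y - σ • (w0 - y) with hg
  have hgℓ : ∀ σ, ℓ (g σ) = (1 + σ) * ℓ y - σ * τ := by
    intro σ
    have := hℓaff y w0 (-σ)
    rw [show (1 - -σ) • y + (-σ) • w0 = g σ by simp only [hg]; module] at this
    rw [this, hτ]; ring
  have h2k : (0:ℝ) < 2⁻¹ ^ k := by positivity
  have h2k1 : (2⁻¹ : ℝ) ^ k ≤ 1 := pow_le_one₀ (by norm_num) (by norm_num)
  have hτh : τ < h := by nlinarith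
  -- the point p
  have hpK : g (-(1/2)) ∈ K := by
    have := hD.cvx.openSegment_interior_closure_subset_interior
      (x := y) (y := w0) (by rwa [hD.op.interior_eq]) hw0c
    rw [hD.op.interior_eq] at this
    apply this
    refine ⟨1/2, 1/2, by norm_num, by norm_num, by norm_num, ?_⟩
    simp only [hg]; module
  have hpB : w (g (-(1/2))) + ℓ (g (-(1/2))) ≤ τ / 2 := by
    -- convexity of the extension to the closure
    have hcl : ConvexOn ℝ (closure K) w := by
      refine ⟨hD.cvx.closure, ?_⟩
      intro a ha b hb s t hs ht hst
      have hmaps : MapsTo (fun p : Euc n × Euc n => s * w p.1 + t * w p.2 - w (s • p.1 + t • p.2))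
          (K ×ˢ K) (Ici 0) := by
        intro p hp
        have := hD.cw.2 hp.1 hp.2 hs ht hst
        simp only [smul_eq_mul] at this
        simp only [mem_Ici]; linarith
      have hco : ContinuousOn (fun p : Euc n × Euc n => s * w p.1 + t * w p.2 - w (s • p.1 + t • p.2))
          (closure (K ×ˢ K)) := by
        rw [closure_prod_eq]
        have c1 : ContinuousOn (fun p : Euc n × Euc n => w p.1) (closure K ×ˢ closure K) :=
          hD.cont.comp continuousOn_fst fun p hp => hp.1
        have c2 : ContinuousOn (fun p : Euc n × Euc n => w p.2) (closure K ×ˢ closure K) :=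
          hD.cont.comp continuousOn_snd fun p hp => hp.2
        have c3 : ContinuousOn (fun p : Euc n × Euc n => w (s • p.1 + t • p.2))
            (closure K ×ˢ closure K) :=
          hD.cont.comp (by fun_prop) fun p hp => hD.cvx.closure hp.1 hp.2 hs ht hst
        exact ((continuousOn_const.mul c1).add (continuousOn_const.mul c2)).sub c3
      have := hmaps.closure_of_continuousOn hco (x := (a, b))
        (by rw [closure_prod_eq]; exact ⟨ha, hb⟩)
      rw [closure_Ici] at this
      simp only [mem_Ici] at this
      simp only [smul_eq_mul]; linarith
    have := hcl.2 (subset_closure hy) hw0c (by norm_num : (0:ℝ) ≤ 1/2)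
      (by norm_num : (0:ℝ) ≤ 1/2) (by norm_num)
    rw [hD.zero w0 hw0] at this
    rw [hgℓ, hℓy]
    have e : g (-(1/2)) = (1/2 : ℝ) • y + (1/2 : ℝ) • w0 := by simp only [hg]; module
    rw [e]; simp only [smul_eq_mul] at this; linarith
  -- step
  have hstep : ∀ s σ : ℝ, 0 < s → s ≤ 1 → 0 ≤ σ → τ < s * h → g σ ∈ K →
      w (g σ) + ℓ (g σ) ≤ s / 2 * ℓ (g σ) → g (σ + c2) ∈ K ∧
      w (g (σ + c2)) + ℓ (g (σ + c2)) ≤ s * ℓ (g (σ + c2)) := by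
    intro s σ hs hs1 hσ hτs hgK hd
    have hfr : ∀ z ∈ frontier K, 0 ≤ (1 - s) * ℓ z := fun z hz =>
      mul_nonneg (by linarith) (hℓ0 z (frontier_subset_closure hz))
    have hform : ∀ z, (1 - s) * ℓ z =
        (-(1 - s) * (w y - fderiv ℝ w y y)) + (-(1 - s) • fderiv ℝ w y) z := by
      intro z
      have : (-(1 - s) • fderiv ℝ w y) z = -(1 - s) * fderiv ℝ w y z := rfl
      rw [this]; simp only [hℓ, map_sub]; ring
    have hDs := hD.sub (-(1 - s) * (w y - fderiv ℝ w y y)) (-(1 - s) • fderiv ℝ w y)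
      (fun z hz => by rw [← hform]; exact hfr z hz)
    simp only [← hform] at hDs
    have hℓσ : h ≤ ℓ (g σ) := by rw [hgℓ, hℓy]; nlinarith
    have hdepth : s * h / 2 ≤ -(w (g σ) + (1 - s) * ℓ (g σ)) := by nlinarith
    have hmem : g σ ∈ {z ∈ K | w z + (1 - s) * ℓ z < 0} := ⟨hgK, by nlinarith⟩
    have hpmem : g (-(1/2)) ∈ {z ∈ K | w z + (1 - s) * ℓ z < 0} := by
      refine ⟨hpK, ?_⟩
      have : h / 2 ≤ ℓ (g (-(1/2))) := by rw [hgℓ, hℓy]; nlinarith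
      nlinarith
    have hden : 0 < σ + c2 + 1/2 := by linarith
    have hq := H _ _ lam Lam (s * (C1 * M)) Θ hDs hL (fun z hz => by
        have e1 := h1 z hz.1; have e2 := hB z hz.1; nlinarith) (g (σ + c2)) (g (-(1/2))) (g σ)
      (c2 / (σ + c2 + 1/2)) (by positivity) (by rw [div_le_one hden]; linarith)
      (subset_closure hpmem) hmem ?_ (by linarith) ?_
    · refine ⟨hq.1, ?_⟩
      have := hq.2; linarith
    · simp only [hg]
      match_scalars
      · field_simp; ring
      · field_simp; ring
    · have hκ : c2 / (σ + c2 + 1/2) ≤ 2 * c2 := by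
        rw [div_le_iff₀ hden]; nlinarith
      have hc2' : C * Θ * (2 * c2) ≤ (η / (2 * C1)) ^ n / 2 := by
        have : c2 ≤ (η / (2 * C1)) ^ n / (4 * (C * Θ)) := min_le_right _ _
        rw [le_div_iff₀ (by positivity)] at this
        linarith
      have e0 : 0 < (s * (C1 * M)) ^ n := by positivity
      have e1 : (s * h / 2) ^ n ≤ (-(w (g σ) + (1 - s) * ℓ (g σ))) ^ n :=
        pow_le_pow_left₀ (by positivity) hdepth n
      have e2 : (η / (2 * C1)) ^ n * (s * (C1 * M)) ^ n ≤ (s * h / 2) ^ n := by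
        rw [← mul_pow]
        apply pow_le_pow_left₀ (by positivity)
        have : η / (2 * C1) * (s * (C1 * M)) = s * (η * M) / 2 := by field_simp
        rw [this]; gcongr
      have e3 : 0 < (η / (2 * C1)) ^ n := by positivity
      calc C * Θ * (c2 / (σ + c2 + 1/2)) * (s * (C1 * M)) ^ n
          ≤ (η / (2 * C1)) ^ n / 2 * (s * (C1 * M)) ^ n := by
            gcongr
            exact (mul_le_mul_of_nonneg_left hκ (by linarith)).trans hc2'
        _ < (η / (2 * C1)) ^ n * (s * (C1 * M)) ^ n := by
            have := mul_pos e3 e0; linarith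
        _ ≤ _ := e2.trans e1
  -- iterate
  have hiter : ∀ j : ℕ, j ≤ k → g (j * c2) ∈ K ∧
      w (g (j * c2)) + ℓ (g (j * c2)) ≤ 2⁻¹ ^ (k - j) * ℓ (g (j * c2)) := by
    intro j
    induction j with
    | zero =>
      intro _
      simp only [Nat.cast_zero, zero_mul]
      have : g 0 = y := by simp [hg]
      rw [this]
      refine ⟨hy, ?_⟩
      rw [hℓy]
      have : 0 ≤ (2⁻¹:ℝ) ^ (k - 0) * -w y := mul_nonneg (by positivity) (by linarith)
      linarith
    | succ j ih =>
      intro hj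
      obtain ⟨a1, a2⟩ := ih (by omega)
      have hs := hstep (2⁻¹ ^ (k - (j+1))) (j * c2) (by positivity)
        (pow_le_one₀ (by norm_num) (by norm_num)) (by positivity) ?_ a1 ?_
      · have : ((j + 1 : ℕ) : ℝ) * c2 = j * c2 + c2 := by push_cast; ring
        rw [this]; exact hs
      · refine hcon.trans_le ?_
        gcongr ?_ * h
        exact pow_le_pow_of_le_one (by norm_num) (by norm_num) (by omega)
      · have : k - j = (k - (j + 1)) + 1 := by omega
        rw [this, pow_succ] at a2
        linarith
  obtain ⟨a1, -⟩ := hiter k le_rfl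
  set σ := (k:ℝ) * c2 with hσ
  have hσ0 : 0 ≤ σ := by positivity
  have hσ1 : 2 * (C * Θ) / η ^ n < σ := by rwa [div_lt_iff₀ hc20] at hk
  apply hw0K
  refine H K w lam Lam M Θ hD hL hM w0 (g σ) y (1 / (1 + σ)) (by positivity)
    (by rw [div_le_one (by positivity)]; linarith) (subset_closure a1) hy ?_ (by linarith) ?_
  · simp only [hg]
    match_scalars
    · field_simp; ring
    · field_simp; ring
  · rw [div_lt_iff₀ hηn] at hσ1
    have : C * Θ * (1 / (1 + σ)) < η ^ n := by
      rw [mul_one_div, div_lt_iff₀ (by positivity)]; nlinarith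
    nlinarith

/-- consequence: small sections are compactly inside -/
lemma lemL_good (hn : 1 ≤ n) {Θ η : ℝ} (hΘ : 1 ≤ Θ) (hη : 0 < η) : ∃ c : ℝ, 0 < c ∧
    ∀ (K : Set (Euc n)) (w : FunE) (lam Lam M h : ℝ), Dom K w lam Lam → Lam ≤ Θ * lam →
    (∀ z ∈ K, - w z ≤ M) → 0 < h → η * M ≤ h → ∀ y ∈ K, h ≤ - w y → ∀ t ≤ c * h,
    closure (Sec K w y t) ⊆ K := by
  obtain ⟨c, hc, H⟩ := lemL hn hΘ hη
  refine ⟨c / 2, by positivity, ?_⟩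
  intro K w lam Lam M h hD hL hM hh hηM y hy hhy t ht z hz
  by_contra hzK
  have hzc : z ∈ closure K := closure_mono Sec_sub hz
  have hzf : z ∈ frontier K := ⟨hzc, by rwa [hD.op.interior_eq]⟩
  have h1 := H K w lam Lam M h hD hL hM hh hηM y hy hhy z hzf
  have hm : MapsTo (Breg w y) (Sec K w y t) (Iic t) := fun x hx => hx.2.le
  have hco : ContinuousOn (Breg w y) (closure (Sec K w y t)) := by
    unfold Breg
    exact ((hD.cont.mono (closure_mono Sec_sub)).sub continuousOn_const).sub
      (by fun_prop)
  have := hm.closure_of_continuousOn hco hz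
  rw [closure_Iic, mem_Iic, Breg, hD.zero z hzf] at this
  have hch : 0 < c * h := by positivity
  linarith

/-! ### Green's formula, mollifier, mean value inequality -/

lemma fderiv_apply_D2 (hg : ContDiffAt ℝ 2 g x) (e h : Euc n) :
    fderiv ℝ (fun y => fderiv ℝ g y e) x h = D2 g x h e := by
  have h4 : DifferentiableAt ℝ (fderiv ℝ g) x :=
    (hg.fderiv_right (m := 1) (by norm_num)).differentiableAt (by simp)
  rw [fderiv_clm_apply h4 (differentiableAt_const e)]
  simp [D2]

lemma contDiff_fderiv_apply (hg : ContDiff ℝ 2 g) (e : Euc n) :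
    ContDiff ℝ 1 (fun y => fderiv ℝ g y e) :=
  (hg.fderiv_right (m := 1) (by norm_num)).clm_apply contDiff_const

lemma continuous_D2 (hg : ContDiff ℝ 2 g) : Continuous (D2 g) :=
  (hg.fderiv_right (m := 1) (by norm_num)).continuous_fderiv (by simp)

lemma continuous_lap (hg : ContDiff ℝ 2 g) : Continuous (lap g) := by
  unfold lap
  have := continuous_D2 hg
  exact continuous_finsetSum _ fun i _ =>
    (this.clm_apply continuous_const).clm_apply continuous_const

lemma ibp (hf : ContDiff ℝ 1 f) (hg : ContDiff ℝ 1 g)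
    (hc : HasCompactSupport f) (v : Euc n) :
    ∫ x, f x * fderiv ℝ g x v = - ∫ x, fderiv ℝ f x v * g x := by
  have c1 : Continuous fun x => fderiv ℝ f x v := (hf.continuous_fderiv (by simp)).clm_apply continuous_const
  have c2 : Continuous fun x => fderiv ℝ g x v := (hg.continuous_fderiv (by simp)).clm_apply continuous_const
  have s1 : HasCompactSupport fun x => fderiv ℝ f x v := hc.fderiv_apply (𝕜 := ℝ) v
  refine integral_mul_fderiv_eq_neg_fderiv_mul_of_integrable ?_ ?_ ?_ ?_ ?_
  · exact (c1.mul hg.continuous).integrable_of_hasCompactSupport s1.mul_right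
  · exact (hf.continuous.mul c2).integrable_of_hasCompactSupport hc.mul_right
  · exact (hf.continuous.mul hg.continuous).integrable_of_hasCompactSupport hc.mul_right
  · exact fun x _ => (hf.differentiable (by simp)) x
  · exact fun x _ => (hg.differentiable (by simp)) x

lemma hasCompactSupport_D2 (hc : HasCompactSupport g) (a b : Euc n) :
    HasCompactSupport fun x => D2 g x a b := by
  have := (hc.fderiv (𝕜 := ℝ)).fderiv (𝕜 := ℝ)
  exact this.comp_left (g := fun B : BilE => B a b) rfl

lemma hasCompactSupport_lap (hc : HasCompactSupport g) :
    HasCompactSupport (lap g) := by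
  have := (hc.fderiv (𝕜 := ℝ)).fderiv (𝕜 := ℝ)
  exact this.comp_left (g := fun B : BilE => ∑ i, B (bv i) (bv i)) (by simp)

lemma green (hf : ContDiff ℝ 2 f) (hg : ContDiff ℝ 2 g)
    (hc : HasCompactSupport f) : ∫ x, f x * lap g x = ∫ x, lap f x * g x := by
  have key : ∀ i : Fin n, ∫ x, f x * D2 g x (bv i) (bv i) = ∫ x, D2 f x (bv i) (bv i) * g x := by
    intro i
    have h1 := ibp (f := f) (g := fun y => fderiv ℝ g y (bv i)) (hf.of_le (by norm_num))
      (contDiff_fderiv_apply hg _) hc (bv i)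
    have h2 := ibp (f := fun y => fderiv ℝ f y (bv i)) (g := g) (contDiff_fderiv_apply hf _)
      (hg.of_le (by norm_num)) (hc.fderiv_apply (𝕜 := ℝ) _) (bv i)
    simp only [fderiv_apply_D2 hg.contDiffAt, fderiv_apply_D2 hf.contDiffAt] at h1 h2
    rw [h1, h2, neg_neg]
  have cg := continuous_D2 hg
  have cf := continuous_D2 hf
  unfold lap
  simp only [mul_sum, Finset.sum_mul]
  rw [integral_finsetSum, integral_finsetSum]
  · exact sum_congr rfl fun i _ => key i
  · intro i _
    exact (((cf.clm_apply continuous_const).clm_apply continuous_const).mul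
      hg.continuous).integrable_of_hasCompactSupport (hasCompactSupport_D2 hc _ _).mul_right
  · intro i _
    exact (hf.continuous.mul ((cg.clm_apply continuous_const).clm_apply
      continuous_const)).integrable_of_hasCompactSupport hc.mul_right

/-- potential -/
def mPsi (z : Euc n) : ℝ := expNegInvGlue (1/64 - ‖z‖ ^ 2)
/-- kernel, unnormalized -/
def mChi (z : Euc n) : ℝ := 2 * deriv expNegInvGlue (1/64 - ‖z‖ ^ 2)

lemma glue_contDiff {k : ℕ∞} : ContDiff ℝ k expNegInvGlue := expNegInvGlue.contDiff

lemma dglue_contDiff {k : ℕ∞} : ContDiff ℝ k (deriv expNegInvGlue) := by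
  have h : ContDiff ℝ (k + 1 : ℕ∞) expNegInvGlue := glue_contDiff
  have h' : ContDiff ℝ ((k : WithTop ℕ∞) + 1) expNegInvGlue := by exact_mod_cast h
  rw [contDiff_succ_iff_deriv] at h'
  exact h'.2.2

lemma dglue_nonneg (x : ℝ) : 0 ≤ deriv expNegInvGlue x := expNegInvGlue.monotone.deriv_nonneg

lemma dglue_zero {x : ℝ} (hx : x < 0) : deriv expNegInvGlue x = 0 := by
  have : expNegInvGlue =ᶠ[𝓝 x] fun _ => 0 := by
    filter_upwards [Iio_mem_nhds hx] with y hy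
    exact expNegInvGlue.zero_of_nonpos hy.le
  rw [this.deriv_eq]; simp

lemma dglue_pos {x : ℝ} (hx : 0 < x) : 0 < deriv expNegInvGlue x := by
  have : expNegInvGlue =ᶠ[𝓝 x] fun y => exp (-y⁻¹) := by
    filter_upwards [Ioi_mem_nhds hx] with y hy
    simp [expNegInvGlue, not_le.2 (mem_Ioi.1 hy)]
  rw [this.deriv_eq]
  have h := ((hasDerivAt_inv hx.ne').neg).exp
  rw [HasDerivAt.deriv (f := fun y => exp (-y⁻¹)) h]
  simp; positivity

lemma mPsi_contDiff {k : ℕ∞} : ContDiff ℝ k (mPsi (n := n)) := by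
  unfold mPsi
  exact glue_contDiff.comp (contDiff_const.sub contDiff_normsq)

lemma mChi_contDiff {k : ℕ∞} : ContDiff ℝ k (mChi (n := n)) := by
  unfold mChi
  exact contDiff_const.mul (dglue_contDiff.comp (contDiff_const.sub contDiff_normsq))

lemma mChi_nonneg (z : Euc n) : 0 ≤ mChi z := mul_nonneg (by norm_num) (dglue_nonneg _)
lemma mPsi_nonneg (z : Euc n) : 0 ≤ mPsi z := expNegInvGlue.nonneg _

lemma mChi_zero (hz : 1/8 < ‖z‖) : mChi z = 0 := by
  unfold mChi; rw [dglue_zero, mul_zero]; nlinarith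

lemma mPsi_zero (hz : 1/8 ≤ ‖z‖) : mPsi z = 0 :=
  expNegInvGlue.zero_of_nonpos (by nlinarith)

lemma hcs_of_zero (h : ∀ z, r < ‖z‖ → f z = 0) :
    HasCompactSupport f :=
  HasCompactSupport.intro (isCompact_closedBall (0 : Euc n) r) fun z hz => h z (by simpa using hz)

lemma mChi_hcs : HasCompactSupport (mChi (n := n)) := hcs_of_zero fun _ hz => mChi_zero hz
lemma mPsi_hcs : HasCompactSupport (mPsi (n := n)) := hcs_of_zero fun _ hz => mPsi_zero hz.le

lemma mPsi_fderiv (z h : Euc n) : fderiv ℝ mPsi z h = - (mChi z * ⟪z, h⟫) := by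
  have h1 : HasFDerivAt (fun z : Euc n => 1/64 - ‖z‖ ^ 2) (- (2 • innerSL ℝ z)) z := by
    simpa using (hasStrictFDerivAt_norm_sq z).hasFDerivAt.const_sub (1/64 : ℝ)
  have h2 : HasDerivAt expNegInvGlue (deriv expNegInvGlue (1/64 - ‖z‖ ^ 2)) (1/64 - ‖z‖ ^ 2) :=
    ((glue_contDiff (k := 1)).differentiable (by simp) _).hasDerivAt
  have h3 : HasFDerivAt (mPsi (n := n)) _ z := h2.comp_hasFDerivAt z h1
  rw [h3.fderiv]
  simp [mChi]; ring

lemma mChi_integrable : Integrable (mChi (n := n)) :=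
  (mChi_contDiff (k := 0)).continuous.integrable_of_hasCompactSupport mChi_hcs

def mN (n : ℕ) : ℝ := ∫ z : Euc n, mChi z

lemma mN_pos (n : ℕ) : 0 < mN n := by
  unfold mN
  refine Continuous.integral_pos_of_hasCompactSupport_nonneg_nonzero
    (mChi_contDiff (k := 0)).continuous mChi_hcs (fun z => mChi_nonneg z) (x := 0) ?_
  unfold mChi
  have := dglue_pos (x := 1/64) (by norm_num)
  simp only [norm_zero]
  norm_num
  norm_num at this
  exact this.ne'

/-- normalized kernel -/
def mker (z : Euc n) : ℝ := (mN n)⁻¹ * mChi z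

lemma mker_contDiff {k : ℕ∞} : ContDiff ℝ k (mker (n := n)) := contDiff_const.mul mChi_contDiff
lemma mker_cont : Continuous (mker (n := n)) := (mker_contDiff (k := 0)).continuous
lemma mker_nonneg (z : Euc n) : 0 ≤ mker z :=
  mul_nonneg (inv_nonneg.2 (mN_pos n).le) (mChi_nonneg z)
lemma mker_zero (hz : 1/8 < ‖z‖) : mker z = 0 := by simp [mker, mChi_zero hz]
lemma mker_hcs : HasCompactSupport (mker (n := n)) := hcs_of_zero fun _ hz => mker_zero hz
lemma mker_neg (z : Euc n) : mker (-z) = mker z := by simp [mker, mChi]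
lemma mker_integral : ∫ z : Euc n, mker z = 1 := by
  unfold mker
  rw [integral_const_mul]
  exact inv_mul_cancel₀ (mN_pos n).ne'
lemma mker_integrable : Integrable (mker (n := n)) :=
  mker_cont.integrable_of_hasCompactSupport mker_hcs

/-- mean value inequality -/
lemma mean_value : ∃ C : ℝ, 0 < C ∧ ∀ (g : FunE) (x : Euc n) (d : ℝ), ContDiff ℝ 2 g →
    0 ≤ d → (∀ y, ‖y - x‖ ≤ 1/8 → - d ≤ lap g y) → g x ≤ (∫ z, mker z * g (x + z)) + C * d := by
  set P : ℝ := ∫ z : Euc n, mPsi z with hP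
  have hP0 : 0 ≤ P := integral_nonneg fun z => mPsi_nonneg z
  refine ⟨(mN n)⁻¹ * P + 1, by have := mN_pos n; positivity, ?_⟩
  intro g x d hg hd hlap
  have cg := hg.continuous
  have cg' := hg.continuous_fderiv (by norm_num : (2 : WithTop ℕ∞) ≠ 0)
  set m : ℝ → ℝ := fun t => ∫ z : Euc n, mChi z * g (x + t • z) with hm
  have hderiv : ∀ t : ℝ, t ∈ Ioo (-1:ℝ) 2 →
      HasDerivAt m (∫ z : Euc n, mChi z * fderiv ℝ g (x + t • z) z) t := by
    intro t ht
    -- bound on the derivative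
    have hcomp : IsCompact (closedBall x 1) := isCompact_closedBall _ _
    obtain ⟨B, hB⟩ := hcomp.exists_bound_of_continuousOn cg'.continuousOn
    have hB0 : 0 ≤ B := (norm_nonneg _).trans (hB x (Metric.mem_closedBall_self zero_le_one))
    refine (hasDerivAt_integral_of_dominated_loc_of_deriv_le (s := Ioo (-1:ℝ) 2)
      (F := fun t z => mChi z * g (x + t • z))
      (F' := fun t z => mChi z * fderiv ℝ g (x + t • z) z) (bound := fun z => mChi z * B)
      (Ioo_mem_nhds ht.1 ht.2) ?_ ?_ ?_ ?_ ?_ ?_).2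
    · refine Eventually.of_forall fun s => Continuous.aestronglyMeasurable ?_
      exact (mChi_contDiff (k := 0)).continuous.mul (by fun_prop)
    · exact ((mChi_contDiff (k := 0)).continuous.mul
        (by fun_prop)).integrable_of_hasCompactSupport mChi_hcs.mul_right
    · refine Continuous.aestronglyMeasurable ?_
      refine (mChi_contDiff (k := 0)).continuous.mul ?_
      exact (cg'.comp (by fun_prop)).clm_apply continuous_id
    · refine Eventually.of_forall fun z s hs => ?_
      rw [norm_mul, norm_of_nonneg (mChi_nonneg z)]
      by_cases hz : 1/8 < ‖z‖
      · simp [mChi_zero hz]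
      · push Not at hz
        have h1 : x + s • z ∈ closedBall x 1 := by
          rw [mem_closedBall, dist_eq_norm, add_sub_cancel_left, norm_smul]
          have : ‖s‖ ≤ 2 := by rw [norm_eq_abs, abs_le]; constructor <;> linarith [hs.1, hs.2]
          nlinarith [norm_nonneg z]
        have h2 := (fderiv ℝ g (x + s • z)).le_opNorm z
        have h3 := hB _ h1
        have : ‖fderiv ℝ g (x + s • z) z‖ ≤ B := by nlinarith [norm_nonneg z]
        exact mul_le_mul_of_nonneg_left this (mChi_nonneg z)
    · exact mChi_integrable.mul_const B
    · refine Eventually.of_forall fun z s hs => ?_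
      exact (hasDerivAt_line (hg.differentiable (by norm_num) _)).const_mul _
  have hlow : ∀ t ∈ Ioo (0:ℝ) 1, - (P * d) ≤ ∫ z : Euc n, mChi z * fderiv ℝ g (x + t • z) z := by
    intro t ht
    -- integrate by parts
    set gt : FunE := fun z => t⁻¹ * g (x + t • z) with hgt
    have hT : ∀ z : Euc n, x + t • z = x + (t • ContinuousLinearMap.id ℝ (Euc n)) z := fun z => rfl
    have hgt2 : ContDiff ℝ 2 gt := by
      simp only [hgt]
      exact contDiff_const.mul (hg.comp (contDiff_const.add (contDiff_const_smul t)))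
    have hfd : ∀ z v : Euc n, fderiv ℝ gt z v = fderiv ℝ g (x + t • z) v := by
      intro z v
      have h1 : HasFDerivAt gt _ z := (((hg.differentiable (by norm_num) (x + t • z)).hasFDerivAt.comp z
        (((hasFDerivAt_id z).const_smul t).const_add x)).const_mul (t⁻¹))
      rw [h1.fderiv]
      simp [ht.1.ne']
    have hlapgt : ∀ z : Euc n, ‖z‖ ≤ 1/8 → - d ≤ lap gt z := by
      intro z hz
      have : lap gt z = t * lap g (x + t • z) := by
        unfold lap
        rw [mul_sum]
        refine sum_congr rfl fun i _ => ?_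
        have e1 : D2 gt z = t⁻¹ • D2 (fun z => g (x + t • z)) z := D2_const_mul _ _
        have e2 := D2_comp_affine (u := g) x (t • ContinuousLinearMap.id ℝ (Euc n)) z
          hg.contDiffAt (bv i) (bv i)
        simp only [← hT] at e2
        rw [e1, _root_.smul_apply, _root_.smul_apply, e2]
        simp
        field_simp [ht.1.ne']
      rw [this]
      have h1 := hlap (x + t • z) (by
        rw [add_sub_cancel_left, norm_smul, norm_of_nonneg ht.1.le]
        nlinarith [norm_nonneg z, ht.2, ht.1])
      nlinarith [ht.1, ht.2]
    have e1 : (∫ z : Euc n, mChi z * fderiv ℝ g (x + t • z) z) = ∫ z : Euc n, mPsi z * lap gt z := by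
      have h1 : ∀ z : Euc n, mChi z * fderiv ℝ g (x + t • z) z =
          ∑ i, - (fderiv ℝ mPsi z (bv i) * fderiv ℝ gt z (bv i)) := by
        intro z
        conv_lhs => rw [← hfd z z]; arg 2; arg 2; rw [vec_eq_sum z]
        rw [map_sum, mul_sum]
        refine sum_congr rfl fun i _ => ?_
        rw [mPsi_fderiv, map_smul]
        simp [bv, EuclideanSpace.inner_single_right]; ring
      have h2 : ∀ i : Fin n, ∫ z : Euc n, mPsi z * D2 gt z (bv i) (bv i) =
          ∫ z : Euc n, - (fderiv ℝ mPsi z (bv i) * fderiv ℝ gt z (bv i)) := by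
        intro i
        have := ibp (f := mPsi) (g := fun y => fderiv ℝ gt y (bv i)) mPsi_contDiff
          (contDiff_fderiv_apply hgt2 _) mPsi_hcs (bv i)
        simp only [fderiv_apply_D2 hgt2.contDiffAt] at this
        rw [this, integral_neg]
      simp only [h1]
      unfold lap
      simp only [mul_sum]
      rw [integral_finsetSum, integral_finsetSum]
      · exact sum_congr rfl fun i _ => (h2 i).symm
      · intro i _
        exact ((mPsi_contDiff (k := 0)).continuous.mul (((continuous_D2 hgt2).clm_apply
          continuous_const).clm_apply continuous_const)).integrable_of_hasCompactSupport
          mPsi_hcs.mul_right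
      · intro i _
        refine Integrable.neg ?_
        have c1 : Continuous fun z : Euc n => fderiv ℝ mPsi z (bv i) :=
          ((mPsi_contDiff (k := 1)).continuous_fderiv (by simp)).clm_apply continuous_const
        have s1 : HasCompactSupport fun z : Euc n => fderiv ℝ mPsi z (bv i) :=
          mPsi_hcs.fderiv_apply (𝕜 := ℝ) _
        exact (c1.mul (contDiff_fderiv_apply hgt2 _).continuous).integrable_of_hasCompactSupport
          s1.mul_right
    rw [e1, hP, ← integral_mul_const, ← integral_neg]
    have i1 : Integrable (mPsi (n := n)) :=
      (mPsi_contDiff (k := 0)).continuous.integrable_of_hasCompactSupport mPsi_hcs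
    refine integral_mono (i1.mul_const d).neg
      (((mPsi_contDiff (k := 0)).continuous.mul
        (continuous_lap hgt2)).integrable_of_hasCompactSupport mPsi_hcs.mul_right) fun z => ?_
    by_cases hz : 1/8 ≤ ‖z‖
    · simp [mPsi_zero hz]
    · push Not at hz
      have := hlapgt z hz.le
      have := mPsi_nonneg z
      simp only
      nlinarith
  have hmono : m 0 ≤ m 1 + P * d := by
    have hF : ∀ t ∈ Icc (0:ℝ) 1, HasDerivAt (fun t => m t + t * (P * d))
        ((∫ z : Euc n, mChi z * fderiv ℝ g (x + t • z) z) + P * d) t := by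
      intro t ht
      have h2 : HasDerivAt (fun t : ℝ => t * (P * d)) (P * d) t := by
        simpa using (hasDerivAt_id t).mul_const (P * d)
      exact (hderiv t ⟨by linarith [ht.1], by linarith [ht.2]⟩).add h2
    have hmon : MonotoneOn (fun t => m t + t * (P * d)) (Icc 0 1) := by
      refine monotoneOn_of_deriv_nonneg (convex_Icc 0 1)
        (fun t ht => (hF t ht).continuousAt.continuousWithinAt) ?_ ?_
      · intro t ht
        rw [interior_Icc] at ht
        exact (hF t ⟨ht.1.le, ht.2.le⟩).differentiableAt.differentiableWithinAt
      · intro t ht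
        rw [interior_Icc] at ht
        rw [(hF t ⟨ht.1.le, ht.2.le⟩).deriv]
        linarith [hlow t ht]
    have := hmon (left_mem_Icc.2 zero_le_one) (right_mem_Icc.2 zero_le_one) zero_le_one
    simpa using this
  have hm0 : m 0 = mN n * g x := by
    simp only [hm, zero_smul, add_zero]
    rw [integral_mul_const]; rfl
  have hm1 : m 1 = mN n * ∫ z, mker z * g (x + z) := by
    simp only [hm, one_smul, mker]
    rw [← integral_const_mul]
    congr 1; funext z
    rw [← mul_assoc, ← mul_assoc, mul_inv_cancel₀ (mN_pos n).ne', one_mul]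
  rw [hm0, hm1] at hmono
  have hN := mN_pos n
  have : g x ≤ (∫ z, mker z * g (x + z)) + (mN n)⁻¹ * P * d := by
    have h1 : mN n * ((mN n)⁻¹ * P * d) = P * d := by field_simp
    nlinarith
  linarith

/-! ### Legendre transform -/

lemma Adm.D2_pos (h : Adm K w lam Lam)
    (hx : x ∈ K) {e : Euc n} (he : e ≠ 0) : 0 < D2 w x e e :=
  posDef_matB_apply _ (posDef_hess h.op h.cw h.cd hx (h.pos.trans_le (h.det x hx).1)) e he

lemma grad_inj (h : Adm U u lam Lam)
    (hx : x ∈ U) (hy : y ∈ U) (he : grad u x = grad u y) : x = y := by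
  by_contra hne
  have hseg : ∀ t ∈ Icc (0:ℝ) 1, x + t • (y - x) ∈ U := by
    intro t ht
    have := h.cvx hx hy (by linarith [ht.2] : 0 ≤ 1 - t) ht.1 (by ring)
    convert this using 1
    module
  have hne' : y - x ≠ 0 := fun hh => hne (sub_eq_zero.1 hh).symm
  have hm : StrictMonoOn (fun s : ℝ => fderiv ℝ u (x + s • (y - x)) (y - x)) (Icc 0 1) := by
    refine strictMonoOn_of_deriv_pos (convex_Icc 0 1) (fun t ht =>
      (hasDerivAt_line2 (y - x) (h.cda (hseg t ht))).continuousAt.continuousWithinAt) ?_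
    intro t ht
    rw [interior_Icc] at ht
    rw [(hasDerivAt_line2 (y - x) (h.cda (hseg t ⟨ht.1.le, ht.2.le⟩))).deriv]
    exact h.D2_pos (hseg t ⟨ht.1.le, ht.2.le⟩) hne'
  have h1 := hm (left_mem_Icc.2 zero_le_one) (right_mem_Icc.2 zero_le_one) zero_lt_one
  simp only [zero_smul, add_zero, one_smul, add_sub_cancel, ← inner_grad, he] at h1
  exact lt_irrefl _ h1

lemma grad_surj {lam Lam ε : ℝ} (h : Adm (ball 0 1) u lam Lam)
    (hε : ε ≤ 1/1024) (hφ : ∀ z ∈ ball (0 : Euc n) 1, |u z - ‖z‖ ^ 2 / 2| ≤ ε)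
    (hy : y ∈ ball (0 : Euc n) (3/4)) :
    ∃ X ∈ ball (0 : Euc n) (7/8), grad u X = y ∧ ‖X - y‖ ^ 2 ≤ 4 * ε := by
  have hy' : ‖y‖ < 3/4 := by simpa using hy
  have hsub : closedBall (0 : Euc n) (7/8) ⊆ ball 0 1 :=
    Metric.closedBall_subset_ball (by norm_num)
  have hcont : ContinuousOn (fun z => u z - ⟪y, z⟫) (closedBall 0 (7/8)) :=
    (h.cd.continuousOn.mono hsub).sub (by fun_prop)
  obtain ⟨X, hX, hmin⟩ := (isCompact_closedBall (0 : Euc n) (7/8)).exists_isMinOn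
    ⟨0, by simp; norm_num⟩ hcont
  have hyc : y ∈ closedBall (0 : Euc n) (7/8) := by simp; linarith
  have h1 : u X - ⟪y, X⟫ ≤ u y - ⟪y, y⟫ := hmin hyc
  have h2 := abs_le.1 (hφ X (hsub hX))
  have h3 := abs_le.1 (hφ y (hsub hyc))
  have h4 : ‖X - y‖ ^ 2 = ‖X‖ ^ 2 - 2 * ⟪y, X⟫ + ‖y‖ ^ 2 := by
    rw [norm_sub_sq_real, real_inner_comm]
  rw [real_inner_self_eq_norm_sq] at h1
  have h5 : ‖X - y‖ ^ 2 ≤ 4 * ε := by linarith [h2.1, h3.2]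
  have h6 : ‖X - y‖ ≤ 1/16 := by nlinarith [norm_nonneg (X - y)]
  have h7 : ‖X‖ < 7/8 := by
    have := norm_add_le (X - y) y
    simp only [sub_add_cancel] at this
    linarith
  refine ⟨X, by simpa using h7, ?_, h5⟩
  have hloc : IsLocalMin (fun z => u z - ⟪y, z⟫) X :=
    hmin.isLocalMin (mem_of_superset (isOpen_ball.mem_nhds
      (by simpa using h7 : X ∈ ball (0 : Euc n) (7/8))) ball_subset_closedBall)
  have hd : HasFDerivAt (fun z => u z - ⟪y, z⟫) (fderiv ℝ u X - innerSL ℝ y) X :=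
    (h.diff (hsub hX)).hasFDerivAt.sub (innerSL ℝ y).hasFDerivAt
  have h0 := hloc.hasFDerivAt_eq_zero hd
  refine ext_inner_right ℝ fun w => ?_
  rw [inner_grad]
  have := congrArg (fun l : DualE => l w) h0
  simp only [_root_.sub_apply, innerSL_apply_apply, _root_.zero_apply] at this
  linarith

lemma gradL_symm (h : ContDiffAt ℝ 2 u x) (a b : Euc n) :
    ⟪gradL u x a, b⟫ = ⟪a, gradL u x b⟫ := by
  rw [inner_gradL, real_inner_comm, inner_gradL]
  exact D2_symm h a b

lemma legendre {δ ε : ℝ}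
    (h : Adm (ball 0 1) u (exp (-δ)) (exp δ))
    (hε : ε ≤ 1/1024) (hφ : ∀ z ∈ ball (0 : Euc n) 1, |u z - ‖z‖ ^ 2 / 2| ≤ ε) :
    ∃ us : FunE, ContDiffOn ℝ 2 us (ball 0 (3/4)) ∧
      ∀ y ∈ ball (0 : Euc n) (3/4), n - δ ≤ lap us y ∧ ‖y‖ ^ 2 - u y ≤ us y ∧
        us y ≤ ‖y‖ ^ 2 / 2 + ε ∧
        us y ≤ ‖y‖ ^ 2 - u y - ⟪grad u y - y, grad us y - y⟫ := by
  choose! X hX1 hX2 hX3 using fun (y : Euc n) (hy : y ∈ ball (0 : Euc n) (3/4)) =>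
    grad_surj h hε hφ hy
  have hsub : ball (0 : Euc n) (7/8) ⊆ ball 0 1 := Metric.ball_subset_ball (by norm_num)
  have hsub2 : ball (0 : Euc n) (3/4) ⊆ ball 0 1 := Metric.ball_subset_ball (by norm_num)
  -- regularity of X
  have hXreg : ∀ y ∈ ball (0 : Euc n) (3/4), ContDiffAt ℝ 1 X y ∧
      ∃ L : EndE, HasFDerivAt X L y ∧ ∀ a, gradL u (X y) (L a) = a := by
    intro y hy
    have hxb := hsub (hX1 y hy)
    have hcd : ContDiffAt ℝ 1 (grad u) (X y) :=
      dualL.contDiff.contDiffAt.comp _ ((h.cda hxb).fderiv_right (m := 1) (by norm_num))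
    have hdet : (gradL u (X y)).det ≠ 0 := by
      rw [det_gradL]; exact (h.pos.trans_le (h.det _ hxb).1).ne'
    set e := (gradL u (X y)).toContinuousLinearEquivOfDetNeZero hdet with he
    have hee : (e : EndE) = gradL u (X y) := by
      ext1 a; rw [he]; rfl
    have hfd : HasFDerivAt (grad u) (e : EndE) (X y) := by
      rw [hee]; exact hasFDerivAt_grad (h.cda hxb)
    have hstr : HasStrictFDerivAt (grad u) (e : EndE) (X y) :=
      hcd.hasStrictFDerivAt' hfd (by simp)
    have hcdi := hcd.to_localInverse hfd (by simp)
    have hsd := hstr.to_localInverse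
    rw [hX2 y hy] at hcdi hsd
    have hev : X =ᶠ[𝓝 y] hcd.localInverse hfd (by simp) := by
      have h1 := hstr.eventually_right_inverse
      have h2 : Tendsto (hstr.localInverse) (𝓝 (grad u (X y))) (𝓝 (X y)) :=
        hstr.localInverse_tendsto
      have h3 := h2.eventually (isOpen_ball.mem_nhds hxb)
      rw [hX2 y hy] at h1 h3
      filter_upwards [h1, h3, isOpen_ball.mem_nhds hy] with z hz1 hz2 hz3
      refine grad_inj h (hsub (hX1 z hz3)) hz2 ?_
      rw [hX2 z hz3]; exact hz1.symm
    refine ⟨hcdi.congr_of_eventuallyEq hev, (e.symm : EndE), ?_, ?_⟩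
    · exact hsd.hasFDerivAt.congr_of_eventuallyEq hev
    · intro a
      rw [← hee]; simp
  set us : FunE := fun y => ⟪y, X y⟫ - u (X y) with hus
  have hder : ∀ y ∈ ball (0 : Euc n) (3/4), HasFDerivAt us (innerSL ℝ (X y)) y := by
    intro y hy
    obtain ⟨_, L, hL, _⟩ := hXreg y hy
    have h1 : HasFDerivAt (fun y => ⟪y, X y⟫) _ y := (hasFDerivAt_id y).inner ℝ hL
    have h2 := (h.diff (hsub (hX1 y hy))).hasFDerivAt.comp y hL
    have h3 := h1.sub h2
    refine h3.congr_fderiv ?_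
    ext1 a
    simp only [_root_.sub_apply, ContinuousLinearMap.comp_apply, innerSL_apply_apply,
      ContinuousLinearMap.prod_apply, fderivInnerCLM_apply, ContinuousLinearMap.id_apply, id,
      ← inner_grad, hX2 y hy]
    rw [real_inner_comm (X y) a]; ring
  have hgrad : ∀ y ∈ ball (0 : Euc n) (3/4), grad us y = X y := by
    intro y hy
    refine ext_inner_right ℝ fun w => ?_
    rw [inner_grad, (hder y hy).fderiv, innerSL_apply_apply]
  have hfe : ∀ y ∈ ball (0 : Euc n) (3/4), fderiv ℝ us =ᶠ[𝓝 y] fun z => innerSL ℝ (X z) := by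
    intro y hy
    filter_upwards [isOpen_ball.mem_nhds hy] with z hz using (hder z hz).fderiv
  have hcd2 : ContDiffOn ℝ 2 us (ball 0 (3/4)) := by
    have : ContDiffOn ℝ (1 + 1) us (ball 0 (3/4)) := by
      rw [contDiffOn_succ_iff_fderiv_of_isOpen isOpen_ball]
      refine ⟨fun y hy => (hder y hy).differentiableAt.differentiableWithinAt, by simp, ?_⟩
      intro y hy
      refine ContDiffAt.contDiffWithinAt ?_
      exact ((innerSL ℝ (E := Euc n)).contDiff.contDiffAt.comp y (hXreg y hy).1).congr_of_eventuallyEq (hfe y hy)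
    convert this using 1; norm_num
  refine ⟨us, hcd2, fun y hy => ?_⟩
  have hxb := hsub (hX1 y hy)
  obtain ⟨hX1c, L, hL, hLi⟩ := hXreg y hy
  have hD2 : ∀ a b, D2 us y a b = ⟪L a, b⟫ := by
    intro a b
    have h1 : HasFDerivAt (fun z => innerSL ℝ (X z)) ((innerSL ℝ (E := Euc n)).comp L) y :=
      (innerSL ℝ (E := Euc n)).hasFDerivAt.comp y hL
    have h2 := h1.congr_of_eventuallyEq (hfe y hy)
    unfold D2
    rw [h2.fderiv]
    simp
  refine ⟨?_, ?_, ?_, ?_⟩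
  · have hs : SymB (D2 us y) := D2_symm (hcd2.contDiffAt (isOpen_ball.mem_nhds hy))
    have hcomp : ∀ a b, D2 us y a b = D2 u (X y) (L a) (L b) := by
      intro a b
      rw [← inner_gradL u, hLi, hs a b, hD2, real_inner_comm]
    have hdetL : L.det * hessDet u (X y) = 1 := by
      rw [← det_gradL]
      have : (gradL u (X y)).comp L = ContinuousLinearMap.id ℝ _ := by ext1 a; simp [hLi]
      have h2 := congrArg ContinuousLinearMap.det this
      have h3 : ((gradL u (X y)).comp L).det = (gradL u (X y)).det * L.det :=
        LinearMap.det_comp _ _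
      rw [h3] at h2
      rw [mul_comm, h2]
      exact LinearMap.det_id
    have hdp := h.pos.trans_le (h.det _ hxb).1
    have hdet : (matB (D2 us y)).det = (hessDet u (X y))⁻¹ := by
      rw [det_matB_comp _ _ L hcomp, ← hessianMatrix_eq]
      change L.det ^ 2 * hessDet u (X y) = _
      rw [eq_inv_of_mul_eq_one_left hdetL]
      field_simp
    have hpd : (matB (D2 us y)).PosDef := by
      refine posDef_matB_of_pos _ hs fun a ha => ?_
      rw [hcomp]
      refine h.D2_pos hxb fun hh => ha ?_
      rw [← hLi a, hh, map_zero]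
    have := trace_ge_log_det _ hpd
    rw [hdet, Real.log_inv, trace_matB] at this
    have hlog : log (hessDet u (X y)) ≤ δ := by
      rw [Real.log_le_iff_le_exp hdp]; exact (h.det _ hxb).2
    unfold lap
    linarith
  · have := tangent_le h.cw hxb (hsub2 hy) (h.diff hxb)
    rw [← inner_grad, hX2 y hy, inner_sub_right, real_inner_self_eq_norm_sq] at this
    simp only [hus]; linarith
  · have := (abs_le.1 (hφ _ hxb)).1
    have h4 : ‖X y - y‖ ^ 2 = ‖X y‖ ^ 2 - 2 * ⟪y, X y⟫ + ‖y‖ ^ 2 := by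
      rw [norm_sub_sq_real, real_inner_comm]
    have := sq_nonneg ‖X y - y‖
    simp only [hus]; linarith
  · have := tangent_le h.cw (hsub2 hy) hxb (h.diff (hsub2 hy))
    rw [hgrad y hy, ← inner_grad] at *
    rw [inner_sub_left, inner_sub_right y, real_inner_self_eq_norm_sq]
    simp only [hus]; linarith

/-! ### Lemma P -/

lemma extend {r R : ℝ} (hr : 0 < r) (hR : r < R)
    (hg : ContDiffOn ℝ 2 g (ball 0 R)) :
    ∃ g' : FunE, ContDiff ℝ 2 g' ∧ ∀ z ∈ ball (0 : Euc n) r, g' z = g z := by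
  let b : ContDiffBump (0 : Euc n) := ⟨r, (r + R) / 2, hr, by linarith⟩
  refine ⟨fun z => b z * g z, ?_, fun z hz => ?_⟩
  · rw [contDiff_iff_contDiffAt]
    intro z
    by_cases hz : ‖z‖ < R
    · exact b.contDiffAt.mul (hg.contDiffAt (isOpen_ball.mem_nhds (by simpa using hz)))
    · have : (fun z => b z * g z) =ᶠ[𝓝 z] fun _ => 0 := by
        have ho : IsOpen {w : Euc n | (r + R) / 2 < ‖w‖} := isOpen_lt continuous_const continuous_norm
        filter_upwards [ho.mem_nhds (by simp only [mem_ofPred_eq]; linarith : z ∈ {w : Euc n | (r + R) / 2 < ‖w‖})] with w hw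
        rw [b.zero_of_le_dist, zero_mul]
        simp only [dist_zero_right]
        exact le_of_lt hw
      exact contDiffAt_const.congr_of_eventuallyEq this
  · show b z * g z = g z
    rw [b.one_of_mem_closedBall (ball_subset_closedBall hz), one_mul]

lemma gradSq (f : FunE) (x : Euc n) :
    ‖grad f x‖ ^ 2 = ∑ i, (fderiv ℝ f x (bv i)) ^ 2 := by
  rw [EuclideanSpace.norm_sq_eq]
  refine sum_congr rfl fun i _ => ?_
  rw [← inner_grad, bv, EuclideanSpace.inner_single_right]
  simp

lemma lap_sq (hf : ContDiff ℝ 2 f) (x : Euc n) :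
    lap (fun y => f y * f y) x = 2 * (f x * lap f x) + 2 * ‖grad f x‖ ^ 2 := by
  have hd : Differentiable ℝ f := hf.differentiable (by norm_num)
  have h1 : fderiv ℝ (fun y => f y * f y) = fun y => (2 * f y) • fderiv ℝ f y := by
    funext y
    rw [((hd y).hasFDerivAt.fun_mul (hd y).hasFDerivAt).fderiv]
    ext1 a; simp; ring
  have h2 : ∀ a, D2 (fun y => f y * f y) x a a = 2 * (f x * D2 f x a a) + 2 * (fderiv ℝ f x a) ^ 2 := by
    intro a
    unfold D2
    rw [h1]
    have hdd : DifferentiableAt ℝ (fderiv ℝ f) x :=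
      ((hf.fderiv_right (m := 1) (by norm_num)).differentiable (by simp)) x
    rw [(((hd x).hasFDerivAt.const_mul 2).fun_smul hdd.hasFDerivAt).fderiv]
    simp; ring
  unfold lap
  rw [gradSq, sum_congr rfl fun i _ => h2 (bv i), sum_add_distrib, mul_sum,
    mul_sum, mul_sum]

/-- the cutoff -/
def cutB (n : ℕ) : ContDiffBump (0 : Euc n) := ⟨5/8, 11/16, by norm_num, by norm_num⟩

lemma cut_one (hz : ‖z‖ ≤ 5/8) : cutB n z = 1 :=
  (cutB n).one_of_mem_closedBall (by simpa [cutB] using hz)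
lemma cut_zero (hz : ¬ ‖z‖ < 11/16) : cutB n z = 0 :=
  (cutB n).zero_of_le_dist (by simpa [cutB] using hz)
lemma cut_contDiff : ContDiff ℝ 2 (fun z => cutB n z) := (cutB n).contDiff
lemma cut_hcs : HasCompactSupport (fun z => cutB n z) := (cutB n).hasCompactSupport

lemma lap_cut_zero (hz : ¬ ‖z‖ ≤ 11/16) : lap (fun z => cutB n z) z = 0 := by
  have ho : IsOpen {w : Euc n | 11/16 < ‖w‖} := isOpen_lt continuous_const continuous_norm
  have : (fun z => cutB n z) =ᶠ[𝓝 z] fun _ => 0 := by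
    filter_upwards [ho.mem_nhds (not_le.1 hz)] with w hw
    exact cut_zero (not_lt.2 (le_of_lt hw))
  unfold lap
  rw [D2_congr this]
  simp [D2]

lemma caccioppoli : ∃ C : ℝ, 0 < C ∧ ∀ (f : FunE) (ε δ : ℝ), ContDiff ℝ 2 f → 0 ≤ ε →
    0 ≤ δ → (∀ z, ‖z‖ ≤ 11/16 → |f z| ≤ ε ∧ - δ ≤ lap f z) →
    ∫ z, cutB n z * ‖grad f z‖ ^ 2 ≤ C * (ε ^ 2 + ε * δ) := by
  set η : FunE := fun z => cutB n z with hη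
  have ηc : ContDiff ℝ 2 η := cut_contDiff
  have ηs : HasCompactSupport η := cut_hcs
  have ηl : Continuous (lap η) := continuous_lap ηc
  have ηls : HasCompactSupport (lap η) := hasCompactSupport_lap ηs
  set A := ∫ z, |lap η z| with hA
  set B := ∫ z, η z with hB
  have hA0 : 0 ≤ A := integral_nonneg fun z => abs_nonneg _
  have hη0 : ∀ z, 0 ≤ η z := fun z => (cutB n).nonneg
  have hB0 : 0 ≤ B := integral_nonneg hη0
  have iA : Integrable (fun z => |lap η z|) :=
    (ηl.abs).integrable_of_hasCompactSupport (ηls.comp_left (g := fun x : ℝ => |x|) abs_zero)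
  have iB : Integrable η := ηc.continuous.integrable_of_hasCompactSupport ηs
  refine ⟨2 * A + 2 * B + 1, by positivity, fun f ε δ hf hε hδ h => ?_⟩
  have hlf := continuous_lap hf
  have cg : Continuous fun z => ‖grad f z‖ ^ 2 :=
    ((dualL.continuous.comp (hf.continuous_fderiv (by norm_num))).norm).pow 2
  have g1 := green ηc (hf.mul hf) ηs
  have g2 := green ηc hf ηs
  have i1 : Integrable fun z => η z * ‖grad f z‖ ^ 2 :=
    (ηc.continuous.mul cg).integrable_of_hasCompactSupport ηs.mul_right
  have i2 : Integrable fun z => η z * lap f z :=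
    (ηc.continuous.mul hlf).integrable_of_hasCompactSupport ηs.mul_right
  have i3 : Integrable fun z => η z * lap (fun y => f y * f y) z :=
    (ηc.continuous.mul (continuous_lap (hf.mul hf))).integrable_of_hasCompactSupport ηs.mul_right
  have b1 : ∫ z, lap η z * (f z * f z) ≤ ε ^ 2 * A := by
    rw [hA, ← integral_const_mul]
    refine integral_mono ((ηl.mul (hf.continuous.mul hf.continuous)).integrable_of_hasCompactSupport
      ηls.mul_right) (iA.const_mul _) fun z => ?_
    by_cases hz : ‖z‖ ≤ 11/16
    · have := (h z hz).1
      have h1 : f z * f z ≤ ε ^ 2 := by rw [← sq, ← sq_abs]; gcongr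
      calc lap η z * (f z * f z) ≤ |lap η z| * (f z * f z) :=
            mul_le_mul_of_nonneg_right (le_abs_self _) (mul_self_nonneg _)
        _ ≤ |lap η z| * ε ^ 2 := mul_le_mul_of_nonneg_left h1 (abs_nonneg _)
        _ = _ := mul_comm _ _
    · simp [hη, lap_cut_zero hz]
  have b2 : ∫ z, lap η z * f z ≤ ε * A := by
    rw [hA, ← integral_const_mul]
    refine integral_mono ((ηl.mul hf.continuous).integrable_of_hasCompactSupport
      ηls.mul_right) (iA.const_mul _) fun z => ?_
    by_cases hz : ‖z‖ ≤ 11/16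
    · have := (h z hz).1
      calc lap η z * f z ≤ |lap η z * f z| := le_abs_self _
        _ = |lap η z| * |f z| := abs_mul _ _
        _ ≤ |lap η z| * ε := mul_le_mul_of_nonneg_left this (abs_nonneg _)
        _ = _ := mul_comm _ _
    · simp [hη, lap_cut_zero hz]
  have key : ∫ z, 2 * (η z * ‖grad f z‖ ^ 2) ≤
      ∫ z, (η z * lap (fun y => f y * f y) z + 2 * ε * (η z * lap f z) + 4 * ε * δ * η z) := by
    refine integral_mono (i1.const_mul 2) ((i3.add (i2.const_mul _)).add (iB.const_mul _)) fun z => ?_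
    simp only
    rw [lap_sq hf]
    by_cases hz : ‖z‖ < 11/16
    · obtain ⟨h1, h2⟩ := h z hz.le
      have h3 := abs_le.1 h1
      have : 0 ≤ f z * lap f z + ε * lap f z + 2 * ε * δ := by
        nlinarith [mul_nonneg (by linarith [h3.1] : 0 ≤ f z + ε) (by linarith : 0 ≤ lap f z + δ),
          mul_nonneg hδ (by linarith [h3.2] : 0 ≤ ε - f z)]
      have := mul_nonneg (hη0 z) this
      linarith
    · simp [hη, cut_zero hz]
  have e1 : ∫ z, (η z * lap (fun y => f y * f y) z + 2 * ε * (η z * lap f z) + 4 * ε * δ * η z)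
      = (∫ z, η z * lap (fun y => f y * f y) z) + 2 * ε * (∫ z, η z * lap f z) + 4 * ε * δ * B := by
    have i4 : Integrable fun z => η z * lap (fun y => f y * f y) z + 2 * ε * (η z * lap f z) :=
      i3.add (i2.const_mul _)
    rw [integral_add i4 (iB.const_mul _), integral_add i3 (i2.const_mul _),
      integral_const_mul, integral_const_mul]
  rw [e1, g1, g2, integral_const_mul] at key
  have := mul_le_mul_of_nonneg_left b2 (by positivity : 0 ≤ 2 * ε)
  change ∫ z, η z * ‖grad f z‖ ^ 2 ≤ _
  nlinarith [mul_nonneg hε hδ, mul_nonneg (mul_nonneg hε hδ) hA0, mul_nonneg (mul_nonneg hε hε) hB0,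
    mul_nonneg hε hε, mul_nonneg (mul_nonneg hε hε) hA0]

lemma lap_sub_sq (hu : ContDiffAt ℝ 2 u x) :
    lap (fun z => u z - ‖z‖ ^ 2 / 2) x = lap u x - n := by
  have h1 : (fun z : Euc n => u z - ‖z‖ ^ 2 / 2) = fun z => u z + (-1/2) * ‖z‖ ^ 2 := by
    funext z; ring
  unfold lap
  rw [h1, D2_add hu (contDiff_const.mul contDiff_normsq).contDiffAt, D2_const_mul]
  have : ∀ i : Fin n, (D2 u x + (-1/2 : ℝ) • D2 (fun y : Euc n => ‖y‖ ^ 2) x) (bv i) (bv i)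
      = D2 u x (bv i) (bv i) - 1 := by
    intro i
    have : (D2 u x + (-1/2 : ℝ) • D2 (fun y : Euc n => ‖y‖ ^ 2) x) (bv i) (bv i)
      = D2 u x (bv i) (bv i) + (-1/2) * D2 (fun y : Euc n => ‖y‖ ^ 2) x (bv i) (bv i) := rfl
    rw [this, D2_normsq, inner_bv]; ring
  rw [sum_congr rfl fun i _ => this i]
  simp

lemma grad_sub_sq (hu : DifferentiableAt ℝ u x) :
    grad (fun z => u z - ‖z‖ ^ 2 / 2) x = grad u x - x := by
  refine ext_inner_right ℝ fun w => ?_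
  rw [inner_grad, inner_sub_left, inner_grad]
  have h1 : HasFDerivAt (fun z : Euc n => ‖z‖ ^ 2 / 2) ((2⁻¹ : ℝ) • (2 • innerSL ℝ x)) x := by
    have := (hasStrictFDerivAt_norm_sq x).hasFDerivAt.const_mul (2⁻¹ : ℝ)
    refine this.congr_of_eventuallyEq (Eventually.of_forall fun z => ?_)
    simp only; ring
  rw [(hu.hasFDerivAt.fun_sub h1).fderiv]
  simp

lemma lemmaP : ∃ C : ℝ, 0 < C ∧ ∀ (u : FunE) (δ ε : ℝ),
    Adm (ball 0 1) u (exp (-δ)) (exp δ) → 0 ≤ δ → 0 ≤ ε → ε ≤ 1/1024 →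
    (∀ z ∈ ball (0 : Euc n) 1, |u z - ‖z‖ ^ 2 / 2| ≤ ε) →
    ∃ φ : FunE, Continuous φ ∧ (∀ z, ‖z‖ < 7/8 → φ z = u z - ‖z‖ ^ 2 / 2) ∧
    (∀ x, ‖x‖ < 1/2 → |φ x - ∫ z, mker z * φ (x + z)| ≤ C * (ε ^ 2 + δ)) ∧
    |∫ z, lap mker z * φ z| ≤ C * (ε ^ 2 + δ) := by
  obtain ⟨C1, hC1, hcac⟩ := caccioppoli (n := n)
  obtain ⟨C2, hC2, hmv⟩ := mean_value (n := n)
  obtain ⟨M1, hM1⟩ := mker_hcs.exists_bound_of_continuous (mker_cont (n := n))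
  obtain ⟨M2, hM2⟩ := (hasCompactSupport_lap (mker_hcs (n := n))).exists_bound_of_continuous
    (continuous_lap (mker_contDiff (k := 2)))
  have hM1p : 0 ≤ M1 := (norm_nonneg _).trans (hM1 0)
  have hM2p : 0 ≤ M2 := (norm_nonneg _).trans (hM2 0)
  refine ⟨C2 + (M1 + M2) * C1 + 1, by positivity, fun u δ ε h hδ hε hε1 hφ => ?_⟩
  obtain ⟨us, husc, hus⟩ := legendre h hε1 hφ
  have cd1 : ContDiffOn ℝ 2 (fun z => u z - ‖z‖ ^ 2 / 2) (ball 0 1) :=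
    h.cd.sub (contDiff_normsq.div_const 2).contDiffOn
  have cd2 : ContDiffOn ℝ 2 (fun z => us z - ‖z‖ ^ 2 / 2) (ball 0 (3/4)) :=
    husc.sub (contDiff_normsq.div_const 2).contDiffOn
  obtain ⟨g1, hg1c, hg1⟩ := extend (r := 7/8) (by norm_num) (by norm_num) cd1
  obtain ⟨g2, hg2c, hg2⟩ := extend (r := 23/32) (by norm_num) (by norm_num) cd2
  have ev1 : ∀ z, ‖z‖ ≤ 11/16 → g1 =ᶠ[𝓝 z] fun z => u z - ‖z‖ ^ 2 / 2 := by
    intro z hz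
    filter_upwards [isOpen_ball.mem_nhds (by simp; linarith : z ∈ ball (0 : Euc n) (7/8))] with w hw using hg1 w hw
  have ev2 : ∀ z, ‖z‖ ≤ 11/16 → g2 =ᶠ[𝓝 z] fun z => us z - ‖z‖ ^ 2 / 2 := by
    intro z hz
    filter_upwards [isOpen_ball.mem_nhds (by simp; linarith : z ∈ ball (0 : Euc n) (23/32))] with w hw using hg2 w hw
  have mb1 : ∀ z : Euc n, ‖z‖ ≤ 11/16 → z ∈ ball (0 : Euc n) 1 := by
    intro z hz; simp; linarith
  have mb2 : ∀ z : Euc n, ‖z‖ ≤ 11/16 → z ∈ ball (0 : Euc n) (3/4) := by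
    intro z hz; simp; linarith
  have p1 : ∀ z, ‖z‖ ≤ 11/16 → |g1 z| ≤ ε ∧ - δ ≤ lap g1 z := by
    intro z hz
    refine ⟨by rw [(ev1 z hz).eq_of_nhds]; exact hφ z (mb1 z hz), ?_⟩
    have e : lap g1 z = lap (fun z => u z - ‖z‖ ^ 2 / 2) z := by unfold lap; rw [D2_congr (ev1 z hz)]
    have hdp := h.pos.trans_le (h.det _ (mb1 z hz)).1
    rw [e, lap_sub_sq (h.cda (mb1 z hz))]
    have := lap_ge h.op h.cw h.cd (mb1 z hz) hdp
    have h2 : - δ ≤ log (hessDet u z) := by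
      rw [Real.le_log_iff_exp_le hdp]; exact (h.det _ (mb1 z hz)).1
    linarith
  have p2 : ∀ z, ‖z‖ ≤ 11/16 → |g2 z| ≤ ε ∧ - δ ≤ lap g2 z := by
    intro z hz
    obtain ⟨h1, h2, h3, h4⟩ := hus z (mb2 z hz)
    constructor
    · rw [(ev2 z hz).eq_of_nhds]
      have := abs_le.1 (hφ z (mb1 z hz))
      rw [abs_le]; constructor <;> linarith [this.2]
    have e : lap g2 z = lap (fun z => us z - ‖z‖ ^ 2 / 2) z := by unfold lap; rw [D2_congr (ev2 z hz)]
    rw [e, lap_sub_sq (husc.contDiffAt (isOpen_ball.mem_nhds (mb2 z hz)))]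
    linarith
  have p3 : ∀ z, ‖z‖ ≤ 11/16 → 0 ≤ g1 z + g2 z ∧
      g1 z + g2 z ≤ 1/2 * (‖grad g1 z‖ ^ 2 + ‖grad g2 z‖ ^ 2) := by
    intro z hz
    obtain ⟨h1, h2, h3, h4⟩ := hus z (mb2 z hz)
    have e1 : grad g1 z = grad u z - z := by
      rw [← grad_sub_sq (h.diff (mb1 z hz))]; unfold grad; rw [(ev1 z hz).fderiv_eq]
    have e2 : grad g2 z = grad us z - z := by
      rw [← grad_sub_sq ((husc.contDiffAt (isOpen_ball.mem_nhds (mb2 z hz))).differentiableAt (by norm_num))]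
      unfold grad; rw [(ev2 z hz).fderiv_eq]
    have q := sq_nonneg ‖(grad u z - z) + (grad us z - z)‖
    rw [norm_add_sq_real] at q
    rw [(ev1 z hz).eq_of_nhds, (ev2 z hz).eq_of_nhds, e1, e2]
    constructor <;> linarith
  have c1 := hg1c.continuous
  have c2 := hg2c.continuous
  have cgr : ∀ {f : FunE}, ContDiff ℝ 2 f → Integrable fun z => cutB n z * ‖grad f z‖ ^ 2 := by
    intro f hf
    have cg : Continuous fun z => ‖grad f z‖ ^ 2 :=
      ((dualL.continuous.comp (hf.continuous_fderiv (by norm_num))).norm).pow 2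
    exact (cut_contDiff.continuous.mul cg).integrable_of_hasCompactSupport cut_hcs.mul_right
  have ih : Integrable fun z => cutB n z * (g1 z + g2 z) :=
    (cut_contDiff.continuous.mul (c1.add c2)).integrable_of_hasCompactSupport cut_hcs.mul_right
  have hI : ∫ z, cutB n z * (g1 z + g2 z) ≤ C1 * (ε ^ 2 + ε * δ) := by
    have q1 := hcac g1 ε δ hg1c hε hδ p1
    have q2 := hcac g2 ε δ hg2c hε hδ p2
    have : ∫ z, cutB n z * (g1 z + g2 z) ≤
        ∫ z, (1/2 * (cutB n z * ‖grad g1 z‖ ^ 2) + 1/2 * (cutB n z * ‖grad g2 z‖ ^ 2)) := by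
      refine integral_mono ih (((cgr hg1c).const_mul _).add ((cgr hg2c).const_mul _)) fun z => ?_
      by_cases hz : ‖z‖ < 11/16
      · have := mul_le_mul_of_nonneg_left (p3 z hz.le).2 ((cutB n).nonneg (x := z))
        simp only; linarith
      · simp [cut_zero hz]
    rw [integral_add ((cgr hg1c).const_mul _) ((cgr hg2c).const_mul _), integral_const_mul,
      integral_const_mul] at this
    linarith
  have hJ : ∀ (k : FunE) (x : Euc n) (M : ℝ), 0 ≤ M → Continuous k → HasCompactSupport k →
      (∀ z, ‖k z‖ ≤ M) → (∀ z, 1/8 < ‖z‖ → k z = 0) → ‖x‖ < 1/2 →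
      ∫ z, k z * (g1 (x + z) + g2 (x + z)) ≤ M * (C1 * (ε ^ 2 + δ)) := by
    intro k x M hM hk hks hkM hk0 hx
    have e : ∫ z, k z * (g1 (x + z) + g2 (x + z)) = ∫ w, k (w - x) * (g1 w + g2 w) := by
      rw [← integral_add_left_eq_self (fun w => k (w - x) * (g1 w + g2 w)) x]
      simp
    have hks' : HasCompactSupport fun w => k (w - x) :=
      hks.comp_homeomorph (Homeomorph.subRight x)
    have : ∫ w, k (w - x) * (g1 w + g2 w) ≤ ∫ w, M * (cutB n w * (g1 w + g2 w)) := by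
      refine integral_mono (((hk.comp (by fun_prop)).mul (c1.add c2)).integrable_of_hasCompactSupport
        hks'.mul_right) (ih.const_mul _) fun w => ?_
      simp only
      by_cases hw : 1/8 < ‖w - x‖
      · rw [hk0 _ hw, zero_mul]
        by_cases hz : ‖w‖ < 11/16
        · exact mul_nonneg hM (mul_nonneg (cutB n).nonneg (p3 w hz.le).1)
        · simp [cut_zero hz]
      · have hw2 : ‖w‖ ≤ 5/8 := by
          have := norm_add_le (w - x) x
          simp only [sub_add_cancel] at this
          linarith
        rw [cut_one hw2, one_mul]
        exact mul_le_mul_of_nonneg_right ((Real.le_norm_self _).trans (hkM _)) (p3 w (by linarith)).1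
    rw [e]
    rw [integral_const_mul] at this
    refine this.trans (mul_le_mul_of_nonneg_left (hI.trans ?_) hM)
    have : ε * δ ≤ δ := by nlinarith
    gcongr
  have lk0 : ∀ z : Euc n, 1/8 < ‖z‖ → lap mker z = 0 := by
    intro z hz
    have ho : IsOpen {w : Euc n | 1/8 < ‖w‖} := isOpen_lt continuous_const continuous_norm
    have : (mker (n := n)) =ᶠ[𝓝 z] fun _ => 0 := by
      filter_upwards [ho.mem_nhds hz] with w hw
      exact mker_zero hw
    unfold lap
    rw [D2_congr this]
    simp [D2]
  have ik : ∀ (k g : FunE) (x : Euc n), Continuous k → HasCompactSupport k → Continuous g →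
      Integrable fun z => k z * g (x + z) := fun k g x hk hs hg =>
    (hk.mul (hg.comp (by fun_prop))).integrable_of_hasCompactSupport hs.mul_right
  have ε2 : 0 ≤ ε ^ 2 := sq_nonneg _
  refine ⟨g1, c1, fun z hz => hg1 z (by simpa using hz), fun x hx => ?_, ?_⟩
  · have hb : ∀ y : Euc n, ‖y - x‖ ≤ 1/8 → ‖y‖ ≤ 11/16 := by
      intro y hy
      have := norm_add_le (y - x) x
      simp only [sub_add_cancel] at this
      linarith
    have m1 := hmv g1 x δ hg1c hδ fun y hy => (p1 y (hb y hy)).2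
    have m2 := hmv g2 x δ hg2c hδ fun y hy => (p2 y (hb y hy)).2
    have m3 := (p3 x (by linarith)).1
    have m4 := hJ mker x M1 hM1p mker_cont mker_hcs hM1 (fun z hz => mker_zero hz) hx
    simp only [mul_add] at m4
    rw [integral_add (ik _ _ _ mker_cont mker_hcs c1) (ik _ _ _ mker_cont mker_hcs c2)] at m4
    rw [abs_le]
    constructor <;> nlinarith [mul_nonneg hC2.le ε2, mul_nonneg (mul_nonneg hM2p hC1.le) ε2,
      mul_nonneg (mul_nonneg hM2p hC1.le) hδ, mul_nonneg (mul_nonneg hM1p hC1.le) ε2,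
      mul_nonneg (mul_nonneg hM1p hC1.le) hδ]
  · have gr1 := green (mker_contDiff (k := 2)) hg1c (mker_hcs (n := n))
    have gr2 := green (mker_contDiff (k := 2)) hg2c (mker_hcs (n := n))
    have ck := continuous_lap (mker_contDiff (n := n) (k := 2))
    have hks := hasCompactSupport_lap (mker_hcs (n := n))
    have m4 := hJ (lap mker) 0 M2 hM2p ck hks hM2 lk0 (by simp)
    simp only [mul_add] at m4
    rw [integral_add (ik _ _ _ ck hks c1) (ik _ _ _ ck hks c2)] at m4
    simp only [zero_add] at m4
    have low : ∀ g : FunE, ContDiff ℝ 2 g → (∀ z, ‖z‖ ≤ 11/16 → - δ ≤ lap g z) →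
        - δ ≤ ∫ z, mker z * lap g z := by
      intro g hg hl
      have : ∫ z : Euc n, mker z * (-δ) ≤ ∫ z, mker z * lap g z := by
        refine integral_mono (mker_integrable.mul_const _)
          ((mker_cont.mul (continuous_lap hg)).integrable_of_hasCompactSupport mker_hcs.mul_right)
          fun z => ?_
        by_cases hz : 1/8 < ‖z‖
        · simp [mker_zero hz]
        · exact mul_le_mul_of_nonneg_left (hl z (by linarith)) (mker_nonneg z)
      rw [integral_mul_const, mker_integral] at this
      linarith
    have l1 := low g1 hg1c fun z hz => (p1 z hz).2
    have l2 := low g2 hg2c fun z hz => (p2 z hz).2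
    rw [gr1] at l1
    rw [gr2] at l2
    rw [abs_le]
    constructor <;> nlinarith [mul_nonneg hC2.le ε2, mul_nonneg (mul_nonneg hM2p hC1.le) ε2,
      mul_nonneg (mul_nonneg hM2p hC1.le) hδ, mul_nonneg (mul_nonneg hM1p hC1.le) ε2,
      mul_nonneg (mul_nonneg hM1p hC1.le) hδ, mul_nonneg hC2.le hδ]

set_option maxSynthPendingDepth 3

/-! ### Normalization and Taylor -/

lemma norm_smulL (c : ℝ) (S : EndE) (x : Euc n) : (c • S) x = c • S x := rfl

lemma det_smulL (c : ℝ) (S : EndE) : (c • S).det = c ^ n * S.det := by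
  have := LinearMap.det_smul c (S : Euc n →ₗ[ℝ] Euc n)
  rw [finrank_euclideanSpace_fin] at this
  exact this

lemma norm_bil {q : ℝ} (hq : ‖Q‖ ≤ q) (x y : Euc n) :
    |Q x y| ≤ q * ‖x‖ * ‖y‖ := by
  have := Q.le_opNorm₂ x y
  rw [norm_eq_abs] at this
  refine this.trans ?_
  gcongr

lemma matB_inner : matB (innerSL ℝ (E := Euc n)) = 1 := by
  ext i j
  simp only [matB, Matrix.of_apply, bv, innerSL_apply_apply, EuclideanSpace.inner_single_left,
    Matrix.one_apply]
  show ⟪EuclideanSpace.single i (1:ℝ), EuclideanSpace.single j (1:ℝ)⟫ = _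
  rw [EuclideanSpace.inner_single_left]
  simp [Pi.single_apply]

set_option maxHeartbeats 1000000 in
lemma normalizeS (hn : 1 ≤ n) : ∃ C : ℝ, 1 ≤ C ∧ ∀ (Q : BilE) (q τ : ℝ),
    SymB Q → ‖Q‖ ≤ q → q ≤ 1/8 → |∑ i, Q (bv i) (bv i)| ≤ τ → τ ≤ 1/2 →
    ∃ S : EndE, S.det ^ 2 = 1 ∧ ‖S - 1‖ ≤ C * (q + τ) ∧
      ∀ x, |‖S x‖ ^ 2 + Q (S x) (S x) - ‖x‖ ^ 2| ≤ C * (q ^ 2 + τ) * ‖x‖ ^ 2 := by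
  refine ⟨40, by norm_num, fun Q q τ hs hQ hq hτ hτ1 => ?_⟩
  have hq0 : 0 ≤ q := (norm_nonneg _).trans hQ
  have hτ0 : 0 ≤ τ := (abs_nonneg _).trans hτ
  set A : EndE := dualL.comp Q with hA
  have hAi : ∀ x y, ⟪A x, y⟫ = Q x y := fun x y => inner_dualL _ _
  have hAn : ∀ x, ‖A x‖ ≤ q * ‖x‖ := by
    intro x
    by_cases h0 : ‖A x‖ = 0
    · rw [h0]; positivity
    have h1 : ‖A x‖ * ‖A x‖ ≤ q * ‖x‖ * ‖A x‖ := by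
      rw [← real_inner_self_eq_norm_mul_norm, hAi]
      exact (le_abs_self _).trans (norm_bil hQ _ _)
    exact le_of_mul_le_mul_right h1 (lt_of_le_of_ne (norm_nonneg _) (Ne.symm h0))
  set S0 : EndE := 1 - (1/2 : ℝ) • A with hS0
  have hS0a : ∀ x, S0 x = x - (1/2 : ℝ) • A x := fun x => rfl
  have hn0 : ∀ x, ‖S0 x‖ ^ 2 = ‖x‖ ^ 2 - Q x x + 1/4 * ‖A x‖ ^ 2 := by
    intro x
    rw [hS0a, norm_sub_sq_real, inner_smul_right, real_inner_comm, hAi, norm_smul]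
    norm_num; ring
  have hAA : ∀ x, ‖A x‖ ^ 2 ≤ q ^ 2 * ‖x‖ ^ 2 := by
    intro x
    rw [← mul_pow]; exact pow_le_pow_left₀ (norm_nonneg _) (hAn x) 2
  have hqx : ∀ x, Q (S0 x) (S0 x) = Q x x - ‖A x‖ ^ 2 + 1/4 * Q (A x) (A x) := by
    intro x
    rw [hS0a]
    simp only [map_sub, map_smul, _root_.sub_apply, _root_.smul_apply, smul_eq_mul]
    rw [hs (A x) x, ← hAi x (A x), real_inner_self_eq_norm_sq]
    ring
  -- bilinear form of S0
  set b : BilE := (innerSL ℝ (E := Euc n)).bilinearComp S0 S0 with hb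
  have hba : ∀ x y, b x y = ⟪S0 x, S0 y⟫ := fun x y => rfl
  have hbs : SymB b := fun x y => by rw [hba, hba, real_inner_comm]
  have hdet : (matB b).det = S0.det ^ 2 := by
    rw [det_matB_comp (innerSL ℝ (E := Euc n)) b S0 (fun x y => rfl)]
    rw [matB_inner]; simp
  have hbx : ∀ x, |b x x - ‖x‖ ^ 2| ≤ (2 * q) * ‖x‖ ^ 2 := by
    intro x
    rw [hba, real_inner_self_eq_norm_sq, hn0]
    have h1 := abs_le.1 (norm_bil hQ x x)
    have h2 := hAA x
    have h3 := sq_nonneg ‖A x‖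
    have h4 : q ^ 2 * ‖x‖ ^ 2 ≤ q * ‖x‖ ^ 2 := by
      refine mul_le_mul_of_nonneg_right ?_ (sq_nonneg _)
      nlinarith
    have h5 : q * ‖x‖ * ‖x‖ = q * ‖x‖ ^ 2 := by ring
    rw [h5] at h1
    rw [abs_le]; constructor <;> linarith [h1.1, h1.2]
  have hpd : (matB b).PosDef := by
    refine posDef_matB_of_pos b hbs fun x hx => ?_
    have := (abs_le.1 (hbx x)).1
    have : 0 < ‖x‖ ^ 2 := by positivity
    nlinarith
  have htr : (matB b).trace = n - ∑ i, Q (bv i) (bv i) + 1/4 * ∑ i, ‖A (bv i)‖ ^ 2 := by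
    rw [trace_matB]
    have : ∀ i : Fin n, b (bv i) (bv i) = 1 - Q (bv i) (bv i) + 1/4 * ‖A (bv i)‖ ^ 2 := by
      intro i
      rw [hba, real_inner_self_eq_norm_sq, hn0, norm_bv]; norm_num
    rw [sum_congr rfl fun i _ => this i, sum_add_distrib, sum_sub_distrib,
      mul_sum]
    simp
  have hsumA : ∑ i : Fin n, ‖A (bv i)‖ ^ 2 ≤ n * q ^ 2 := by
    calc ∑ i : Fin n, ‖A (bv i)‖ ^ 2 ≤ ∑ i : Fin n, q ^ 2 :=
          sum_le_sum fun i _ => by simpa [norm_bv] using hAA (bv i)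
      _ = n * q ^ 2 := by simp
  have hsumA0 : 0 ≤ ∑ i : Fin n, ‖A (bv i)‖ ^ 2 := Finset.sum_nonneg fun i _ => sq_nonneg _
  have t1 := trace_ge_log_det _ hpd
  have t2 := trace_le_log_det b hbs (η := 2 * q) (by linarith) hbx
  rw [htr, hdet] at t1 t2
  have hdpos : 0 < S0.det ^ 2 := by rw [← hdet]; exact hpd.det_pos
  set p := log (S0.det ^ 2) / n with hp
  have hn' : (1:ℝ) ≤ n := by exact_mod_cast hn
  have hpn : log (S0.det ^ 2) = n * p := by rw [hp]; field_simp
  have hpb : |p| ≤ τ + 8 * q ^ 2 := by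
    rw [hpn] at t1 t2
    have h3 := abs_le.1 hτ
    have h4 : (n:ℝ) * |p| ≤ τ + n * (8 * q ^ 2) := by
      rw [← abs_of_nonneg (by linarith : (0:ℝ) ≤ n), ← abs_mul, abs_of_nonneg (by linarith : (0:ℝ) ≤ n)]
      rw [abs_le]; constructor <;> nlinarith [h3.1, h3.2, sq_nonneg q]
    have h5 : (n:ℝ) * |p| ≤ n * (τ + 8 * q ^ 2) := by nlinarith
    exact le_of_mul_le_mul_left h5 (by linarith)
  have hp1 : |p| ≤ 1 := by nlinarith
  have hs1 : |exp (-p) - 1| ≤ 2 * |p| := by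
    simpa using Real.abs_exp_sub_one_le (x := -p) (by simpa using hp1)
  have hs2 : |exp (-p/2) - 1| ≤ |p| := by
    have := Real.abs_exp_sub_one_le (x := -p/2) (by rw [abs_div, abs_neg]; norm_num; linarith)
    rw [abs_div, abs_neg] at this
    norm_num at this; linarith
  set s := exp (-p/2) with hsd
  have hss : s ^ 2 = exp (-p) := by rw [hsd, ← exp_nat_mul]; congr 1; push_cast; ring
  have hqq : q ^ 2 ≤ q := by nlinarith
  refine ⟨s • S0, ?_, ?_, ?_⟩
  · rw [det_smulL, mul_pow, ← pow_mul, mul_comm n 2, pow_mul, hss, ← exp_nat_mul,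
      ← Real.exp_log hdpos, hpn, ← exp_add]
    simp
  · refine ContinuousLinearMap.opNorm_le_bound _ (by positivity) fun x => ?_
    have e : (s • S0 - 1) x = (s - 1) • x - (s/2) • A x := by
      show s • S0 x - x = _
      rw [hS0a]; module
    rw [e]
    have h1 := norm_sub_le ((s - 1) • x) ((s/2) • A x)
    rw [norm_smul, norm_smul, norm_eq_abs, norm_eq_abs] at h1
    have hs0 : 0 < s := exp_pos _
    have hs3 : s ≤ 2 := by linarith [(abs_le.1 hs2).2]
    rw [abs_of_pos (by positivity : 0 < s/2)] at h1
    have h2 : s/2 * ‖A x‖ ≤ q * ‖x‖ :=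
      (mul_le_of_le_one_left (norm_nonneg _) (by linarith)).trans (hAn x)
    have h3 : |s - 1| * ‖x‖ ≤ (τ + 8 * q) * ‖x‖ :=
      mul_le_mul_of_nonneg_right (by linarith) (norm_nonneg _)
    have := mul_nonneg hτ0 (norm_nonneg x)
    have := mul_nonneg hq0 (norm_nonneg x)
    linarith
  · intro x
    rw [norm_smulL, norm_smul, mul_pow, norm_eq_abs, sq_abs]
    simp only [map_smul, _root_.smul_apply, smul_eq_mul]
    have e : s ^ 2 * ‖S0 x‖ ^ 2 + s * (s * Q (S0 x) (S0 x)) - ‖x‖ ^ 2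
        = (s ^ 2 - 1) * ‖x‖ ^ 2 + s ^ 2 * (-(3/4) * ‖A x‖ ^ 2 + 1/4 * Q (A x) (A x)) := by
      rw [hn0, hqx]; ring
    rw [e, hss]
    have hE := (abs_le.1 hs1).2
    have hE3 : exp (-p) ≤ 3 := by linarith
    have h1 : |(exp (-p) - 1) * ‖x‖ ^ 2| ≤ 2 * (τ + 8 * q ^ 2) * ‖x‖ ^ 2 := by
      rw [abs_mul, abs_of_nonneg (sq_nonneg ‖x‖)]
      exact mul_le_mul_of_nonneg_right (by linarith) (sq_nonneg _)
    have h2 : |-(3/4) * ‖A x‖ ^ 2 + 1/4 * Q (A x) (A x)| ≤ q ^ 2 * ‖x‖ ^ 2 := by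
      have h3 := abs_le.1 (norm_bil hQ (A x) (A x))
      have h4 := hAA x
      have h5 : q * ‖A x‖ * ‖A x‖ ≤ ‖A x‖ ^ 2 := by
        rw [mul_assoc, ← sq]; exact mul_le_of_le_one_left (sq_nonneg _) (by linarith)
      have h6 := sq_nonneg ‖A x‖
      rw [abs_le]; constructor <;> linarith [h3.1, h3.2]
    have h3 : |exp (-p) * (-(3/4) * ‖A x‖ ^ 2 + 1/4 * Q (A x) (A x))| ≤ 3 * (q ^ 2 * ‖x‖ ^ 2) := by
      rw [abs_mul, abs_of_pos (exp_pos _)]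
      exact mul_le_mul hE3 h2 (abs_nonneg _) (by norm_num)
    refine (abs_add_le _ _).trans ?_
    have := mul_nonneg hτ0 (sq_nonneg ‖x‖)
    have := mul_nonneg (sq_nonneg q) (sq_nonneg ‖x‖)
    linarith

lemma taylor_step {F : Type*} [NormedAddCommGroup F] [NormedSpace ℝ F] {G : Euc n → F}
    {G' : Euc n → Euc n →L[ℝ] F} (hG : ∀ y, HasFDerivAt G (G' y) y) (w x : Euc n) (p p' : ℝ → F)
    (hp : ∀ t, HasDerivAt p (p' t) t) (h0 : p 0 = G w) {B : ℝ}
    (hB : ∀ t ∈ Icc (0:ℝ) 1, ‖G' (w + t • x) x - p' t‖ ≤ B) : ‖G (w + x) - p 1‖ ≤ B := by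
  have hd : ∀ t : ℝ, HasDerivAt (fun t : ℝ => G (w + t • x) - p t) (G' (w + t • x) x - p' t) t := by
    intro t
    have h1 : HasDerivAt (fun t : ℝ => w + t • x) x t := by
      simpa using ((hasDerivAt_id t).smul_const x).const_add w
    exact ((hG _).comp_hasDerivAt t h1).sub (hp t)
  have := (convex_Icc (0:ℝ) 1).norm_image_sub_le_of_norm_hasDerivWithin_le
    (fun t _ => (hd t).hasDerivWithinAt) hB (left_mem_Icc.2 zero_le_one) (right_mem_Icc.2 zero_le_one)
  simpa [h0] using this

/-- trilinear forms -/
abbrev Tri (n : ℕ) := Euc n →L[ℝ] Euc n →L[ℝ] Euc n →L[ℝ] ℝ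

def D3k (w : Euc n) : Tri n := fderiv ℝ (D2 mker) w

lemma mker_taylor : ∃ C : ℝ, 0 ≤ C ∧ ∀ w x : Euc n,
    |mker (w + x) - (mker w + fderiv ℝ mker w x + 1/2 * D2 mker w x x + 1/6 * D3k w x x x)|
      ≤ C * ‖x‖ ^ 4 := by
  have c4 : ContDiff ℝ 4 (mker (n := n)) := mker_contDiff (k := 4)
  have d1 : ContDiff ℝ 3 (fderiv ℝ (mker (n := n))) := c4.fderiv_right (by norm_num)
  have d2 : ContDiff ℝ 2 (D2 (mker (n := n))) := d1.fderiv_right (by norm_num)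
  have d3 : ContDiff ℝ 1 (D3k (n := n)) := d2.fderiv_right (by norm_num)
  have s3 : HasCompactSupport (D3k (n := n)) :=
    ((mker_hcs.fderiv (𝕜 := ℝ)).fderiv (𝕜 := ℝ)).fderiv (𝕜 := ℝ)
  obtain ⟨C, hC⟩ := d3.lipschitzWith_of_hasCompactSupport s3 (by norm_num)
  have h0 : ∀ y, HasFDerivAt (mker (n := n)) (fderiv ℝ mker y) y := fun y =>
    (c4.differentiable (by norm_num) y).hasFDerivAt
  have h1 : ∀ y, HasFDerivAt (fderiv ℝ (mker (n := n))) (D2 mker y) y := fun y =>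
    (d1.differentiable (by norm_num) y).hasFDerivAt
  have h2 : ∀ y, HasFDerivAt (D2 (mker (n := n))) (D3k y) y := fun y =>
    (d2.differentiable (by norm_num) y).hasFDerivAt
  have hC0 : (0:ℝ) ≤ C := C.2
  have L1 : ∀ w x : Euc n, ‖D3k (w + x) - D3k w‖ ≤ C * ‖x‖ := by
    intro w x
    have := hC.dist_le_mul (w + x) w
    simpa [dist_eq_norm] using this
  have tb : ∀ (t : ℝ), t ∈ Icc (0:ℝ) 1 → ∀ (x : Euc n) (k : ℕ), C * ‖t • x‖ ^ k ≤ C * ‖x‖ ^ k := by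
    intro t ht x k
    rw [norm_smul, norm_eq_abs, abs_of_nonneg ht.1]
    gcongr
    · exact mul_nonneg ht.1 (norm_nonneg x)
    · exact mul_le_of_le_one_left (norm_nonneg x) ht.2
  have L2 : ∀ w x : Euc n, ‖D2 mker (w + x) - (D2 mker w + D3k w x)‖ ≤ C * ‖x‖ ^ 2 := by
    intro w x
    have := taylor_step h2 w x (fun t => D2 mker w + t • D3k w x) (fun _ => D3k w x)
      (fun t => by simpa using ((hasDerivAt_id t).smul_const (D3k w x)).const_add (D2 mker w)) (by simp)
      (B := C * ‖x‖ ^ 2) (fun t ht => ?_)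
    · simpa using this
    · have e : D3k (w + t • x) x - D3k w x = (D3k (w + t • x) - D3k w) x := rfl
      rw [e]
      have h4 : ‖(D3k (w + t • x) - D3k w) x‖ ≤ ‖D3k (w + t • x) - D3k w‖ * ‖x‖ :=
        ContinuousLinearMap.le_opNorm (D3k (w + t • x) - D3k w) x
      have h3 : ‖D3k (w + t • x) - D3k w‖ ≤ C * ‖x‖ := (L1 w (t • x)).trans (by simpa using tb t ht x 1)
      calc _ ≤ C * ‖x‖ * ‖x‖ := h4.trans (mul_le_mul_of_nonneg_right h3 (norm_nonneg _))
        _ = _ := by ring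
  have hd2 : ∀ t : ℝ, HasDerivAt (fun t : ℝ => t ^ 2 / 2) t t := fun t => by
    have := (hasDerivAt_pow 2 t).div_const 2
    simpa using this
  have hd3 : ∀ t : ℝ, HasDerivAt (fun t : ℝ => t ^ 3 / 6) (t ^ 2 / 2) t := fun t => by
    have := (hasDerivAt_pow 3 t).div_const 6
    refine this.congr_deriv ?_
    norm_num; ring
  have L3 : ∀ w x : Euc n, ‖fderiv ℝ mker (w + x) - (fderiv ℝ mker w + D2 mker w x
      + (1/2:ℝ) • D3k w x x)‖ ≤ C * ‖x‖ ^ 3 := by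
    intro w x
    have := taylor_step h1 w x (fun t => fderiv ℝ mker w + t • D2 mker w x + (t ^ 2 / 2) • D3k w x x)
      (fun t => D2 mker w x + t • D3k w x x)
      (fun t => ?_) (by simp)
      (B := C * ‖x‖ ^ 3) (fun t ht => ?_)
    · simpa using this
    · have e1 := ((hasDerivAt_id' t).smul_const (D2 mker w x)).const_add (fderiv ℝ mker w)
      have e2 := (hd2 t).smul_const (D3k w x x)
      have := e1.fun_add e2
      rw [one_smul] at this
      exact this
    · have e : D2 mker (w + t • x) x - (D2 mker w x + t • D3k w x x)
        = (D2 mker (w + t • x) - (D2 mker w + D3k w (t • x))) x := by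
        simp
      rw [e]
      refine (ContinuousLinearMap.le_opNorm _ x).trans ?_
      have h3 := (L2 w (t • x)).trans (tb t ht x 2)
      calc _ ≤ C * ‖x‖ ^ 2 * ‖x‖ := by gcongr
        _ = _ := by ring
  refine ⟨C, hC0, fun w x => ?_⟩
  have := taylor_step h0 w x (fun t => mker w + t * fderiv ℝ mker w x + (t ^ 2 / 2) * D2 mker w x x
      + (t ^ 3 / 6) * D3k w x x x)
      (fun t => fderiv ℝ mker w x + t * D2 mker w x x + t ^ 2 / 2 * D3k w x x x)
      (fun t => ?_) (by simp)
      (B := C * ‖x‖ ^ 4) (fun t ht => ?_)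
  · rw [norm_eq_abs] at this
    convert this using 3; ring
  · have e1 := ((hasDerivAt_id' t).mul_const (fderiv ℝ mker w x)).const_add (mker w)
    have e2 := (hd2 t).mul_const (D2 mker w x x)
    have e3 := (hd3 t).mul_const (D3k w x x x)
    have := (e1.fun_add e2).fun_add e3
    rw [one_mul] at this
    exact this
  · have e : fderiv ℝ mker (w + t • x) x - (fderiv ℝ mker w x + t * D2 mker w x x + t ^ 2 / 2 * D3k w x x x)
        = (fderiv ℝ mker (w + t • x) - (fderiv ℝ mker w + D2 mker w (t • x)
          + (1/2:ℝ) • D3k w (t • x) (t • x))) x := by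
      simp; ring
    rw [e]
    refine (ContinuousLinearMap.le_opNorm _ x).trans ?_
    have h3 := (L3 w (t • x)).trans (tb t ht x 3)
    calc _ ≤ C * ‖x‖ ^ 3 * ‖x‖ := by gcongr
      _ = _ := by ring

/-! ### One step of the iteration -/

lemma wint {F : Type*} [NormedAddCommGroup F] [NormedSpace ℝ F] {G : Euc n → F} {ψ : FunE}
    (hψ : Continuous ψ) (hG : Continuous G) (hs : HasCompactSupport G) :
    Integrable (fun w => ψ w • G w) :=
  (hψ.smul hG).integrable_of_hasCompactSupport hs.smul_left

lemma wint_bound {F : Type*} [NormedAddCommGroup F] [NormedSpace ℝ F] {G : Euc n → F} {ψ : FunE}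
    (hG : Continuous G) (hs : HasCompactSupport G) {ζ : ℝ} (hz : ∀ w, ζ < |ψ w| → G w = 0) :
    ‖∫ w, ψ w • G w‖ ≤ ζ * ∫ w, ‖G w‖ := by
  rw [← integral_const_mul]
  refine norm_integral_le_of_norm_le ((hG.norm.integrable_of_hasCompactSupport hs.norm).const_mul _)
    (Eventually.of_forall fun w => ?_)
  rw [norm_smul, norm_eq_abs]
  by_cases h : |ψ w| ≤ ζ
  · exact mul_le_mul_of_nonneg_right h (norm_nonneg _)
  · rw [hz w (not_le.1 h)]; simp

lemma fderiv_zero_out {F : Type*} [NormedAddCommGroup F] [NormedSpace ℝ F] {G : Euc n → F}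
    (h : ∀ w, r < ‖w‖ → G w = 0) : ∀ w, r < ‖w‖ → fderiv ℝ G w = 0 := by
  intro w hw
  have : G =ᶠ[𝓝 w] fun _ => 0 := by
    filter_upwards [(isOpen_lt continuous_const continuous_norm).mem_nhds hw] with y hy using h y hy
  rw [this.fderiv_eq]; simp

lemma mker_int_symm (g : FunE) : ∫ z, mker z * g (-z) = ∫ z : Euc n, mker z * g z := by
  have := integral_neg_eq_self (fun z : Euc n => mker z * g z) volume
  rw [← this]; simp [mker_neg]

lemma lap_mker_neg (z : Euc n) : lap mker (-z) = lap mker z := by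
  have h : (fun z : Euc n => mker (0 + (-(1 : EndE)) z)) = mker := by
    funext z; simp [mker_neg]
  have c : ContDiff ℝ 2 (mker (n := n)) := mker_contDiff (k := 2)
  have h2 := D2_comp_affine (u := mker) 0 (-(1 : EndE)) z c.contDiffAt
  rw [h] at h2
  unfold lap
  refine sum_congr rfl fun i _ => ?_
  rw [h2]; simp

lemma tri_cont (T : Tri n) {f g h : Euc n → Euc n} (hf : Continuous f) (hg : Continuous g)
    (hh : Continuous h) : Continuous fun z => T (f z) (g z) (h z) :=
  ((T.continuous.comp hf).clm_apply hg).clm_apply hh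

lemma conv_cubic (T : Tri n) : ∃ l0 : DualE, ∀ x,
    ∫ z, mker z * T (x + z) (x + z) (x + z) = T x x x + l0 x := by
  have hint : ∀ g : FunE, Continuous g → Integrable (fun z => mker z * g z) := fun g hg =>
    (mker_cont.mul hg).integrable_of_hasCompactSupport (mker_hcs.mul_right)
  have cq : ∀ x, Continuous fun z => T x z z + T z x z + T z z x := fun x =>
    ((tri_cont T continuous_const continuous_id continuous_id).add
      (tri_cont T continuous_id continuous_const continuous_id)).add
      (tri_cont T continuous_id continuous_id continuous_const)
  let L : Euc n →ₗ[ℝ] ℝ :=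
    { toFun := fun x => ∫ z, mker z * (T x z z + T z x z + T z z x)
      map_add' := by
        intro x y
        rw [← integral_add (hint _ (cq x)) (hint _ (cq y))]
        congr 1; funext z
        simp only [map_add, _root_.add_apply]; ring
      map_smul' := by
        intro c x
        rw [RingHom.id_apply, smul_eq_mul, ← integral_const_mul]
        congr 1; funext z
        simp only [map_smul, _root_.smul_apply, smul_eq_mul]; ring }
  refine ⟨LinearMap.toContinuousLinearMap L, fun x => ?_⟩
  have hL : LinearMap.toContinuousLinearMap L x = ∫ z, mker z * (T x z z + T z x z + T z z x) := rfl
  have c1 : Continuous fun z => T (x + z) (x + z) (x + z) :=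
    tri_cont T (by fun_prop) (by fun_prop) (by fun_prop)
  have c2 : Continuous fun z => T (x + -z) (x + -z) (x + -z) :=
    tri_cont T (by fun_prop) (by fun_prop) (by fun_prop)
  have hsy := mker_int_symm (fun z => T (x + z) (x + z) (x + z))
  have h2 : 2 * ∫ z, mker z * T (x + z) (x + z) (x + z)
      = ∫ z, (mker z * T (x + z) (x + z) (x + z) + mker z * T (x + -z) (x + -z) (x + -z)) := by
    rw [integral_add (hint _ c1) (hint _ c2), hsy]; ring
  have h3 : ∫ z, (mker z * T (x + z) (x + z) (x + z) + mker z * T (x + -z) (x + -z) (x + -z))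
      = ∫ z, ((2 * T x x x) * mker z + 2 * (mker z * (T x z z + T z x z + T z z x))) := by
    congr 1; funext z
    simp only [map_add, map_neg, _root_.add_apply, _root_.neg_apply]; ring
  rw [h3, integral_add (mker_integrable.const_mul _) ((hint _ (cq x)).const_mul _), integral_const_mul,
    integral_const_mul, mker_integral] at h2
  rw [hL]; linarith

lemma lap_mker_cubic (T : Tri n) : ∫ z, lap mker z * T z z z = 0 := by
  have := integral_neg_eq_self (fun z : Euc n => lap mker z * T z z z) volume
  have h2 : ∫ z : Euc n, lap mker (-z) * T (-z) (-z) (-z) = - ∫ z, lap mker z * T z z z := by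
    rw [← integral_neg]
    congr 1; funext z
    rw [lap_mker_neg]; simp
  linarith

lemma conv_taylor : ∃ C : ℝ, 0 ≤ C ∧ ∀ (ψ : FunE) (ζ : ℝ), Continuous ψ → 0 ≤ ζ →
    (∀ w, ‖w‖ ≤ 5/8 → |ψ w| ≤ ζ) → ∃ (a1 : ℝ) (l1 : DualE) (Q : BilE)
      (T2 : Tri n), SymB Q ∧ ‖Q‖ ≤ C * ζ ∧ ‖T2‖ ≤ C * ζ ∧
      (∑ i, Q (bv i) (bv i) = ∫ w, lap mker w * ψ w) ∧
      ∀ x, ‖x‖ < 1/2 → |(∫ z, mker z * ψ (x + z)) - (a1 + l1 x + 1/2 * Q x x + T2 x x x)|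
        ≤ C * ζ * ‖x‖ ^ 4 := by
  have c4 : ContDiff ℝ 4 (mker (n := n)) := mker_contDiff (k := 4)
  have d1 : ContDiff ℝ 3 (fderiv ℝ (mker (n := n))) := c4.fderiv_right (by norm_num)
  have d2 : ContDiff ℝ 2 (D2 (mker (n := n))) := d1.fderiv_right (by norm_num)
  have d3 : ContDiff ℝ 1 (D3k (n := n)) := d2.fderiv_right (by norm_num)
  have z0 : ∀ w : Euc n, 1/8 < ‖w‖ → mker w = 0 := fun w hw => mker_zero hw
  have z1 := fderiv_zero_out z0
  have z2 : ∀ w : Euc n, 1/8 < ‖w‖ → D2 mker w = 0 := fderiv_zero_out z1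
  have z3 : ∀ w : Euc n, 1/8 < ‖w‖ → D3k w = 0 := fderiv_zero_out z2
  have s1 : HasCompactSupport (fderiv ℝ (mker (n := n))) := mker_hcs.fderiv (𝕜 := ℝ)
  have s2 : HasCompactSupport (D2 (mker (n := n))) := s1.fderiv (𝕜 := ℝ)
  have s3 : HasCompactSupport (D3k (n := n)) := s2.fderiv (𝕜 := ℝ)
  obtain ⟨C0, hC0, hT⟩ := mker_taylor (n := n)
  set V := (volume (closedBall (0 : Euc n) (5/8))).toReal with hV
  have hV0 : 0 ≤ V := ENNReal.toReal_nonneg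
  have I2 : 0 ≤ ∫ w : Euc n, ‖D2 mker w‖ := integral_nonneg fun _ => norm_nonneg _
  have I3 : 0 ≤ ∫ w : Euc n, ‖D3k w‖ := integral_nonneg fun w => norm_nonneg (D3k w)
  have hCV : 0 ≤ C0 * V := mul_nonneg hC0 hV0
  refine ⟨(∫ w : Euc n, ‖D2 mker w‖) + (∫ w : Euc n, ‖D3k w‖) + C0 * V, by positivity,
    fun ψ ζ hψ hζ hb => ?_⟩
  have hv : ∀ {F : Type} [NormedAddCommGroup F] (G : Euc n → F), (∀ w, 1/8 < ‖w‖ → G w = 0) →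
      ∀ w, ζ < |ψ w| → G w = 0 := by
    intro F _ G hG w hw
    apply hG
    by_contra h
    exact absurd (hb w (by linarith)) (not_le.2 hw)
  have i1 := wint hψ d1.continuous s1
  have i2 := wint hψ d2.continuous s2
  have i3 := wint hψ d3.continuous s3
  have i0 := wint hψ mker_cont mker_hcs
  have b2 := wint_bound (ψ := ψ) d2.continuous s2 (hv _ z2)
  have b3 := wint_bound (ψ := ψ) d3.continuous s3 (hv _ z3)
  have e1 : ∀ x, (∫ w, ψ w • fderiv ℝ mker w) x = ∫ w, ψ w * fderiv ℝ mker w x := fun x =>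
    ContinuousLinearMap.integral_apply i1 x
  have e2 : ∀ x y, (∫ w, ψ w • D2 mker w) x y = ∫ w, ψ w * D2 mker w x y := by
    intro x y
    rw [ContinuousLinearMap.integral_apply i2 x,
      ContinuousLinearMap.integral_apply (i2.apply_continuousLinearMap x) y]
    rfl
  have e3 : ∀ x y z, (∫ w, ψ w • D3k w) x y z = ∫ w, ψ w * D3k w x y z := by
    intro x y z
    rw [ContinuousLinearMap.integral_apply i3 x,
      ContinuousLinearMap.integral_apply (i3.apply_continuousLinearMap x) y,
      ContinuousLinearMap.integral_apply ((i3.apply_continuousLinearMap x).apply_continuousLinearMap y) z]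
    rfl
  have j1 : ∀ x, Integrable (fun w => ψ w * fderiv ℝ mker w x) := fun x => i1.apply_continuousLinearMap x
  have j2 : ∀ x y, Integrable (fun w => ψ w * D2 mker w x y) := fun x y =>
    (i2.apply_continuousLinearMap x).apply_continuousLinearMap y
  have j3 : ∀ x y z, Integrable (fun w => ψ w * D3k w x y z) := fun x y z =>
    ((i3.apply_continuousLinearMap x).apply_continuousLinearMap y).apply_continuousLinearMap z
  have j0 : Integrable (fun w => ψ w * mker w) := i0
  refine ⟨∫ w, ψ w * mker w, -∫ w, ψ w • fderiv ℝ mker w, ∫ w, ψ w • D2 mker w,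
    (-(1/6) : ℝ) • ∫ w, ψ w • D3k w, ?_, ?_, ?_, ?_, ?_⟩
  · intro x y
    rw [e2, e2]
    congr 1; funext w
    rw [D2_symm (c4.of_le (by norm_num)).contDiffAt x y]
  · refine b2.trans ?_
    nlinarith
  · rw [norm_smul]
    have : ‖(-(1/6) : ℝ)‖ = 1/6 := by norm_num
    rw [this]
    nlinarith
  · simp_rw [e2]
    rw [← integral_finsetSum _ (fun i _ => j2 _ _)]
    congr 1; funext w
    rw [lap, Finset.sum_mul]
    exact sum_congr rfl fun i _ => mul_comm _ _
  · intro x hx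
    have hch : ∫ z, mker z * ψ (x + z) = ∫ w, ψ w * mker (w - x) := by
      rw [← integral_add_left_eq_self (fun w => ψ w * mker (w - x)) x]
      congr 1; funext z
      rw [add_sub_cancel_left, mul_comm]
    have hcomb : (∫ w, ψ w * mker w) + (-∫ w, ψ w • fderiv ℝ mker w) x
        + 1/2 * (∫ w, ψ w • D2 mker w) x x + ((-(1/6) : ℝ) • ∫ w, ψ w • D3k w) x x x
        = ∫ w, ψ w * (mker w + fderiv ℝ mker w (-x) + 1/2 * D2 mker w (-x) (-x)
          + 1/6 * D3k w (-x) (-x) (-x)) := by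
      have ee : ((-(1/6) : ℝ) • ∫ w, ψ w • D3k w) x x x = -(1/6) * (∫ w, ψ w • D3k w) x x x := rfl
      rw [ee, _root_.neg_apply, e1, e2, e3]
      rw [← integral_neg, ← integral_const_mul, ← integral_const_mul]
      have k1 : Integrable fun w => -(ψ w * fderiv ℝ mker w x) := (j1 x).neg
      have k2 : Integrable fun w => 1/2 * (ψ w * D2 mker w x x) := (j2 x x).const_mul _
      have k3 : Integrable fun w => -(1/6) * (ψ w * D3k w x x x) := (j3 x x x).const_mul _
      have k01 : Integrable fun w => ψ w * mker w + -(ψ w * fderiv ℝ mker w x) := j0.add k1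
      have k02 : Integrable fun w => ψ w * mker w + -(ψ w * fderiv ℝ mker w x)
        + 1/2 * (ψ w * D2 mker w x x) := k01.add k2
      rw [← integral_add j0 k1, ← integral_add k01 k2, ← integral_add k02 k3]
      congr 1; funext w
      simp only [map_neg, _root_.neg_apply]; ring
    have jj : Integrable fun w => ψ w * mker (w - x) := by
      refine (hψ.mul (mker_cont.comp (continuous_id.sub continuous_const))).integrable_of_hasCompactSupport ?_
      refine hcs_of_zero (r := 5/8) fun z hz => ?_
      have : mker (z - x) = 0 := mker_zero (by
        have := norm_sub_norm_le z x
        linarith)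
      simp [this]
    have jt : Integrable fun w => ψ w * (mker w + fderiv ℝ mker w (-x) + 1/2 * D2 mker w (-x) (-x)
          + 1/6 * D3k w (-x) (-x) (-x)) := by
      have := ((j0.add (j1 (-x))).add ((j2 (-x) (-x)).const_mul (1/2))).add
        ((j3 (-x) (-x) (-x)).const_mul (1/6))
      refine this.congr (Eventually.of_forall fun w => ?_)
      simp only [Pi.add_apply]; ring
    rw [hch, hcomb, ← integral_sub jj jt]
    have hz : ∀ w, w ∉ closedBall (0 : Euc n) (5/8) → ψ w * mker (w - x) - ψ w * (mker w +
        fderiv ℝ mker w (-x) + 1/2 * D2 mker w (-x) (-x) + 1/6 * D3k w (-x) (-x) (-x)) = 0 := by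
      intro w hw
      have hw' : 5/8 < ‖w‖ := by simpa using hw
      have h1 : mker (w - x) = 0 := mker_zero (by
        have := norm_sub_norm_le w x
        linarith)
      have h8 : 1/8 < ‖w‖ := by linarith
      rw [h1, z0 w h8, z1 w h8, z2 w h8, z3 w h8]
      simp
    rw [← setIntegral_eq_integral_of_forall_compl_eq_zero hz]
    have := norm_setIntegral_le_of_norm_le_const (μ := volume) (s := closedBall (0 : Euc n) (5/8))
      (C := ζ * (C0 * ‖x‖ ^ 4)) (f := fun w => ψ w * mker (w - x) - ψ w * (mker w +
        fderiv ℝ mker w (-x) + 1/2 * D2 mker w (-x) (-x) + 1/6 * D3k w (-x) (-x) (-x)))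
      measure_closedBall_lt_top (fun w hw => by
        rw [← mul_sub, norm_mul]
        have hw' : ‖w‖ ≤ 5/8 := by simpa using hw
        refine mul_le_mul (hb w hw') ?_ (norm_nonneg _) hζ
        have := hT w (-x)
        rw [norm_neg, ← sub_eq_add_neg] at this
        exact this)
    rw [norm_eq_abs] at this
    refine this.trans ?_
    rw [Measure.real, ← hV]
    have hx4 : 0 ≤ ‖x‖ ^ 4 := by positivity
    have := mul_nonneg (mul_nonneg I2 hζ) hx4
    have := mul_nonneg (mul_nonneg I3 hζ) hx4
    nlinarith

def triComp (T : Tri n) (S : EndE) : Tri n :=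
  (ContinuousLinearMap.compL ℝ (Euc n) (DualE) (DualE)
    ((ContinuousLinearMap.compL ℝ (Euc n) (Euc n) ℝ).flip S)).comp (T.bilinearComp S S)

lemma triComp_apply (T : Tri n) (S : EndE) (x y z : Euc n) :
    triComp T S x y z = T (S x) (S y) (S z) := rfl

lemma norm_tri {T : Tri n} (h : ‖T‖ ≤ κ) (x y z : Euc n) :
    |T x y z| ≤ κ * ‖x‖ * ‖y‖ * ‖z‖ := by
  have h1 := norm_bil (Q := T x) (q := κ * ‖x‖) ((ContinuousLinearMap.le_opNorm T x).trans (by gcongr)) y z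
  exact h1

lemma tri_bound {T : Tri n} (hκ : 0 ≤ κ)
    (h : ∀ x y z, |T x y z| ≤ κ * ‖x‖ * ‖y‖ * ‖z‖) : ‖T‖ ≤ κ := by
  refine ContinuousLinearMap.opNorm_le_bound T hκ fun x => ?_
  refine ContinuousLinearMap.opNorm_le_bound (T x) (by positivity) fun y => ?_
  exact ContinuousLinearMap.opNorm_le_bound (T x y) (by positivity) fun z => h x y z

lemma triComp_norm {T : Tri n} (h : ‖T‖ ≤ κ)
    (hS : ∀ x, ‖S x‖ ≤ 2 * ‖x‖) : ‖triComp T S‖ ≤ 8 * κ := by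
  have hκ : 0 ≤ κ := (norm_nonneg T).trans h
  refine tri_bound (by positivity) fun x y z => ?_
  rw [triComp_apply]
  refine (norm_tri h _ _ _).trans ?_
  calc κ * ‖S x‖ * ‖S y‖ * ‖S z‖ ≤ κ * (2 * ‖x‖) * (2 * ‖y‖) * (2 * ‖z‖) := by
        gcongr <;> exact hS _
    _ = _ := by ring

/-- `u` is approximated on the unit ball by a cubic with quadratic part `|z|²/2`. -/
def St (u : FunE) (κ ζ : ℝ) : Prop :=
  ∃ (a : ℝ) (l : DualE) (T : Tri n), ‖T‖ ≤ κ ∧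
    ∀ z ∈ ball (0 : Euc n) 1, |u z - (a + l z + ‖z‖ ^ 2 / 2 + T z z z)| ≤ ζ

lemma close_norm (h : ‖S - 1‖ ≤ c) (x : Euc n) :
    ‖S x - x‖ ≤ c * ‖x‖ := by
  have := (S - 1).le_opNorm x
  refine le_trans ?_ (this.trans (mul_le_mul_of_nonneg_right h (norm_nonneg _)))
  exact le_of_eq rfl

set_option maxHeartbeats 1000000 in
lemma IT_arith {ρ v a a1 l l0 l1 t t2 q y2 z2 J ε δ ζ C1 C2 C3 M : ℝ} (hρ : 0 < ρ) (hρ1 : ρ ≤ 1)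
    (hδ : 0 ≤ δ) (hζ : 0 ≤ ζ) (hζε : ζ ≤ ε) (hC2 : 0 ≤ C2) (hC1 : 0 ≤ C1) (hC3 : 0 ≤ C3) (m2 : C2 ≤ M)
    (m4 : C1 + C3 * C2 ^ 2 + C3 * C1 ≤ M)
    (f1 : |v - ρ ^ 2 * y2 / 2 - J| ≤ C1 * (ε ^ 2 + δ))
    (f2' : |J - (ρ * (ρ * (ρ * t)) + ρ * l0)
          - (a1 + ρ * l1 + 1/2 * (ρ * (ρ * q)) + ρ * (ρ * (ρ * t2)))| ≤ C2 * ζ * (16 * ρ ^ 4))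
    (f3' : |y2 + q - z2| ≤ C3 * ((C2 * ζ) ^ 2 + C1 * (ε ^ 2 + δ))) :
    |ρ⁻¹ ^ 2 * (v + a + ρ * l) - (ρ⁻¹ ^ 2 * (a + a1) + ρ⁻¹ * (l + l0 + l1)
        + z2 / 2 + ρ * (t + t2))| ≤ 16 * M * ρ ^ 2 * ζ + 16 * M * ρ⁻¹ ^ 2 * (ε ^ 2 + δ) := by
  have m3c := mul_nonneg hC3 (sq_nonneg C2)
  have hM0 : 0 ≤ M := hC2.trans m2
  have key : ρ⁻¹ ^ 2 * (v + a + ρ * l) - (ρ⁻¹ ^ 2 * (a + a1) + ρ⁻¹ * (l + l0 + l1)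
      + z2 / 2 + ρ * (t + t2))
      = ρ⁻¹ ^ 2 * (v - ρ ^ 2 * y2 / 2 - J)
      + ρ⁻¹ ^ 2 * (J - (ρ * (ρ * (ρ * t)) + ρ * l0)
        - (a1 + ρ * l1 + 1/2 * (ρ * (ρ * q)) + ρ * (ρ * (ρ * t2))))
      + 1/2 * (y2 + q - z2) := by
    field_simp
    ring
  rw [key]
  have hi0 : 0 ≤ ρ⁻¹ ^ 2 := by positivity
  have hi1 : 1 ≤ ρ⁻¹ ^ 2 := by
    refine one_le_pow₀ ?_
    rw [one_le_inv₀ hρ]; linarith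
  have g1 : |ρ⁻¹ ^ 2 * (v - ρ ^ 2 * y2 / 2 - J)| ≤ ρ⁻¹ ^ 2 * (C1 * (ε ^ 2 + δ)) := by
    rw [abs_mul, abs_of_nonneg hi0]; exact mul_le_mul_of_nonneg_left f1 hi0
  have g2 : |ρ⁻¹ ^ 2 * (J - (ρ * (ρ * (ρ * t)) + ρ * l0)
        - (a1 + ρ * l1 + 1/2 * (ρ * (ρ * q)) + ρ * (ρ * (ρ * t2))))|
        ≤ 16 * C2 * ρ ^ 2 * ζ := by
    rw [abs_mul, abs_of_nonneg hi0]
    refine (mul_le_mul_of_nonneg_left f2' hi0).trans (le_of_eq ?_)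
    field_simp
  have g3 : |1/2 * (y2 + q - z2)| ≤ ρ⁻¹ ^ 2 * ((C3 * C2 ^ 2 + C3 * C1) * (ε ^ 2 + δ)) := by
    rw [abs_mul, abs_of_pos (by norm_num : (0:ℝ) < 1/2)]
    have h1 : C3 * ((C2 * ζ) ^ 2 + C1 * (ε ^ 2 + δ)) ≤ (C3 * C2 ^ 2 + C3 * C1) * (ε ^ 2 + δ) := by
      have : ζ ^ 2 ≤ ε ^ 2 := pow_le_pow_left₀ hζ hζε 2
      have : C3 * C2 ^ 2 * ζ ^ 2 ≤ C3 * C2 ^ 2 * (ε ^ 2 + δ) :=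
        mul_le_mul_of_nonneg_left (by linarith) m3c
      nlinarith
    have h2 : 0 ≤ (C3 * C2 ^ 2 + C3 * C1) * (ε ^ 2 + δ) := by positivity
    have h3 := le_mul_of_one_le_left h2 hi1
    have := abs_nonneg (y2 + q - z2)
    linarith
  refine (abs_add_le _ _).trans ((add_le_add (abs_add_le _ _) le_rfl).trans ?_)
  have hE0 : 0 ≤ ρ⁻¹ ^ 2 * (ε ^ 2 + δ) := by positivity
  have g4 : (C1 + C3 * C2 ^ 2 + C3 * C1) * (ρ⁻¹ ^ 2 * (ε ^ 2 + δ)) ≤ M * (ρ⁻¹ ^ 2 * (ε ^ 2 + δ)) :=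
    mul_le_mul_of_nonneg_right m4 hE0
  have g5 : C2 * (ρ ^ 2 * ζ) ≤ M * (ρ ^ 2 * ζ) := mul_le_mul_of_nonneg_right m2 (by positivity)
  have g6 : 0 ≤ M * (ρ⁻¹ ^ 2 * (ε ^ 2 + δ)) := by positivity
  linarith

set_option maxHeartbeats 1000000 in
lemma IT (hn : 1 ≤ n) : ∃ C ε1 : ℝ, 1 ≤ C ∧ 0 < ε1 ∧ ∀ (u : FunE) (δ κ ζ : ℝ),
    Adm (ball 0 1) u (exp (-δ)) (exp δ) → 0 ≤ δ → δ ≤ ε1 → 0 ≤ ζ → 0 ≤ κ →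
    κ + ζ ≤ ε1 → St u κ ζ → ∃ S : EndE, S.det ^ 2 = 1 ∧ ‖S - 1‖ ≤ C * (κ + ζ + δ) ∧
      ‖S - 1‖ ≤ 1/2 ∧
      ∀ ρ : ℝ, 0 < ρ → ρ ≤ 1/8 → St (fun z => ρ⁻¹ ^ 2 * u (ρ • S z)) (C * ρ * (κ + ζ))
        (C * ρ ^ 2 * ζ + C * ρ⁻¹ ^ 2 * ((κ + ζ) ^ 2 + δ)) := by
  obtain ⟨C1, hC1, hP⟩ := lemmaP (n := n)
  obtain ⟨C2, hC2, hT⟩ := conv_taylor (n := n)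
  obtain ⟨C3, hC3, hN⟩ := normalizeS hn
  set M := 1 + C1 + C2 + C3 * (C2 + C1 + C2 ^ 2) with hM
  have hC3' : 0 ≤ C3 * (C2 + C1 + C2 ^ 2) := by positivity
  have hM1 : 1 ≤ M := by linarith
  have m1 : C1 ≤ M := by linarith
  have m2 : C2 ≤ M := by linarith
  have hC30 : 0 ≤ C3 := by linarith
  have m3a := mul_nonneg hC30 hC2
  have m3b := mul_nonneg hC30 hC1.le
  have m3c := mul_nonneg hC30 (sq_nonneg C2)
  have hMe : M = 1 + C1 + C2 + (C3 * C2 + C3 * C1 + C3 * C2 ^ 2) := by rw [hM]; ring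
  have m3 : C3 * C2 + C3 * C1 ≤ M := by linarith
  have m4 : C1 + C3 * C2 ^ 2 + C3 * C1 ≤ M := by linarith
  refine ⟨16 * M, 1 / (1024 * M), by linarith, by positivity, ?_⟩
  intro u δ κ ζ hA hδ hδ1 hζ hκ hε ⟨a, l, T, hTn, hap⟩
  set ε := κ + ζ with hεd
  have hε0 : 0 ≤ ε := by positivity
  have hMe1 : M * ε ≤ 1/1024 := by
    calc M * ε ≤ M * (1 / (1024 * M)) := by gcongr
      _ = _ := by field_simp
  have hMe2 : M * δ ≤ 1/1024 := by
    calc M * δ ≤ M * (1 / (1024 * M)) := by gcongr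
      _ = _ := by field_simp
  have hεs : ε ≤ 1/1024 := le_trans (by nlinarith) hMe1
  have hε2 : ε ^ 2 ≤ ε := by nlinarith
  have hζε : ζ ≤ ε := by linarith
  have hA' := hA.add_aff (-a) (-l)
  set v : FunE := fun y => u y + (-a + (-l) y) with hv
  have hva : ∀ y, u y = v y + a + l y := by
    intro y
    simp only [hv, _root_.neg_apply]; ring
  have hcl : ∀ z ∈ ball (0 : Euc n) 1, |v z - ‖z‖ ^ 2 / 2| ≤ ε := by
    intro z hz
    have hz1 : ‖z‖ ≤ 1 := by simpa using (mem_ball_zero_iff.1 hz).le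
    have h1 := abs_le.1 (hap z hz)
    have h2 := abs_le.1 (norm_tri hTn z z z)
    have h3 : κ * ‖z‖ * ‖z‖ * ‖z‖ ≤ κ := by
      have : κ * ‖z‖ * ‖z‖ * ‖z‖ = κ * ‖z‖ ^ 3 := by ring
      rw [this]
      exact mul_le_of_le_one_right hκ (pow_le_one₀ (norm_nonneg _) hz1)
    rw [hva] at h1
    rw [abs_le]; constructor <;> linarith [h1.1, h1.2, h2.1, h2.2]
  obtain ⟨φ, hφc, hφ, hφ1, hφ2⟩ := hP v δ ε hA' hδ hε0 hεs hcl
  have cT : Continuous fun z => T z z z := tri_cont T continuous_id continuous_id continuous_id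
  obtain ⟨a1, l1, Q, T2, hQs, hQn, hT2n, hQt, hQa⟩ := hT (fun z => φ z - T z z z) ζ (hφc.sub cT) hζ (by
    intro w hw
    have hw1 : w ∈ ball (0 : Euc n) 1 := by rw [mem_ball_zero_iff]; linarith
    have h1 := hap w hw1
    rw [hva] at h1
    rw [hφ w (by linarith)]
    rw [show v w - ‖w‖ ^ 2 / 2 - T w w w = v w + a + l w - (a + l w + ‖w‖ ^ 2 / 2 + T w w w) by ring]
    exact h1)
  obtain ⟨l0, hl0⟩ := conv_cubic T
  have hint : ∀ g : FunE, Continuous g → Integrable (fun z => mker z * g z) := fun g hg =>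
    (mker_cont.mul hg).integrable_of_hasCompactSupport (mker_hcs.mul_right)
  have hconv : ∀ x, ∫ z, mker z * (φ (x + z) - T (x + z) (x + z) (x + z))
      = (∫ z, mker z * φ (x + z)) - (T x x x + l0 x) := by
    intro x
    have q1 : Integrable fun z => mker z * φ (x + z) := hint (fun z => φ (x + z)) (hφc.comp (by fun_prop))
    have q2 : Integrable fun z => mker z * T (x + z) (x + z) (x + z) :=
      hint (fun z => T (x + z) (x + z) (x + z)) (tri_cont T (by fun_prop) (by fun_prop) (by fun_prop))
    rw [← hl0, ← integral_sub q1 q2]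
    congr 1; funext z
    ring
  have hlapc : Continuous (lap (mker (n := n))) := continuous_lap (mker_contDiff (k := 2))
  have htr : |∑ i, Q (bv i) (bv i)| ≤ C1 * (ε ^ 2 + δ) := by
    rw [hQt]
    have hs : HasCompactSupport (lap (mker (n := n))) := hasCompactSupport_lap mker_hcs
    have k1 : Integrable fun z => lap mker z * φ z :=
      (hlapc.mul hφc).integrable_of_hasCompactSupport hs.mul_right
    have k2 : Integrable fun z => lap mker z * T z z z :=
      (hlapc.mul cT).integrable_of_hasCompactSupport hs.mul_right
    have : ∫ w, lap mker w * (φ w - T w w w) = (∫ w, lap mker w * φ w) - ∫ w, lap mker w * T w w w := by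
      rw [← integral_sub k1 k2]; congr 1; funext w; ring
    rw [this, lap_mker_cubic, sub_zero]; exact hφ2
  have hq1 : C2 * ζ ≤ 1/8 := by
    have : C2 * ζ ≤ M * ε := mul_le_mul m2 hζε hζ (by linarith)
    linarith
  have hτ1 : C1 * (ε ^ 2 + δ) ≤ 1/2 := by
    have : C1 * (ε ^ 2 + δ) ≤ M * (ε + δ) := mul_le_mul m1 (by linarith) (by positivity) (by linarith)
    linarith
  obtain ⟨S, hSd, hS1, hS2⟩ := hN Q (C2 * ζ) (C1 * (ε ^ 2 + δ)) hQs hQn hq1 htr hτ1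
  have hS1' : ‖S - 1‖ ≤ M * (ε + δ) := by
    refine hS1.trans ?_
    have h1 : C3 * (C2 * ζ + C1 * (ε ^ 2 + δ)) ≤ C3 * (C2 * (ε + δ) + C1 * (ε + δ)) := by
      have : C2 * ζ ≤ C2 * (ε + δ) := mul_le_mul_of_nonneg_left (by linarith) hC2
      have : C1 * (ε ^ 2 + δ) ≤ C1 * (ε + δ) := mul_le_mul_of_nonneg_left (by linarith) hC1.le
      exact mul_le_mul_of_nonneg_left (by linarith) hC30
    have h2 : (C3 * C2 + C3 * C1) * (ε + δ) ≤ M * (ε + δ) := mul_le_mul_of_nonneg_right m3 (by positivity)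
    linarith
  have hSx : ∀ x, ‖S x‖ ≤ 2 * ‖x‖ := by
    intro x
    have h1 := close_norm hS1' x
    have h2 := norm_sub_norm_le (S x) x
    have h3 : M * (ε + δ) * ‖x‖ ≤ 1 * ‖x‖ := mul_le_mul_of_nonneg_right (by linarith) (norm_nonneg _)
    linarith
  refine ⟨S, hSd, ?_, by linarith, ?_⟩
  · refine hS1'.trans ?_
    have : 0 ≤ M * (ε + δ) := by positivity
    nlinarith
  intro ρ hρ hρ8
  have hTT : ‖T + T2‖ ≤ M * ε := by
    refine (norm_add_le T T2).trans ?_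
    have h1 : C2 * ζ ≤ M * ζ := mul_le_mul_of_nonneg_right m2 hζ
    have h2 : κ ≤ M * κ := le_mul_of_one_le_left hκ hM1
    have h3 : M * ε = M * κ + M * ζ := by rw [hεd]; ring
    linarith
  refine ⟨ρ⁻¹ ^ 2 * (a + a1), ρ⁻¹ • (l + l0 + l1).comp S, ρ • triComp (T + T2) S, ?_, ?_⟩
  · rw [norm_smul, norm_eq_abs, abs_of_pos hρ]
    have := triComp_norm hTT hSx
    have h3 : ρ * ‖triComp (T + T2) S‖ ≤ ρ * (8 * (M * ε)) := by gcongr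
    refine h3.trans ?_
    have : 0 ≤ ρ * (M * ε) := by positivity
    linarith
  · intro z hz
    have hz1 : ‖z‖ < 1 := by simpa using hz
    set y := S z with hy
    have hy2 : ‖y‖ ≤ 2 := (hSx z).trans (by linarith)
    have hx : ‖ρ • y‖ ≤ 2 * ρ := by
      rw [norm_smul, norm_eq_abs, abs_of_pos hρ]; nlinarith
    have hx2 : ‖ρ • y‖ < 1/2 := by linarith
    have f1 := hφ1 _ hx2
    have f2 := hQa _ hx2
    rw [hφ _ (by linarith)] at f1
    rw [hconv] at f2
    show |ρ⁻¹ ^ 2 * u (ρ • y) - _| ≤ _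
    rw [hva]
    have hx4 : ‖ρ • y‖ ^ 4 ≤ 16 * ρ ^ 4 := by
      calc _ ≤ (2 * ρ) ^ 4 := pow_le_pow_left₀ (norm_nonneg _) hx 4
        _ = _ := by ring
    have f3 := hS2 z
    rw [← hy] at f3
    have hzz : ‖z‖ ^ 2 ≤ 1 := pow_le_one₀ (norm_nonneg _) hz1.le
    have f3' : |‖y‖ ^ 2 + Q y y - ‖z‖ ^ 2| ≤ C3 * ((C2 * ζ) ^ 2 + C1 * (ε ^ 2 + δ)) :=
      f3.trans (mul_le_of_le_one_right (by positivity) hzz)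
    have f2' := f2.trans (mul_le_mul_of_nonneg_left hx4 (by positivity : 0 ≤ C2 * ζ))
    set J := ∫ z, mker z * φ (ρ • y + z) with hJ
    have nrm : ‖ρ • y‖ ^ 2 = ρ ^ 2 * ‖y‖ ^ 2 := by
      rw [norm_smul, mul_pow, norm_eq_abs, sq_abs]
    have eT : (ρ • triComp (T + T2) S) z z z = ρ * (T y y y + T2 y y y) := rfl
    have el : (ρ⁻¹ • (l + l0 + l1).comp S) z = ρ⁻¹ * (l y + l0 y + l1 y) := rfl
    rw [eT, el]
    simp only [map_smul, _root_.smul_apply, smul_eq_mul] at f2' ⊢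
    rw [nrm] at f1
    exact IT_arith hρ (by linarith) hδ hζ hζε hC2 hC1.le hC30 m2 m4 f1 f2' f3'

/-! ### Dini iteration -/

lemma adm_scale {Ω B : Set (Euc n)} (ho : IsOpen Ω) (hcv : ConvexOn ℝ Ω v)
    (hcd : ContDiffOn ℝ 2 v Ω) (x0 : Euc n) (L : EndE) {c lam Lam : ℝ} (hc : 0 ≤ c)
    (hBo : IsOpen B) (hBc : Convex ℝ B) (hlam : 0 < lam) (hB : ∀ z ∈ B, x0 + L z ∈ Ω)
    (hd : ∀ z ∈ B, lam ≤ c ^ n * (L.det ^ 2 * hessDet v (x0 + L z)) ∧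
      c ^ n * (L.det ^ 2 * hessDet v (x0 + L z)) ≤ Lam) :
    Adm B (fun z => c * v (x0 + L z)) lam Lam where
  op := hBo
  cvx := hBc
  cw := ((convexOn_comp_aff hcv x0 L).subset hB hBc).smul hc
  cd := contDiffOn_const.mul ((contDiffOn_comp_aff hcd x0 L).mono hB)
  pos := hlam
  det := by
    intro z hz
    rw [hessDet_const_mul, hessDet_comp_affine x0 L z (hcd.contDiffAt (ho.mem_nhds (hB z hz)))]
    exact hd z hz

lemma one_sub_exp {x : ℝ} (h0 : 0 ≤ x) (h1 : x ≤ 1/2) : exp (-(2 * x)) ≤ 1 - x := by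
  have h2 := add_one_le_exp (2 * x)
  have h3 : exp (-(2*x)) * exp (2*x) = 1 := by rw [← exp_add]; simp
  have h4 := exp_pos (-(2*x))
  nlinarith

lemma second_diff_limit (h : ContDiffAt ℝ 2 v x) {η : ℝ} (hη : 0 < η) :
    ∃ r > 0, ∀ y : Euc n, ‖y‖ < r → |v (x + y) + v (x - y) - 2 * v x - D2 v x y y| ≤ η * ‖y‖ ^ 2 := by
  have hcont : ContinuousAt (D2 v) x := by
    have := (h.fderiv_right (m := 1) (by norm_num)).fderiv_right (m := 0) (by norm_num)
    exact this.continuousAt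
  have hev : ∀ᶠ y in 𝓝 x, ContDiffAt ℝ 2 v y := h.eventually (by simp)
  obtain ⟨r, hr, hb⟩ := Metric.eventually_nhds_iff_ball.1
    (hev.and (hcont.eventually (Metric.ball_mem_nhds _ (half_pos hη))))
  refine ⟨r, hr, fun y hy => ?_⟩
  have hmem : ∀ t : ℝ, |t| ≤ 1 → x + t • y ∈ ball x r := by
    intro t ht
    rw [mem_ball_iff_norm]
    simp only [add_sub_cancel_left, norm_smul, norm_eq_abs]
    exact lt_of_le_of_lt (mul_le_of_le_one_left (norm_nonneg _) ht) hy
  have hD : ∀ t : ℝ, |t| ≤ 1 → |D2 v (x + t • y) y y - D2 v x y y| ≤ η / 2 * ‖y‖ ^ 2 := by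
    intro t ht
    have h1 := (hb _ (hmem t ht)).2
    rw [dist_eq_norm] at h1
    have h2 := norm_bil h1.le y y
    have e : (D2 v (x + t • y) - D2 v x) y y = D2 v (x + t • y) y y - D2 v x y y := rfl
    rw [e] at h2
    linarith [h2, (by ring : η / 2 * ‖y‖ * ‖y‖ = η / 2 * ‖y‖ ^ 2)]
  -- g' (t) = fderiv v (x + t y) y
  have g1 : ∀ t : ℝ, |t| ≤ 1 → |fderiv ℝ v (x + t • y) y - fderiv ℝ v x y - t * D2 v x y y| ≤ η / 2 * ‖y‖ ^ 2 := by
    intro t ht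
    have hd : ∀ s ∈ Icc (-1:ℝ) 1, HasDerivWithinAt
        (fun s : ℝ => fderiv ℝ v (x + s • y) y - s * D2 v x y y) (D2 v (x + s • y) y y - D2 v x y y)
        (Icc (-1) 1) s := by
      intro s hs
      have := (hasDerivAt_line2 (u := v) (x := x) (h := y) y (hb _ (hmem s (abs_le.2 hs))).1).fun_sub
        ((hasDerivAt_id' s).mul_const (D2 v x y y))
      rw [one_mul] at this
      exact this.hasDerivWithinAt
    have := (convex_Icc (-1:ℝ) 1).norm_image_sub_le_of_norm_hasDerivWithin_le hd
      (fun s hs => hD s (abs_le.2 hs)) (by simp : (0:ℝ) ∈ Icc (-1:ℝ) 1) (abs_le.1 ht)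
    rw [norm_eq_abs, norm_eq_abs] at this
    simp only [zero_smul, add_zero, zero_mul, sub_zero] at this
    have h3 : η / 2 * ‖y‖ ^ 2 * |t| ≤ η / 2 * ‖y‖ ^ 2 := mul_le_of_le_one_right (by positivity) ht
    rw [show fderiv ℝ v (x + t • y) y - fderiv ℝ v x y - t * D2 v x y y
      = fderiv ℝ v (x + t • y) y - t * D2 v x y y - fderiv ℝ v x y by ring]
    exact this.trans h3
  have g2 : ∀ t : ℝ, |t| ≤ 1 → |v (x + t • y) - v x - t * fderiv ℝ v x y - t ^ 2 / 2 * D2 v x y y| ≤ η / 2 * ‖y‖ ^ 2 := by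
    intro t ht
    have hd : ∀ s ∈ Icc (-1:ℝ) 1, HasDerivWithinAt
        (fun s : ℝ => v (x + s • y) - s * fderiv ℝ v x y - s ^ 2 / 2 * D2 v x y y)
        (fderiv ℝ v (x + s • y) y - fderiv ℝ v x y - s * D2 v x y y) (Icc (-1) 1) s := by
      intro s hs
      have e2 : HasDerivAt (fun s : ℝ => s ^ 2 / 2) s s := by
        have := (hasDerivAt_pow 2 s).div_const 2
        simpa using this
      have := ((hasDerivAt_line (u := v) (x := x) (h := y)
        ((hb _ (hmem s (abs_le.2 hs))).1.differentiableAt (by norm_num))).fun_sub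
        ((hasDerivAt_id' s).mul_const (fderiv ℝ v x y))).fun_sub (e2.mul_const (D2 v x y y))
      rw [one_mul] at this
      exact this.hasDerivWithinAt
    have := (convex_Icc (-1:ℝ) 1).norm_image_sub_le_of_norm_hasDerivWithin_le hd
      (fun s hs => g1 s (abs_le.2 hs)) (by simp : (0:ℝ) ∈ Icc (-1:ℝ) 1) (abs_le.1 ht)
    rw [norm_eq_abs, norm_eq_abs] at this
    simp only [zero_smul, add_zero, zero_mul, sub_zero] at this
    have h3 : η / 2 * ‖y‖ ^ 2 * |t| ≤ η / 2 * ‖y‖ ^ 2 := mul_le_of_le_one_right (by positivity) ht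
    norm_num at this
    rw [show v (x + t • y) - v x - t * fderiv ℝ v x y - t ^ 2 / 2 * D2 v x y y
      = v (x + t • y) - t * fderiv ℝ v x y - t ^ 2 / 2 * D2 v x y y - v x by ring]
    exact this.trans h3
  have a1 := abs_le.1 (g2 1 (by norm_num))
  have a2 := abs_le.1 (g2 (-1) (by norm_num))
  simp only [one_smul, neg_smul, ← sub_eq_add_neg] at a1 a2
  rw [abs_le]; constructor <;> linarith [a1.1, a1.2, a2.1, a2.2]

lemma St_second {κ ζ : ℝ} (h : St u κ ζ) (hz : ‖z‖ < 1) :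
    |u z + u (-z) - 2 * u 0 - ‖z‖ ^ 2| ≤ 4 * ζ := by
  obtain ⟨a, l, T, -, h⟩ := h
  have h1 := abs_le.1 (h z (by simpa using hz))
  have h2 := abs_le.1 (h (-z) (by simpa using hz))
  have h3 := abs_le.1 (h 0 (by simp))
  simp only [map_neg, norm_neg, _root_.neg_apply, map_zero, norm_zero] at h1 h2 h3
  norm_num at h3
  rw [abs_le]; constructor <;> linarith [h1.1, h1.2, h2.1, h2.2, h3.1, h3.2]

/-- State of the Dini iteration. -/
def DSt (Ω : Set (Euc n)) (v : FunE) (x0 : Euc n) (D q C εa g0 G0 Y : ℝ) : Prop :=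
  ∃ (L : EndE) (c m κ ζ A : ℝ), 0 < c ∧ c ^ n * L.det ^ 2 * D = 1 ∧ ‖L‖ ≤ q ∧
    (∀ z ∈ ball (0 : Euc n) 1, x0 + L z ∈ Ω) ∧ 0 < m ∧ (∀ z, m * ‖z‖ ≤ ‖L z‖) ∧ 0 ≤ κ ∧ 0 ≤ ζ ∧
    κ + ζ ≤ εa ∧ St (fun z => c * v (x0 + L z)) κ ζ ∧ 0 ≤ A ∧ g0 ≤ c * m ^ 2 * exp (2 * A) ∧
    c * ‖L‖ ^ 2 ≤ G0 * exp (2 * A) ∧ A + 4 * C * (κ + ζ) ≤ Y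

set_option maxHeartbeats 1000000 in
lemma dst_step (hn : 1 ≤ n) : ∃ C εa εd B : ℝ, 1 ≤ C ∧ 0 < εa ∧ εa ≤ 1/8 ∧ 0 < εd ∧ 0 ≤ B ∧
    ∀ (Ω : Set (Euc n)) (v : FunE) (x0 : Euc n) (D q g0 G0 Y δ : ℝ), IsOpen Ω → ConvexOn ℝ Ω v →
      ContDiffOn ℝ 2 v Ω → 0 < D → 0 ≤ δ → δ ≤ εd →
      (∀ y ∈ Ω, ‖y - x0‖ ≤ q → exp (-δ) * D ≤ hessDet v y ∧ hessDet v y ≤ exp δ * D) →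
      DSt Ω v x0 D q C εa g0 G0 Y → DSt Ω v x0 D (q / 2) C εa g0 G0 (Y + B * δ) := by
  obtain ⟨C, ε1, hC, hε1, H⟩ := IT hn
  obtain ⟨ρ, hρdef⟩ : ∃ ρ : ℝ, ρ = 1 / (8 * C) := ⟨_, rfl⟩
  have hρ : 0 < ρ := by rw [hρdef]; positivity
  have hCρ : C * ρ = 1 / 8 := by rw [hρdef]; field_simp
  have hρ8 : ρ ≤ 1 / 8 := by nlinarith
  obtain ⟨C', hC'⟩ : ∃ C' : ℝ, C' = C * ρ⁻¹ ^ 2 := ⟨_, rfl⟩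
  have hC'1 : 1 ≤ C' := by
    have : 1 ≤ ρ⁻¹ := (one_le_inv₀ hρ).2 (by linarith)
    rw [hC']; nlinarith [one_le_pow₀ this (n := 2)]
  obtain ⟨εa, hεa⟩ : ∃ εa : ℝ, εa = min ε1 (1 / (8 * C')) := ⟨_, rfl⟩
  have ha0 : 0 < εa := by rw [hεa]; exact lt_min hε1 (by positivity)
  have ha1 : εa ≤ ε1 := by rw [hεa]; exact min_le_left _ _
  have ha2 : C' * εa ≤ 1 / 8 := by
    have : εa ≤ 1 / (8 * C') := by rw [hεa]; exact min_le_right _ _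
    calc C' * εa ≤ C' * (1 / (8 * C')) := by gcongr
      _ = 1 / 8 := by field_simp
  refine ⟨C, εa, εa / (2 * C'), 2 * C + 4 * C * C', hC, ha0, by nlinarith, by positivity, by positivity, ?_⟩
  rintro Ω v x0 D q g0 G0 Y δ ho hcv hcd hD hδ0 hδ1 hdet ⟨L, c, m, κ, ζ, A, hc, hnorm, hLq, hLΩ, hm, hmL, hκ, hζ, he, hSt, hA, hg, hG, hY⟩
  have hδC : C' * δ ≤ εa / 2 := by
    calc C' * δ ≤ C' * (εa / (2 * C')) := by gcongr
      _ = εa / 2 := by field_simp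
  have hδa : δ ≤ εa := by nlinarith
  have hadm : Adm (ball 0 1) (fun z => c * v (x0 + L z)) (exp (-δ)) (exp δ) := by
    refine adm_scale ho hcv hcd x0 L hc.le isOpen_ball (convex_ball _ _) (exp_pos _) hLΩ ?_
    intro z hz
    have hz1 : ‖z‖ < 1 := by simpa using hz
    have h1 : ‖(x0 + L z) - x0‖ ≤ q := by
      rw [add_sub_cancel_left]
      exact (L.le_opNorm z).trans ((mul_le_of_le_one_right (norm_nonneg _) hz1.le).trans hLq)
    obtain ⟨h2, h3⟩ := hdet _ (hLΩ z hz) h1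
    have hpos : 0 ≤ c ^ n * L.det ^ 2 := by positivity
    constructor
    · calc exp (-δ) = c ^ n * L.det ^ 2 * (exp (-δ) * D) := by
            rw [show c ^ n * L.det ^ 2 * (exp (-δ) * D) = c ^ n * L.det ^ 2 * D * exp (-δ) by ring, hnorm, one_mul]
        _ ≤ c ^ n * L.det ^ 2 * hessDet v (x0 + L z) := by gcongr
        _ = _ := by ring
    · calc c ^ n * (L.det ^ 2 * hessDet v (x0 + L z)) = c ^ n * L.det ^ 2 * hessDet v (x0 + L z) := by ring
        _ ≤ c ^ n * L.det ^ 2 * (exp δ * D) := by gcongr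
        _ = exp δ := by
            rw [show c ^ n * L.det ^ 2 * (exp δ * D) = c ^ n * L.det ^ 2 * D * exp δ by ring, hnorm, one_mul]
  obtain ⟨S, hSd, hS1, hS2, hSt'⟩ := H _ δ κ ζ hadm hδ0 (hδa.trans ha1) hζ hκ (he.trans ha1) hSt
  specialize hSt' ρ hρ hρ8
  obtain ⟨σ, hσ⟩ : ∃ σ, σ = ‖S - 1‖ := ⟨_, rfl⟩
  rw [← hσ] at hS1 hS2
  have hσ0 : 0 ≤ σ := by rw [hσ]; exact norm_nonneg _
  have hcl := fun x => close_norm (S := S) hσ.ge x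
  have hSlow : ∀ x, (1 - σ) * ‖x‖ ≤ ‖S x‖ := by
    intro x
    have := norm_sub_norm_le x (S x)
    rw [norm_sub_rev] at this
    linarith [hcl x]
  have hSup : ∀ x, ‖S x‖ ≤ (1 + σ) * ‖x‖ := by
    intro x
    have := norm_sub_norm_le (S x) x
    linarith [hcl x]
  have hSe : ‖(ρ • (L.comp S))‖ ≤ ρ * (‖L‖ * (1 + σ)) := by
    refine ContinuousLinearMap.opNorm_le_bound _ (by positivity) fun x => ?_
    have : (ρ • (L.comp S)) x = ρ • L (S x) := rfl
    rw [this, norm_smul, norm_eq_abs, abs_of_pos hρ]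
    have := (L.le_opNorm (S x)).trans (mul_le_mul_of_nonneg_left (hSup x) (norm_nonneg _))
    nlinarith
  have he' : C * ρ * (κ + ζ) + (C * ρ ^ 2 * ζ + C * ρ⁻¹ ^ 2 * ((κ + ζ) ^ 2 + δ)) ≤ (κ + ζ) / 2 + C' * δ := by
    rw [← hC', hCρ, pow_two ρ, ← mul_assoc, hCρ]
    have : C' * (κ + ζ) ^ 2 ≤ (κ + ζ) / 8 := by
      have := mul_le_mul_of_nonneg_left he (by positivity : 0 ≤ C' * (κ + ζ))
      nlinarith
    nlinarith
  refine ⟨ρ • (L.comp S), ρ⁻¹ ^ 2 * c, ρ * m * (1 - σ), C * ρ * (κ + ζ), C * ρ ^ 2 * ζ + C * ρ⁻¹ ^ 2 * ((κ + ζ) ^ 2 + δ), A + 2 * C * (κ + ζ + δ), by positivity, ?_, ?_, ?_, ?_, ?_, by positivity, by positivity, ?_, ?_, by positivity, ?_, ?_, ?_⟩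
  · have h1 : (L.comp S).det = L.det * S.det := by
      show LinearMap.det ((L : Euc n →ₗ[ℝ] Euc n) ∘ₗ (S : Euc n →ₗ[ℝ] Euc n)) = _
      rw [LinearMap.det_comp]
    rw [det_smulL, h1]
    rw [show (ρ⁻¹ ^ 2 * c) ^ n * (ρ ^ n * (L.det * S.det)) ^ 2 * D = (ρ⁻¹ * ρ) ^ (2 * n) * S.det ^ 2 * (c ^ n * L.det ^ 2 * D) by ring,
      hnorm, hSd, inv_mul_cancel₀ hρ.ne']; simp
  · refine hSe.trans ?_
    have : ‖L‖ * (1 + σ) ≤ q * (3/2) := mul_le_mul hLq (by linarith) (by positivity) ((norm_nonneg _).trans hLq)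
    have hq : 0 ≤ q := (norm_nonneg _).trans hLq
    nlinarith
  · intro z hz
    have hz1 : ‖z‖ < 1 := by simpa using hz
    have : (ρ • (L.comp S)) z = L (ρ • S z) := by rw [map_smul]; rfl
    rw [this]
    apply hLΩ
    rw [mem_ball_zero_iff, norm_smul, norm_eq_abs, abs_of_pos hρ]
    have h1 := hSup z
    have h2 : ‖S z‖ ≤ 2 := by nlinarith [norm_nonneg z]
    nlinarith [norm_nonneg (S z)]
  · have : 0 < 1 - σ := by linarith
    positivity
  · intro z
    have : (ρ • (L.comp S)) z = ρ • L (S z) := rfl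
    rw [this, norm_smul, norm_eq_abs, abs_of_pos hρ]
    have h1 := (mul_le_mul_of_nonneg_left (hSlow z) hm.le).trans (hmL (S z))
    calc ρ * m * (1 - σ) * ‖z‖ = ρ * (m * ((1 - σ) * ‖z‖)) := by ring
      _ ≤ _ := by gcongr
  · linarith
  · convert hSt' using 1
    funext z
    have : (ρ • (L.comp S)) z = L (ρ • S z) := by rw [map_smul]; rfl
    rw [this]; ring
  · have h1 : exp (-(2 * σ)) ≤ 1 - σ := one_sub_exp hσ0 hS2
    have h2 : exp (2 * A) ≤ (1 - σ) ^ 2 * exp (2 * (A + 2 * C * (κ + ζ + δ))) := by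
      calc exp (2 * A) ≤ exp (-(2 * σ)) ^ 2 * exp (2 * (A + 2 * C * (κ + ζ + δ))) := by
            rw [← exp_nat_mul, ← exp_add]
            apply exp_le_exp.2; push_cast; linarith
        _ ≤ _ := by gcongr
    calc g0 ≤ c * m ^ 2 * exp (2 * A) := hg
      _ ≤ c * m ^ 2 * ((1 - σ) ^ 2 * exp (2 * (A + 2 * C * (κ + ζ + δ)))) := by gcongr
      _ = _ := by field_simp
  · have h2 : (1 + σ) ^ 2 * exp (2 * A) ≤ exp (2 * (A + 2 * C * (κ + ζ + δ))) := by
      have h1 : 1 + σ ≤ exp σ := by linarith [add_one_le_exp σ]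
      calc (1 + σ) ^ 2 * exp (2 * A) ≤ exp σ ^ 2 * exp (2 * A) := by gcongr
        _ ≤ _ := by
            rw [← exp_nat_mul, ← exp_add]
            apply exp_le_exp.2; push_cast; nlinarith
    have hG0 : 0 ≤ G0 := by
      have := (by positivity : 0 ≤ c * ‖L‖ ^ 2).trans hG
      exact nonneg_of_mul_nonneg_left this (exp_pos _)
    calc ρ⁻¹ ^ 2 * c * ‖ρ • (L.comp S)‖ ^ 2 ≤ ρ⁻¹ ^ 2 * c * (ρ * (‖L‖ * (1 + σ))) ^ 2 := by gcongr
      _ = (c * ‖L‖ ^ 2) * (1 + σ) ^ 2 := by field_simp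
      _ ≤ (G0 * exp (2 * A)) * (1 + σ) ^ 2 := by gcongr
      _ = G0 * ((1 + σ) ^ 2 * exp (2 * A)) := by ring
      _ ≤ _ := by gcongr
  · have := mul_le_mul_of_nonneg_left he' (by positivity : 0 ≤ 4 * C)
    nlinarith

set_option maxHeartbeats 1000000 in
lemma stage3 (hn : 1 ≤ n) : ∃ C ε2 : ℝ, 0 ≤ C ∧ 0 < ε2 ∧
    ∀ (Ω : Set (Euc n)) (v : FunE) (x0 : Euc n) (D q c0 m0 W : ℝ) (δ : ℕ → ℝ) (L0 : EndE),
      IsOpen Ω → ConvexOn ℝ Ω v → ContDiffOn ℝ 2 v Ω → 0 < D → (∀ j, 0 ≤ δ j ∧ δ j ≤ ε2) →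
      (∀ k, ∑ j ∈ Finset.range k, δ j ≤ W) →
      (∀ j, ∀ y ∈ Ω, ‖y - x0‖ ≤ q / 2 ^ j → exp (-δ j) * D ≤ hessDet v y ∧ hessDet v y ≤ exp (δ j) * D) →
      0 < c0 → c0 ^ n * L0.det ^ 2 * D = 1 → ‖L0‖ ≤ q → (∀ z ∈ ball (0 : Euc n) 1, x0 + L0 z ∈ Ω) →
      0 < m0 → (∀ z, m0 * ‖z‖ ≤ ‖L0 z‖) → St (fun z => c0 * v (x0 + L0 z)) 0 ε2 →
      ∀ h, D2 v x0 h h ≤ 4 * exp (C * (1 + W)) / (c0 * m0 ^ 2) * ‖h‖ ^ 2 := by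
  obtain ⟨C, εa, εd, B, hC, ha, ha8, hd, hB, H⟩ := dst_step hn
  refine ⟨2 * (4 * C * εa + B), min εa εd, by positivity, lt_min ha hd, ?_⟩
  intro Ω v x0 D q c0 m0 W δ L0 ho hcv hcd hD hδ hW hdet hc0 hn0 hLq hLΩ hm0 hmL hSt h
  have hk : ∀ k, DSt Ω v x0 D (q / 2 ^ k) C εa (c0 * m0 ^ 2) (c0 * ‖L0‖ ^ 2) (4 * C * εa + B * ∑ j ∈ Finset.range k, δ j) := by
    intro k
    induction k with
    | zero =>
      refine ⟨L0, c0, m0, 0, min εa εd, 0, hc0, hn0, by simpa using hLq, hLΩ, hm0, hmL, le_rfl, (lt_min ha hd).le, ?_, hSt, le_rfl, by simp, by simp, ?_⟩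
      · rw [zero_add]; exact min_le_left _ _
      · have : min εa εd ≤ εa := min_le_left _ _
        simp; nlinarith
    | succ k ih =>
      have := H Ω v x0 D _ _ _ _ (δ k) ho hcv hcd hD (hδ k).1 ((hδ k).2.trans (min_le_right _ _)) (hdet k) ih
      rw [Finset.sum_range_succ, pow_succ, ← div_div, mul_add, ← add_assoc]
      exact this
  have hx0 : x0 ∈ Ω := by simpa using hLΩ 0 (by simp)
  rcases eq_or_ne h 0 with rfl | hh
  · simp
  obtain ⟨A1, hA1⟩ : ∃ A1, A1 = 4 * C * εa + B * W := ⟨_, rfl⟩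
  have hW0 : 0 ≤ W := by simpa using hW 0
  obtain ⟨r, hr, hlim⟩ := second_diff_limit (hcd.contDiffAt (ho.mem_nhds hx0))
    (by positivity : 0 < 1 / (c0 * ‖L0‖ ^ 2 * exp (2 * A1) + 1))
  obtain ⟨k, hkr⟩ : ∃ k : ℕ, q / 2 ^ k < r := by
    have hq : 0 ≤ q := (norm_nonneg _).trans hLq
    obtain ⟨k, hk⟩ := exists_pow_lt_of_lt_one (by positivity : 0 < r / (q + 1)) (by norm_num : (1/2:ℝ) < 1)
    refine ⟨k, ?_⟩
    rw [lt_div_iff₀ (by positivity)] at hk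
    calc q / 2 ^ k = (1/2)^k * q := by rw [one_div, inv_pow]; ring
      _ ≤ (1/2)^k * (q + 1) := by gcongr; linarith
      _ < r := hk
  obtain ⟨L, c, m, κ, ζ, A, hc, hnorm, hLq', hLΩ', hm, hmL', hκ, hζ, he, hSt', hA, hg, hG, hY⟩ := hk k
  have hAA : A ≤ A1 := by
    have : B * ∑ j ∈ Finset.range k, δ j ≤ B * W := mul_le_mul_of_nonneg_left (hW k) hB
    have : 0 ≤ 4 * C * (κ + ζ) := by positivity
    rw [hA1]; linarith
  have hexp : exp (2 * A) ≤ exp (2 * A1) := exp_le_exp.2 (by linarith)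
  have hdet0 : L.det ≠ 0 := by
    intro h0; rw [h0] at hnorm; norm_num at hnorm
  obtain ⟨w, rfl⟩ : ∃ w, L w = h := (L.toContinuousLinearEquivOfDetNeZero hdet0).surjective h
  have hw : w ≠ 0 := by rintro rfl; simp at hh
  have hw0 : 0 < ‖w‖ := norm_pos_iff.2 hw
  obtain ⟨t, ht⟩ : ∃ t, t = 1 / (2 * ‖w‖) := ⟨_, rfl⟩
  have ht0 : 0 < t := by rw [ht]; positivity
  have htw : t * ‖w‖ = 1/2 := by rw [ht]; field_simp
  have hz : ‖t • w‖ = 1/2 := by rw [norm_smul, norm_eq_abs, abs_of_pos ht0, htw]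
  have hs := abs_le.1 (St_second hSt' (by rw [hz]; norm_num : ‖t • w‖ < 1))
  have hyle : ‖L (t • w)‖ ≤ ‖L‖ * (1/2) := by rw [← hz]; exact L.le_opNorm _
  have hl := abs_le.1 (hlim (L (t • w)) (by linarith [norm_nonneg L]))
  have hs2 := hs.2
  simp only [map_neg, map_zero, add_zero, hz, ← sub_eq_add_neg] at hs2
  have hD2 : D2 v x0 (L (t • w)) (L (t • w)) = t ^ 2 * D2 v x0 (L w) (L w) := by
    rw [map_smul, map_smul, map_smul, _root_.smul_apply, smul_eq_mul, smul_eq_mul]; ring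
  rw [hD2] at hl
  have h5 : c * (1 / (c0 * ‖L0‖ ^ 2 * exp (2 * A1) + 1) * ‖L (t • w)‖ ^ 2) ≤ 1/4 := by
    have h6 : c * ‖L‖ ^ 2 ≤ c0 * ‖L0‖ ^ 2 * exp (2 * A1) := hG.trans (by gcongr)
    have h7 : ‖L (t • w)‖ ^ 2 ≤ ‖L‖ ^ 2 * (1/4) := by
      calc _ ≤ (‖L‖ * (1/2)) ^ 2 := by gcongr
        _ = _ := by ring
    calc c * (1 / (c0 * ‖L0‖ ^ 2 * exp (2 * A1) + 1) * ‖L (t • w)‖ ^ 2)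
        ≤ c * (1 / (c0 * ‖L0‖ ^ 2 * exp (2 * A1) + 1) * (‖L‖ ^ 2 * (1/4))) := by gcongr
      _ = (c * ‖L‖ ^ 2) / (c0 * ‖L0‖ ^ 2 * exp (2 * A1) + 1) * (1/4) := by ring
      _ ≤ 1 * (1/4) := by
          gcongr
          rw [div_le_one (by positivity)]
          linarith
      _ = 1/4 := by ring
  have h8 : c * (t ^ 2 * D2 v x0 (L w) (L w)) ≤ 1 := by
    have := mul_le_mul_of_nonneg_left hl.1 hc.le
    nlinarith
  have h9 : m ^ 2 * ‖w‖ ^ 2 ≤ ‖L w‖ ^ 2 := by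
    rw [← mul_pow]; exact pow_le_pow_left₀ (by positivity) (hmL' w) 2
  have h10 : 4 * exp (2 * A1) / (c0 * m0 ^ 2) ≤ 4 * exp (2 * (4 * C * εa + B) * (1 + W)) / (c0 * m0 ^ 2) := by
    have : 0 ≤ 4 * C * εa := by positivity
    have : 2 * A1 ≤ 2 * (4 * C * εa + B) * (1 + W) := by rw [hA1]; nlinarith
    have := exp_le_exp.2 this
    gcongr
  refine le_trans ?_ (mul_le_mul_of_nonneg_right h10 (sq_nonneg _))
  have h11 : c0 * m0 ^ 2 ≤ c * m ^ 2 * exp (2 * A1) := hg.trans (by gcongr)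
  have h12 : c * D2 v x0 (L w) (L w) ≤ 4 * ‖w‖ ^ 2 := by
    have e : 4 * ‖w‖^2 * (c * (t ^ 2 * D2 v x0 (L w) (L w))) = c * D2 v x0 (L w) (L w) := by
      calc _ = 4 * (t * ‖w‖)^2 * (c * D2 v x0 (L w) (L w)) := by ring
        _ = _ := by rw [htw]; ring
    rw [← e]; exact mul_le_of_le_one_right (by positivity) h8
  have h13 : 0 ≤ D2 v x0 (L w) (L w) := D2_nonneg ho hcv hcd hx0 _
  rw [div_mul_eq_mul_div, le_div_iff₀ (by positivity)]
  calc D2 v x0 (L w) (L w) * (c0 * m0 ^ 2) ≤ D2 v x0 (L w) (L w) * (c * m ^ 2 * exp (2 * A1)) := by gcongr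
    _ = (c * D2 v x0 (L w) (L w)) * m ^ 2 * exp (2 * A1) := by ring
    _ ≤ (4 * ‖w‖ ^ 2) * m ^ 2 * exp (2 * A1) := by gcongr
    _ = 4 * exp (2 * A1) * (m ^ 2 * ‖w‖ ^ 2) := by ring
    _ ≤ _ := by gcongr

/-! ### Local cubic approximation -/

/-- Cubic polynomial. -/
def Pol (α : ℝ) (l : DualE) (Q : BilE) (K : Tri n) (x : Euc n) : ℝ :=
  α + l x + 1/2 * Q x x + 1/6 * K x x x

def SymT (K : Tri n) : Prop := ∀ x y z, K x y z = K y x z ∧ K x y z = K x z y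

lemma symT_exists (T : Tri n) : ∃ K : Tri n, SymT K ∧ ∀ x, K x x x = T x x x := by
  obtain ⟨F, hF⟩ : ∃ F : Tri n → Tri n, ∀ T x y z, F T x y z = T x z y :=
    ⟨fun T => ((ContinuousLinearMap.flipₗᵢ ℝ (Euc n) (Euc n) ℝ : (BilE) →L[ℝ] _)).comp T, fun T x y z => rfl⟩
  obtain ⟨G, hG⟩ : ∃ G : Tri n → Tri n, ∀ T x y z, G T x y z = T y x z :=
    ⟨fun T => T.flip, fun T x y z => rfl⟩
  refine ⟨(1/6:ℝ) • (T + F T + G T + F (G T) + G (F T) + F (G (F T))), ?_, ?_⟩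
  · intro x y z
    simp only [_root_.smul_apply, _root_.add_apply, hF, hG]
    constructor <;> (congr 1; ring)
  · intro x
    simp only [_root_.smul_apply, _root_.add_apply, hF, hG, smul_eq_mul]
    ring

lemma Pol_smul (α : ℝ) (l : DualE) (Q : BilE) (K : Tri n) (t : ℝ) (x : Euc n) :
    Pol α l Q K (t • x) = α + t * l x + t ^ 2 / 2 * Q x x + t ^ 3 / 6 * K x x x := by
  simp only [Pol, map_smul, _root_.smul_apply, smul_eq_mul]; ring

lemma coef_small {K : Tri n} {ε r : ℝ}
    (hr : 0 < r) (h : ∀ x, ‖x‖ ≤ r → |Pol α l Q K x| ≤ ε) :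
    |α| ≤ ε ∧ (∀ x, |l x| ≤ 3 * ε / r * ‖x‖) ∧ (∀ x, |Q x x| ≤ 4 * ε / r ^ 2 * ‖x‖ ^ 2) ∧
      ∀ x, |K x x x| ≤ 24 * ε / r ^ 3 * ‖x‖ ^ 3 := by
  have h0 : |α| ≤ ε := by simpa [Pol] using h 0 (by simp [hr.le])
  have key : ∀ x : Euc n, x ≠ 0 → |r / ‖x‖ * l x| ≤ 3 * ε ∧ |(r / ‖x‖) ^ 2 * Q x x| ≤ 4 * ε ∧
      |(r / ‖x‖) ^ 3 * K x x x| ≤ 24 * ε := by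
    intro x hx
    have hx0 : 0 < ‖x‖ := norm_pos_iff.2 hx
    obtain ⟨t, ht⟩ : ∃ t, t = r / ‖x‖ := ⟨_, rfl⟩
    have ht0 : 0 < t := by rw [ht]; positivity
    have htx : t * ‖x‖ = r := by rw [ht]; field_simp
    have hp : ∀ c : ℝ, |c| ≤ 1 → |Pol α l Q K ((c * t) • x)| ≤ ε := by
      intro c hc
      apply h
      rw [norm_smul, norm_eq_abs, abs_mul, abs_of_pos ht0, mul_assoc, htx]
      exact mul_le_of_le_one_left hr.le hc
    have a1 := abs_le.1 (hp 1 (by norm_num))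
    have a2 := abs_le.1 (hp (-1) (by norm_num))
    have a3 := abs_le.1 (hp (1/2) (by rw [abs_le]; constructor <;> norm_num))
    have a4 := abs_le.1 (hp (-1/2) (by rw [abs_le]; constructor <;> norm_num))
    have b0 := abs_le.1 h0
    rw [Pol_smul] at a1 a2 a3 a4
    rw [← ht]
    obtain ⟨X, hX⟩ : ∃ X, X = t * l x := ⟨_, rfl⟩
    obtain ⟨Y, hY⟩ : ∃ Y, Y = t ^ 2 * Q x x := ⟨_, rfl⟩
    obtain ⟨V, hV⟩ : ∃ V, V = t ^ 3 * K x x x := ⟨_, rfl⟩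
    have e : ∀ c : ℝ, α + c * t * l x + (c * t) ^ 2 / 2 * Q x x + (c * t) ^ 3 / 6 * K x x x =
      α + c * X + c ^ 2 / 2 * Y + c ^ 3 / 6 * V := by intro c; rw [hX, hY, hV]; ring
    rw [e] at a1 a2 a3 a4
    rw [← hX, ← hY, ← hV]
    norm_num at a1 a2 a3 a4
    refine ⟨abs_le.2 ⟨?_, ?_⟩, abs_le.2 ⟨?_, ?_⟩, abs_le.2 ⟨?_, ?_⟩⟩ <;>
      linarith [a1.1, a1.2, a2.1, a2.2, a3.1, a3.2, a4.1, a4.2, b0.1, b0.2]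
  refine ⟨h0, fun x => ?_, fun x => ?_, fun x => ?_⟩
  · rcases eq_or_ne x 0 with rfl | hx
    · simp
    have hx0 : 0 < ‖x‖ := norm_pos_iff.2 hx
    have := (key x hx).1
    rw [abs_mul, abs_of_pos (by positivity), div_mul_eq_mul_div, div_le_iff₀ hx0] at this
    rw [div_mul_eq_mul_div, le_div_iff₀ hr]; linarith
  · rcases eq_or_ne x 0 with rfl | hx
    · simp
    have hx0 : 0 < ‖x‖ := norm_pos_iff.2 hx
    have := (key x hx).2.1
    rw [abs_mul, abs_of_pos (by positivity), div_pow, div_mul_eq_mul_div, div_le_iff₀ (by positivity)] at this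
    rw [div_mul_eq_mul_div, le_div_iff₀ (by positivity)]; linarith
  · rcases eq_or_ne x 0 with rfl | hx
    · simp
    have hx0 : 0 < ‖x‖ := norm_pos_iff.2 hx
    have := (key x hx).2.2
    rw [abs_mul, abs_of_pos (by positivity), div_pow, div_mul_eq_mul_div, div_le_iff₀ (by positivity)] at this
    rw [div_mul_eq_mul_div, le_div_iff₀ (by positivity)]; linarith

lemma tele {f : ℕ → ℝ} {C β : ℝ} (hC : 0 ≤ C) (hβ : 0 ≤ β) (hβ2 : β ≤ 1/2) {J : ℕ}
    (h : ∀ j, j < J → |f (j+1) - f j| ≤ C * β ^ j) : ∀ i, i ≤ J → |f J - f i| ≤ 2 * C * β ^ i := by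
  suffices H : ∀ m i, i + m = J → |f J - f i| ≤ 2 * C * β ^ i from fun i hi => H (J - i) i (by omega)
  intro m
  induction m with
  | zero => intro i hi; simp at hi; subst hi; simp; positivity
  | succ m ih =>
    intro i hi
    have h1 := abs_le.1 (ih (i+1) (by omega))
    have h2 := abs_le.1 (h i (by omega))
    have h3 : 2 * C * β ^ (i+1) ≤ C * β ^ i := by
      rw [pow_succ]
      have : 0 ≤ C * β ^ i := by positivity
      nlinarith
    rw [abs_le]; constructor <;> linarith [h1.1, h1.2, h2.1, h2.2]

lemma St_shift {ε : ℝ} (h : St w 0 ε) (hp : ‖p‖ ≤ 1/2) :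
    St (fun z => ((1/2:ℝ)⁻¹) ^ 2 * w (p + (1/2:ℝ) • z)) 0 (4 * ε) := by
  obtain ⟨a, l, T, hT, h⟩ := h
  refine ⟨4 * a + 4 * l p + 2 * ‖p‖ ^ 2, (2:ℝ) • l + (2:ℝ) • innerSL ℝ p, 0, by simp, fun z hz => ?_⟩
  have hz1 : ‖z‖ < 1 := by simpa using hz
  have hm : p + (1/2:ℝ) • z ∈ ball (0 : Euc n) 1 := by
    rw [mem_ball_zero_iff]
    refine lt_of_le_of_lt (norm_add_le _ _) ?_
    rw [norm_smul]; norm_num; linarith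
  have h1 := h _ hm
  have hT0 : ∀ x, T x x x = 0 := by
    intro x
    have := norm_tri hT x x x
    simp at this; exact this
  have h2 : ‖p + (1/2:ℝ) • z‖ ^ 2 = ‖p‖ ^ 2 + inner ℝ p z + ‖z‖ ^ 2 / 4 := by
    rw [norm_add_sq_real, inner_smul_right, norm_smul]; norm_num; ring
  rw [hT0, h2, map_add, map_smul, smul_eq_mul] at h1
  have e : ((2:ℝ) • l + (2:ℝ) • innerSL ℝ p) z = 2 * l z + 2 * inner ℝ p z := rfl
  have e0 : (0 : Tri n) z z z = 0 := rfl
  rw [e, e0]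
  have h3 := abs_le.1 h1
  norm_num
  rw [abs_le]; constructor <;> linarith [h3.1, h3.2]

lemma St_mono {κ ζ κ' ζ' : ℝ} (h : St w κ ζ) (h1 : κ ≤ κ') (h2 : ζ ≤ ζ') : St w κ' ζ' := by
  obtain ⟨a, l, T, hT, h⟩ := h
  exact ⟨a, l, T, hT.trans h1, fun z hz => (h z hz).trans h2⟩

set_option maxHeartbeats 1000000 in
lemma it_seq (hn : 1 ≤ n) : ∃ ε0 ρ1 : ℝ, 0 < ε0 ∧ ε0 ≤ 1/400 ∧ 0 < ρ1 ∧ ρ1 ≤ 1/2 ∧ ∀ J : ℕ, ∃ d : ℝ, 0 < d ∧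
    ∀ w : FunE, Adm (ball 0 1) w (exp (-d)) (exp d) → St w 0 ε0 →
    ∀ p : Euc n, ‖p‖ ≤ 1/2 → ∀ j, j ≤ J → ∃ N : EndE, N.det ^ 2 = 1 ∧ ‖N - 1‖ ≤ 1/32 * (1 - (1/2) ^ j) ∧
      St (fun z => (((ρ1 ^ j) ^ 5 / 2)⁻¹) ^ 2 * w (p + ((ρ1 ^ j) ^ 5 / 2) • N z)) (4 * ε0 * (ρ1 ^ j) ^ 4) (4 * ε0 * (ρ1 ^ j) ^ 8) := by
  obtain ⟨C, ε1, hC, hε1, H⟩ := IT hn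
  obtain ⟨ρ1, hρdef⟩ : ∃ ρ1 : ℝ, ρ1 = 1 / (8 * C) := ⟨_, rfl⟩
  have hρ : 0 < ρ1 := by rw [hρdef]; positivity
  have hCρ : C * ρ1 = 1 / 8 := by rw [hρdef]; field_simp
  have hρ8 : ρ1 ≤ 1 / 8 := by nlinarith
  obtain ⟨ε, hε, hεe, hε4, hε5, hε6⟩ : ∃ ε : ℝ, 0 < ε ∧ ε ≤ ε1 / 4 ∧ ε ≤ 1/100 ∧ 4 * C * ρ1⁻¹ ^ 10 * ε ≤ ρ1 ^ 8 / 4 ∧ C * (2 * ε) ≤ 1/256 := by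
    refine ⟨min (min (ε1 / 4) (1/100)) (min (ρ1 ^ 8 / 4 / (4 * C * ρ1⁻¹ ^ 10)) (1/256/(2*C))), ?_, ?_, ?_, ?_, ?_⟩
    · positivity
    · exact (min_le_left _ _).trans (min_le_left _ _)
    · exact (min_le_left _ _).trans (min_le_right _ _)
    · rw [mul_comm, ← le_div_iff₀ (by positivity)]
      exact (min_le_right _ _).trans (min_le_left _ _)
    · rw [← mul_assoc, mul_comm, ← le_div_iff₀ (by positivity), mul_comm C 2]
      exact (min_le_right _ _).trans (min_le_right _ _)
  refine ⟨ε / 4, ρ1, by positivity, by linarith, hρ, by linarith, fun J => ?_⟩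
  obtain ⟨d, hd, hd1, hd2, hd3⟩ : ∃ d : ℝ, 0 < d ∧ d ≤ ε1 ∧ C * ρ1⁻¹ ^ 10 * d ≤ ε * (ρ1 ^ (J+1)) ^ 8 / 4 ∧ C * d ≤ 1/256 * (1/2) ^ J := by
    refine ⟨min ε1 (min (ε * (ρ1 ^ (J+1)) ^ 8 / 4 / (C * ρ1⁻¹ ^ 10)) (1/256 * (1/2) ^ J / C)), by positivity, min_le_left _ _, ?_, ?_⟩
    · rw [mul_comm, ← le_div_iff₀ (by positivity)]
      exact (min_le_right _ _).trans (min_le_left _ _)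
    · rw [mul_comm, ← le_div_iff₀ (by positivity)]
      exact (min_le_right _ _).trans (min_le_right _ _)
  refine ⟨d, hd, fun w hw hSt p hp j => ?_⟩
  have h4 : 4 * (ε / 4) = ε := by ring
  rw [h4]
  induction j with
  | zero =>
    intro _
    refine ⟨1, by simp [ContinuousLinearMap.det], by simp, ?_⟩
    have := St_shift hSt hp
    rw [h4] at this
    simpa using St_mono this hε.le le_rfl
  | succ j ih =>
    intro hj
    obtain ⟨N, hNd, hN1, hSt'⟩ := ih (by omega)
    obtain ⟨b, hb⟩ : ∃ b, b = ρ1 ^ j := ⟨_, rfl⟩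
    obtain ⟨R, hR⟩ : ∃ R, R = b ^ 5 / 2 := ⟨_, rfl⟩
    rw [← hb, ← hR] at hSt'
    have hb0 : 0 < b := by rw [hb]; positivity
    have hb1 : b ≤ 1 := by rw [hb]; exact pow_le_one₀ hρ.le (by linarith)
    have hR0 : 0 < R := by rw [hR]; positivity
    have hR1 : R ≤ 1/2 := by
      rw [hR]; have := pow_le_one₀ (n := 5) hb0.le hb1; linarith
    have hbJ : (ρ1 ^ (J+1)) ≤ ρ1 * b := by
      rw [hb, ← pow_succ']; exact pow_le_pow_of_le_one hρ.le (by linarith) (by omega)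
    have hNle : ∀ x, ‖N x‖ ≤ 33/32 * ‖x‖ := by
      intro x
      have h1 := close_norm (hN1.trans (by have : (0:ℝ) ≤ (1/2)^j := by positivity
                                           linarith : (1/32 * (1 - (1/2)^j) : ℝ) ≤ 1/32)) x
      have := norm_sub_norm_le (N x) x
      linarith
    have hadm : Adm (ball 0 1) (fun z => R⁻¹ ^ 2 * w (p + R • N z)) (exp (-d)) (exp d) := by
      have hmem : ∀ z ∈ ball (0 : Euc n) 1, p + (R • N) z ∈ ball (0 : Euc n) 1 := by
        intro z hz
        have hz1 : ‖z‖ < 1 := by simpa using hz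
        -- need strictness
        rw [mem_ball_zero_iff]
        refine lt_of_le_of_lt (norm_add_le _ _) ?_
        rw [norm_smulL, norm_smul, norm_eq_abs, abs_of_pos hR0]
        rcases Nat.eq_zero_or_pos j with h0 | h0
        · subst h0
          have hN0 : ‖N - 1‖ ≤ 0 := by simpa using hN1
          have := close_norm hN0 z
          have h5 := norm_sub_norm_le (N z) z
          nlinarith
        · have hb8 : b ≤ 1/8 := by
            rw [hb]; calc ρ1 ^ j ≤ ρ1 ^ 1 := pow_le_pow_of_le_one hρ.le (by linarith) h0
              _ ≤ 1/8 := by simpa using hρ8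
          have : R ≤ 1/4 := by
            have : b ^ 5 ≤ b := by simpa using pow_le_pow_of_le_one hb0.le hb1 (by norm_num : 1 ≤ 5)
            rw [hR]; linarith
          have h5 := hNle z
          have h6 : ‖N z‖ ≤ 33/32 := by linarith
          nlinarith [norm_nonneg (N z)]
      refine adm_scale hw.op hw.cw hw.cd p (R • N) (by positivity) isOpen_ball (convex_ball _ _) (exp_pos _) hmem ?_
      intro z hz
      have e : (R⁻¹ ^ 2) ^ n * ((R • N).det ^ 2 * hessDet w (p + (R • N) z)) = hessDet w (p + (R • N) z) := by
        rw [det_smulL, show (R⁻¹ ^ 2) ^ n * ((R ^ n * N.det) ^ 2 * hessDet w (p + (R • N) z)) = (R⁻¹ * R) ^ (2 * n) * N.det ^ 2 * hessDet w (p + (R • N) z) by ring,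
          inv_mul_cancel₀ hR0.ne', hNd]; simp
      rw [e]; exact hw.det _ (hmem z hz)
    have hb4 : b ^ 4 ≤ 1 := pow_le_one₀ hb0.le hb1
    have hb84 : b ^ 8 ≤ b ^ 4 := pow_le_pow_of_le_one hb0.le hb1 (by norm_num)
    have hκζ : ε * b ^ 4 + ε * b ^ 8 ≤ 2 * ε * b ^ 4 := by nlinarith
    have hκζ1 : ε * b ^ 4 + ε * b ^ 8 ≤ 2 * ε := hκζ.trans (by nlinarith)
    obtain ⟨S, hSd, hS1, hS2, hS3⟩ := H _ d (ε * b ^ 4) (ε * b ^ 8) hadm hd.le hd1 (by positivity) (by positivity) (by linarith) hSt'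
    have hρ5 : ρ1 ^ 5 ≤ 1/8 := (by simpa using pow_le_pow_of_le_one hρ.le (by linarith) (by norm_num : 1 ≤ 5) : ρ1 ^ 5 ≤ ρ1).trans hρ8
    specialize hS3 (ρ1 ^ 5) (by positivity) hρ5
    have hb4j : b ^ 4 ≤ (1/2) ^ j := by
      calc b ^ 4 ≤ b := by simpa using pow_le_pow_of_le_one hb0.le hb1 (by norm_num : 1 ≤ 4)
        _ ≤ (1/2) ^ j := by rw [hb]; exact pow_le_pow_left₀ hρ.le (by linarith) j
    refine ⟨N.comp S, ?_, ?_, ?_⟩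
    · have h1 : (N.comp S).det = N.det * S.det := by
        show LinearMap.det ((N : Euc n →ₗ[ℝ] Euc n) ∘ₗ (S : Euc n →ₗ[ℝ] Euc n)) = _
        rw [LinearMap.det_comp]
      rw [h1, mul_pow, hNd, hSd, one_mul]
    · have h1 : N.comp S - 1 = N.comp (S - 1) + (N - 1) := by ext x; simp
      have hNn : ‖N‖ ≤ 33/32 := ContinuousLinearMap.opNorm_le_bound _ (by norm_num) hNle
      have h2 : ‖S - 1‖ ≤ 1/128 * (1/2) ^ j := by
        refine hS1.trans ?_
        have h3 : C * d ≤ 1/256 * (1/2) ^ j := hd3.trans (by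
          have : ((1:ℝ)/2) ^ J ≤ (1/2) ^ j := pow_le_pow_of_le_one (by norm_num) (by norm_num) (by omega)
          linarith)
        have h4 : C * (ε * b ^ 4 + ε * b ^ 8) ≤ 1/256 * (1/2) ^ j := by
          calc C * (ε * b ^ 4 + ε * b ^ 8) ≤ C * (2 * ε * b ^ 4) := by gcongr
            _ = C * (2 * ε) * b ^ 4 := by ring
            _ ≤ 1/256 * (1/2) ^ j := by gcongr
        rw [mul_add]; linarith
      -- crude: 33/32 * 1/64 > 1/64, so use the slack
      rw [h1]
      refine (norm_add_le _ _).trans ?_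
      have h5 := ContinuousLinearMap.opNorm_comp_le N (S - 1)
      have h6 : ‖N‖ * ‖S - 1‖ ≤ 33/32 * (1/128 * (1/2) ^ j) := by gcongr
      rw [pow_succ]
      have h7 : (0:ℝ) ≤ (1/2) ^ j := by positivity
      linarith
    · convert St_mono hS3 ?_ ?_ using 1
      · funext z
        have e1 : (ρ1 ^ (j+1)) ^ 5 / 2 = R * ρ1 ^ 5 := by rw [hR, hb]; ring
        have e2 : N (ρ1 ^ 5 • S z) = ρ1 ^ 5 • N (S z) := map_smul _ _ _
        have e3 : (N.comp S) z = N (S z) := rfl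
        rw [e1, e2, smul_smul, e3, mul_inv]; ring
      · rw [show ρ1 ^ (j+1) = b * ρ1 by rw [hb, pow_succ]]
        calc C * ρ1 ^ 5 * (ε * b ^ 4 + ε * b ^ 8) ≤ C * ρ1 ^ 5 * (2 * ε * b ^ 4) := by gcongr
          _ = (C * ρ1) * 2 * (ε * (b * ρ1) ^ 4) := by ring
          _ = 1/4 * (ε * (b * ρ1) ^ 4) := by rw [hCρ]; ring
          _ ≤ _ := by
              have : 0 ≤ ε * (b * ρ1) ^ 4 := by positivity
              linarith
      · rw [show ρ1 ^ (j+1) = b * ρ1 by rw [hb, pow_succ]]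
        have t1 : C * (ρ1 ^ 5) ^ 2 * (ε * b ^ 8) ≤ 1/4 * (ε * (b * ρ1) ^ 8) := by
          calc C * (ρ1 ^ 5) ^ 2 * (ε * b ^ 8) = (C * ρ1) * ρ1 * (ε * (b * ρ1) ^ 8) := by ring
            _ ≤ 1/4 * (ε * (b * ρ1) ^ 8) := by
                rw [hCρ]; gcongr; linarith
        have t2 : C * ((ρ1 ^ 5)⁻¹) ^ 2 * (ε * b ^ 4 + ε * b ^ 8) ^ 2 ≤ 1/4 * (ε * (b * ρ1) ^ 8) := by
          calc C * ((ρ1 ^ 5)⁻¹) ^ 2 * (ε * b ^ 4 + ε * b ^ 8) ^ 2 ≤ C * ((ρ1 ^ 5)⁻¹) ^ 2 * (2 * ε * b ^ 4) ^ 2 := by gcongr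
            _ = (4 * C * ρ1⁻¹ ^ 10 * ε) * (ε * b ^ 8) := by rw [← inv_pow]; ring
            _ ≤ ρ1 ^ 8 / 4 * (ε * b ^ 8) := by gcongr
            _ = _ := by ring
        have t3 : C * ((ρ1 ^ 5)⁻¹) ^ 2 * d ≤ 1/4 * (ε * (b * ρ1) ^ 8) := by
          calc C * ((ρ1 ^ 5)⁻¹) ^ 2 * d = C * ρ1⁻¹ ^ 10 * d := by rw [← inv_pow]; ring
            _ ≤ ε * (ρ1 ^ (J+1)) ^ 8 / 4 := hd2
            _ ≤ ε * (ρ1 * b) ^ 8 / 4 := by gcongr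
            _ = _ := by ring
        have : 0 ≤ ε * (b * ρ1) ^ 8 := by positivity
        rw [mul_add (C * ((ρ1 ^ 5)⁻¹) ^ 2)]
        linarith

lemma inv_close (hd : N.det ^ 2 = 1) (hN : ‖N - 1‖ ≤ 1/32) :
    ∃ M : EndE, M.det ^ 2 = 1 ∧ (∀ x, N (M x) = x) ∧ (∀ x, M (N x) = x) ∧
      (∀ x, 32 * ‖x‖ ≤ 33 * ‖M x‖) ∧ ∀ x, 31 * ‖M x‖ ≤ 32 * ‖x‖ := by
  have hd0 : N.det ≠ 0 := by intro h; rw [h] at hd; norm_num at hd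
  obtain ⟨E, hE⟩ : ∃ E : Euc n ≃L[ℝ] Euc n, E = N.toContinuousLinearEquivOfDetNeZero hd0 := ⟨_, rfl⟩
  have hEN : ∀ x, E x = N x := by intro x; rw [hE]; rfl
  obtain ⟨M, hM⟩ : ∃ M : EndE, M = (E.symm : EndE) := ⟨_, rfl⟩
  have hMa : ∀ x, M x = E.symm x := by intro x; rw [hM]; rfl
  have h1 : ∀ x, N (M x) = x := by intro x; rw [hMa, ← hEN]; exact E.apply_symm_apply x
  have h2 : ∀ x, M (N x) = x := by intro x; rw [hMa, ← hEN]; exact E.symm_apply_apply x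
  have h3 : ∀ x, ‖x - M x‖ ≤ 1/32 * ‖M x‖ := by
    intro x
    have := close_norm hN (M x)
    rwa [h1] at this
  refine ⟨M, ?_, h1, h2, fun x => ?_, fun x => ?_⟩
  · have h4 : M.det * N.det = 1 := by
      have h5 : (M.comp N).det = M.det * N.det := by
        show LinearMap.det ((M : Euc n →ₗ[ℝ] Euc n) ∘ₗ (N : Euc n →ₗ[ℝ] Euc n)) = _
        rw [LinearMap.det_comp]
      have h6 : M.comp N = 1 := by ext x; simp [h2]
      rw [← h5, h6]; simp [ContinuousLinearMap.det]
    have : (M.det * N.det) ^ 2 = 1 := by rw [h4]; norm_num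
    rwa [mul_pow, hd, mul_one] at this
  · have := h3 x
    have h5 := norm_sub_norm_le x (M x)
    linarith
  · have := h3 x
    have h5 := norm_sub_norm_le (M x) x
    rw [norm_sub_rev] at h5
    linarith

set_option maxHeartbeats 1000000 in
lemma St_to_Pol {R κ ζ : ℝ} (hd : N.det ^ 2 = 1) (hN : ‖N - 1‖ ≤ 1/32)
    (hR : 0 < R) (hκ : 0 ≤ κ) (h : St (fun z => R⁻¹ ^ 2 * w (p + R • N z)) κ ζ) :
    ∃ (α : ℝ) (l : DualE) (Q : BilE) (K : Tri n), SymB Q ∧ SymT K ∧ (matB Q).det = 1 ∧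
      (∀ x, |Q x x - ‖x‖ ^ 2| ≤ 1/10 * ‖x‖ ^ 2) ∧ (∀ x, |K x x x| ≤ 48 * R⁻¹ * κ * ‖x‖ ^ 3) ∧
      ∀ x, ‖x‖ ≤ R / 2 → |w (p + x) - Pol α l Q K x| ≤ R ^ 2 * ζ := by
  obtain ⟨M, hMd, hNM, hMN, hM1, hM2⟩ := inv_close hd hN
  obtain ⟨a, l, T, hT, h⟩ := h
  obtain ⟨K0, hK0, hK0T⟩ := symT_exists (triComp T M)
  obtain ⟨Q, hQ⟩ : ∃ Q : BilE, ∀ x y, Q x y = inner ℝ (M x) (M y) :=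
    ⟨(innerSL ℝ).bilinearComp M M, fun x y => rfl⟩
  have hKa : ∀ x y z, ((6 * R⁻¹) • K0) x y z = 6 * R⁻¹ * K0 x y z := fun x y z => rfl
  refine ⟨R ^ 2 * a, R • l.comp M, Q, (6 * R⁻¹) • K0, ?_, ?_, ?_, ?_, ?_, ?_⟩
  · intro x y; rw [hQ, hQ, real_inner_comm]
  · intro x y z; simp only [hKa]; rw [← (hK0 x y z).1, ← (hK0 x y z).2]; exact ⟨rfl, rfl⟩
  · have := det_matB_comp (innerSL ℝ (E := Euc n)) Q M (by intro x y; rw [hQ]; rfl)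
    rw [this, hMd, matB_inner]; simp
  · intro x
    rw [hQ, real_inner_self_eq_norm_sq, abs_le]
    have h1 := hM1 x
    have h2 := hM2 x
    have h3 := norm_nonneg x
    have h4 := norm_nonneg (M x)
    constructor <;> nlinarith
  · intro x
    rw [hKa, hK0T, triComp_apply, abs_mul, abs_of_pos (by positivity : 0 < 6 * R⁻¹)]
    have h1 := norm_tri hT (M x) (M x) (M x)
    have h2 : ‖M x‖ ≤ 2 * ‖x‖ := by have := hM2 x; have := norm_nonneg x; linarith
    have h3 : κ * ‖M x‖ * ‖M x‖ * ‖M x‖ ≤ κ * (2 * ‖x‖) * (2 * ‖x‖) * (2 * ‖x‖) := by gcongr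
    calc 6 * R⁻¹ * |T (M x) (M x) (M x)| ≤ 6 * R⁻¹ * (κ * (2 * ‖x‖) * (2 * ‖x‖) * (2 * ‖x‖)) := by
          gcongr; exact h1.trans h3
      _ = _ := by ring
  · intro x hx
    have hz : ‖R⁻¹ • M x‖ < 1 := by
      rw [norm_smul, norm_eq_abs, abs_of_pos (by positivity), inv_mul_lt_iff₀ hR]
      have := hM2 x
      linarith
    have h1 := h (R⁻¹ • M x) (by simpa using hz)
    have e1 : p + R • N (R⁻¹ • M x) = p + x := by
      rw [map_smul, hNM, smul_smul, mul_inv_cancel₀ hR.ne', one_smul]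
    have e2 : T (R⁻¹ • M x) (R⁻¹ • M x) (R⁻¹ • M x) = R⁻¹ ^ 3 * T (M x) (M x) (M x) := by
      simp only [map_smul, _root_.smul_apply, smul_eq_mul]; ring
    have e3 : ‖R⁻¹ • M x‖ ^ 2 = R⁻¹ ^ 2 * ‖M x‖ ^ 2 := by
      rw [norm_smul, norm_eq_abs, abs_of_pos (by positivity), mul_pow]
    beta_reduce at h1
    rw [e1, e2, e3, map_smul, smul_eq_mul] at h1
    have e4 : (R • l.comp M) x = R * l (M x) := rfl
    unfold Pol
    rw [hKa, hK0T, triComp_apply, hQ, real_inner_self_eq_norm_sq, e4]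
    have : w (p + x) - (R ^ 2 * a + R * l (M x) + 1 / 2 * ‖M x‖ ^ 2 + 1 / 6 * (6 * R⁻¹ * T (M x) (M x) (M x))) =
      R ^ 2 * (R⁻¹ ^ 2 * w (p + x) - (a + R⁻¹ * l (M x) + R⁻¹ ^ 2 * ‖M x‖ ^ 2 / 2 + R⁻¹ ^ 3 * T (M x) (M x) (M x))) := by
      field_simp
    rw [this, abs_mul, abs_of_pos (by positivity)]
    gcongr

lemma Pol_sub (α α' : ℝ) (l l' : DualE) (Q Q' : BilE) (K K' : Tri n) (x : Euc n) :
    Pol (α - α') (l - l') (Q - Q') (K - K') x = Pol α l Q K x - Pol α' l' Q' K' x := by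
  simp only [Pol, _root_.sub_apply]; ring

set_option maxHeartbeats 1000000 in
lemma LOC (hn : 1 ≤ n) : ∃ C ε0 ρ1 : ℝ, 1 ≤ C ∧ 0 < ε0 ∧ ε0 ≤ 1/400 ∧ 0 < ρ1 ∧ ρ1 ≤ 1/2 ∧ ∀ J : ℕ, ∃ d : ℝ, 0 < d ∧
    ∀ w : FunE, Adm (ball 0 1) w (exp (-d)) (exp d) → St w 0 ε0 →
    ∀ p : Euc n, ‖p‖ ≤ 1/2 →
    ∃ (α : ℝ) (l : DualE) (Q : BilE) (K : Tri n), SymB Q ∧ SymT K ∧ (matB Q).det = 1 ∧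
      (∀ x, |Q x x - ‖x‖ ^ 2| ≤ 1/10 * ‖x‖ ^ 2) ∧ (∀ x, |K x x x| ≤ C * ‖x‖ ^ 3) ∧
      ∀ j, j ≤ J → ∀ x, ‖x‖ ≤ (ρ1 ^ j) ^ 5 / 8 → |w (p + x) - Pol α l Q K x| ≤ C * (ρ1 ^ j) ^ 18 := by
  obtain ⟨ε0, ρ1, hε0, hε1, hρ, hρ2, H⟩ := it_seq hn
  obtain ⟨c, hc⟩ : ∃ c : ℝ, c = ρ1 ^ 5 / 4 := ⟨_, rfl⟩
  have hc0 : 0 < c := by rw [hc]; positivity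
  have hc1 : c ≤ 1 := by
    rw [hc]; have := pow_le_one₀ (n := 5) hρ.le (by linarith); linarith
  obtain ⟨C0, hC0⟩ : ∃ C0 : ℝ, C0 = 24 / c ^ 3 := ⟨_, rfl⟩
  have hC00 : 0 < C0 := by rw [hC0]; positivity
  have hc3 : c ^ 3 ≤ 1 := pow_le_one₀ hc0.le hc1
  have hC01 : 1 ≤ C0 := by
    rw [hC0, le_div_iff₀ (by positivity)]; linarith
  refine ⟨8 * C0, ε0, ρ1, by linarith, hε0, hε1, hρ, hρ2, fun J => ?_⟩
  obtain ⟨d, hd, H⟩ := H J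
  refine ⟨d, hd, fun w hw hSt p hp => ?_⟩
  have hj : ∀ j, ∃ (α : ℝ) (l : DualE) (Q : BilE) (K : Tri n), j ≤ J → (SymB Q ∧ SymT K ∧ (matB Q).det = 1 ∧
      (∀ x, |Q x x - ‖x‖ ^ 2| ≤ 1/10 * ‖x‖ ^ 2) ∧ (∀ x, |K x x x| ≤ 48 * ((ρ1 ^ j) ^ 5 / 2)⁻¹ * (4 * ε0 * (ρ1 ^ j) ^ 4) * ‖x‖ ^ 3) ∧
      ∀ x, ‖x‖ ≤ ((ρ1 ^ j) ^ 5 / 2) / 2 → |w (p + x) - Pol α l Q K x| ≤ (ρ1 ^ j) ^ 18 / 400) := by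
    intro j
    by_cases hjJ : j ≤ J
    · obtain ⟨N, hNd, hN1, hN2⟩ := H w hw hSt p hp j hjJ
      obtain ⟨α, l, Q, K, h1, h2, h3, h4, h5, h6⟩ := St_to_Pol hNd (hN1.trans (by
        have : (0:ℝ) ≤ (1/2)^j := by positivity
        linarith)) (by positivity) (by positivity) hN2
      refine ⟨α, l, Q, K, fun _ => ⟨h1, h2, h3, h4, h5, fun x hx => (h6 x hx).trans ?_⟩⟩
      obtain ⟨b, hb⟩ : ∃ b, b = ρ1 ^ j := ⟨_, rfl⟩
      rw [← hb]
      have hb0 : 0 < b := by rw [hb]; positivity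
      have e : (b ^ 5 / 2) ^ 2 * (4 * ε0 * b ^ 8) = ε0 * b ^ 18 := by ring
      have : 0 < b ^ 18 := by positivity
      rw [e]; nlinarith
    · exact ⟨0, 0, 0, 0, fun h => absurd h hjJ⟩
  choose α l Q K hP using hj
  have hstep : ∀ j, j < J → |α (j+1) - α j| ≤ C0 * (ρ1 ^ 18) ^ j ∧ (∀ x, |(l (j+1) - l j) x| ≤ C0 * (ρ1 ^ 13) ^ j * ‖x‖) ∧
      (∀ x, |(Q (j+1) - Q j) x x| ≤ C0 * (ρ1 ^ 8) ^ j * ‖x‖ ^ 2) ∧ ∀ x, |(K (j+1) - K j) x x x| ≤ C0 * (ρ1 ^ 3) ^ j * ‖x‖ ^ 3 := by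
    intro j hj
    obtain ⟨b, hb⟩ : ∃ b, b = ρ1 ^ j := ⟨_, rfl⟩
    have hb0 : 0 < b := by rw [hb]; positivity
    have hb1 : b ≤ 1 := by rw [hb]; exact pow_le_one₀ hρ.le (by linarith)
    have hs : ρ1 ^ (j+1) = ρ1 * b := by rw [hb, pow_succ']
    have h1 := (hP j hj.le).2.2.2.2.2
    have h2 := (hP (j+1) hj).2.2.2.2.2
    rw [hs] at h2
    rw [← hb] at h1
    have hρ51 : ρ1 ^ 5 ≤ 1 := pow_le_one₀ hρ.le (by linarith)
    have hb5 : 0 < b ^ 5 := by positivity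
    have hdiff : ∀ x, ‖x‖ ≤ c * b ^ 5 → |Pol (α (j+1) - α j) (l (j+1) - l j) (Q (j+1) - Q j) (K (j+1) - K j) x| ≤ b ^ 18 := by
      intro x hx
      rw [Pol_sub]
      have t1 := h1 x (hx.trans (by rw [hc]; nlinarith))
      have t2 := h2 x (hx.trans (by rw [hc]; apply le_of_eq; ring))
      have t3 : (ρ1 * b) ^ 18 ≤ b ^ 18 := by
        apply pow_le_pow_left₀ (by positivity); nlinarith
      have t4 : 0 < b ^ 18 := by positivity
      have t1 := abs_le.1 t1
      have t2 := abs_le.1 t2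
      rw [abs_le]; constructor <;> linarith [t1.1, t1.2, t2.1, t2.2]
    obtain ⟨g1, g2, g3, g4⟩ := coef_small (by positivity : 0 < c * b ^ 5) hdiff
    have hcc : c ^ 3 ≤ c ^ 2 := pow_le_pow_of_le_one hc0.le hc1 (by norm_num)
    have hcc1 : c ^ 3 ≤ c := by simpa using pow_le_pow_of_le_one hc0.le hc1 (by norm_num : 1 ≤ 3)
    have hpw : ∀ m : ℕ, (ρ1 ^ m) ^ j = b ^ m := by intro m; rw [hb, ← pow_mul, ← pow_mul, mul_comm]
    refine ⟨?_, fun x => (g2 x).trans ?_, fun x => (g3 x).trans ?_, fun x => (g4 x).trans ?_⟩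
    · rw [hpw]; refine g1.trans ?_
      have : 0 < b ^ 18 := by positivity
      nlinarith
    · rw [hpw]; gcongr
      rw [div_le_iff₀ (by positivity), hC0]
      rw [show 24 / c ^ 3 * b ^ 13 * (c * b ^ 5) = 24 * (c / c ^ 3) * b ^ 18 by ring]
      have : 1 ≤ c / c ^ 3 := by rw [le_div_iff₀ (by positivity)]; linarith
      have : 0 < b ^ 18 := by positivity
      nlinarith
    · rw [hpw]; gcongr
      rw [div_le_iff₀ (by positivity), hC0]
      rw [show 24 / c ^ 3 * b ^ 8 * (c * b ^ 5) ^ 2 = 24 * (c ^ 2 / c ^ 3) * b ^ 18 by ring]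
      have : 1 ≤ c ^ 2 / c ^ 3 := by rw [le_div_iff₀ (by positivity)]; linarith
      have : 0 < b ^ 18 := by positivity
      nlinarith
    · rw [hpw]; gcongr
      rw [div_le_iff₀ (by positivity), hC0]
      apply le_of_eq; field_simp
  have hβ : ∀ m : ℕ, 1 ≤ m → ρ1 ^ m ≤ 1/2 := fun m hm => (by
    simpa using pow_le_pow_of_le_one hρ.le (by linarith) hm : ρ1 ^ m ≤ ρ1).trans hρ2
  have T1 : ∀ i, i ≤ J → |α J - α i| ≤ 2 * C0 * (ρ1 ^ 18) ^ i :=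
    tele hC00.le (by positivity) (hβ 18 (by norm_num)) fun j hj => (hstep j hj).1
  have T2 : ∀ x, ∀ i, i ≤ J → |l J x - l i x| ≤ 2 * (C0 * ‖x‖) * (ρ1 ^ 13) ^ i := fun x =>
    tele (f := fun i => l i x) (by positivity) (by positivity) (hβ 13 (by norm_num)) fun j hj => by
      have := (hstep j hj).2.1 x
      rw [_root_.sub_apply] at this; linarith
  have T3 : ∀ x, ∀ i, i ≤ J → |Q J x x - Q i x x| ≤ 2 * (C0 * ‖x‖ ^ 2) * (ρ1 ^ 8) ^ i := fun x =>
    tele (f := fun i => Q i x x) (by positivity) (by positivity) (hβ 8 (by norm_num)) fun j hj => by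
      have := (hstep j hj).2.2.1 x
      rw [_root_.sub_apply, _root_.sub_apply] at this; linarith
  have T4 : ∀ x, ∀ i, i ≤ J → |K J x x x - K i x x x| ≤ 2 * (C0 * ‖x‖ ^ 3) * (ρ1 ^ 3) ^ i := fun x =>
    tele (f := fun i => K i x x x) (by positivity) (by positivity) (hβ 3 (by norm_num)) fun j hj => by
      have := (hstep j hj).2.2.2 x
      rw [_root_.sub_apply, _root_.sub_apply, _root_.sub_apply] at this; linarith
  obtain ⟨p1, p2, p3, p4, -, -⟩ := hP J le_rfl
  refine ⟨α J, l J, Q J, K J, p1, p2, p3, p4, fun x => ?_, fun j hj x hx => ?_⟩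
  · have h1 := T4 x 0 (Nat.zero_le _)
    have h2 := (hP 0 (Nat.zero_le _)).2.2.2.2.1 x
    norm_num at h1 h2
    have h3 : 0 ≤ ‖x‖ ^ 3 := by positivity
    have h4 : ε0 * ‖x‖ ^ 3 ≤ 1/400 * ‖x‖ ^ 3 := by gcongr
    have h5 : ‖x‖ ^ 3 ≤ C0 * ‖x‖ ^ 3 := le_mul_of_one_le_left h3 hC01
    have h1 := abs_le.1 h1
    have h2 := abs_le.1 h2
    rw [abs_le]; constructor <;> linarith [h1.1, h1.2, h2.1, h2.2]
  · obtain ⟨b, hb⟩ : ∃ b, b = ρ1 ^ j := ⟨_, rfl⟩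
    have hb0 : 0 < b := by rw [hb]; positivity
    have hpw : ∀ m : ℕ, (ρ1 ^ m) ^ j = b ^ m := by intro m; rw [hb, ← pow_mul, ← pow_mul, mul_comm]
    rw [← hb] at hx ⊢
    have h1 := T1 j hj
    have h2 := T2 x j hj
    have h3 := T3 x j hj
    have h4 := T4 x j hj
    have h5 := (hP j hj).2.2.2.2.2 x (hx.trans (by rw [← hb]; have : 0 < b ^ 5 := by positivity
                                                   linarith))
    rw [hpw] at h1 h2 h3 h4
    rw [← hb] at h5
    have hx0 := norm_nonneg x
    have k2 : 2 * (C0 * ‖x‖) * b ^ 13 ≤ 2 * (C0 * (b ^ 5 / 8)) * b ^ 13 := by gcongr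
    have k3 : 2 * (C0 * ‖x‖ ^ 2) * b ^ 8 ≤ 2 * (C0 * (b ^ 5 / 8) ^ 2) * b ^ 8 := by gcongr
    have k4 : 2 * (C0 * ‖x‖ ^ 3) * b ^ 3 ≤ 2 * (C0 * (b ^ 5 / 8) ^ 3) * b ^ 3 := by gcongr
    have e2 : 2 * (C0 * (b ^ 5 / 8)) * b ^ 13 = 1/4 * (C0 * b ^ 18) := by ring
    have e3 : 2 * (C0 * (b ^ 5 / 8) ^ 2) * b ^ 8 = 1/32 * (C0 * b ^ 18) := by ring
    have e4 : 2 * (C0 * (b ^ 5 / 8) ^ 3) * b ^ 3 = 1/256 * (C0 * b ^ 18) := by ring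
    have e5 : b ^ 18 ≤ C0 * b ^ 18 := le_mul_of_one_le_left (by positivity) hC01
    have e6 : 0 < b ^ 18 := by positivity
    have h1 := abs_le.1 h1
    have h2 := abs_le.1 h2
    have h3 := abs_le.1 h3
    have h4 := abs_le.1 h4
    have h5 := abs_le.1 h5
    unfold Pol at h5 ⊢
    rw [abs_le]; constructor <;> linarith [h1.1, h1.2, h2.1, h2.2, h3.1, h3.2, h4.1, h4.2, h5.1, h5.2]

/-! ### Second and third differences -/

structure LP (w : FunE) (C b : ℝ) (p : Euc n) (α : ℝ) (l : DualE)
    (Q : BilE) (K : Tri n) : Prop where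
  sQ : SymB Q
  sK : SymT K
  dt : (matB Q).det = 1
  nr : ∀ x, |Q x x - ‖x‖ ^ 2| ≤ 1/10 * ‖x‖ ^ 2
  kb : ∀ x, |K x x x| ≤ C * ‖x‖ ^ 3
  a1 : ∀ x, ‖x‖ ≤ b ^ 5 / 8 → |w (p + x) - Pol α l Q K x| ≤ C * b ^ 18
  a2 : ∀ x, ‖x‖ ≤ b ^ 10 / 8 → |w (p + x) - Pol α l Q K x| ≤ C * b ^ 36

def th2 (w : FunE) (y h : Euc n) : ℝ := w (y + h) - 2 * w y + w (y - h)

def th3 (w : FunE) (y h : Euc n) : ℝ :=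
  w (y + (3/2:ℝ) • h) - 3 * w (y + (1/2:ℝ) • h) + 3 * w (y - (1/2:ℝ) • h) - w (y - (3/2:ℝ) • h)

lemma LOC2 (hn : 1 ≤ n) : ∃ C ε0 ρ1 : ℝ, 1 ≤ C ∧ 0 < ε0 ∧ ε0 ≤ 1/400 ∧ 0 < ρ1 ∧ ρ1 ≤ 1/2 ∧ ∀ k : ℕ, ∃ d : ℝ, 0 < d ∧
    ∀ w : FunE, Adm (ball 0 1) w (exp (-d)) (exp d) → St w 0 ε0 →
    ∀ p : Euc n, ‖p‖ ≤ 1/2 → ∃ α l Q K, LP w C (ρ1 ^ k) p α l Q K := by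
  obtain ⟨C, ε0, ρ1, hC, h0, h1, h2, h3, H⟩ := LOC hn
  refine ⟨C, ε0, ρ1, hC, h0, h1, h2, h3, fun k => ?_⟩
  obtain ⟨d, hd, H⟩ := H (2 * k)
  refine ⟨d, hd, fun w hw hS p hp => ?_⟩
  obtain ⟨α, l, Q, K, g1, g2, g3, g4, g5, g6⟩ := H w hw hS p hp
  have e : ∀ m, (ρ1 ^ (2 * k)) ^ m = (ρ1 ^ k) ^ (2 * m) := by intro m; ring
  refine ⟨α, l, Q, K, g1, g2, g3, g4, g5, fun x hx => g6 k (by omega) x hx, fun x hx => ?_⟩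
  have := g6 (2 * k) le_rfl x
  rw [e, e] at this
  exact this hx

lemma LP.th2_est {α l Q K} (H : LP w C b p α l Q K) {h : Euc n}
    (hh : ‖h‖ ≤ b ^ 5 / 8) : |th2 w p h - Q h h| ≤ 4 * (C * b ^ 18) := by
  have h0 := abs_le.1 (H.a1 0 (by simp; linarith [norm_nonneg h]))
  have h1 := abs_le.1 (H.a1 h hh)
  have h2 := abs_le.1 (H.a1 (-h) (by rwa [norm_neg]))
  have e1 : Pol α l Q K (-h) = α - l h + 1/2 * Q h h - 1/6 * K h h h := by
    have := Pol_smul α l Q K (-1) h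
    rw [neg_one_smul] at this; rw [this]; ring
  have e0 : Pol α l Q K 0 = α := by simp [Pol]
  rw [e1, ← sub_eq_add_neg] at h2
  rw [e0, add_zero] at h0
  unfold th2
  unfold Pol at h1
  rw [abs_le]; constructor <;> linarith [h0.1, h0.2, h1.1, h1.2, h2.1, h2.2]

lemma LP.th3_est {α l Q K} (H : LP w C b p α l Q K) {h : Euc n}
    (hh : ‖h‖ ≤ b ^ 5 / 16) : |th3 w p h - K h h h| ≤ 8 * (C * b ^ 18) := by
  have key : ∀ t : ℝ, |t| ≤ 3/2 → |w (p + t • h) - (α + t * l h + t ^ 2 / 2 * Q h h + t ^ 3 / 6 * K h h h)| ≤ C * b ^ 18 := by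
    intro t ht
    rw [← Pol_smul]
    apply H.a1
    rw [norm_smul, norm_eq_abs]
    nlinarith [norm_nonneg h]
  have h1 := abs_le.1 (key (3/2) (by norm_num))
  have h2 := abs_le.1 (key (1/2) (by rw [abs_le]; constructor <;> norm_num))
  have h3 := abs_le.1 (key (-(1/2)) (by rw [abs_le]; constructor <;> norm_num))
  have h4 := abs_le.1 (key (-(3/2)) (by norm_num))
  rw [neg_smul, ← sub_eq_add_neg] at h3 h4
  unfold th3
  rw [abs_le]; constructor <;> linarith [h1.1, h1.2, h2.1, h2.2, h3.1, h3.2, h4.1, h4.2]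

lemma Pol_shift {K : Tri n} (hQ : SymB Q) (hK : SymT K) (v x : Euc n) :
    Pol α l Q K (v + x) = Pol (Pol α l Q K v) (l + Q v + (1/2:ℝ) • K v v) (Q + K v) K x := by
  simp only [Pol, map_add, _root_.add_apply, _root_.smul_apply, smul_eq_mul]
  have e1 : Q x v = Q v x := hQ _ _
  have e2 : K x v v = K v v x := by rw [(hK x v v).1, (hK v x v).2]
  have e3 : K v x v = K v v x := (hK _ _ _).2
  have e4 : K x v x = K v x x := (hK _ _ _).1
  have e5 : K x x v = K v x x := by rw [(hK x x v).2, (hK x v x).1]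
  rw [e1, e2, e3, e4, e5]; ring

lemma LP.shift (hb : 0 < b) {p v : Euc n} {α l Q K} (H : LP w C b p α l Q K) {α' l' Q' K'}
    (H' : LP w C b (p + v) α' l' Q' K') (hv : ‖v‖ ≤ b ^ 5 / 16) :
    (∀ x, |l' x - (l x + Q v x + 1/2 * K v v x)| ≤ 96 * C * b ^ 13 * ‖x‖) ∧
      ∀ x, |Q' x x - (Q x x + K v x x)| ≤ 2048 * C * b ^ 8 * ‖x‖ ^ 2 := by
  have h : ∀ x, ‖x‖ ≤ b ^ 5 / 16 → |Pol (α' - Pol α l Q K v) (l' - (l + Q v + (1/2:ℝ) • K v v)) (Q' - (Q + K v)) (K' - K) x| ≤ 2 * (C * b ^ 18) := by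
    intro x hx
    rw [Pol_sub, ← Pol_shift H.sQ H.sK]
    have h1 := abs_le.1 (H.a1 (v + x) ((norm_add_le _ _).trans (by linarith)))
    have h2 := abs_le.1 (H'.a1 x (hx.trans (by have : 0 < b ^ 5 := by positivity
                                               linarith)))
    rw [← add_assoc] at h1
    rw [abs_le]; constructor <;> linarith [h1.1, h1.2, h2.1, h2.2]
  obtain ⟨-, g1, g2, -⟩ := coef_small (by positivity) h
  refine ⟨fun x => ?_, fun x => ?_⟩
  · have := g1 x
    simp only [_root_.sub_apply, _root_.add_apply, _root_.smul_apply, smul_eq_mul] at this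
    refine this.trans (le_of_eq ?_)
    field_simp; ring
  · have := g2 x
    simp only [_root_.sub_apply, _root_.add_apply] at this
    refine this.trans (le_of_eq ?_)
    field_simp; ring

lemma LP.K2 {α l Q K} (H : LP w C b p α l Q K) (v x : Euc n) :
    |K v x x| ≤ 3 * C * ‖v‖ * ‖x‖ ^ 2 := by
  have hC : 0 ≤ C * ‖v‖ ^ 3 := (abs_nonneg _).trans (H.kb v)
  rcases eq_or_ne v 0 with rfl | hv
  · simp
  rcases eq_or_ne x 0 with rfl | hx
  · simp
  have hv0 : 0 < ‖v‖ := norm_pos_iff.2 hv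
  have hx0 : 0 < ‖x‖ := norm_pos_iff.2 hx
  have hC0 : 0 ≤ C := by
    by_contra hneg; push Not at hneg
    have : 0 < ‖v‖ ^ 3 := by positivity
    nlinarith
  have pol : ∀ a c : Euc n, K (a + c) (a + c) (a + c) + K (a - c) (a - c) (a - c) = 2 * K a a a + 6 * K a c c := by
    intro a c
    simp only [map_add, map_sub, _root_.add_apply, _root_.sub_apply]
    have e4 : K c a c = K a c c := (H.sK _ _ _).1
    have e5 : K c c a = K a c c := by rw [(H.sK c c a).2, (H.sK c a c).1]
    rw [e4, e5]; ring
  have unit : ∀ a c : Euc n, ‖a‖ = 1 → ‖c‖ = 1 → |K a c c| ≤ 3 * C := by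
    intro a c ha hc
    have h1 := H.kb (a + c)
    have h2 := H.kb (a - c)
    have h3 := H.kb a
    have k1 : ‖a + c‖ ^ 3 ≤ 2 ^ 3 := pow_le_pow_left₀ (norm_nonneg _) ((norm_add_le _ _).trans (by linarith)) 3
    have k2 : ‖a - c‖ ^ 3 ≤ 2 ^ 3 := pow_le_pow_left₀ (norm_nonneg _) ((norm_sub_le _ _).trans (by linarith)) 3
    have m1 := mul_le_mul_of_nonneg_left k1 hC0
    have m2 := mul_le_mul_of_nonneg_left k2 hC0
    rw [ha] at h3
    have h1 := abs_le.1 (h1.trans m1)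
    have h2 := abs_le.1 (h2.trans m2)
    have h3 := abs_le.1 h3
    have := pol a c
    rw [abs_le]; constructor <;> linarith [h1.1, h1.2, h2.1, h2.2, h3.1, h3.2]
  have h1 := unit (‖v‖⁻¹ • v) (‖x‖⁻¹ • x) (by rw [norm_smul, norm_inv, norm_norm, inv_mul_cancel₀ hv0.ne']) (by rw [norm_smul, norm_inv, norm_norm, inv_mul_cancel₀ hx0.ne'])
  simp only [map_smul, _root_.smul_apply, smul_eq_mul] at h1
  rw [abs_mul, abs_mul, abs_mul, abs_of_pos (by positivity : 0 < ‖v‖⁻¹), abs_of_pos (by positivity : 0 < ‖x‖⁻¹)] at h1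
  have e : |K v x x| = ‖v‖ * ‖x‖ ^ 2 * (‖x‖⁻¹ * (‖x‖⁻¹ * (‖v‖⁻¹ * |K v x x|))) := by field_simp
  rw [e]
  calc _ ≤ ‖v‖ * ‖x‖ ^ 2 * (3 * C) := by gcongr
    _ = _ := by ring

open scoped MatrixOrder in
lemma psd_factor {A : Matrix (Fin n) (Fin n) ℝ} (h : A.PosSemidef) : ∃ B : Matrix (Fin n) (Fin n) ℝ, A = B.conjTranspose * B := by
  obtain ⟨B, hB⟩ := CStarAlgebra.nonneg_iff_eq_star_mul_self.mp h.nonneg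
  exact ⟨B, hB⟩

lemma simdiag {Q A : BilE} (hQ : SymB Q) (hA : SymB A) (hp : ∀ x, x ≠ 0 → 0 < Q x x) :
    ∃ (B : EndE) (lam : Fin n → ℝ), (∀ x y, Q (B x) (B y) = inner ℝ x y) ∧
      (∀ z, ∃ x, B x = z) ∧ ∀ i y, A (B (bv i)) y = lam i * Q (B (bv i)) y := by
  have hpd := posDef_matB_of_pos Q hQ hp
  obtain ⟨M, hM⟩ := psd_factor hpd.posSemidef
  obtain ⟨L, hL⟩ : ∃ L : EndE, matL L = M := by
    refine ⟨colMap fun j => WithLp.toLp 2 fun i => M i j, ?_⟩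
    ext i j; simp [matL, colMap_bv]
  have hLQ : ∀ x y, inner ℝ (L x) (L y) = Q x y := by
    intro x y
    obtain ⟨b', hb'⟩ : ∃ b' : BilE, ∀ x y, b' x y = inner ℝ (L x) (L y) :=
      ⟨(innerSL ℝ).bilinearComp L L, fun x y => rfl⟩
    have h1 := matB_comp (innerSL ℝ (E := Euc n)) b' L (by intro x y; rw [hb']; rfl)
    rw [matB_inner, mul_one, hL] at h1
    have h2 : matB b' = matB Q := by rw [h1, hM, Matrix.conjTranspose_eq_transpose_of_trivial]
    have h3 : ∀ i j, b' (bv i) (bv j) = Q (bv i) (bv j) := fun i j => congrFun (congrFun h2 i) j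
    rw [← hb', bil_expand b', bil_expand Q]
    simp only [h3]
  have hLd : L.det ≠ 0 := by
    rw [← det_matL, hL]
    intro h0
    have := hpd.det_pos
    rw [hM, Matrix.det_mul, h0, mul_zero] at this
    exact lt_irrefl _ this
  obtain ⟨E, hE⟩ : ∃ E : Euc n ≃L[ℝ] Euc n, ∀ x, E x = L x := ⟨L.toContinuousLinearEquivOfDetNeZero hLd, fun x => rfl⟩
  have hES : ∀ x, L (E.symm x) = x := fun x => by rw [← hE]; exact E.apply_symm_apply x
  obtain ⟨T, hT⟩ : ∃ T : Euc n →ₗ[ℝ] Euc n, ∀ x y, inner ℝ (T x) y = A (E.symm x) (E.symm y) := by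
    refine ⟨((dualL.comp (A.bilinearComp (E.symm : EndE) (E.symm : EndE)) : EndE) : Euc n →ₗ[ℝ] Euc n), fun x y => ?_⟩
    exact inner_dualL _ _
  have hTs : T.IsSymmetric := by
    intro x y
    rw [hT, real_inner_comm, hT]; exact hA _ _
  have hfr : Module.finrank ℝ (Euc n) = n := by simp
  obtain ⟨U, hU⟩ : ∃ U : Euc n ≃ₗᵢ[ℝ] Euc n, ∀ i, U (bv i) = hTs.eigenvectorBasis hfr i :=
    ⟨(hTs.eigenvectorBasis hfr).repr.symm, fun i => by simp [bv]⟩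
  refine ⟨(E.symm : EndE).comp (U : EndE), fun i => hTs.eigenvalues hfr i, fun x y => ?_, fun z => ?_, fun i y => ?_⟩
  · show Q (E.symm (U x)) (E.symm (U y)) = _
    rw [← hLQ, hES, hES, U.inner_map_map]
  · refine ⟨U.symm (E z), ?_⟩
    show E.symm (U (U.symm (E z))) = z
    simp
  · show A (E.symm (U (bv i))) y = _ * Q (E.symm (U (bv i))) y
    have h1 : T (U (bv i)) = hTs.eigenvalues hfr i • U (bv i) := by
      rw [hU]; exact hTs.apply_eigenvectorBasis hfr i
    have h2 := hT (U (bv i)) (E y)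
    rw [h1, inner_smul_left] at h2
    rw [E.symm_apply_apply] at h2
    rw [← h2, ← hLQ, hES, ← hE y]
    simp

lemma tr_lemma {Q Q' : BilE} (hB : ∀ x y, Q (B x) (B y) = inner ℝ x y)
    (hd : (matB Q).det = 1) (hs' : SymB Q') (hd' : (matB Q').det = 1) (g : Fin n → ℝ) (hg : ∀ i, 0 < g i) {η : ℝ} (hη : η ≤ 1/2)
    (h : ∀ c : Euc n, |Q' (∑ i, (c i * g i) • B (bv i)) (∑ i, (c i * g i) • B (bv i)) - ‖c‖ ^ 2| ≤ η * ‖c‖ ^ 2) :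
    |∑ i, g i ^ 2 * Q' (B (bv i)) (B (bv i)) - n - 2 * ∑ i, log (g i)| ≤ 2 * n * η ^ 2 := by
  have hBd : B.det ^ 2 = 1 := by
    have := det_matB_comp Q (innerSL ℝ (E := Euc n)) B (fun x y => by rw [hB]; rfl)
    rw [matB_inner, hd, Matrix.det_one, mul_one] at this
    exact this.symm
  obtain ⟨G, hG⟩ : ∃ G : EndE, G = colMap fun i => g i • bv i := ⟨_, rfl⟩
  have hGd : G.det = ∏ i, g i := by
    rw [← det_matL, ← Matrix.det_diagonal]
    congr 1
    ext i j
    have e : matL G i j = (g j • (bv j : Euc n)) i := by show (G (bv j)) i = _; rw [hG, colMap_bv]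
    rw [e, Matrix.diagonal_apply]
    by_cases hij : i = j
    · subst hij; simp [bv]
    · simp [bv, hij]
  have hGc : ∀ c, B (G c) = ∑ i, (c i * g i) • B (bv i) := by
    intro c
    rw [hG, colMap_apply, map_sum]
    refine sum_congr rfl fun i _ => ?_
    rw [map_smul, map_smul, smul_smul]
  obtain ⟨b', hb'⟩ : ∃ b' : BilE, ∀ x y, b' x y = Q' ((B.comp G) x) ((B.comp G) y) :=
      ⟨Q'.bilinearComp (B.comp G) (B.comp G), fun x y => rfl⟩
  have hdet : (matB b').det = (∏ i, g i) ^ 2 := by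
    rw [det_matB_comp Q' b' (B.comp G) hb', hd', mul_one]
    have : (B.comp G).det = B.det * G.det := by
      show LinearMap.det ((B : Euc n →ₗ[ℝ] Euc n) ∘ₗ (G : Euc n →ₗ[ℝ] Euc n)) = _
      rw [LinearMap.det_comp]
    rw [this, mul_pow, hBd, one_mul, hGd]
  have hsym : SymB b' := fun x y => by rw [hb', hb']; exact hs' _ _
  have hbb : ∀ x, |b' x x - ‖x‖ ^ 2| ≤ η * ‖x‖ ^ 2 := by
    intro x
    rw [hb']
    show |Q' (B (G x)) (B (G x)) - _| ≤ _
    rw [hGc]; exact h x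
  have hpd : (matB b').PosDef := by
    apply posDef_matB_of_pos _ hsym
    intro x hx
    have h1 := (abs_le.1 (hbb x)).1
    have : 0 < ‖x‖ ^ 2 := by have := norm_pos_iff.2 hx; positivity
    nlinarith
  have t1 := trace_ge_log_det _ hpd
  have t2 := trace_le_log_det b' hsym hη hbb
  have htr : (matB b').trace = ∑ i, g i ^ 2 * Q' (B (bv i)) (B (bv i)) := by
    rw [trace_matB]
    refine sum_congr rfl fun i _ => ?_
    rw [hb']
    show Q' (B (G (bv i))) (B (G (bv i))) = _
    have : G (bv i) = g i • bv i := by rw [hG, colMap_bv]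
    rw [this, map_smul, map_smul, map_smul, _root_.smul_apply, smul_eq_mul, smul_eq_mul]; ring
  have hlog : log (matB b').det = 2 * ∑ i, log (g i) := by
    rw [hdet, Real.log_pow, Real.log_prod (fun i _ => (hg i).ne')]; norm_num
  rw [htr, hlog] at t1 t2
  have : 0 ≤ 2 * (n:ℝ) * η ^ 2 := by positivity
  rw [abs_le]; constructor <;> linarith

structure FR (w : FunE) (C b : ℝ) (y h : Euc n) (α : ℝ) (l : DualE)
    (Q : BilE) (K : Tri n) (B : EndE) (lam : Fin n → ℝ) : Prop where
  H : LP w C b y α l Q K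
  hB : ∀ x z, Q (B x) (B z) = inner ℝ x z
  hl : ∀ i z, K h (B (bv i)) z = lam i * Q (B (bv i)) z
  hh : ‖h‖ ≤ b ^ 5 / 64
  b0 : 0 < b
  b1 : b ≤ 1
  C1 : 1 ≤ C
  Cb : C * b ≤ 1/100

section
variable {K : Tri n} {lam : Fin n → ℝ}
namespace FR
lemma xin
    (F : FR w C b y h α l Q K B lam) (i : Fin n) : ‖B (bv i)‖ ≤ 11/10 := by
  have h1 := (abs_le.1 (F.H.nr (B (bv i)))).1
  rw [F.hB] at h1
  have h2 : inner ℝ (bv i) (bv i) = (1:ℝ) := by simp [bv]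
  rw [h2] at h1
  nlinarith [norm_nonneg (B (bv i))]

lemma lamb
    (F : FR w C b y h α l Q K B lam) (i : Fin n) : |lam i| ≤ C * b ^ 5 / 16 := by
  have h1 := F.H.K2 h (B (bv i))
  rw [F.hl, F.hB] at h1
  have h2 : inner ℝ (bv i) (bv i) = (1:ℝ) := by simp [bv]
  rw [h2, mul_one] at h1
  have h3 := F.xin i
  have h4 : ‖B (bv i)‖ ^ 2 ≤ (11/10) ^ 2 := pow_le_pow_left₀ (norm_nonneg _) h3 2
  have hC := F.C1
  calc |lam i| ≤ _ := h1
    _ ≤ 3 * C * (b ^ 5 / 64) * (11/10) ^ 2 := by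
          have := F.b0; have := F.hh
          gcongr
    _ ≤ _ := by have := F.b0; have : 0 ≤ C * b ^ 5 := by positivity
                nlinarith

lemma b99
    (F : FR w C b y h α l Q K B lam) : b ≤ 1/100 := by
  have := F.Cb; have := F.C1; have := F.b0; nlinarith

lemma lamsq
    (F : FR w C b y h α l Q K B lam) (i : Fin n) : lam i ^ 2 ≤ C * b ^ 8 / 1000 := by
  have h1 := F.lamb i
  have h2 := F.b0
  have h3 := F.C1
  have h4 : |lam i| ^ 2 ≤ (C * b ^ 5 / 16) ^ 2 := pow_le_pow_left₀ (abs_nonneg _) h1 2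
  rw [sq_abs] at h4
  refine h4.trans ?_
  have h5 : (C * b ^ 5 / 16) ^ 2 = (C * b ^ 8) * ((C * b) * b) / 256 := by ring
  rw [h5]
  have h6 : (C * b) * b ≤ 1/100 * 1 := by have := F.Cb; have := F.b1; gcongr
  have : 0 ≤ C * b ^ 8 := by positivity
  nlinarith

lemma lam4
    (F : FR w C b y h α l Q K B lam) (i : Fin n) : lam i ^ 4 ≤ b ^ 16 := by
  have h1 := F.lamb i
  have h2 := F.b0
  have h3 := F.C1
  have h4 : |lam i| ^ 4 ≤ (C * b ^ 5 / 16) ^ 4 := pow_le_pow_left₀ (abs_nonneg _) h1 4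
  rw [Even.pow_abs (by decide)] at h4
  refine h4.trans ?_
  have h5 : (C * b ^ 5 / 16) ^ 4 = b ^ 16 * (C * b / 16) ^ 4  := by ring
  rw [h5]
  have h6 : (C * b / 16) ^ 4 ≤ 1 := by
    apply pow_le_one₀ (by positivity); have := F.Cb; linarith
  have : 0 ≤ b ^ 16 := by positivity
  nlinarith

lemma lams
    (F : FR w C b y h α l Q K B lam) (i : Fin n) : |lam i| ≤ 1/100 := by
  have h1 := F.lamsq i
  have h2 := F.b0
  have h3 := F.Cb
  have h4 : C * b ^ 8 = (C * b) * b ^ 7 := by ring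
  have h5 : b ^ 7 ≤ 1 * b := by
    calc b ^ 7 = b ^ 6 * b := by ring
      _ ≤ 1 * b := by gcongr; exact pow_le_one₀ h2.le F.b1
  have h6 := F.b99
  have : C * b ^ 8 ≤ 1/100 * (1/100) := by rw [h4]; gcongr; linarith
  rw [abs_le]; constructor <;> nlinarith

lemma gb
    (F : FR w C b y h α l Q K B lam) {j : ℝ} (hj : |j| ≤ 3/2) (i : Fin n) : |j * lam i| ≤ 3/200 := by
  rw [abs_mul]; have := F.lams i
  calc _ ≤ 3/2 * (1/100 : ℝ) := by gcongr
    _ = _ := by norm_num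

lemma pt_tr
    (F : FR w C b y h α l Q K B lam) {j : ℝ} (hj : |j| ≤ 3/2) {α' l' Q' K'} (H' : LP w C b (y + j • h) α' l' Q' K') :
    (∀ i, |(1 - j * lam i / 2) ^ 2 * Q' (B (bv i)) (B (bv i)) - 1| ≤ 5000 * C * b ^ 8) ∧
    |∑ i, (1 - j * lam i / 2) ^ 2 * Q' (B (bv i)) (B (bv i)) - n - 2 * ∑ i, log (1 - j * lam i / 2)| ≤ 2 * n * (5000 * C * b ^ 8) ^ 2 := by
  have hb := F.b0
  have hC := F.C1
  have hCb : 0 ≤ C * b ^ 8 := by positivity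
  have hv : ‖j • h‖ ≤ b ^ 5 / 16 := by
    rw [norm_smul, norm_eq_abs]
    calc |j| * ‖h‖ ≤ 3/2 * (b ^ 5 / 64) := by gcongr; exact F.hh
      _ ≤ _ := by have : 0 < b ^ 5 := by positivity
                  linarith
  have hS := (F.H.shift hb H' hv).2
  have hK : ∀ x, K (j • h) x x = j * K h x x := by intro x; rw [map_smul]; rfl
  have key : ∀ c : Euc n, |Q' (∑ i, (c i * (1 - j * lam i / 2)) • B (bv i)) (∑ i, (c i * (1 - j * lam i / 2)) • B (bv i)) - ‖c‖ ^ 2| ≤ 5000 * C * b ^ 8 * ‖c‖ ^ 2 := by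
    intro c
    obtain ⟨Z, hZ⟩ : ∃ Z, Z = ∑ i, (c i * (1 - j * lam i / 2)) • B (bv i) := ⟨_, rfl⟩
    rw [← hZ]
    have hbb : ∀ i k : Fin n, Q (B (bv i)) (B (bv k)) = if i = k then 1 else 0 := by
      intro i k; rw [F.hB]; simp [bv, EuclideanSpace.inner_single_left, Pi.single_apply]
    have e1 : ∀ i, Q (B (bv i)) Z = c i * (1 - j * lam i / 2) := by
      intro i
      rw [hZ, map_sum]
      simp [hbb]
    have e2 : Q Z Z = ∑ i, (c i * (1 - j * lam i / 2)) ^ 2 := by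
      rw [show Q Z Z = Q (∑ i, (c i * (1 - j * lam i / 2)) • B (bv i)) Z by rw [← hZ], map_sum, ContinuousLinearMap.sum_apply]
      refine sum_congr rfl fun i _ => ?_
      rw [map_smul, _root_.smul_apply, e1, smul_eq_mul, sq]
    have e3 : K h Z Z = ∑ i, lam i * (c i * (1 - j * lam i / 2)) ^ 2 := by
      rw [show K h Z Z = K h (∑ i, (c i * (1 - j * lam i / 2)) • B (bv i)) Z by rw [← hZ], map_sum, ContinuousLinearMap.sum_apply]
      refine sum_congr rfl fun i _ => ?_
      rw [map_smul, _root_.smul_apply, F.hl, e1, smul_eq_mul]; ring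
    have e4 : ‖c‖ ^ 2 = ∑ i, c i ^ 2 := by
      rw [EuclideanSpace.norm_sq_eq]; simp
    have h1 := hS Z
    rw [hK] at h1
    have h2 : |Q Z Z + j * K h Z Z - ‖c‖ ^ 2| ≤ C * b ^ 8 * ‖c‖ ^ 2 := by
      rw [e2, e3, e4, mul_sum, mul_sum, ← sum_add_distrib, ← sum_sub_distrib]
      refine (abs_sum_le_sum_abs _ _).trans (sum_le_sum fun i _ => ?_)
      have e : (c i * (1 - j * lam i / 2)) ^ 2 + j * (lam i * (c i * (1 - j * lam i / 2)) ^ 2) - c i ^ 2 =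
        ((j * lam i) ^ 2 * (-3/4 + (j * lam i) / 4)) * c i ^ 2 := by ring
      rw [e, abs_mul, abs_of_nonneg (sq_nonneg (c i))]
      apply mul_le_mul_of_nonneg_right _ (sq_nonneg _)
      rw [abs_mul, abs_of_nonneg (sq_nonneg _)]
      have g1 := abs_le.1 (F.gb hj i)
      have g2 : |(-3/4 + (j * lam i) / 4)| ≤ 1 := by rw [abs_le]; constructor <;> linarith
      have g3 : (j * lam i) ^ 2 ≤ 9/4 * (C * b ^ 8 / 1000) := by
        rw [mul_pow]
        have : j ^ 2 ≤ 9/4 := by rw [← sq_abs]; nlinarith [abs_nonneg j]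
        gcongr; exact F.lamsq i
      calc _ ≤ 9/4 * (C * b ^ 8 / 1000) * 1 := by gcongr
        _ ≤ _ := by linarith
    have h3 : ‖Z‖ ^ 2 ≤ 2 * ‖c‖ ^ 2 := by
      have g1 := (abs_le.1 (F.H.nr Z)).1
      have g2 : Q Z Z ≤ 11/10 * ‖c‖ ^ 2 := by
        rw [e2, e4, mul_sum]
        refine sum_le_sum fun i _ => ?_
        have g1 := abs_le.1 (F.gb hj i)
        rw [mul_pow]
        have : (1 - j * lam i / 2) ^ 2 ≤ 11/10 := by nlinarith
        nlinarith [sq_nonneg (c i)]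
      nlinarith
    have h4 : 2048 * C * b ^ 8 * ‖Z‖ ^ 2 ≤ 4096 * (C * b ^ 8) * ‖c‖ ^ 2 := by
      calc _ ≤ 2048 * C * b ^ 8 * (2 * ‖c‖ ^ 2) := by gcongr
        _ = _ := by ring
    have h1 := abs_le.1 h1
    have h2 := abs_le.1 h2
    have : 0 ≤ C * b ^ 8 * ‖c‖ ^ 2 := by positivity
    rw [abs_le]; constructor <;> linarith [h1.1, h1.2, h2.1, h2.2]
  refine ⟨fun i => ?_, ?_⟩
  · have := key (bv i)
    have e : ∑ k, ((bv i : Euc n) k * (1 - j * lam k / 2)) • B (bv k) = (1 - j * lam i / 2) • B (bv i) := by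
      rw [Finset.sum_eq_single i]
      · simp [bv]
      · intro k _ hk; simp [bv, hk]
      · simp
    rw [e, map_smul, map_smul, _root_.smul_apply, smul_eq_mul, smul_eq_mul] at this
    have e2 : ‖(bv i : Euc n)‖ = 1 := by simp [bv]
    rw [e2] at this
    have e3 : (1 - j * lam i / 2) ^ 2 * Q' (B (bv i)) (B (bv i)) = (1 - j * lam i / 2) * ((1 - j * lam i / 2) * Q' (B (bv i)) (B (bv i))) := by ring
    rw [e3]; simpa using this
  · refine tr_lemma F.hB F.H.dt H'.sQ H'.dt (fun i => 1 - j * lam i / 2) (fun i => ?_) ?_ key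
    · have g1 := abs_le.1 (F.gb hj i)
      linarith
    · have h4 : 5000 * C * b ^ 8 = 5000 * ((C * b) * (b ^ 6 * b)) := by ring
      have h5 : b ^ 6 ≤ 1 := pow_le_one₀ hb.le F.b1
      have h6 := F.b99
      have h7 := F.Cb
      have h8 : (C * b) * (b ^ 6 * b) ≤ 1/100 * (1 * (1/100)) := by gcongr
      linarith

set_option maxHeartbeats 1000000 in
lemma pt_w
    (F : FR w C b y h α l Q K B lam) {j : ℝ} (hj : |j| ≤ 3/2) {α' l' Q' K'} (H' : LP w C b (y + j • h) α' l' Q' K') (i : Fin n) (hτ : τ = b ^ 10 / 128) :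
    |w (y + j • h + (τ * (1 - j * lam i / 2)) • B (bv i)) + w (y + j • h - (τ * (1 - j * lam i / 2)) • B (bv i)) - 2 * w (y + j • h)
      - τ ^ 2 * ((1 - j * lam i / 2) ^ 2 * Q' (B (bv i)) (B (bv i)))| ≤ 4 * C * b ^ 36 ∧
    |w (y + j • h + (τ * (1 - j * lam i / 2)) • B (bv i)) - w (y + j • h - (τ * (1 - j * lam i / 2)) • B (bv i))
      - 2 * τ * (1 - j * lam i / 2) * (l (B (bv i)) + j * Q h (B (bv i)) + 1/2 * j ^ 2 * K h h (B (bv i)))| ≤ 1000 * C * τ * b ^ 13 := by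
  have hb := F.b0
  have hC := F.C1
  have hτ0 : 0 < τ := by rw [hτ]; positivity
  have hv : ‖j • h‖ ≤ b ^ 5 / 16 := by
    rw [norm_smul, norm_eq_abs]
    calc |j| * ‖h‖ ≤ 3/2 * (b ^ 5 / 64) := by gcongr; exact F.hh
      _ ≤ _ := by have : 0 < b ^ 5 := by positivity
                  linarith
  have hS := (F.H.shift hb H' hv).1 (B (bv i))
  have e1 : Q (j • h) (B (bv i)) = j * Q h (B (bv i)) := by rw [map_smul]; rfl
  have e2 : K (j • h) (j • h) (B (bv i)) = j ^ 2 * K h h (B (bv i)) := by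
    rw [map_smul, _root_.smul_apply, map_smul, _root_.smul_apply, _root_.smul_apply, smul_eq_mul, smul_eq_mul]; ring
  rw [e1, e2] at hS
  have hx := F.xin i
  have hg := abs_le.1 (F.gb hj i)
  obtain ⟨ξ, hξ⟩ : ∃ ξ, ξ = B (bv i) := ⟨_, rfl⟩
  obtain ⟨g, hgg⟩ : ∃ g, g = 1 - j * lam i / 2 := ⟨_, rfl⟩
  rw [← hξ] at hS hx ⊢
  rw [← hgg]
  have g1 : 0 ≤ g := by linarith
  have g2 : g ≤ 11/10 := by linarith
  obtain ⟨r, hr⟩ : ∃ r, r = τ * g := ⟨_, rfl⟩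
  rw [← hr]
  have hr0 : 0 ≤ r := by rw [hr]; positivity
  have hr1 : r ≤ τ * (11/10) := by rw [hr]; gcongr
  have hrx : ‖r • ξ‖ ≤ b ^ 10 / 8 := by
    rw [norm_smul, norm_eq_abs, abs_of_nonneg hr0]
    calc r * ‖ξ‖ ≤ (τ * (11/10)) * (11/10) := by gcongr
      _ ≤ _ := by rw [hτ]; have : 0 < b ^ 10 := by positivity
                  linarith
  have k0 := abs_le.1 (H'.a2 0 (by rw [norm_zero]; positivity))
  have k1 := abs_le.1 (H'.a2 (r • ξ) hrx)
  have k2 := abs_le.1 (H'.a2 ((-r) • ξ) (by rw [neg_smul, norm_neg]; exact hrx))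
  rw [Pol_smul] at k1 k2
  rw [neg_smul, ← sub_eq_add_neg] at k2
  have e0 : Pol α' l' Q' K' 0 = α' := by simp [Pol]
  rw [e0, add_zero] at k0
  refine ⟨?_, ?_⟩
  · have : τ ^ 2 * (g ^ 2 * Q' ξ ξ) = r ^ 2 * Q' ξ ξ := by rw [hr]; ring
    rw [this, abs_le]
    constructor <;> linarith [k0.1, k0.2, k1.1, k1.2, k2.1, k2.2]
  · have m1 : |K' ξ ξ ξ| ≤ 2 * C := by
      refine (H'.kb ξ).trans ?_
      have : ‖ξ‖ ^ 3 ≤ (11/10) ^ 3 := pow_le_pow_left₀ (norm_nonneg _) hx 3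
      nlinarith
    have m2 : |r ^ 3 / 3 * K' ξ ξ ξ| ≤ C * τ * b ^ 13 := by
      rw [abs_mul, abs_of_nonneg (by positivity)]
      calc r ^ 3 / 3 * |K' ξ ξ ξ| ≤ (τ * (11/10)) ^ 3 / 3 * (2 * C) := by gcongr
        _ = τ * C * (τ ^ 2 * ((11/10)^3 / 3 * 2)) := by ring
        _ ≤ τ * C * b ^ 13 := by
          gcongr
          rw [hτ]
          have : b ^ 20 ≤ b ^ 13 := pow_le_pow_of_le_one hb.le F.b1 (by norm_num)
          have : 0 < b ^ 20 := by positivity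
          nlinarith
        _ = _ := by ring
    have m3 : |2 * r * (l' ξ - (l ξ + j * Q h ξ + 1/2 * (j ^ 2 * K h h ξ)))| ≤ 300 * C * τ * b ^ 13 := by
      rw [abs_mul, abs_of_nonneg (by positivity)]
      calc _ ≤ 2 * (τ * (11/10)) * (96 * C * b ^ 13 * (11/10)) := by
            gcongr
            exact hS.trans (by gcongr)
        _ = (2 * 96 * (11/10) ^ 2) * (C * τ * b ^ 13) := by ring
        _ ≤ 300 * (C * τ * b ^ 13) := by gcongr; norm_num
        _ = _ := by ring
    have m4 : 2 * (C * b ^ 36) ≤ 300 * C * τ * b ^ 13 := by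
      have : b ^ 36 ≤ b ^ 23 := pow_le_pow_of_le_one hb.le F.b1 (by norm_num)
      calc 2 * (C * b ^ 36) ≤ 2 * (C * b ^ 23) := by gcongr
        _ = 256 * C * τ * b ^ 13 := by rw [hτ]; ring
        _ ≤ _ := by gcongr; norm_num
    have m5 : 0 ≤ C * τ * b ^ 13 := by positivity
    have m2 := abs_le.1 m2
    have m3 := abs_le.1 m3
    have e : 2 * τ * g * (l ξ + j * Q h ξ + 1/2 * j ^ 2 * K h h ξ) = 2 * r * l' ξ - 2 * r * (l' ξ - (l ξ + j * Q h ξ + 1/2 * (j ^ 2 * K h h ξ))) := by rw [hr]; ring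
    rw [e, abs_le]
    constructor <;> linarith [k0.1, k0.2, k1.1, k1.2, k2.1, k2.2, m2.1, m2.2, m3.1, m3.2]
end FR

lemma log_exp3 {x : ℝ} (hx : |x| ≤ 1/2) : |log (1 - x) + x + x ^ 2 / 2 + x ^ 3 / 3| ≤ 2 * x ^ 4 := by
  have h := Real.abs_log_sub_add_sum_range_le (x := x) (by linarith) 3
  simp only [Finset.sum_range_succ, Finset.sum_range_zero] at h
  have e : log (1 - x) + x + x ^ 2 / 2 + x ^ 3 / 3 = 0 + x ^ (0 + 1) / ((0:ℕ) + 1) + x ^ (1 + 1) / ((1:ℕ) + 1) + x ^ (2 + 1) / ((2:ℕ) + 1) + log (1 - x) := by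
    push_cast; ring
  rw [e]
  refine h.trans ?_
  rw [div_le_iff₀ (by linarith), Even.pow_abs (by decide)]
  have : 0 ≤ x ^ 4 := by positivity
  norm_num
  nlinarith

def dtp (w : FunE) (B : EndE) (lam : Fin n → ℝ) (τ : ℝ) (y h : Euc n) (j : ℝ) (i : Fin n) : ℝ :=
  w (y + j • h + (τ * (1 - j * lam i / 2)) • B (bv i))

lemma FR.sum_est
    (F : FR w C b y h α l Q K B lam) (HP : ∀ p, ‖p - y‖ ≤ b ^ 5 / 16 → ∃ α l Q K, LP w C b p α l Q K) (hτ : τ = b ^ 10 / 128) {j : ℝ} (hj : |j| ≤ 3/2) :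
    |∑ i, (dtp w B lam τ y h j i + dtp w B lam (-τ) y h j i - 2 * w (y + j • h))
      - τ ^ 2 * (n - j * ∑ i, lam i - j ^ 2 / 4 * ∑ i, lam i ^ 2 - j ^ 3 / 12 * ∑ i, lam i ^ 3)| ≤ 6 * 10 ^ 7 * n * C ^ 2 * (τ ^ 2 * b ^ 16) ∧
    ∀ i, |(dtp w B lam τ y h j i + dtp w B lam (-τ) y h j i - 2 * w (y + j • h)) - τ ^ 2| ≤ 10 ^ 5 * C * (τ ^ 2 * b ^ 8) := by
  have hb := F.b0
  have hC := F.C1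
  have hv : ‖y + j • h - y‖ ≤ b ^ 5 / 16 := by
    rw [add_sub_cancel_left, norm_smul, norm_eq_abs]
    calc |j| * ‖h‖ ≤ 3/2 * (b ^ 5 / 64) := by gcongr; exact F.hh
      _ ≤ _ := by have : 0 < b ^ 5 := by positivity
                  linarith
  obtain ⟨α', l', Q', K', H'⟩ := HP _ hv
  obtain ⟨h1, h2⟩ := F.pt_tr hj H'
  have h3 : ∀ i, |(dtp w B lam τ y h j i + dtp w B lam (-τ) y h j i - 2 * w (y + j • h)) - τ ^ 2 * ((1 - j * lam i / 2) ^ 2 * Q' (B (bv i)) (B (bv i)))| ≤ 4 * C * b ^ 36 := by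
    intro i
    have := (F.pt_w hj H' i hτ).1
    unfold dtp
    rwa [neg_mul, neg_smul, ← sub_eq_add_neg]
  obtain ⟨X, hX⟩ : ∃ X : Fin n → ℝ, ∀ i, X i = (1 - j * lam i / 2) ^ 2 * Q' (B (bv i)) (B (bv i)) := ⟨_, fun i => rfl⟩
  obtain ⟨W, hW⟩ : ∃ W : Fin n → ℝ, ∀ i, W i = dtp w B lam τ y h j i + dtp w B lam (-τ) y h j i - 2 * w (y + j • h) := ⟨_, fun i => rfl⟩
  simp only [← hX, ← hW] at h1 h2 h3 ⊢
  have hb36 : b ^ 36 = 16384 * (τ ^ 2 * b ^ 16) := by rw [hτ]; ring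
  have hb16 : b ^ 16 ≤ b ^ 8 := pow_le_pow_of_le_one hb.le F.b1 (by norm_num)
  constructor
  · have k1 : |∑ i, W i - τ ^ 2 * ∑ i, X i| ≤ n * (4 * C * b ^ 36) := by
      rw [mul_sum, ← sum_sub_distrib]
      refine (abs_sum_le_sum_abs _ _).trans ((sum_le_sum fun i _ => h3 i).trans ?_)
      simp
    have k2 : |∑ i, log (1 - j * lam i / 2) + (j / 2 * ∑ i, lam i + j ^ 2 / 8 * ∑ i, lam i ^ 2 + j ^ 3 / 24 * ∑ i, lam i ^ 3)| ≤ n * b ^ 16 := by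
      rw [mul_sum, mul_sum, mul_sum, ← sum_add_distrib, ← sum_add_distrib, ← sum_add_distrib]
      refine (abs_sum_le_sum_abs _ _).trans ((sum_le_sum (g := fun _ => b ^ 16) fun i _ => ?_).trans (by simp))
      have g1 := F.gb hj i
      have := log_exp3 (x := j * lam i / 2) (by rw [abs_div, abs_of_pos (by norm_num : (0:ℝ) < 2)]; linarith)
      have e : log (1 - j * lam i / 2) + (j / 2 * lam i + j ^ 2 / 8 * lam i ^ 2 + j ^ 3 / 24 * lam i ^ 3) =
        log (1 - j * lam i / 2) + j * lam i / 2 + (j * lam i / 2) ^ 2 / 2 + (j * lam i / 2) ^ 3 / 3 := by ring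
      rw [e]
      refine this.trans ?_
      have e2 : 2 * (j * lam i / 2) ^ 4 = j ^ 4 / 8 * lam i ^ 4 := by ring
      rw [e2]
      have h5 : j ^ 4 ≤ (3/2) ^ 4 := by
        rw [← Even.pow_abs (by decide)]; exact pow_le_pow_left₀ (abs_nonneg _) hj 4
      have h6 := F.lam4 i
      have h7 : 0 ≤ lam i ^ 4 := by positivity
      calc _ ≤ 1 * lam i ^ 4 := by gcongr; linarith
        _ ≤ _ := by linarith
    have k3 : |τ ^ 2 * (∑ i, X i - n - 2 * ∑ i, log (1 - j * lam i / 2))| ≤ τ ^ 2 * (2 * n * (5000 * C * b ^ 8) ^ 2) := by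
      rw [abs_mul, abs_of_nonneg (sq_nonneg τ)]; gcongr
    have k4 : |τ ^ 2 * (∑ i, log (1 - j * lam i / 2) + (j / 2 * ∑ i, lam i + j ^ 2 / 8 * ∑ i, lam i ^ 2 + j ^ 3 / 24 * ∑ i, lam i ^ 3))| ≤ τ ^ 2 * (n * b ^ 16) := by
      rw [abs_mul, abs_of_nonneg (sq_nonneg τ)]; gcongr
    obtain ⟨Y, hY⟩ : ∃ Y : ℝ, Y = τ ^ 2 * b ^ 16 * n := ⟨_, rfl⟩
    have hY0 : 0 ≤ Y := by rw [hY]; positivity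
    have e1 : n * (4 * C * b ^ 36) = 65536 * (C * Y) := by rw [hb36, hY]; ring
    have e2 : τ ^ 2 * (2 * n * (5000 * C * b ^ 8) ^ 2) = 50000000 * (C ^ 2 * Y) := by rw [hY]; ring
    have e3 : τ ^ 2 * (n * b ^ 16) = Y := by rw [hY]; ring
    have e4 : 6 * 10 ^ 7 * n * C ^ 2 * (τ ^ 2 * b ^ 16) = 60000000 * (C ^ 2 * Y) := by rw [hY]; ring
    rw [e1] at k1; rw [e2] at k3; rw [e3] at k4; rw [e4]
    have f1 : Y ≤ C * Y := le_mul_of_one_le_left hY0 hC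
    have f2 : C * Y ≤ C ^ 2 * Y := by nlinarith
    have k1 := abs_le.1 k1
    have k3 := abs_le.1 k3
    have k4 := abs_le.1 k4
    rw [abs_le]; constructor <;> linarith [k1.1, k1.2, k3.1, k3.2, k4.1, k4.2]
  · intro i
    have k1 := abs_le.1 (h3 i)
    have k2 : |τ ^ 2 * (X i - 1)| ≤ τ ^ 2 * (5000 * C * b ^ 8) := by
      rw [abs_mul, abs_of_nonneg (sq_nonneg τ)]; gcongr; exact h1 i
    have k2 := abs_le.1 k2
    have e1 : 4 * C * b ^ 36 ≤ 65536 * (C * (τ ^ 2 * b ^ 8)) := by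
      rw [hb36]
      calc _ = 65536 * (C * (τ ^ 2 * b ^ 16)) := by ring
        _ ≤ _ := by gcongr
    have : 0 ≤ C * (τ ^ 2 * b ^ 8) := by positivity
    rw [abs_le]; constructor <;> linarith [k1.1, k1.2, k2.1, k2.2]

def tv2 (w : FunE) (B : EndE) (lam : Fin n → ℝ) (τ : ℝ) (y h : Euc n) (i : Fin n) : ℝ :=
  th2 w (y + τ • B (bv i)) (h - (τ * lam i / 2) • B (bv i))
def tv3 (w : FunE) (B : EndE) (lam : Fin n → ℝ) (τ : ℝ) (y h : Euc n) (i : Fin n) : ℝ :=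
  th3 w (y + τ • B (bv i)) (h - (τ * lam i / 2) • B (bv i))

lemma tv2_eq (w : FunE) (B : EndE) (lam : Fin n → ℝ) (τ : ℝ) (y h : Euc n) (i : Fin n) :
    tv2 w B lam τ y h i = dtp w B lam τ y h 1 i - 2 * dtp w B lam τ y h 0 i + dtp w B lam τ y h (-1) i := by
  unfold tv2 th2 dtp
  congr 2
  · congr 1; module
  · congr 2; module
  · module

lemma tv3_eq (w : FunE) (B : EndE) (lam : Fin n → ℝ) (τ : ℝ) (y h : Euc n) (i : Fin n) :
    tv3 w B lam τ y h i = dtp w B lam τ y h (3/2) i - 3 * dtp w B lam τ y h (1/2) i + 3 * dtp w B lam τ y h (-(1/2)) i - dtp w B lam τ y h (-(3/2)) i := by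
  have e : ∀ j : ℝ, y + τ • B (bv i) + j • (h - (τ * lam i / 2) • B (bv i)) = y + j • h + (τ * (1 - j * lam i / 2)) • B (bv i) := by
    intro j; module
  unfold tv3 th3 dtp
  rw [← e, ← e, ← e, ← e, neg_smul, neg_smul, ← sub_eq_add_neg, ← sub_eq_add_neg]

set_option maxHeartbeats 1000000 in
lemma FR.second_var
    (F : FR w C b y h α l Q K B lam) (HP : ∀ p, ‖p - y‖ ≤ b ^ 5 / 16 → ∃ α l Q K, LP w C b p α l Q K) (hτ : τ = b ^ 10 / 128) :
    |∑ i, (tv3 w B lam τ y h i + tv3 w B lam (-τ) y h i - 2 * th3 w y h) + τ ^ 2 / 2 * ∑ i, lam i ^ 3| ≤ 10 ^ 9 * n * C ^ 2 * (τ ^ 2 * b ^ 16) ∧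
    |∑ i, (tv2 w B lam τ y h i + tv2 w B lam (-τ) y h i - 2 * th2 w y h) + τ ^ 2 / 2 * ∑ i, lam i ^ 2| ≤ 10 ^ 9 * n * C ^ 2 * (τ ^ 2 * b ^ 16) ∧
    (∀ i, |tv2 w B lam τ y h i + tv2 w B lam (-τ) y h i - 2 * th2 w y h| ≤ 10 ^ 6 * C * (τ ^ 2 * b ^ 8)) ∧
    ∀ i, |tv2 w B lam τ y h i - tv2 w B lam (-τ) y h i| ≤ 10 ^ 4 * C * (τ * b ^ 13) := by
  have hb := F.b0
  have hC := F.C1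
  obtain ⟨W, hW⟩ : ∃ W : ℝ → Fin n → ℝ, ∀ j i, W j i = dtp w B lam τ y h j i + dtp w B lam (-τ) y h j i - 2 * w (y + j • h) := ⟨_, fun j i => rfl⟩
  have hS := fun (j : ℝ) (hj : |j| ≤ 3/2) => (F.sum_est HP hτ hj).1
  have hI := fun (j : ℝ) (hj : |j| ≤ 3/2) => (F.sum_est HP hτ hj).2
  simp only [← hW] at hS hI
  have t2 : ∀ i, tv2 w B lam τ y h i + tv2 w B lam (-τ) y h i - 2 * th2 w y h = W 1 i - 2 * W 0 i + W (-1) i := by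
    intro i
    have e : th2 w y h = w (y + (1:ℝ) • h) - 2 * w (y + (0:ℝ) • h) + w (y + (-1:ℝ) • h) := by
      unfold th2; rw [one_smul, zero_smul, add_zero, neg_one_smul, ← sub_eq_add_neg]
    rw [tv2_eq, tv2_eq, e, hW, hW, hW]; ring
  have t3 : ∀ i, tv3 w B lam τ y h i + tv3 w B lam (-τ) y h i - 2 * th3 w y h = W (3/2) i - 3 * W (1/2) i + 3 * W (-(1/2)) i - W (-(3/2)) i := by
    intro i
    have e : th3 w y h = w (y + (3/2:ℝ) • h) - 3 * w (y + (1/2:ℝ) • h) + 3 * w (y + (-(1/2):ℝ) • h) - w (y + (-(3/2):ℝ) • h) := by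
      unfold th3; rw [neg_smul, neg_smul, ← sub_eq_add_neg, ← sub_eq_add_neg]
    rw [tv3_eq, tv3_eq, e, hW, hW, hW, hW]; ring
  have a1 : |(1:ℝ)| ≤ 3/2 := by norm_num
  have a2 : |(0:ℝ)| ≤ 3/2 := by norm_num
  have a3 : |(-1:ℝ)| ≤ 3/2 := by norm_num
  have a4 : |(3/2:ℝ)| ≤ 3/2 := by norm_num
  have a5 : |(1/2:ℝ)| ≤ 3/2 := by rw [abs_le]; constructor <;> norm_num
  have a6 : |(-(1/2):ℝ)| ≤ 3/2 := by rw [abs_le]; constructor <;> norm_num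
  have a7 : |(-(3/2):ℝ)| ≤ 3/2 := by norm_num
  obtain ⟨Y, hY⟩ : ∃ Y : ℝ, Y = n * C ^ 2 * (τ ^ 2 * b ^ 16) := ⟨_, rfl⟩
  have hY0 : 0 ≤ Y := by rw [hY]; positivity
  have eY : 6 * 10 ^ 7 * n * C ^ 2 * (τ ^ 2 * b ^ 16) = 60000000 * Y := by rw [hY]; ring
  have eY' : 10 ^ 9 * n * C ^ 2 * (τ ^ 2 * b ^ 16) = 1000000000 * Y := by rw [hY]; ring
  rw [eY] at hS
  rw [eY']
  refine ⟨?_, ?_, ?_, ?_⟩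
  · simp only [t3]
    rw [sum_sub_distrib, sum_add_distrib, sum_sub_distrib, ← mul_sum, ← mul_sum]
    have h1 := abs_le.1 (hS _ a4)
    have h2 := abs_le.1 (hS _ a5)
    have h3 := abs_le.1 (hS _ a6)
    have h4 := abs_le.1 (hS _ a7)
    rw [abs_le]; constructor <;> linarith [h1.1, h1.2, h2.1, h2.2, h3.1, h3.2, h4.1, h4.2]
  · simp only [t2]
    rw [sum_add_distrib, sum_sub_distrib, ← mul_sum]
    have h1 := abs_le.1 (hS _ a1)
    have h2 := abs_le.1 (hS _ a2)
    have h3 := abs_le.1 (hS _ a3)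
    rw [abs_le]; constructor <;> linarith [h1.1, h1.2, h2.1, h2.2, h3.1, h3.2]
  · intro i
    rw [t2]
    have h1 := abs_le.1 (hI _ a1 i)
    have h2 := abs_le.1 (hI _ a2 i)
    have h3 := abs_le.1 (hI _ a3 i)
    have : 0 ≤ C * (τ ^ 2 * b ^ 8) := by have := F.C1; positivity
    rw [abs_le]; constructor <;> linarith [h1.1, h1.2, h2.1, h2.2, h3.1, h3.2]
  · intro i
    rw [tv2_eq, tv2_eq]
    have hv : ∀ j : ℝ, |j| ≤ 3/2 → ‖y + j • h - y‖ ≤ b ^ 5 / 16 := by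
      intro j hj
      rw [add_sub_cancel_left, norm_smul, norm_eq_abs]
      calc |j| * ‖h‖ ≤ 3/2 * (b ^ 5 / 64) := by gcongr; exact F.hh
        _ ≤ _ := by have : 0 < b ^ 5 := by positivity
                    linarith
    have hD : ∀ j : ℝ, |j| ≤ 3/2 → |dtp w B lam τ y h j i - dtp w B lam (-τ) y h j i
      - 2 * τ * (1 - j * lam i / 2) * (l (B (bv i)) + j * Q h (B (bv i)) + 1/2 * j ^ 2 * K h h (B (bv i)))| ≤ 1000 * C * τ * b ^ 13 := by
      intro j hj
      obtain ⟨α', l', Q', K', H'⟩ := HP _ (hv j hj)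
      have := (F.pt_w hj H' i hτ).2
      unfold dtp
      rwa [neg_mul, neg_smul, ← sub_eq_add_neg]
    have hk : K h h (B (bv i)) = lam i * Q h (B (bv i)) := by
      rw [(F.H.sK h h (B (bv i))).2, F.hl, F.H.sQ]
    rw [hk] at hD
    have h1 := abs_le.1 (hD _ a1)
    have h2 := abs_le.1 (hD _ a2)
    have h3 := abs_le.1 (hD _ a3)
    have : 0 ≤ C * τ * b ^ 13 := by have := F.C1; have : 0 < τ := by (rw [hτ]; positivity)
                                    positivity
    rw [abs_le]; constructor <;> nlinarith [h1.1, h1.2, h2.1, h2.2, h3.1, h3.2]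
end

set_option maxHeartbeats 800000 in
lemma LP.cub_up {α l Q K} (H : LP w C b y α l Q K) {s ε θ a : ℝ}
    (hs : s = b ^ 5 / 128) (hs0 : 0 < s) (hs1 : s ≤ 1) (hε : 8 * (C * b ^ 18) ≤ ε * s ^ 3) (hε0 : 0 ≤ ε) (hθ0 : 0 < θ) (hθ : θ ≤ 1/2) (ha : 0 < a)
    (hε1 : ε ≤ θ / 8) (hε2 : ε ≤ θ * a / 8)
    (hB : ∀ h, ‖h‖ ≤ b ^ 5 / 64 → th2 w y h ≤ s ^ 2 → th3 w y h ≤ (1 + θ) * a * s ^ 3) :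
    ∀ e x, 0 ≤ x → Q e e ≤ x ^ 2 → K e e e ≤ (1 + 2 * θ) * a * x ^ 3 := by
  intro e x hx hQ
  rcases eq_or_ne e 0 with rfl | he
  · simp; positivity
  have he0 : 0 < ‖e‖ := norm_pos_iff.2 he
  have hn := abs_le.1 (H.nr e)
  have hQ0 : 0 < Q e e := by nlinarith [pow_pos he0 2]
  obtain ⟨x0, hx0, hx02⟩ : ∃ x0, 0 < x0 ∧ x0 ^ 2 = Q e e := ⟨Real.sqrt (Q e e), Real.sqrt_pos.2 hQ0, sq_sqrt hQ0.le⟩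
  have hx0x : x0 ≤ x := by
    apply le_of_sq_le_sq _ hx
    rw [hx02]; exact hQ
  obtain ⟨r, hr⟩ : ∃ r, r = s * (1 - θ / 8) / x0 := ⟨_, rfl⟩
  have hr0 : 0 < r := by rw [hr]; apply div_pos _ hx0; apply mul_pos hs0; linarith
  have hrx : r * x0 = s * (1 - θ / 8) := by rw [hr]; field_simp
  have hrx1 : r * x0 ≤ s := by rw [hrx]; nlinarith
  have e2 : Q (r • e) (r • e) = (r * x0) ^ 2 := by
    rw [map_smul, map_smul, _root_.smul_apply, smul_eq_mul, smul_eq_mul, ← hx02]; ring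
  have e3 : K (r • e) (r • e) (r • e) = r ^ 3 * K e e e := by
    simp only [map_smul, _root_.smul_apply, smul_eq_mul]; ring
  have hnr := abs_le.1 (H.nr (r • e))
  have hnorm : ‖r • e‖ ≤ 2 * s := by
    rw [e2] at hnr
    have : (r * x0) ^ 2 ≤ s ^ 2 := pow_le_pow_left₀ (by positivity) hrx1 2
    apply le_of_sq_le_sq _ (by positivity)
    nlinarith
  have hb5 : b ^ 5 = 128 * s := by rw [hs]; ring
  have t2 := abs_le.1 (H.th2_est (h := r • e) (by rw [hb5]; linarith))
  have t3 := abs_le.1 (H.th3_est (h := r • e) (by rw [hb5]; linarith))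
  rw [e2, hrx] at t2
  have hs3 : ε * s ^ 3 ≤ ε * s ^ 2 := by
    have : s ^ 3 ≤ s ^ 2 := pow_le_pow_of_le_one hs0.le hs1 (by norm_num)
    gcongr
  have hh : th2 w y (r • e) ≤ s ^ 2 := by
    have : s ^ 2 * ε ≤ s ^ 2 * (θ / 8) := by gcongr
    have h1 : (s * (1 - θ / 8)) ^ 2 ≤ s ^ 2 * (1 - θ / 8) := by
      rw [mul_pow]; gcongr; nlinarith
    have : 0 ≤ ε * s ^ 2 := by positivity
    nlinarith [t2.2]
  have h3 := hB _ (by rw [hb5]; linarith) hh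
  rw [e3] at t3
  have h4 : r ^ 3 * K e e e ≤ ((1 + θ) * a + ε) * s ^ 3 := by
    have : ((1 + θ) * a + ε) * s ^ 3 = (1 + θ) * a * s ^ 3 + ε * s ^ 3 := by ring
    linarith [t3.1]
  have h5 : ((1 + θ) * a + ε) * s ^ 3 ≤ r ^ 3 * ((1 + 2 * θ) * a * x0 ^ 3) := by
    have : r ^ 3 * ((1 + 2 * θ) * a * x0 ^ 3) = (1 + 2 * θ) * a * (1 - θ / 8) ^ 3 * s ^ 3 := by
      calc _ = (1 + 2 * θ) * a * (r * x0) ^ 3 := by ring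
        _ = _ := by rw [hrx]; ring
    rw [this]
    apply mul_le_mul_of_nonneg_right _ (by positivity)
    have g1 : 1 - 3 * θ / 8 ≤ (1 - θ / 8) ^ 3 := by
      have e : (1 - θ / 8) ^ 3 - (1 - 3 * θ / 8) = θ ^ 2 * (3/64 - θ / 512) := by ring
      have : 0 ≤ θ ^ 2 * (3/64 - θ / 512) := mul_nonneg (sq_nonneg _) (by linarith)
      linarith
    have g2 : (1 + θ) + θ / 8 ≤ (1 + 2 * θ) * (1 - 3 * θ / 8) := by nlinarith only [hθ0, hθ]
    calc (1 + θ) * a + ε ≤ a * ((1 + θ) + θ / 8) := by linarith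
      _ ≤ a * ((1 + 2 * θ) * (1 - θ / 8) ^ 3) := by
        apply mul_le_mul_of_nonneg_left _ ha.le
        exact g2.trans (by gcongr)
      _ = _ := by ring
  have h6 := le_of_mul_le_mul_left (h4.trans h5) (by positivity)
  exact h6.trans (by gcongr)

lemma algA {a t E X r k : ℝ} (ha : 0 < a) (ht0 : 0 < t) (ht : t ≤ 1/500) (hE : E ≤ t * a / 10) (hX0 : 0 ≤ X) (hX : X ≤ 11/5) (hr : 0 ≤ r)
    (h1 : k ≤ (1 + t) * a * X ^ 3) (h2 : a / 4 + 3/4 * a * X ^ 4 + 4 * t * a * r - E ≤ k) :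
    4/5 ≤ X ∧ X ≤ 7/5 ∧ r ≤ 7/8 ∧ a * X ^ 3 - E ≤ k := by
  have h3 : 1/4 * (X - 1) ^ 2 * (3 * X ^ 2 + 2 * X + 1) + 4 * t * r ≤ t * X ^ 3 + t / 10 := by
    have : a * (1/4 * (X - 1) ^ 2 * (3 * X ^ 2 + 2 * X + 1) + 4 * t * r) ≤ a * (t * X ^ 3 + t / 10) := by nlinarith
    exact le_of_mul_le_mul_left this ha
  have htr : 0 ≤ 4 * t * r := by positivity
  have hX3 : X ^ 3 ≤ (11/5) ^ 3 := pow_le_pow_left₀ hX0 hX 3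
  have hX30 : 0 ≤ X ^ 3 := by positivity
  have hT : t * X ^ 3 + t / 10 ≤ 1/40 := by nlinarith
  have g1 : 4/5 ≤ X := by
    by_contra hc; push Not at hc
    have hX3 : X ^ 3 ≤ (4/5) ^ 3 := pow_le_pow_left₀ hX0 hc.le 3
    have h5 : t * X ^ 3 + t / 10 ≤ 1/500 := by nlinarith
    have h6 : (1/5) ^ 2 ≤ (X - 1) ^ 2 := by nlinarith
    have h7 : 1 ≤ 3 * X ^ 2 + 2 * X + 1 := by nlinarith
    nlinarith
  have g2 : X ≤ 7/5 := by
    by_contra hc; push Not at hc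
    have h6 : (2/5) ^ 2 ≤ (X - 1) ^ 2 := by nlinarith
    have h7 : 1 ≤ 3 * X ^ 2 + 2 * X + 1 := by nlinarith
    nlinarith
  refine ⟨g1, g2, ?_, ?_⟩
  · have hX3 : X ^ 3 ≤ (7/5) ^ 3 := pow_le_pow_left₀ hX0 g2 3
    have h8 : 0 ≤ 1/4 * (X - 1) ^ 2 * (3 * X ^ 2 + 2 * X + 1) := by positivity
    have : t * (4 * r) ≤ t * (X ^ 3 + 1/10) := by linarith
    have := le_of_mul_le_mul_left this ht0
    linarith
  · have h8 : 0 ≤ a * (1/4 * (X - 1) ^ 2 * (3 * X ^ 2 + 2 * X + 1)) := by positivity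
    have : 0 ≤ 4 * t * a * r := by positivity
    nlinarith

set_option maxHeartbeats 1000000 in
lemma algF {a t ε X n M b S2 S3 s τ G3 G2 R Y2 T : ℝ} (ha : 0 < a) (ht0 : 0 < t) (ht : t ≤ 1/500) (hs : 0 < s) (hτ : 0 < τ)
    (hX : 4/5 ≤ X) (hX2 : X ≤ 7/5) (hε0 : 0 ≤ ε) (hε : ε ≤ 1/100) (hS2 : a ^ 2 / 4 ≤ S2) (hS3 : S3 ≤ X * a * (1 + 2 * t) * S2)
    (h3 : -(τ ^ 2 * s ^ 3) * (1/2 * S3 + M * b) ≤ G3) (h2 : G2 ≤ τ ^ 2 * s ^ 2 * (-(1/2) * S2 + M * b))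
    (hR : R ≤ τ ^ 2 * s ^ 4 * (M * b)) (hY : Y2 ≤ 5/2 * n * τ ^ 2) (hT1 : |T - X ^ 2 * s ^ 2| ≤ ε * s ^ 2)
    (hZ : s * G3 - 3/4 * a * (2 * T * G2 + R) - 256 * t * a * s ^ 4 * Y2 ≤ 0)
    (hn : 0 ≤ n) (hta : 640 * n * t ≤ a ^ 2 / 200) (hM : M * b * (1 + 5 * a) ≤ a ^ 3 / 300) (hMb : 0 ≤ M * b) : False := by
  obtain ⟨T', hT'⟩ : ∃ T', T = T' * s ^ 2 := ⟨T / s ^ 2, by field_simp⟩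
  have hT2 : |T' - X ^ 2| ≤ ε := by
    have : T - X ^ 2 * s ^ 2 = (T' - X ^ 2) * s ^ 2 := by rw [hT']; ring
    rw [this, abs_mul, abs_of_nonneg (by positivity : 0 ≤ s ^ 2)] at hT1
    exact le_of_mul_le_mul_right hT1 (by positivity)
  have hT3 := abs_le.1 hT2
  have hX4 : X ^ 2 ≤ 49/25 := by nlinarith
  have hX5 : 16/25 ≤ X ^ 2 := by nlinarith
  have hT0 : 0 ≤ T' := by linarith
  have k1 : s * (-(τ ^ 2 * s ^ 3) * (1/2 * S3 + M * b)) ≤ s * G3 := by gcongr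
  have k2 : 2 * T * G2 ≤ 2 * T * (τ ^ 2 * s ^ 2 * (-(1/2) * S2 + M * b)) := by
    apply mul_le_mul_of_nonneg_left h2; rw [hT']; positivity
  have k3 : 3/4 * a * (2 * T * G2 + R) ≤ 3/4 * a * (2 * T * (τ ^ 2 * s ^ 2 * (-(1/2) * S2 + M * b)) + τ ^ 2 * s ^ 4 * (M * b)) := by gcongr
  have k4 : 256 * t * a * s ^ 4 * Y2 ≤ 256 * t * a * s ^ 4 * (5/2 * n * τ ^ 2) := by gcongr
  have k5 : (τ ^ 2 * s ^ 4) * (-(1/2 * S3 + M * b) - 3/4 * a * (2 * T' * (-(1/2) * S2 + M * b) + M * b) - 640 * t * a * n) ≤ (τ ^ 2 * s ^ 4) * 0 := by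
    have e : (τ ^ 2 * s ^ 4) * (-(1/2 * S3 + M * b) - 3/4 * a * (2 * T' * (-(1/2) * S2 + M * b) + M * b) - 640 * t * a * n) =
      s * (-(τ ^ 2 * s ^ 3) * (1/2 * S3 + M * b)) - 3/4 * a * (2 * T * (τ ^ 2 * s ^ 2 * (-(1/2) * S2 + M * b)) + τ ^ 2 * s ^ 4 * (M * b)) - 256 * t * a * s ^ 4 * (5/2 * n * τ ^ 2) := by
      rw [hT']; ring
    rw [e, mul_zero]; linarith
  have k6 := le_of_mul_le_mul_left k5 (by positivity)
  have hS20 : 0 ≤ S2 := le_trans (by positivity) hS2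
  have k7 : a * S2 * (1/20) ≤ a * S2 * (3/4 * T' - 1/2 * X * (1 + 2 * t)) := by
    gcongr
    have z1 : 2/25 ≤ 3/4 * X ^ 2 - 1/2 * X := by nlinarith only [hX]
    have z2 : t * X ≤ 1/500 * (7/5) := by gcongr
    linarith [hT3.1]
  have k8 : a * (a ^ 2 / 4) ≤ a * S2 := by gcongr
  have k9 : a * (640 * n * t) ≤ a * (a ^ 2 / 200) := by gcongr
  have k10 : 3/4 * a * (2 * T' * (M * b) + M * b) ≤ a * (M * b) * 5 := by
    have : 2 * T' ≤ 4 := by linarith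
    have : a * (M * b) * (2 * T') ≤ a * (M * b) * 4 := by gcongr
    nlinarith [mul_nonneg ha.le hMb]
  have : 0 < a ^ 3 := by positivity
  linarith

lemma frame_lam {α l Q K} (H : LP w C b y α l Q K)
    {lam : Fin n → ℝ} (hB : ∀ x z, Q (B x) (B z) = inner ℝ x z) (hsur : ∀ z, ∃ x, B x = z)
    (hl : ∀ i z, K h (B (bv i)) z = lam i * Q (B (bv i)) z) {S a t : ℝ} (hS : 0 < S) (hQ : Q h h = S ^ 2) (ha : 0 < a) (ht : 0 < t) (ht1 : t ≤ 1/500)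
    (hK : ∀ e x, 0 ≤ x → Q e e ≤ x ^ 2 → K e e e ≤ (1 + t) * a * x ^ 3) (hk : a * S ^ 3 * (1 - 2 * t) ≤ K h h h) :
    (∀ i, lam i ≤ S * a * (1 + 2 * t)) ∧ a ^ 2 * S ^ 2 * (9/10) ≤ ∑ i, lam i ^ 2 := by
  have hbb : ∀ i : Fin n, Q (B (bv i)) (B (bv i)) = 1 := by
    intro i; rw [hB]; simp [bv]
  have pos : ∀ e, 0 ≤ Q e e := by
    intro e; have := (abs_le.1 (H.nr e)).1; nlinarith [sq_nonneg ‖e‖]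
  constructor
  · intro i
    obtain ⟨e, he⟩ : ∃ e, e = S • B (bv i) := ⟨_, rfl⟩
    have e1 : Q e e = S ^ 2 := by
      rw [he, map_smul, map_smul, _root_.smul_apply, smul_eq_mul, smul_eq_mul, hbb]; ring
    have e2 : K h e e = S ^ 2 * lam i := by
      rw [he, map_smul, map_smul, _root_.smul_apply, smul_eq_mul, smul_eq_mul, hl, hbb]; ring
    have q1 : Q (h + e) (h + e) + Q (h - e) (h - e) = 4 * S ^ 2 := by
      simp only [map_add, map_sub, _root_.add_apply, _root_.sub_apply]
      rw [hQ, e1]; ring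
    have k1 : K (h + e) (h + e) (h + e) + K (h - e) (h - e) (h - e) = 2 * K h h h + 6 * K h e e := by
      simp only [map_add, map_sub, _root_.add_apply, _root_.sub_apply]
      have e4 : K e h e = K h e e := (H.sK _ _ _).1
      have e5 : K e e h = K h e e := by rw [(H.sK e e h).2, (H.sK e h e).1]
      rw [e4, e5]; ring
    have key : ∀ f, Q f f ≤ 4 * S ^ 2 → K f f f ≤ (1 + t) * a * (2 * S * Q f f) := by
      intro f hf
      have h1 := hK f (Real.sqrt (Q f f)) (Real.sqrt_nonneg _) (by rw [sq_sqrt (pos f)])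
      refine h1.trans ?_
      have h2 : Real.sqrt (Q f f) ≤ 2 * S := by
        rw [Real.sqrt_le_left (by positivity)]; linarith
      have h3 : Real.sqrt (Q f f) ^ 3 = Real.sqrt (Q f f) * Q f f := by
        rw [pow_succ, sq_sqrt (pos f), mul_comm]
      rw [h3]
      have := pos f
      gcongr
    have m1 := key (h + e) (by linarith [pos (h - e)])
    have m2 := key (h - e) (by linarith [pos (h + e)])
    have m3 : K (h + e) (h + e) (h + e) + K (h - e) (h - e) (h - e) ≤ (1 + t) * a * (2 * S * (4 * S ^ 2)) := by
      rw [← q1]; linarith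
    rw [k1, e2] at m3
    have m4 : S ^ 2 * lam i ≤ S ^ 2 * (S * a * (1 + 2 * t)) := by
      have : 0 ≤ a * S ^ 3 * t := by positivity
      nlinarith only [m3, hk, this]
    exact le_of_mul_le_mul_left m4 (by positivity)
  · obtain ⟨c, hc⟩ := hsur h
    have hBc : h = ∑ i, c i • B (bv i) := by
      conv_lhs => rw [← hc, vec_eq_sum c, map_sum]
      exact sum_congr rfl fun i _ => map_smul _ _ _
    have hQi : ∀ i, Q (B (bv i)) h = c i := by
      intro i; rw [← hc, hB]; simp [bv, EuclideanSpace.inner_single_left]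
    have e3 : K h h h = ∑ i, lam i * c i ^ 2 := by
      rw [show K h h h = K h (∑ i, c i • B (bv i)) h by rw [← hBc], map_sum, ContinuousLinearMap.sum_apply]
      refine sum_congr rfl fun i _ => ?_
      rw [map_smul, _root_.smul_apply, hl, hQi, smul_eq_mul]; ring
    have e4 : S ^ 2 = ∑ i, c i ^ 2 := by
      rw [← hQ, ← hc, hB, real_inner_self_eq_norm_sq, EuclideanSpace.norm_sq_eq]; simp
    have : ∃ i, a * S * (1 - 2 * t) ≤ lam i := by
      by_contra hc; push Not at hc
      have h1 : K h h h ≤ ∑ i, (a * S * (1 - 2 * t)) * c i ^ 2 := by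
        rw [e3]; exact sum_le_sum fun i _ => mul_le_mul_of_nonneg_right (hc i).le (sq_nonneg _)
      have h2 : ∑ i, lam i * c i ^ 2 < ∑ i, (a * S * (1 - 2 * t)) * c i ^ 2 := by
        apply Finset.sum_lt_sum
        · exact fun i _ => mul_le_mul_of_nonneg_right (hc i).le (sq_nonneg _)
        · by_contra hne; push Not at hne
          have : ∑ i, c i ^ 2 = 0 := by
            apply Finset.sum_eq_zero
            intro i hi
            by_contra h0
            have h0' : 0 < c i ^ 2 := lt_of_le_of_ne (sq_nonneg _) (Ne.symm h0)
            have := hne i hi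
            nlinarith [hc i]
          rw [this] at e4
          have : 0 < S ^ 2 := by positivity
          linarith
      rw [← e3, ← mul_sum, ← e4] at h2
      nlinarith
    obtain ⟨i, hi⟩ := this
    have h1 : (a * S * (1 - 2 * t)) ^ 2 ≤ lam i ^ 2 := pow_le_pow_left₀ (by apply mul_nonneg (by positivity); linarith) hi 2
    have h2 : lam i ^ 2 ≤ ∑ i, lam i ^ 2 := Finset.single_le_sum (f := fun i => lam i ^ 2) (fun i _ => sq_nonneg _) (Finset.mem_univ i)
    refine le_trans ?_ (h1.trans h2)
    have : (a * S * (1 - 2 * t)) ^ 2 = a ^ 2 * S ^ 2 * (1 - 2 * t) ^ 2 := by ring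
    rw [this]
    gcongr
    nlinarith only [ht1, ht]

lemma ZcontOn (hw : ContinuousOn w (ball 0 1)) {s A D : ℝ} (hs : s ≤ 1/100) :
    ContinuousOn (fun p : Euc n × Euc n => s * th3 w p.1 p.2 - A * th2 w p.1 p.2 ^ 2 - D * ‖p.1‖ ^ 2)
      (closedBall 0 (1/8) ×ˢ closedBall 0 (2 * s)) := by
  have key : ∀ j : ℝ, |j| ≤ 3/2 → ContinuousOn (fun p : Euc n × Euc n => w (p.1 + j • p.2)) (closedBall 0 (1/8) ×ˢ closedBall 0 (2 * s)) := by
    intro j hj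
    apply hw.comp (by fun_prop)
    rintro ⟨x, h⟩ ⟨hx, hh⟩
    rw [mem_closedBall_zero_iff] at hx hh
    rw [mem_ball_zero_iff]
    calc ‖x + j • h‖ ≤ ‖x‖ + |j| * ‖h‖ := by
          refine (norm_add_le _ _).trans ?_; rw [norm_smul, norm_eq_abs]
      _ ≤ 1/8 + 3/2 * (2 * s) := by gcongr
      _ < 1 := by linarith
  have a1 := key 1 (by norm_num)
  have a2 := key 0 (by norm_num)
  have a3 := key (-1) (by norm_num)
  have a4 := key (3/2) (by norm_num)
  have a5 := key (1/2) (by rw [abs_le]; constructor <;> norm_num)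
  have a6 := key (-(1/2)) (by rw [abs_le]; constructor <;> norm_num)
  have a7 := key (-(3/2)) (by norm_num)
  simp only [one_smul, zero_smul, add_zero, neg_smul, ← sub_eq_add_neg] at a1 a2 a3 a6 a7
  unfold th2 th3
  exact ((continuousOn_const.mul (((a4.sub (continuousOn_const.mul a5)).add (continuousOn_const.mul a6)).sub a7)).sub (continuousOn_const.mul (((a1.sub (continuousOn_const.mul a2)).add a3).pow 2))).sub (continuousOn_const.mul ((continuous_fst.norm.pow 2).continuousOn))

set_option maxHeartbeats 2000000 in
lemma max_core (hn : 1 ≤ n) {C b a θ ε s : ℝ} (hC : 1 ≤ C) (hb0 : 0 < b) (hb1 : b ≤ 1) (hCb : C * b ≤ 1/100) (hs : s = b ^ 5 / 128)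
    (hε0 : 0 ≤ ε) (hε : 8 * (C * b ^ 18) ≤ ε * s ^ 3) (ha : 0 < a) (hθ0 : 0 < θ) (hθ : θ ≤ 1/1000) (hε1 : ε ≤ θ / 8) (hε2 : ε ≤ θ * a / 8)
    (hE : 10 * (1 + a) * ε ≤ 2 * θ * a / 10) (hta : 640 * n * (2 * θ) ≤ a ^ 2 / 200)
    (hM : 10 ^ 18 * n * C ^ 2 * b * (1 + 5 * a) ≤ a ^ 3 / 300)
    (hw : ContinuousOn w (ball 0 1)) (HL : ∀ p, ‖p‖ ≤ 1/2 → ∃ α l Q K, LP w C b p α l Q K)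
    {h0 : Euc n} (hh0 : ‖h0‖ ≤ 2 * s) (h02 : th2 w 0 h0 ≤ s ^ 2) (h03 : a * s ^ 3 < th3 w 0 h0)
    (hB : ∀ y, ‖y‖ ≤ 1/8 → ∀ h, ‖h‖ ≤ 2 * s → th2 w y h ≤ s ^ 2 → th3 w y h ≤ (1 + θ) * a * s ^ 3) : False := by
  have hb99 : b ≤ 1/100 := by nlinarith only [hC, hCb, hb0]
  have hb5 : b ^ 5 = 128 * s := by rw [hs]; ring
  have h2s : 2 * s = b ^ 5 / 64 := by rw [hs]; ring
  have hs0 : 0 < s := by rw [hs]; positivity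
  have hb51 : b ^ 5 ≤ b := by
    calc b ^ 5 ≤ b ^ 1 := pow_le_pow_of_le_one hb0.le hb1 (by norm_num)
      _ = b := pow_one b
  have hs1 : s ≤ 1/100 := by rw [hs]; linarith
  obtain ⟨t, ht⟩ : ∃ t, t = 2 * θ := ⟨_, rfl⟩
  rw [← ht] at hE hta
  have ht0 : 0 < t := by rw [ht]; positivity
  have ht1 : t ≤ 1/500 := by rw [ht]; linarith
  have hε3 : ε ≤ 1/100 := by linarith
  have hs32 : ε * s ^ 3 ≤ ε * s ^ 2 := by
    have : s ^ 3 ≤ s ^ 2 := pow_le_pow_of_le_one hs0.le (by linarith) (by norm_num)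
    gcongr
  obtain ⟨Z, hZ⟩ : ∃ Z : Euc n × Euc n → ℝ, ∀ p, Z p = s * th3 w p.1 p.2 - 3/4 * a * th2 w p.1 p.2 ^ 2 - 256 * t * a * s ^ 4 * ‖p.1‖ ^ 2 := ⟨_, fun p => rfl⟩
  have hZc : ContinuousOn Z (closedBall 0 (1/8) ×ˢ closedBall 0 (2 * s)) := by
    have : Z = _ := funext hZ
    rw [this]; exact ZcontOn hw hs1
  obtain ⟨⟨y, h⟩, ⟨hy, hh⟩, hmax⟩ := ((isCompact_closedBall (0 : Euc n) (1/8)).prod (isCompact_closedBall (0 : Euc n) (2 * s))).exists_isMaxOn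
    ⟨(0, 0), by simp; linarith⟩ hZc
  rw [mem_closedBall_zero_iff] at hy hh
  simp only at hy hh
  have hmax' : ∀ y' h', ‖y'‖ ≤ 1/8 → ‖h'‖ ≤ 2 * s → Z (y', h') ≤ Z (y, h) := fun y' h' g1 g2 => hmax ⟨by simpa using g1, by simpa using g2⟩
  obtain ⟨α, l, Q, K, H⟩ := HL y (by linarith)
  have hcub := H.cub_up hs hs0 (by linarith) hε hε0 hθ0 (by linarith) ha hε1 hε2 (fun h' g => hB y hy h' (by rw [h2s]; exact g))
  rw [← ht] at hcub
  have T2 := H.th2_est (h := h) (by rw [hb5]; linarith)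
  have T3 := H.th3_est (h := h) (by rw [hb5]; linarith)
  have hCb18 : 0 ≤ C * b ^ 18 := by positivity
  have T2' : |th2 w y h - Q h h| ≤ ε * s ^ 2 := T2.trans (by linarith)
  have T3' : |th3 w y h - K h h h| ≤ ε * s ^ 3 := T3.trans hε
  have hnr := abs_le.1 (H.nr h)
  have hQh0 : 0 ≤ Q h h := by linarith [sq_nonneg ‖h‖, hnr.1]
  -- S and X
  obtain ⟨S, hS0, hSQ⟩ : ∃ S, 0 ≤ S ∧ Q h h = S ^ 2 := ⟨Real.sqrt (Q h h), Real.sqrt_nonneg _, (sq_sqrt hQh0).symm⟩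
  obtain ⟨X, hX⟩ : ∃ X, S = X * s := ⟨S / s, by field_simp⟩
  have hX0 : 0 ≤ X := by
    by_contra hc; push Not at hc; nlinarith only [hc, hX, hS0, hs0]
  have hXu : X ≤ 11/5 := by
    have : Q h h ≤ (11/5 * s) ^ 2 := by
      have : ‖h‖ ^ 2 ≤ (2 * s) ^ 2 := pow_le_pow_left₀ (norm_nonneg _) hh 2
      nlinarith only [hnr.2, this]
    rw [hSQ] at this
    have := le_of_sq_le_sq this (by positivity)
    rw [hX] at this
    exact le_of_mul_le_mul_right this hs0
  obtain ⟨k, hk⟩ : ∃ k, K h h h = k * s ^ 3 := ⟨K h h h / s ^ 3, by field_simp⟩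
  obtain ⟨T, hT⟩ : ∃ T, th2 w y h = T * s ^ 2 := ⟨th2 w y h / s ^ 2, by field_simp⟩
  obtain ⟨U, hU⟩ : ∃ U, th3 w y h = U * s ^ 3 := ⟨th3 w y h / s ^ 3, by field_simp⟩
  have TX : |T - X ^ 2| ≤ ε := by
    have e : th2 w y h - Q h h = (T - X ^ 2) * s ^ 2 := by rw [hT, hSQ, hX]; ring
    rw [e, abs_mul, abs_of_nonneg (by positivity : 0 ≤ s ^ 2)] at T2'
    exact le_of_mul_le_mul_right T2' (by positivity)
  have UK : |U - k| ≤ ε := by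
    have e : th3 w y h - K h h h = (U - k) * s ^ 3 := by rw [hU, hk]; ring
    rw [e, abs_mul, abs_of_nonneg (by positivity : 0 ≤ s ^ 3)] at T3'
    exact le_of_mul_le_mul_right T3' (by positivity)
  have hk1 : k ≤ (1 + t) * a * X ^ 3 := by
    have := hcub h S hS0 hSQ.le
    rw [hk, hX] at this
    have e : (1 + t) * a * (X * s) ^ 3 = (1 + t) * a * X ^ 3 * s ^ 3 := by ring
    rw [e] at this
    exact le_of_mul_le_mul_right this (by positivity)
  have hk2 : a / 4 + 3/4 * a * X ^ 4 + 4 * t * a * (64 * ‖y‖ ^ 2) - 10 * (1 + a) * ε ≤ k := by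
    have z0 := hmax' 0 h0 (by simp) hh0
    rw [hZ, hZ] at z0
    simp only [norm_zero] at z0
    rw [hT, hU] at z0
    obtain ⟨α0, l0, Q0, K0, H0⟩ := HL 0 (by simp)
    have q1 := (abs_le.1 (H0.th2_est (h := h0) (by rw [hb5]; linarith))).1
    have q2 : 0 ≤ Q0 h0 h0 := by have := (abs_le.1 (H0.nr h0)).1; linarith [sq_nonneg ‖h0‖]
    have q3 : -s ^ 2 ≤ th2 w 0 h0 := by
      have : ε * s ^ 2 ≤ 1 * s ^ 2 := by gcongr; linarith
      linarith
    have q4 : th2 w 0 h0 ^ 2 ≤ (s ^ 2) ^ 2 := sq_le_sq' q3 h02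
    have q5 : s * (a * s ^ 3) ≤ s * th3 w 0 h0 := by gcongr
    have q6 : 3/4 * a * th2 w 0 h0 ^ 2 ≤ 3/4 * a * (s ^ 2) ^ 2 := by gcongr
    have q7 : s ^ 4 * (a / 4) ≤ s ^ 4 * (U - 3/4 * a * T ^ 2 - 256 * t * a * ‖y‖ ^ 2) := by
      linarith
    have q8 := le_of_mul_le_mul_left q7 (by positivity)
    have TX := abs_le.1 TX
    have UK := abs_le.1 UK
    have q9 : X ^ 4 - 10 * ε ≤ T ^ 2 := by
      have hX2 : X ^ 2 ≤ (11/5) ^ 2 := pow_le_pow_left₀ hX0 hXu 2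
      have : X ^ 4 = (X ^ 2) ^ 2 := by ring
      rw [this]
      nlinarith only [TX.1, hX2, hε0, sq_nonneg X, sq_nonneg (T - X ^ 2)]
    have q10 : 3/4 * a * (X ^ 4 - 10 * ε) ≤ 3/4 * a * T ^ 2 := by gcongr
    nlinarith only [q8, q10, UK.2, mul_nonneg ha.le hε0, hε0]
  obtain ⟨x1, x2, x3, x4⟩ := algA ha ht0 ht1 hE hX0 hXu (by positivity) hk1 hk2
  have hSpos : 0 < S := by rw [hX]; apply mul_pos _ hs0; linarith
  -- frame
  have hA : SymB (K h) := fun u v => (H.sK h u v).2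
  have hQp : ∀ x, x ≠ 0 → 0 < Q x x := by
    intro x hx
    have := (abs_le.1 (H.nr x)).1
    have : 0 < ‖x‖ ^ 2 := by have := norm_pos_iff.2 hx; positivity
    linarith
  obtain ⟨B, lam, hBQ, hsur, hlam⟩ := simdiag H.sQ hA hQp
  have F : FR w C b y h α l Q K B lam := ⟨H, hBQ, hlam, by rw [← h2s]; exact hh, hb0, hb1, hC, hCb⟩
  have hX3 : (4/5) ^ 3 ≤ X ^ 3 := pow_le_pow_left₀ (by norm_num) x1 3
  obtain ⟨f1, f2⟩ := frame_lam H hBQ hsur hlam hSpos hSQ ha ht0 ht1 hcub (by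
    rw [hk, hX]
    have e : a * (X * s) ^ 3 * (1 - 2 * t) = a * X ^ 3 * (1 - 2 * t) * s ^ 3 := by ring
    rw [e]
    apply mul_le_mul_of_nonneg_right _ (by positivity)
    have : a * t * (4/5) ^ 3 ≤ a * t * X ^ 3 := by gcongr
    nlinarith only [x4, hE, this, mul_pos ha ht0])
  obtain ⟨τ, hτ⟩ : ∃ τ, τ = b ^ 10 / 128 := ⟨_, rfl⟩
  have hτ0 : 0 < τ := by rw [hτ]; positivity
  have hτs : τ = 128 * s ^ 2 := by rw [hτ, hs]; ring
  obtain ⟨v1, v2, v3, v4⟩ := F.second_var (fun p hp => HL p (by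
    have : ‖p‖ ≤ ‖p - y‖ + ‖y‖ := by simpa using norm_add_le (p - y) y
    linarith)) hτ
  -- test points
  have hyn : ‖y‖ ≤ 1/8 * (19/20) := by
    apply le_of_sq_le_sq _ (by norm_num)
    linarith [x3]
  have hhn : ‖h‖ ≤ 3/2 * s := by
    apply le_of_sq_le_sq _ (by positivity)
    have : S ^ 2 ≤ (7/5 * s) ^ 2 := pow_le_pow_left₀ hS0 (by rw [hX]; gcongr) 2
    nlinarith only [hnr.1, this, hSQ]
  have htest : ∀ σ : ℝ, |σ| = τ → ∀ i, Z (y + σ • B (bv i), h - (σ * lam i / 2) • B (bv i)) ≤ Z (y, h) := by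
    intro σ hσ i
    have hx := F.xin i
    have hls := F.lams i
    apply hmax'
    · refine (norm_add_le _ _).trans ?_
      rw [norm_smul, norm_eq_abs, hσ]
      have : τ * ‖B (bv i)‖ ≤ (1/10000) * (11/10) := by
        gcongr
        rw [hτ]
        have : b ^ 10 ≤ b := by
          calc b ^ 10 ≤ b ^ 1 := pow_le_pow_of_le_one hb0.le hb1 (by norm_num)
            _ = b := pow_one b
        linarith
      linarith
    · refine (norm_sub_le _ _).trans ?_
      rw [norm_smul, norm_eq_abs, abs_div, abs_mul, hσ, abs_of_pos (by norm_num : (0:ℝ) < 2)]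
      have : τ * |lam i| / 2 * ‖B (bv i)‖ ≤ 128 * s ^ 2 * (1/100) / 2 * (11/10) := by
        rw [hτs]; gcongr
      nlinarith only [this, hhn, hs0, hs1]
  have hsum : ∑ i, (Z (y + τ • B (bv i), h - (τ * lam i / 2) • B (bv i)) + Z (y + (-τ) • B (bv i), h - ((-τ) * lam i / 2) • B (bv i)) - 2 * Z (y, h)) ≤ 0 := by
    apply Finset.sum_nonpos
    intro i _
    have := htest τ (abs_of_pos hτ0) i
    have := htest (-τ) (by rw [abs_neg]; exact abs_of_pos hτ0) i
    linarith
  obtain ⟨D, hD⟩ : ∃ D : Fin n → ℝ, ∀ i, D i = tv2 w B lam τ y h i + tv2 w B lam (-τ) y h i - 2 * th2 w y h := ⟨_, fun i => rfl⟩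
  obtain ⟨d, hd⟩ : ∃ d : Fin n → ℝ, ∀ i, d i = tv2 w B lam τ y h i - tv2 w B lam (-τ) y h i := ⟨_, fun i => rfl⟩
  obtain ⟨G, hG⟩ : ∃ G : Fin n → ℝ, ∀ i, G i = tv3 w B lam τ y h i + tv3 w B lam (-τ) y h i - 2 * th3 w y h := ⟨_, fun i => rfl⟩
  have hexp : ∀ i, Z (y + τ • B (bv i), h - (τ * lam i / 2) • B (bv i)) + Z (y + (-τ) • B (bv i), h - ((-τ) * lam i / 2) • B (bv i)) - 2 * Z (y, h) =
      s * G i - 3/4 * a * (2 * th2 w y h * D i + (D i ^ 2 + d i ^ 2) / 2) - 256 * t * a * s ^ 4 * (2 * τ ^ 2 * ‖B (bv i)‖ ^ 2) := by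
    intro i
    rw [hZ, hZ, hZ]
    simp only
    have en : ‖y + τ • B (bv i)‖ ^ 2 + ‖y + (-τ) • B (bv i)‖ ^ 2 - 2 * ‖y‖ ^ 2 = 2 * τ ^ 2 * ‖B (bv i)‖ ^ 2 := by
      have := parallelogram_law_with_norm ℝ y (τ • B (bv i))
      rw [neg_smul, ← sub_eq_add_neg]
      rw [norm_smul, norm_eq_abs, abs_of_pos hτ0] at this
      nlinarith only [this]
    rw [← en]
    have g2 : th2 w (y + τ • B (bv i)) (h - (τ * lam i / 2) • B (bv i)) = tv2 w B lam τ y h i := rfl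
    have g2' : th2 w (y + (-τ) • B (bv i)) (h - (-τ * lam i / 2) • B (bv i)) = tv2 w B lam (-τ) y h i := rfl
    have g3 : th3 w (y + τ • B (bv i)) (h - (τ * lam i / 2) • B (bv i)) = tv3 w B lam τ y h i := rfl
    have g3' : th3 w (y + (-τ) • B (bv i)) (h - (-τ * lam i / 2) • B (bv i)) = tv3 w B lam (-τ) y h i := rfl
    rw [g2, g2', g3, g3', hG, hD, hd]
    ring
  simp only [hexp] at hsum
  simp only [← hD, ← hd, ← hG] at v1 v2 v3 v4
  rw [sum_sub_distrib, sum_sub_distrib, ← mul_sum, ← mul_sum, ← mul_sum, sum_add_distrib, ← mul_sum] at hsum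
  have hn1 : (1:ℝ) ≤ n := by exact_mod_cast hn
  have hb16 : b ^ 16 = 128 ^ 3 * s ^ 3 * b := by rw [hs]; ring
  have hb6 : ∀ m : ℕ, b ^ (m + 1) ≤ b := fun m => by
    calc b ^ (m+1) ≤ b ^ 1 := pow_le_pow_of_le_one hb0.le hb1 (by omega)
      _ = b := pow_one b
  obtain ⟨N, hN⟩ : ∃ N : ℝ, N = n * C ^ 2 * b := ⟨_, rfl⟩
  have hN0 : 0 ≤ N := by rw [hN]; positivity
  have hMN : 10 ^ 18 * n * C ^ 2 * b = 10 ^ 18 * N := by rw [hN]; ring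
  refine algF (X := X) (S2 := ∑ i, (lam i / s) ^ 2) (S3 := ∑ i, (lam i / s) ^ 3) (M := 10 ^ 18 * n * C ^ 2) (b := b) (n := n) ha ht0 ht1 hs0 hτ0 x1 x2 hε0 hε3 ?_ ?_ ?_ ?_ ?_ ?_ ?_ hsum (by linarith) hta hM (by positivity)
  · simp only [div_pow]
    rw [← Finset.sum_div, le_div_iff₀ (by positivity)]
    refine le_trans ?_ f2
    rw [hX]
    have : (4/5) ^ 2 ≤ X ^ 2 := pow_le_pow_left₀ (by norm_num) x1 2
    have h1 : a ^ 2 * s ^ 2 * (4/5) ^ 2 ≤ a ^ 2 * s ^ 2 * X ^ 2 := by gcongr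
    have h2 : 0 < a ^ 2 * s ^ 2 := by positivity
    nlinarith only [h1, h2]
  · rw [mul_sum]
    refine sum_le_sum fun i _ => ?_
    have h1 : lam i / s ≤ X * a * (1 + 2 * t) := by
      rw [div_le_iff₀ hs0]
      have := f1 i
      rw [hX] at this; linarith
    have : (lam i / s) ^ 3 = (lam i / s) * (lam i / s) ^ 2 := by ring
    rw [this]
    exact mul_le_mul_of_nonneg_right h1 (sq_nonneg _)
  · have h1 := (abs_le.1 v1).1
    simp only [div_pow]
    rw [← Finset.sum_div]
    have e : -(τ ^ 2 * s ^ 3) * (1/2 * ((∑ i, lam i ^ 3) / s ^ 3) + 10 ^ 18 * n * C ^ 2 * b) = - (τ ^ 2 / 2 * ∑ i, lam i ^ 3) - 10 ^ 18 * (τ ^ 2 * s ^ 3 * N) := by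
      rw [hN]; field_simp; ring
    rw [e]
    have e2 : 10 ^ 9 * n * C ^ 2 * (τ ^ 2 * b ^ 16) = 10 ^ 9 * 128 ^ 3 * (τ ^ 2 * s ^ 3 * N) := by rw [hb16, hN]; ring
    rw [e2] at h1
    have : 0 ≤ τ ^ 2 * s ^ 3 * N := by positivity
    linarith
  · have h1 := (abs_le.1 v2).2
    simp only [div_pow]
    rw [← Finset.sum_div]
    have e : τ ^ 2 * s ^ 2 * (-(1/2) * ((∑ i, lam i ^ 2) / s ^ 2) + 10 ^ 18 * n * C ^ 2 * b) = - (τ ^ 2 / 2 * ∑ i, lam i ^ 2) + 10 ^ 18 * (τ ^ 2 * s ^ 2 * N) := by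
      rw [hN]; field_simp; try ring
    rw [e]
    have e2 : 10 ^ 9 * n * C ^ 2 * (τ ^ 2 * b ^ 16) = 10 ^ 9 * 128 ^ 3 * (τ ^ 2 * s ^ 3 * N) := by rw [hb16, hN]; ring
    rw [e2] at h1
    have h3 : τ ^ 2 * s ^ 3 * N ≤ τ ^ 2 * s ^ 2 * N := by
      have : s ^ 3 ≤ s ^ 2 := pow_le_pow_of_le_one hs0.le (by linarith) (by norm_num)
      gcongr
    have : 0 ≤ τ ^ 2 * s ^ 2 * N := by positivity
    linarith
  · have h1 : ∀ i, (D i ^ 2 + d i ^ 2) / 2 ≤ 10 ^ 17 * (τ ^ 2 * s ^ 4 * (C ^ 2 * b)) := by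
      intro i
      have g1 : D i ^ 2 ≤ (10 ^ 6 * C * (τ ^ 2 * b ^ 8)) ^ 2 := by
        rw [← sq_abs]; exact pow_le_pow_left₀ (abs_nonneg _) (v3 i) 2
      have g2 : d i ^ 2 ≤ (10 ^ 4 * C * (τ * b ^ 13)) ^ 2 := by
        rw [← sq_abs]; exact pow_le_pow_left₀ (abs_nonneg _) (v4 i) 2
      have e1 : (10 ^ 6 * C * (τ ^ 2 * b ^ 8)) ^ 2 = 10 ^ 12 * 128 ^ 2 * (τ ^ 2 * s ^ 4 * (C ^ 2 * b ^ 16)) := by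
        have : (10 ^ 6 * C * (τ ^ 2 * b ^ 8)) ^ 2 = 10 ^ 12 * C ^ 2 * b ^ 16 * τ ^ 2 * τ ^ 2 := by ring
        rw [this]; nth_rewrite 2 [hτs]; ring
      have e2 : (10 ^ 4 * C * (τ * b ^ 13)) ^ 2 = 10 ^ 8 * 128 ^ 4 * (τ ^ 2 * s ^ 4 * (C ^ 2 * b ^ 6)) := by
        rw [hs]; ring
      rw [e1] at g1; rw [e2] at g2
      have m1 : τ ^ 2 * s ^ 4 * (C ^ 2 * b ^ 16) ≤ τ ^ 2 * s ^ 4 * (C ^ 2 * b) := by gcongr; exact hb6 15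
      have m2 : τ ^ 2 * s ^ 4 * (C ^ 2 * b ^ 6) ≤ τ ^ 2 * s ^ 4 * (C ^ 2 * b) := by gcongr; exact hb6 5
      have m3 : 0 ≤ τ ^ 2 * s ^ 4 * (C ^ 2 * b) := by positivity
      linarith
    calc ∑ i, (D i ^ 2 + d i ^ 2) / 2 ≤ ∑ i : Fin n, 10 ^ 17 * (τ ^ 2 * s ^ 4 * (C ^ 2 * b)) := sum_le_sum fun i _ => h1 i
      _ = 10 ^ 17 * (τ ^ 2 * s ^ 4 * (n * C ^ 2 * b)) := by simp; ring
      _ ≤ 10 ^ 18 * (τ ^ 2 * s ^ 4 * (n * C ^ 2 * b)) := mul_le_mul_of_nonneg_right (by norm_num) (by positivity)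
      _ = _ := by ring
  · calc ∑ i, 2 * τ ^ 2 * ‖B (bv i)‖ ^ 2 ≤ ∑ i : Fin n, 5/2 * τ ^ 2 := by
          refine sum_le_sum fun i _ => ?_
          have := F.xin i
          have : ‖B (bv i)‖ ^ 2 ≤ (11/10) ^ 2 := pow_le_pow_left₀ (norm_nonneg _) this 2
          have h3 : 0 < τ ^ 2 := by positivity
          nlinarith only [this, h3]
      _ = _ := by simp; ring
  · rw [hSQ, hX] at T2'
    rw [← mul_pow]; exact T2'

lemma max_wrap (hn : 1 ≤ n) {C η Ca : ℝ} (hC : 1 ≤ C) (hη0 : 0 < η) (hη1 : η ≤ 1) (hCa : 1 ≤ Ca) :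
    ∃ θ b0 : ℝ, 0 < θ ∧ 0 < b0 ∧ ∀ b, 0 < b → b ≤ b0 → ∀ a, η ≤ a → a ≤ Ca → ∀ s, s = b ^ 5 / 128 →
    ∀ w : FunE, ContinuousOn w (ball 0 1) → (∀ p, ‖p‖ ≤ 1/2 → ∃ α l Q K, LP w C b p α l Q K) →
    ∀ h0 : Euc n, ‖h0‖ ≤ 2 * s → th2 w 0 h0 ≤ s ^ 2 → a * s ^ 3 < th3 w 0 h0 →
    (∀ y, ‖y‖ ≤ 1/8 → ∀ h, ‖h‖ ≤ 2 * s → th2 w y h ≤ s ^ 2 → th3 w y h ≤ (1 + θ) * a * s ^ 3) → False := by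
  have hn1 : (1:ℝ) ≤ n := by exact_mod_cast hn
  obtain ⟨θ, hθ⟩ : ∃ θ, θ = η ^ 2 / (10 ^ 6 * n) := ⟨_, rfl⟩
  have hθ0 : 0 < θ := by rw [hθ]; positivity
  have hθn : n * θ = η ^ 2 / 10 ^ 6 := by rw [hθ]; field_simp
  have hθ1 : θ ≤ 1/1000 := by
    have : 1 * θ ≤ n * θ := by gcongr
    have : η ^ 2 ≤ 1 := pow_le_one₀ hη0.le hη1
    linarith
  obtain ⟨M, hM⟩ : ∃ M, M = n * C ^ 2 * (1 + Ca) := ⟨_, rfl⟩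
  have hC2 : C ≤ C ^ 2 := by nlinarith only [hC]
  have hMC : C * (1 + Ca) ≤ M := by
    rw [hM]
    have : 1 * C ≤ n * C ^ 2 := by gcongr
    rw [one_mul] at this
    gcongr
  have hMpos : 0 < M := by rw [hM]; positivity
  have hη31 : η ^ 3 ≤ η := by
    calc η ^ 3 ≤ η ^ 1 := pow_le_pow_of_le_one hη0.le hη1 (by norm_num)
      _ = η := pow_one η
  refine ⟨θ, η ^ 3 * θ / (10 ^ 25 * M), hθ0, by positivity, ?_⟩
  intro b hb0 hb a ha1 ha2 s hs w hw HL h0 hh0 h02 h03 hB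
  rw [le_div_iff₀ (by positivity)] at hb
  have ha0 : 0 < a := by linarith
  have hbM : 10 ^ 25 * (C * (1 + Ca) * b) ≤ η * θ := by
    calc 10 ^ 25 * (C * (1 + Ca) * b) ≤ 10 ^ 25 * (M * b) := by gcongr
      _ = b * (10 ^ 25 * M) := by ring
      _ ≤ η ^ 3 * θ := hb
      _ ≤ η * θ := by gcongr
  have hCb' : 0 < C * b := by positivity
  have hCb : 10 ^ 25 * (C * b) ≤ η * θ := by
    have : C * b * 1 ≤ C * b * (1 + Ca) := by gcongr; linarith
    linarith
  have hηθ : η * θ ≤ 1 * (1/1000) := by gcongr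
  have hηθ2 : η * θ ≤ 1 * θ := by gcongr
  have hηθ3 : η * θ ≤ a * θ := by gcongr
  have hCb1 : C * b ≤ 1/100 := by linarith
  have hb1 : b ≤ 1 := by nlinarith only [hCb1, hC, hb0]
  have hb3 : b ^ 3 ≤ b := by
    calc b ^ 3 ≤ b ^ 1 := pow_le_pow_of_le_one hb0.le hb1 (by norm_num)
      _ = b := pow_one b
  have hε : 8 * 128 ^ 3 * (C * b ^ 3) ≤ 8 * 128 ^ 3 * (C * b) := by gcongr
  refine max_core (ε := 8 * 128 ^ 3 * (C * b ^ 3)) hn hC hb0 hb1 hCb1 hs (by positivity) (by rw [hs]; apply le_of_eq; ring) ha0 hθ0 hθ1 (by linarith) (by linarith) ?_ ?_ ?_ hw HL hh0 h02 h03 hB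
  · have h1 : C * b * (1 + a) ≤ C * b * (1 + Ca) := by gcongr
    have h2 : 10 * (1 + a) * (8 * 128 ^ 3 * (C * b ^ 3)) ≤ 10 * (1 + a) * (8 * 128 ^ 3 * (C * b)) := by gcongr
    linarith
  · have : η ^ 2 ≤ a ^ 2 := by gcongr
    have e : 640 * n * (2 * θ) = 1280 * (n * θ) := by ring
    rw [e, hθn]
    linarith [sq_nonneg η]
  · have h1 : n * C ^ 2 * b * (1 + 5 * a) ≤ 5 * (M * b) := by
      rw [hM]
      calc n * C ^ 2 * b * (1 + 5 * a) ≤ n * C ^ 2 * b * (5 * (1 + Ca)) := by gcongr; linarith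
        _ = _ := by ring
    have h2 : η ^ 3 * θ ≤ a ^ 3 * (1/1000) := by gcongr
    have h3 : 0 < a ^ 3 := by positivity
    linarith

lemma newton {g E D : ℕ → ℝ} {δ : ℝ} (hδ : 0 ≤ δ) {m : ℕ} (h1 : ∀ j, D (j + 1) = D j + E (j + 1)) (h2 : ∀ j, g (j + 1) = g j + D j)
    (h3 : ∀ j, j ≤ m → |E j - E 0| ≤ j * δ) :
    |g m - (g 0 + m * D 0 + m * (m - 1) / 2 * E 0)| ≤ m ^ 3 * δ := by
  have hD : ∀ j, j ≤ m → |D j - (D 0 + j * E 0)| ≤ j ^ 2 * δ := by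
    intro j
    induction j with
    | zero => intro _; simp
    | succ j ih =>
      intro hj
      have a1 := abs_le.1 (ih (by omega))
      have a2 := abs_le.1 (h3 (j + 1) hj)
      rw [h1 j]
      push_cast at a2 ⊢
      have : (0:ℝ) ≤ j * δ := by positivity
      rw [abs_le]; constructor <;> nlinarith only [a1.1, a1.2, a2.1, a2.2, this]
  have hG : ∀ j, j ≤ m → |g j - (g 0 + j * D 0 + j * (j - 1) / 2 * E 0)| ≤ j ^ 3 * δ := by
    intro j
    induction j with
    | zero => intro _; simp
    | succ j ih =>
      intro hj
      have a1 := abs_le.1 (ih (by omega))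
      have a2 := abs_le.1 (hD j (by omega))
      rw [h2 j]
      push_cast at a2 ⊢
      have : (0:ℝ) ≤ j * δ := by positivity
      have : (0:ℝ) ≤ j ^ 2 * δ := by positivity
      rw [abs_le]; constructor <;> nlinarith only [a1.1, a1.2, a2.1, a2.2, this, ‹(0:ℝ) ≤ j * δ›, hδ]
  exact hG m le_rfl

lemma quad_alg {m W W0 W1 E q P α k t x e0 e1 e3 X : ℝ} (hm : 1 ≤ m) (N : |W - (W0 + m * (W1 - W0) + m * (m - 1) / 2 * E)| ≤ x)
    (T2 : |E - q| ≤ e0) (p1 : |W1 - P| ≤ e1) (p0 : |W0 - α| ≤ e1) (ht : t = α + m * (P - α) + m * (m - 1) / 2 * q - m * k) (hk : |m * k| ≤ e3)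
    (hX : x + m ^ 2 * e0 + 2 * m * e1 + 1 * e1 + e3 ≤ X) : |W - t| ≤ X := by
  have he0 : 0 ≤ e0 := (abs_nonneg _).trans T2
  have h1 : |m * (m - 1) / 2 * (E - q)| ≤ m ^ 2 * e0 := by
    rw [abs_mul, abs_of_nonneg (by nlinarith)]
    gcongr; nlinarith
  have h2 : |m * (W1 - P)| ≤ m * e1 := by rw [abs_mul, abs_of_nonneg (by linarith)]; gcongr
  have h3 : |m * (W0 - α)| ≤ m * e1 := by rw [abs_mul, abs_of_nonneg (by linarith)]; gcongr
  rw [abs_le] at *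
  rw [ht]
  constructor <;> nlinarith only [N.1, N.2, h1.1, h1.2, h2.1, h2.2, h3.1, h3.2, hk.1, hk.2, p0.1, p0.2, hX]

lemma quad {C b s R η : ℝ} (hC : 1 ≤ C) (hb0 : 0 < b) (hb1 : C * b ≤ 1/10^6) (hs : s = b ^ 5 / 128) (hR : 1 ≤ R) (hη0 : 0 ≤ η) (hη : 6 * R * η ≤ 1)
    {α l Q K} (H : LP w C b 0 α l Q K)
    (hB : ∀ y, ‖y‖ ≤ R → ∀ h, ‖h‖ ≤ s → th2 w y h ≤ s ^ 2 → |th3 w y h| ≤ η * s ^ 3) (hz : ‖z‖ ≤ R) :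
    |w z - (α + l z + 1/2 * Q z z)| ≤ 27 * R ^ 3 * η + 10 ^ 7 * C * R ^ 3 * b := by
  have hb2 : b ≤ 1/10^6 := by nlinarith only [hC, hb1, hb0]
  have hs0 : 0 < s := by rw [hs]; positivity
  have hbp : ∀ k : ℕ, b ^ (k + 1) ≤ b := fun k => by
    calc b ^ (k + 1) ≤ b ^ 1 := pow_le_pow_of_le_one hb0.le (by linarith) (by omega)
      _ = b := pow_one b
  have hsb : s ≤ b := by rw [hs]; have : b ^ 5 ≤ b := hbp 4; linarith
  -- number of steps
  obtain ⟨m, hm⟩ : ∃ m : ℕ, m = ⌈2 * R / s⌉₊ := ⟨_, rfl⟩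
  have hm1 : 2 * R / s ≤ m := by rw [hm]; exact Nat.le_ceil _
  have hm2 : (m:ℝ) < 2 * R / s + 1 := by rw [hm]; exact Nat.ceil_lt_add_one (by positivity)
  have hms1 : 2 * R ≤ m * s := by rwa [div_le_iff₀ hs0] at hm1
  have hms2 : m * s ≤ 3 * R := by
    have : m * s ≤ (2 * R / s + 1) * s := by gcongr
    have e : (2 * R / s + 1) * s = 2 * R + s := by field_simp
    linarith
  have hm0 : (0:ℝ) < m := by
    by_contra hc; push Not at hc
    nlinarith only [hc, hms1, hs0, hR]
  obtain ⟨h, hh⟩ : ∃ h : Euc n, h = (m:ℝ)⁻¹ • z := ⟨_, rfl⟩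
  have hmh : (m:ℝ) • h = z := by rw [hh, smul_smul, mul_inv_cancel₀ hm0.ne', one_smul]
  have hhn : ‖h‖ ≤ s / 2 := by
    rw [hh, norm_smul, norm_inv, norm_eq_abs, abs_of_pos hm0, inv_mul_le_iff₀ hm0]
    linarith
  have hb5 : b ^ 5 = 128 * s := by rw [hs]; ring
  have T2 := H.th2_est (h := h) (by rw [hb5]; linarith)
  have hb18 : b ^ 18 = 128 ^ 2 * s ^ 2 * b ^ 8 := by rw [hs]; ring
  have hCb8 : C * b ^ 8 ≤ 1/10^6 := by
    have : C * b ^ 8 ≤ C * b := by gcongr; exact hbp 7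
    linarith
  have hE18 : 4 * (C * b ^ 18) ≤ s ^ 2 / 8 := by
    have : 4 * (C * b ^ 18) = 4 * 128 ^ 2 * s ^ 2 * (C * b ^ 8) := by rw [hb18]; ring
    rw [this]
    have : 4 * 128 ^ 2 * s ^ 2 * (C * b ^ 8) ≤ 4 * 128 ^ 2 * s ^ 2 * (1/10^6) := by gcongr
    have : 0 < s ^ 2 := by positivity
    linarith
  have hQh : Q h h ≤ 11/40 * s ^ 2 := by
    have h1 := (abs_le.1 (H.nr h)).2
    have : ‖h‖ ^ 2 ≤ (s/2) ^ 2 := pow_le_pow_left₀ (norm_nonneg _) hhn 2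
    linarith
  have hE0 : th2 w 0 h ≤ s ^ 2 / 2 := by
    have := (abs_le.1 T2).2
    have : 0 < s ^ 2 := by positivity
    linarith
  have hs2 : 0 < s ^ 2 := by positivity
  obtain ⟨k, hk⟩ : ∃ k : Euc n, k = (1/2:ℝ) • h := ⟨_, rfl⟩
  have hkn : ‖k‖ ≤ s / 4 := by
    rw [hk, norm_smul, norm_eq_abs, abs_of_pos (by norm_num)]; linarith
  obtain ⟨F, hF⟩ : ∃ F : ℕ → ℝ, ∀ j, F j = th2 w ((j:ℝ) • k) h := ⟨_, fun _ => rfl⟩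
  have hF0 : F 0 = th2 w 0 h := by rw [hF]; simp
  have hF1 : F 1 ≤ s ^ 2 / 2 := by
    rw [hF]
    unfold th2
    have p1 := (abs_le.1 (H.a1 (k + h) (by
      refine (norm_add_le _ _).trans ?_
      rw [hb5]; linarith))).2
    have p2 := (abs_le.1 (H.a1 k (by rw [hb5]; linarith))).1
    have p3 := (abs_le.1 (H.a1 (k - h) (by
      refine (norm_sub_le _ _).trans ?_
      rw [hb5]; linarith))).2
    rw [zero_add] at p1 p2 p3
    rw [Pol_shift H.sQ H.sK] at p1
    rw [sub_eq_add_neg k h, Pol_shift H.sQ H.sK] at p3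
    have e1 : Pol α l Q K k = Pol (Pol α l Q K k) (l + Q k + (1/2:ℝ) • K k k) (Q + K k) K 0 := by
      simp [Pol]
    have p4 := (abs_le.1 (H.K2 k h)).2
    have p5 : 3 * C * ‖k‖ * ‖h‖ ^ 2 ≤ s ^ 2 / 100 := by
      have : 3 * C * ‖k‖ * ‖h‖ ^ 2 ≤ 3 * C * (s/4) * (s/2) ^ 2 := by gcongr
      have : C * s ≤ 1/10^6 := le_trans (by gcongr) hb1
      have : C * s * s ^ 2 ≤ 1/10^6 * s ^ 2 := by gcongr
      linarith
    have e2 : (Q + K k) h h = Q h h + K k h h := rfl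
    simp only [Nat.cast_one, one_smul]
    rw [sub_eq_add_neg k h]
    have e3 : Pol (Pol α l Q K k) (l + Q k + (1/2:ℝ) • K k k) (Q + K k) K h + Pol (Pol α l Q K k) (l + Q k + (1/2:ℝ) • K k k) (Q + K k) K (-h) - 2 * Pol α l Q K k = (Q + K k) h h := by
      generalize l + Q k + (1/2:ℝ) • K k k = l'
      generalize Q + K k = Q'
      generalize Pol α l Q K k = a'
      simp only [Pol, map_neg, _root_.neg_apply]
      ring
    linarith
  have hstepF : ∀ j : ℕ, F (j + 2) - F j = th3 w (((j + 1 : ℕ):ℝ) • k) h := by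
    intro j
    rw [hF, hF, hk]
    unfold th2 th3
    push_cast
    rw [show ((j:ℝ) + 1) • (1/2:ℝ) • h + (3/2:ℝ) • h = ((j:ℝ) + 2) • (1/2:ℝ) • h + h by module, show ((j:ℝ) + 1) • (1/2:ℝ) • h + (1/2:ℝ) • h = ((j:ℝ) + 2) • (1/2:ℝ) • h by module,
      show ((j:ℝ) + 1) • (1/2:ℝ) • h - (1/2:ℝ) • h = (j:ℝ) • (1/2:ℝ) • h by module, show ((j:ℝ) + 1) • (1/2:ℝ) • h - (3/2:ℝ) • h = (j:ℝ) • (1/2:ℝ) • h - h by module,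
      show ((j:ℝ) + 2) • (1/2:ℝ) • h - h = (j:ℝ) • (1/2:ℝ) • h by module, show (j:ℝ) • (1/2:ℝ) • h + h = ((j:ℝ) + 2) • (1/2:ℝ) • h by module]
    ring
  have hcen : ∀ j : ℕ, j ≤ 2 * m → ‖(j:ℝ) • k‖ ≤ R := by
    intro j hj
    have : (j:ℝ) ≤ 2 * m := by exact_mod_cast hj
    rw [hk, smul_smul, norm_smul, norm_eq_abs, abs_of_nonneg (by positivity)]
    calc ((j:ℝ) * (1/2)) * ‖h‖ ≤ m * ‖h‖ := by gcongr; linarith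
      _ = ‖z‖ := by rw [← hmh, norm_smul, norm_eq_abs, abs_of_pos hm0]
      _ ≤ R := hz
  have hηs : 0 ≤ η * s ^ 3 := by positivity
  have hmη : m * (η * s ^ 3) ≤ s ^ 2 / 2 := by
    have : m * (η * s ^ 3) = (m * s) * η * s ^ 2 := by ring
    rw [this]
    have : (m * s) * η * s ^ 2 ≤ (3 * R) * η * s ^ 2 := by gcongr
    have : 6 * R * η * s ^ 2 ≤ 1 * s ^ 2 := by gcongr
    linarith
  have hsmall : ∀ i : ℕ, i ≤ m → F (2 * i) ≤ s ^ 2 / 2 + i * (η * s ^ 3) ∧ (2 * i + 1 ≤ 2 * m → F (2 * i + 1) ≤ s ^ 2 / 2 + i * (η * s ^ 3)) ∧ |F (2 * i) - F 0| ≤ i * (η * s ^ 3) := by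
    intro i
    induction i with
    | zero =>
      intro _
      refine ⟨by rw [mul_zero, hF0]; simpa using hE0, fun _ => by simpa using hF1, by simp⟩
    | succ i ih =>
      intro hi
      obtain ⟨i1, i2, i3⟩ := ih (by omega)
      have i2 := i2 (by omega)
      have hile : (i:ℝ) + 1 ≤ m := by exact_mod_cast hi
      have hle : ((i:ℝ) + 1) * (η * s ^ 3) ≤ m * (η * s ^ 3) := by gcongr
      have c1 := abs_le.1 (hB _ (hcen (2 * i + 1) (by omega)) h (by linarith) (by rw [← hF]; linarith))
      rw [← hstepF (2 * i)] at c1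
      have i3 := abs_le.1 i3
      have g1 : F (2 * (i + 1)) ≤ s ^ 2 / 2 + ((i:ℝ) + 1) * (η * s ^ 3) := by
        rw [show 2 * (i + 1) = 2 * i + 2 by ring]; linarith
      push_cast
      refine ⟨g1, fun h3 => ?_, ?_⟩
      · have c2 := abs_le.1 (hB _ (hcen (2 * i + 1 + 1) (by omega)) h (by linarith) (by rw [← hF]; rw [show 2 * i + 1 + 1 = 2 * (i + 1) by ring]; linarith))
        rw [← hstepF (2 * i + 1)] at c2
        rw [show 2 * (i + 1) + 1 = 2 * i + 1 + 2 by ring]; linarith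
      · rw [show 2 * (i + 1) = 2 * i + 2 by ring, abs_le]
        constructor <;> linarith
  have N := newton (g := fun j => w ((j:ℝ) • h)) (D := fun j => w (((j:ℝ) + 1) • h) - w ((j:ℝ) • h)) (E := fun j => F (2 * j)) (m := m) hηs
    (by
      intro j
      simp only [hF, hk, th2]
      push_cast
      rw [show (2 * ((j:ℝ) + 1)) • (1/2:ℝ) • h + h = ((j:ℝ) + 1 + 1) • h by module, show (2 * ((j:ℝ) + 1)) • (1/2:ℝ) • h - h = (j:ℝ) • h by module, show (2 * ((j:ℝ) + 1)) • (1/2:ℝ) • h = ((j:ℝ) + 1) • h by module]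
      ring)
    (by intro j; push_cast; ring)
    (by intro j hj; exact (hsmall j hj).2.2)
  simp only [hmh, Nat.cast_zero, zero_smul, zero_add, one_smul, mul_zero, hF0] at N
  -- compare
  have p1 := H.a1 h (by rw [hb5]; linarith)
  have p0 := H.a1 0 (by rw [norm_zero]; positivity)
  rw [zero_add] at p1 p0
  have e0 : Pol α l Q K 0 = α := by simp [Pol]
  rw [e0] at p0
  have hlz : l z = m * l h := by rw [← hmh, map_smul, smul_eq_mul]
  have hQz : Q z z = m ^ 2 * Q h h := by
    rw [← hmh]; simp only [map_smul, _root_.smul_apply, smul_eq_mul]; ring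
  have hKh : |m * (1/6 * K h h h)| ≤ C * R ^ 3 * s := by
    have := H.kb h
    rw [abs_mul, abs_mul, abs_of_pos hm0, abs_of_pos (by norm_num : (0:ℝ) < 1/6)]
    have h3 : ‖h‖ ^ 3 ≤ (s/2) ^ 3 := pow_le_pow_left₀ (norm_nonneg _) hhn 3
    calc m * (1/6 * |K h h h|) ≤ m * (1/6 * (C * (s/2) ^ 3)) := by
          gcongr; exact this.trans (by gcongr)
      _ = (m * s) * (C * s ^ 2 / 48) := by ring
      _ ≤ (3 * R) * (C * s ^ 2 / 48) := by gcongr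
      _ = C * R * s * (s / 16) := by ring
      _ ≤ C * R ^ 3 * s * 1 := by
          have : R ≤ R ^ 3 := by
            calc R = R ^ 1 := (pow_one R).symm
              _ ≤ R ^ 3 := pow_le_pow_right₀ hR (by norm_num)
          gcongr; linarith
      _ = _ := mul_one _
  have hm1' : (1:ℝ) ≤ m := by
    have : (0:ℕ) < m := by exact_mod_cast hm0
    exact_mod_cast this
  have hm18 : m ^ 2 * (C * b ^ 18) ≤ 128 ^ 2 * 9 * (C * R ^ 3 * b) := by
    have : m ^ 2 * (C * b ^ 18) = (m * s) ^ 2 * 128 ^ 2 * C * b ^ 8 := by rw [hb18]; ring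
    rw [this]
    have hR2 : R ^ 2 ≤ R ^ 3 := pow_le_pow_right₀ hR (by norm_num)
    calc (m * s) ^ 2 * 128 ^ 2 * C * b ^ 8 ≤ (3 * R) ^ 2 * 128 ^ 2 * C * b := by gcongr; exact hbp 7
      _ = 128 ^ 2 * 9 * (C * R ^ 2 * b) := by ring
      _ ≤ _ := by gcongr
  have hm18' : m * (C * b ^ 18) ≤ m ^ 2 * (C * b ^ 18) := by
    have : (m:ℝ) ≤ m ^ 2 := by nlinarith only [hm1']
    gcongr
  have hm18'' : 1 * (C * b ^ 18) ≤ m * (C * b ^ 18) := by gcongr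
  have hN3 : m ^ 3 * (η * s ^ 3) ≤ 27 * R ^ 3 * η := by
    calc m ^ 3 * (η * s ^ 3) = (m * s) ^ 3 * η := by ring
      _ ≤ (3 * R) ^ 3 * η := by gcongr
      _ = _ := by ring
  have hCR : C * R ^ 3 * s ≤ C * R ^ 3 * b := by gcongr
  have hCR0 : 0 ≤ C * R ^ 3 * b := by positivity
  exact quad_alg (m := m) hm1' N T2 p1 p0 (e0 := 4 * (C * b ^ 18)) (e1 := C * b ^ 18) (by rw [hlz, hQz]; unfold Pol; ring) hKh (by linarith)

lemma Adm.breg_cont (h : Adm U u lam Lam) (x : Euc n) :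
    ContinuousOn (Breg u x) U := by
  unfold Breg
  exact (h.cd.continuousOn.sub continuousOn_const).sub (by fun_prop)

lemma Adm.sec_open (h : Adm U u lam Lam) (x : Euc n) (t : ℝ) :
    IsOpen (Sec U u x t) := (h.breg_cont x).isOpen_inter_preimage h.op isOpen_Iio

lemma Adm.sec_convex (h : Adm U u lam Lam) (x : Euc n) (t : ℝ) :
    Convex ℝ (Sec U u x t) := by
  have e : (Breg u x) = fun z => u z + ((- u x + fderiv ℝ u x x) + (- fderiv ℝ u x) z) := by
    funext z; simp only [Breg, map_sub, _root_.neg_apply]; ring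
  have := (convexOn_add_aff h.cw (- u x + fderiv ℝ u x x) (- fderiv ℝ u x)).convex_lt t
  show Convex ℝ {z | z ∈ U ∧ Breg u x z < t}
  rw [e]
  exact this

lemma Breg_add_aff (hd : DifferentiableAt ℝ u y) (c : ℝ) (l : DualE) (z : Euc n) :
    Breg (fun z => u z + (c + l z)) y z = Breg u y z := by
  unfold Breg
  have : HasFDerivAt (fun z => u z + (c + l z)) (fderiv ℝ u y + l) y := by
    exact hd.hasFDerivAt.fun_add (l.hasFDerivAt.const_add c)
  rw [this.fderiv, _root_.add_apply, map_sub l]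
  ring

/-- engulfing -/
lemma engulf (hn : 1 ≤ n) {Θ : ℝ} (hΘ : 1 ≤ Θ) : ∃ c : ℝ, 0 < c ∧ c < 1 ∧
    ∀ (U : Set (Euc n)) (u : FunE) (lam Lam : ℝ), Adm U u lam Lam → Lam ≤ Θ * lam → Bornology.IsBounded U →
    ∀ (x y : Euc n) (t : ℝ), x ∈ U → 0 < t → closure (Sec U u x t) ⊆ U → y ∈ Sec U u x (t/2) →
    closure (Sec U u y (c * t)) ⊆ Sec U u x t := by
  obtain ⟨c, hc, H⟩ := lemL_good hn hΘ (η := 1/2) (by norm_num)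
  refine ⟨min c 1 / 2, by positivity, by have := min_le_right c 1; linarith, ?_⟩
  intro U u lam Lam hA hL hb x y t hx ht hg hy
  have hyS : y ∈ Sec U u x t := Sec_mono (by linarith) hy
  have hyU : y ∈ U := hy.1
  have hD := hA.sec_dom (hb.subset Sec_sub) hg
  have h1 := H _ _ lam Lam t (t/2) hD hL (by
    intro z hz
    have := hA.Breg_nonneg hx hz.1
    linarith) (by linarith) (by linarith) y hyS (by
    have := hy.2
    linarith) (min c 1 / 2 * t) (by
    have : min c 1 * t ≤ c * t := by gcongr; exact min_le_left _ _
    linarith)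
  have e : Sec (Sec U u x t) (fun z => Breg u x z - t) y (min c 1 / 2 * t) = Sec U u x t ∩ Sec U u y (min c 1 / 2 * t) := by
    ext z
    rw [Breg_eq]
    simp only [Sec, mem_setOf_eq, mem_inter_iff]
    rw [Breg_add_aff (hA.diff hyU)]
    tauto
  rw [e] at h1
  have hsub : Sec U u y (min c 1 / 2 * t) ⊆ Sec U u x t := by
    have hpre := (hA.sec_convex y (min c 1 / 2 * t)).isPreconnected
    have := hpre.subset_of_closure_inter_subset ((hA.sec_open x t).inter (hA.sec_open y (min c 1 / 2 * t)))
      ⟨y, mem_Sec_self hyU (by positivity), hyS, mem_Sec_self hyU (by positivity)⟩ (fun z hz => ⟨h1 hz.1, hz.2⟩)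
    exact this.trans inter_subset_left
  rwa [inter_eq_self_of_subset_right hsub] at h1

lemma sec_clos (h : Adm U u lam Lam) (hst : s < t)
    (hg : closure (Sec U u x t) ⊆ U) : closure (Sec U u x s) ⊆ Sec U u x t := by
  intro z hz
  have hzU : z ∈ U := hg (closure_mono (Sec_mono hst.le) hz)
  refine ⟨hzU, ?_⟩
  have hm : MapsTo (Breg u x) (Sec U u x s) (Iic s) := fun x hx => hx.2.le
  have := hm.closure_of_continuousOn ((h.breg_cont x).mono ((closure_mono (Sec_mono hst.le)).trans hg)) hz
  rw [closure_Iic, mem_Iic] at this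
  linarith

lemma shrink_iter (hc0 : 0 < c) (hc1 : c < 1)
    (hU : closure (Sec U u x t) ⊆ U) (ht : 0 < t)
    (H : ∀ t' : ℝ, 0 < t' → closure (Sec U u x t') ⊆ U → ∀ z ∈ Sec U u x (t'/2), x + (1 - c)⁻¹ • (z - x) ∈ Sec U u x t') (k : ℕ) :
    ∀ z ∈ Sec U u x (t / 2 ^ k), x + ((1 - c)⁻¹ ^ k) • (z - x) ∈ Sec U u x t := by
  induction k with
  | zero => intro z hz; simpa using hz
  | succ k ih =>
    intro z hz
    have h1 := H (t / 2 ^ k) (by positivity) ((closure_mono (Sec_mono (div_le_self ht.le (one_le_pow₀ (by norm_num))))).trans hU) z (by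
      rw [pow_succ, ← div_div] at hz; exact hz)
    have h2 := ih _ h1
    rw [add_sub_cancel_left, smul_smul, ← pow_succ] at h2
    exact h2

def flat (ε : ℝ) (U : Set (Euc n)) (u : FunE) (x : Euc n) (r : ℝ) : Prop :=
  ∃ A : EndE, A.det ^ 2 = 1 ∧ (∀ z ∈ ball (0 : Euc n) 1, x + r • A z ∈ U) ∧ St (fun z => r⁻¹ ^ 2 * u (x + r • A z)) 0 ε

def Bd (U : Set (Euc n)) (u : FunE) (r s : ℝ) (y : Euc n) (a : ℝ) : Prop :=
  ∀ h : Euc n, y + (2:ℝ) • h ∈ U → y - (2:ℝ) • h ∈ U → th2 u y h ≤ r ^ 2 * s ^ 2 → th3 u y h ≤ r ^ 2 * (a * s ^ 3)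

lemma Bd.mono {r s : ℝ} {a a' : ℝ} (h : Bd U u r s y a) (hs : 0 ≤ s) (ha : a ≤ a') : Bd U u r s y a' := by
  intro k h1 h2 h3
  exact (h k h1 h2 h3).trans (by gcongr)

lemma chart_adm (h : Adm U u lam Lam) (hr : 0 < r)
    (hA : A.det ^ 2 = 1) (hU : ∀ z ∈ ball (0 : Euc n) 1, x + r • A z ∈ U) :
    Adm (ball 0 1) (fun z => r⁻¹ ^ 2 * u (x + r • A z)) lam Lam := by
  have hdet : (r • A).det = r ^ n * A.det := by
    have : (r • A).det = LinearMap.det (r • (A : Euc n →ₗ[ℝ] Euc n)) := rfl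
    rw [this, LinearMap.det_smul]
    simp
  refine adm_scale h.op h.cw h.cd x (r • A) (by positivity) isOpen_ball (convex_ball 0 1) h.pos hU ?_
  intro z hz
  have e : (r⁻¹ ^ 2) ^ n * ((r • A).det ^ 2 * hessDet u (x + (r • A) z)) = hessDet u (x + r • A z) := by
    rw [hdet, mul_pow, hA, ← pow_mul, mul_one, ← mul_assoc]
    rw [show (r⁻¹ ^ (2 * n) * (r ^ n) ^ 2) = 1 by
      rw [← pow_mul, mul_comm n 2, ← mul_pow, inv_mul_cancel₀ hr.ne', one_pow], one_mul]
    rfl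
  rw [e]
  exact h.det _ (hU z hz)

lemma th2_chart (u : FunE) (x : Euc n) (hr : 0 < r) (A : EndE) (y h : Euc n) :
    th2 u (x + r • A y) (r • A h) = r ^ 2 * th2 (fun z => r⁻¹ ^ 2 * u (x + r • A z)) y h := by
  unfold th2
  simp only [map_add, map_sub, smul_add, smul_sub, ← add_assoc, ← add_sub_assoc]
  field_simp

lemma th3_chart (u : FunE) (x : Euc n) (hr : 0 < r) (A : EndE) (y h : Euc n) :
    th3 u (x + r • A y) (r • A h) = r ^ 2 * th3 (fun z => r⁻¹ ^ 2 * u (x + r • A z)) y h := by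
  unfold th3
  have e : ∀ c : ℝ, r • A (y + c • h) = r • A y + c • r • A h := fun c => by rw [map_add, map_smul, smul_add, smul_comm]
  have e' : ∀ c : ℝ, r • A (y - c • h) = r • A y - c • r • A h := fun c => by rw [map_sub, map_smul, smul_sub, smul_comm]
  simp only [e, e', ← add_assoc, ← add_sub_assoc]
  field_simp

lemma chart_surj (hA : A.det ^ 2 = 1) (hr : 0 < r) (h : Euc n) : ∃ z, h = r • A z := by
  have hd : A.det ≠ 0 := by intro h0; rw [h0] at hA; norm_num at hA
  refine ⟨r⁻¹ • (A.toContinuousLinearEquivOfDetNeZero hd).symm h, ?_⟩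
  rw [map_smul, smul_smul, mul_inv_cancel₀ hr.ne', one_smul]
  have := (A.toContinuousLinearEquivOfDetNeZero hd).apply_symm_apply h
  exact this.symm

/-- Second difference is superlinear-convex. -/
lemma th2_convex (hu : ConvexOn ℝ U u) (hy : y ∈ U) (h1 : y + h ∈ U) (h2 : y - h ∈ U)
    (ht0 : 0 ≤ t) (ht1 : t ≤ 1) : th2 u y (t • h) ≤ t * th2 u y h := by
  unfold th2
  have a1 := hu.2 hy h1 (sub_nonneg.2 ht1) ht0 (by ring)
  have a2 := hu.2 hy h2 (sub_nonneg.2 ht1) ht0 (by ring)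
  rw [show (1 - t) • y + t • (y + h) = y + t • h by module] at a1
  rw [show (1 - t) • y + t • (y - h) = y - t • h by module] at a2
  simp only [smul_eq_mul] at a1 a2
  linarith

/-- tangent-plane excess is bounded by the second difference. -/
lemma breg_le_th2 (hA : Adm U u lam Lam) (hy : y ∈ U) (h2 : y - h ∈ U) :
    Breg u y (y + h) ≤ th2 u y h := by
  have := hA.Breg_nonneg hy h2
  unfold Breg th2 at *
  rw [add_sub_cancel_left]
  rw [sub_sub_cancel_left, map_neg] at this
  linarith

lemma s_arith {C b s : ℝ} (hC : 1 ≤ C) (hb0 : 0 < b) (hb1 : C * b ≤ 1/10^6) (hs : s = b ^ 5 / 128) :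
    0 < s ∧ s ≤ 1/100 ∧ 4 * (C * b ^ 18) ≤ s ^ 2 / 10 ∧ 8 * (C * b ^ 18) ≤ C * s ^ 3 := by
  have hb2 : b ≤ 1/10^6 := by nlinarith only [hC, hb1, hb0]
  have h5 : b ^ 5 ≤ 1 := pow_le_one₀ hb0.le (by linarith)
  have h7 : b ^ 7 ≤ 1 := pow_le_one₀ hb0.le (by linarith)
  have h3 : b ^ 3 ≤ 1/10^18 := by
    calc b ^ 3 ≤ (1/10^6) ^ 3 := by gcongr
      _ = _ := by norm_num
  refine ⟨by rw [hs]; positivity, by rw [hs]; linarith, ?_, ?_⟩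
  · have : C * b ^ 18 ≤ 1/10^6 * b ^ 10 := by
      calc C * b ^ 18 = (C * b) * (b ^ 7 * b ^ 10) := by ring
        _ ≤ 1/10^6 * (1 * b ^ 10) := by gcongr
        _ = _ := by ring
    have h10 : 0 < b ^ 10 := by positivity
    rw [hs, show (b ^ 5 / 128) ^ 2 = b ^ 10 / 16384 by ring]
    linarith
  · have : b ^ 18 ≤ 1/10^18 * b ^ 15 := by
      calc b ^ 18 = b ^ 3 * b ^ 15 := by ring
        _ ≤ 1/10^18 * b ^ 15 := by gcongr
    have h10 : 0 < b ^ 15 := by positivity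
    rw [hs, show (b ^ 5 / 128) ^ 3 = b ^ 15 / 2097152 by ring, show 8 * (C * b ^ 18) = C * (8 * b ^ 18) by ring]
    gcongr
    linarith

/-- In a flat chart, increments with small second difference are short. -/
lemma chart_h (hu : ConvexOn ℝ U u) {C b s r : ℝ} (hC : 1 ≤ C) (hb0 : 0 < b)
    (hb1 : C * b ≤ 1/10^6) (hs : s = b ^ 5 / 128) (hr : 0 < r) (hy : y ∈ U) (hA : A.det ^ 2 = 1)
    {α l Q K} (H : LP (fun z => r⁻¹ ^ 2 * u (y + r • A z)) C b 0 α l Q K) {h : Euc n} (h1 : y + (2:ℝ) • h ∈ U) (h2 : y - (2:ℝ) • h ∈ U)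
    (h3 : th2 u y h ≤ r ^ 2 * s ^ 2) : ∃ z, h = r • A z ∧ ‖z‖ ≤ 2 * s ∧ th2 (fun z => r⁻¹ ^ 2 * u (y + r • A z)) 0 z ≤ s ^ 2 ∧
      th3 u y h = r ^ 2 * th3 (fun z => r⁻¹ ^ 2 * u (y + r • A z)) 0 z := by
  obtain ⟨hs0, hs1, ha1, ha2⟩ := s_arith hC hb0 hb1 hs
  obtain ⟨z, hz⟩ := chart_surj hA hr h
  have e2 : ∀ z, th2 u y (r • A z) = r ^ 2 * th2 (fun z => r⁻¹ ^ 2 * u (y + r • A z)) 0 z := fun z => by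
    rw [← th2_chart u y hr A 0 z, map_zero, smul_zero, add_zero]
  have e3 : th3 u y (r • A z) = r ^ 2 * th3 (fun z => r⁻¹ ^ 2 * u (y + r • A z)) 0 z := by
    rw [← th3_chart u y hr A 0 z, map_zero, smul_zero, add_zero]
  refine ⟨z, hz, ?_, ?_, by rw [hz, e3]⟩
  · by_contra hcon
    push Not at hcon
    have hz0 : 0 < ‖z‖ := by linarith
    have g1 : y + h ∈ U := by
      have := hu.1 hy h1 (by norm_num : (0:ℝ) ≤ 1/2) (by norm_num : (0:ℝ) ≤ 1/2) (by norm_num)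
      convert this using 1; module
    have g2 : y - h ∈ U := by
      have := hu.1 hy h2 (by norm_num : (0:ℝ) ≤ 1/2) (by norm_num : (0:ℝ) ≤ 1/2) (by norm_num)
      convert this using 1; module
    have ht1 : 2 * s / ‖z‖ ≤ 1 := by rw [div_le_one hz0]; exact hcon.le
    have ht0 : 0 ≤ 2 * s / ‖z‖ := by positivity
    have hc := th2_convex hu hy g1 g2 ht0 ht1
    have hle : (2 * s / ‖z‖) * th2 u y h ≤ r ^ 2 * s ^ 2 := by
      calc (2 * s / ‖z‖) * th2 u y h ≤ (2 * s / ‖z‖) * (r ^ 2 * s ^ 2) := by gcongr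
        _ ≤ 1 * (r ^ 2 * s ^ 2) := by gcongr
        _ = _ := one_mul _
    have hz2 : ‖(2 * s / ‖z‖) • z‖ = 2 * s := by
      rw [norm_smul, norm_of_nonneg ht0]; field_simp
    rw [show (2 * s / ‖z‖) • h = r • A ((2 * s / ‖z‖) • z) by rw [hz, map_smul, smul_comm], e2] at hc
    have hw : th2 (fun z => r⁻¹ ^ 2 * u (y + r • A z)) 0 ((2 * s / ‖z‖) • z) ≤ s ^ 2 :=
      le_of_mul_le_mul_left (hc.trans hle) (by positivity)
    have k1 := (abs_le.1 (H.th2_est (h := (2 * s / ‖z‖) • z) (by rw [hz2, hs]; have : 0 < b ^ 5 := by positivity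
                                                                 linarith))).1
    have k2 := (abs_le.1 (H.nr ((2 * s / ‖z‖) • z))).1
    rw [hz2] at k2
    have : 0 < s ^ 2 := by positivity
    nlinarith only [hw, k1, k2, ha1, this]
  · rw [hz, e2] at h3
    exact le_of_mul_le_mul_left h3 (by positivity)

lemma bd_always (hu : ConvexOn ℝ U u) {C b s r : ℝ} (hC : 1 ≤ C) (hb0 : 0 < b)
    (hb1 : C * b ≤ 1/10^6) (hs : s = b ^ 5 / 128) (hr : 0 < r) (hy : y ∈ U) (hA : A.det ^ 2 = 1)
    {α l Q K} (H : LP (fun z => r⁻¹ ^ 2 * u (y + r • A z)) C b 0 α l Q K) : Bd U u r s y (9 * C) := by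
  intro h h1 h2 h3
  obtain ⟨hs0, hs1, ha1, ha2⟩ := s_arith hC hb0 hb1 hs
  obtain ⟨z, hz, hzn, k1, k2⟩ := chart_h hu hC hb0 hb1 hs hr hy hA H h1 h2 h3
  rw [k2]
  have k3 := (abs_le.1 (H.th3_est (h := z) (by rw [hs] at hzn; linarith))).2
  have k4 := (abs_le.1 (H.kb z)).2
  have k5 : C * ‖z‖ ^ 3 ≤ C * (2 * s) ^ 3 := by gcongr
  gcongr
  linarith

lemma St_zero {ζ : ℝ} (h : St w 0 ζ) : ∃ (a : ℝ) (l : DualE),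
    ∀ z ∈ ball (0 : Euc n) 1, |w z - (a + l z + ‖z‖ ^ 2 / 2)| ≤ ζ := by
  obtain ⟨a, l, T, hT, h⟩ := h
  have : T = 0 := norm_le_zero_iff.1 hT
  subst this
  refine ⟨a, l, fun z hz => ?_⟩
  have := h z hz
  simpa using this

lemma flat_sec (h : Adm U u lam Lam) (hy : y ∈ U) {r ε : ℝ} (hr : 0 < r) (hε : ε ≤ 1/400)
    (hU : ∀ z ∈ ball (0 : Euc n) 1, y + r • A z ∈ U) (hS : St (fun z => r⁻¹ ^ 2 * u (y + r • A z)) 0 ε) (hz : ‖z‖ ≤ 1/2) :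
    y + r • A z ∈ Sec U u y (r ^ 2) := by
  have hzb : z ∈ ball (0 : Euc n) 1 := by rw [mem_ball_zero_iff]; linarith
  have hzb' : -z ∈ ball (0 : Euc n) 1 := by rw [mem_ball_zero_iff, norm_neg]; linarith
  refine ⟨hU z hzb, ?_⟩
  obtain ⟨a, l, H⟩ := St_zero hS
  have h0 := abs_le.1 (H 0 (by simp))
  have h1 := abs_le.1 (H z hzb)
  have h2 := abs_le.1 (H (-z) hzb')
  have hb := breg_le_th2 h hy (h := r • A z) (by have := hU (-z) hzb'; rwa [map_neg, smul_neg, ← sub_eq_add_neg] at this)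
  refine hb.trans_lt ?_
  have e2 := th2_chart u y hr A 0 z
  rw [map_zero, smul_zero, add_zero] at e2
  rw [e2]
  refine mul_lt_of_lt_one_right (by positivity) ?_
  unfold th2
  rw [zero_add, zero_sub]
  simp only [map_zero, norm_zero, map_neg, norm_neg] at h0 h1 h2 ⊢
  have : ‖z‖ ^ 2 ≤ (1/2) ^ 2 := by gcongr
  linarith only [this, h0.1, h1.2, h2.2, hε]

lemma ext_flat {C b s R η ε c r : ℝ} (hC : 1 ≤ C) (hb0 : 0 < b)
    (hb1 : C * b ≤ 1/10^6) (hs : s = b ^ 5 / 128) (hr : 0 < r) (hc0 : 0 < c) (hc1 : c ≤ 1) (hR : R = 2 / c) (hη0 : 0 ≤ η) (hη : 6 * R * η ≤ 1)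
    (hE : 27 * R ^ 3 * η + 10 ^ 7 * C * R ^ 3 * b ≤ ε) (hA : A.det ^ 2 = 1)
    {α l Q K} (H : LP (fun z => (c * r)⁻¹ ^ 2 * u (x + (c * r) • A z)) C b 0 α l Q K)
    (hU : ∀ z, ‖z‖ ≤ R + 1 → x + (c * r) • A z ∈ U) (hB : ∀ z, ‖z‖ ≤ R → Bd U u (c * r) s (x + (c * r) • A z) η) : flat ε U u x r := by
  obtain ⟨hs0, hs1, ha1, ha2⟩ := s_arith hC hb0 hb1 hs
  have hcr : 0 < c * r := by positivity
  have hR1 : 2 ≤ R := by rw [hR, le_div_iff₀ hc0]; linarith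
  obtain ⟨w, hw⟩ : ∃ w, w = fun z => (c * r)⁻¹ ^ 2 * u (x + (c * r) • A z) := ⟨_, rfl⟩
  rw [← hw] at H
  have hcr2 : 0 < (c * r) ^ 2 := by positivity
  have hq := fun z hz => quad hC hb0 hb1 hs (by linarith : 1 ≤ R) hη0 hη H (z := z) (by
    have one : ∀ y : Euc n, ‖y‖ ≤ R → ∀ h, ‖h‖ ≤ s → th2 w y h ≤ s ^ 2 → th3 w y h ≤ η * s ^ 3 := by
      intro y hy h hh ht
      have hb := hB y hy ((c * r) • A h) (by
        have := hU (y + (2:ℝ) • h) (by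
          refine (norm_add_le _ _).trans ?_
          rw [norm_smul]; norm_num; linarith)
        rwa [map_add, map_smul, smul_add, smul_comm (c * r) (2:ℝ), ← add_assoc] at this) (by
        have := hU (y - (2:ℝ) • h) (by
          refine (norm_sub_le _ _).trans ?_
          rw [norm_smul]; norm_num; linarith)
        rwa [map_sub, map_smul, smul_sub, smul_comm (c * r) (2:ℝ), ← add_sub_assoc] at this)
      rw [th2_chart u x hcr A y h, th3_chart u x hcr A y h, ← hw] at hb
      exact le_of_mul_le_mul_left (hb (by gcongr)) hcr2
    intro y hy h hh ht
    have o1 := one y hy h hh ht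
    have o2 := one y hy (-h) (by rwa [norm_neg]) (by
      refine le_trans (le_of_eq ?_) ht
      unfold th2; rw [sub_neg_eq_add, ← sub_eq_add_neg]; ring)
    rw [show th3 w y (-h) = - th3 w y h by
      unfold th3; simp only [smul_neg, sub_neg_eq_add, ← sub_eq_add_neg]; ring] at o2
    exact abs_le.2 ⟨by linarith, o1⟩) hz
  have hQp : ∀ x, x ≠ 0 → 0 < Q x x := fun x hx => by
    have := (abs_le.1 (H.nr x)).1
    have : 0 < ‖x‖ ^ 2 := by have := norm_pos_iff.2 hx; positivity
    linarith
  obtain ⟨B, -, hBQ, -, -⟩ := simdiag H.sQ H.sQ hQp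
  have hBdet : B.det ^ 2 = 1 := by
    have := det_matB_comp Q (innerSL ℝ) B (fun x y => by rw [hBQ, innerSL_apply_apply])
    rw [matB_inner, H.dt, Matrix.det_one, mul_one] at this
    exact this.symm
  have hBn : ∀ z : Euc n, ‖B z‖ ≤ 2 * ‖z‖ := by
    intro z
    have h1 := (abs_le.1 (H.nr (B z))).1
    rw [hBQ, real_inner_self_eq_norm_sq] at h1
    refine le_of_sq_le_sq ?_ (by positivity)
    nlinarith only [h1, sq_nonneg ‖z‖]
  have key : ∀ z : Euc n, r • (A.comp B) z = (c * r) • A (c⁻¹ • B z) := by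
    intro z
    rw [map_smul, smul_smul, ContinuousLinearMap.comp_apply]
    congr 1; field_simp
  have hnz : ∀ z ∈ ball (0 : Euc n) 1, ‖c⁻¹ • B z‖ ≤ R := by
    intro z hz
    rw [mem_ball_zero_iff] at hz
    rw [norm_smul, norm_of_nonneg (by positivity), hR, div_eq_inv_mul]
    gcongr
    linarith [hBn z]
  refine ⟨A.comp B, ?_, ?_, ?_⟩
  · have : (A.comp B).det = A.det * B.det := by
      show LinearMap.det ((A : Euc n →ₗ[ℝ] Euc n) ∘ₗ (B : Euc n →ₗ[ℝ] Euc n)) = _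
      rw [LinearMap.det_comp]
    rw [this, mul_pow, hA, hBdet, mul_one]
  · intro z hz
    rw [key]
    exact hU _ ((hnz z hz).trans (by linarith))
  · refine ⟨c ^ 2 * α, (c ^ 2 * c⁻¹) • (l.comp B), 0, by simp, fun z hz => ?_⟩
    have h1 := hq _ (hnz z hz)
    simp only [map_smul, _root_.smul_apply, smul_eq_mul, hBQ, real_inner_self_eq_norm_sq] at h1
    have h2 : r⁻¹ ^ 2 * u (x + r • (A.comp B) z) = c ^ 2 * w (c⁻¹ • B z) := by
      rw [key, hw]
      field_simp
    simp only [h2]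
    have e : c ^ 2 * w (c⁻¹ • B z) - (c ^ 2 * α + ((c ^ 2 * c⁻¹) • (l.comp B)) z + ‖z‖ ^ 2 / 2 + (0 : Tri n) z z z)
        = c ^ 2 * (w (c⁻¹ • B z) - (α + c⁻¹ * l (B z) + 1/2 * (c⁻¹ * (c⁻¹ * ‖z‖ ^ 2)))) := by
      have e1 : ((c ^ 2 * c⁻¹) • (l.comp B)) z = (c ^ 2 * c⁻¹) * l (B z) := rfl
      have e2 : (0 : Tri n) z z z = 0 := rfl
      rw [e1, e2]
      field_simp
      ring
    rw [e, abs_mul, abs_of_nonneg (by positivity)]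
    calc c ^ 2 * _ ≤ 1 * _ := by
          gcongr
          exact pow_le_one₀ hc0.le hc1
      _ ≤ ε := by rw [one_mul]; exact h1.trans hE

/-- One step of the growth iteration. -/
lemma grow (h : Adm U u lam Lam) {C b s r ε θ η a : ℝ} (hC : 1 ≤ C) (hb0 : 0 < b)
    (hb1 : C * b ≤ 1/10^6) (hs : s = b ^ 5 / 128) (hr : 0 < r) (hε : ε ≤ 1/400)
    (hmax : ∀ a, η ≤ a → a ≤ 9 * C → ∀ s, s = b ^ 5 / 128 →
    ∀ w : FunE, ContinuousOn w (ball 0 1) → (∀ p, ‖p‖ ≤ 1/2 → ∃ α l Q K, LP w C b p α l Q K) →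
    ∀ h0 : Euc n, ‖h0‖ ≤ 2 * s → th2 w 0 h0 ≤ s ^ 2 → a * s ^ 3 < th3 w 0 h0 →
    (∀ y, ‖y‖ ≤ 1/8 → ∀ h, ‖h‖ ≤ 2 * s → th2 w y h ≤ s ^ 2 → th3 w y h ≤ (1 + θ) * a * s ^ 3) → False)
    (hy : y ∈ U) (hA : A.det ^ 2 = 1)
    (hU : ∀ z ∈ ball (0 : Euc n) 1, y + r • A z ∈ U) (hS : St (fun z => r⁻¹ ^ 2 * u (y + r • A z)) 0 ε)
    (hLP : ∀ p, ‖p‖ ≤ 1/2 → ∃ α l Q K, LP (fun z => r⁻¹ ^ 2 * u (y + r • A z)) C b p α l Q K) (ha : η ≤ a) (hB : ¬ Bd U u r s y a) :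
    ∃ y' ∈ Sec U u y (r ^ 2), ¬ Bd U u r s y' ((1 + θ) * a) := by
  obtain ⟨hs0, hs1, ha1, ha2⟩ := s_arith hC hb0 hb1 hs
  obtain ⟨α, l, Q, K, H⟩ := hLP 0 (by simp)
  have haC : a ≤ 9 * C := by
    by_contra hcon
    exact hB ((bd_always h.cw hC hb0 hb1 hs hr hy hA H).mono hs0.le (not_le.1 hcon).le)
  have hB' := hB
  unfold Bd at hB'
  push Not at hB'
  obtain ⟨k, k1, k2, k3, k4⟩ := hB'
  obtain ⟨z, hz, hzn, g1, g2⟩ := chart_h h.cw hC hb0 hb1 hs hr hy hA H k1 k2 k3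
  rw [g2] at k4
  have hr2 : 0 < r ^ 2 := by positivity
  have := mt (hmax a ha haC s hs _ (chart_adm h hr hA hU).cd.continuousOn hLP z hzn g1 (lt_of_mul_lt_mul_left k4 hr2.le)) id
  push Not at this
  obtain ⟨y', hy', h', hh', t2, t3⟩ := this
  refine ⟨y + r • A y', flat_sec h hy hr hε hU hS (by linarith), fun hcon => ?_⟩
  have := hcon (r • A h') (by
        have := hU (y' + (2:ℝ) • h') (by
          rw [mem_ball_zero_iff]
          refine (norm_add_le _ _).trans_lt ?_
          rw [norm_smul]; norm_num; linarith)
        rwa [map_add, map_smul, smul_add, smul_comm r (2:ℝ), ← add_assoc] at this) (by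
        have := hU (y' - (2:ℝ) • h') (by
          rw [mem_ball_zero_iff]
          refine (norm_sub_le _ _).trans_lt ?_
          rw [norm_smul]; norm_num; linarith)
        rwa [map_sub, map_smul, smul_sub, smul_comm r (2:ℝ), ← add_sub_assoc] at this)
  rw [th2_chart u y hr A y' h', th3_chart u y hr A y' h'] at this
  have := le_of_mul_le_mul_left (this (by gcongr)) hr2
  linarith

set_option maxHeartbeats 1000000 in
lemma step (hn : 1 ≤ n) {ε : ℝ} (hε : 0 < ε) : ∃ ε' N d c1 : ℝ, 0 < ε' ∧ ε' ≤ ε ∧ 0 < N ∧ 0 < d ∧ d ≤ 1 ∧ 2 * d ≤ ε' ∧ 0 < c1 ∧ c1 ≤ 1/2 ∧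
    ∀ (U : Set (Euc n)) (u : FunE), Adm U u (exp (-d)) (exp d) → Bornology.IsBounded U → ∀ K ⊆ U, ∀ r, 0 < r →
    (∀ y ∈ U, closure (Sec U u y (N ^ 2 * (c1 * r) ^ 2)) ⊆ K → flat ε' U u y (c1 * r)) →
    ∀ x ∈ U, closure (Sec U u x (N ^ 2 * r ^ 2)) ⊆ K → flat ε' U u x r := by
  obtain ⟨C, ε0, ρ1, hC, hε0, hε01, hρ0, hρ1, HL⟩ := LOC2 hn
  obtain ⟨ε', hε'⟩ : ∃ ε', ε' = min ε ε0 := ⟨_, rfl⟩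
  have hε'0 : 0 < ε' := by rw [hε']; exact lt_min hε hε0
  have hε'1 : ε' ≤ ε0 := by rw [hε']; exact min_le_right _ _
  have hΘ : (1:ℝ) ≤ exp 2 := Real.one_le_exp (by norm_num)
  obtain ⟨c, hc0, hc1, HE⟩ := engulf hn hΘ
  obtain ⟨e, he0, he1, HS⟩ := sec_shrink hn hΘ
  obtain ⟨c1, hc1e⟩ : ∃ c1, c1 = min c (1/2) := ⟨_, rfl⟩
  have hc10 : 0 < c1 := by rw [hc1e]; exact lt_min hc0 (by norm_num)
  have hc1c : c1 ≤ c := by rw [hc1e]; exact min_le_left _ _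
  have hc12 : c1 ≤ 1/2 := by rw [hc1e]; exact min_le_right _ _
  obtain ⟨R, hR⟩ : ∃ R, R = 2 / c1 := ⟨_, rfl⟩
  have hR0 : 0 < R := by rw [hR]; positivity
  have hR2 : 2 ≤ R := by rw [hR, le_div_iff₀ hc10]; linarith
  have hR3 : 0 < R ^ 3 := by positivity
  obtain ⟨k, hk⟩ := pow_unbounded_of_one_lt (2 * (R + 1)) (one_lt_inv₀ (sub_pos.2 he1) |>.2 (by linarith : 1 - e < 1))
  obtain ⟨η, hηe⟩ : ∃ η, η = min (1 / (6 * R)) (ε' / (54 * R ^ 3)) := ⟨_, rfl⟩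
  have hη0 : 0 < η := by rw [hηe]; positivity
  have hη1 : 6 * R * η ≤ 1 := by
    have : η ≤ 1 / (6 * R) := by rw [hηe]; exact min_le_left _ _
    rwa [le_div_iff₀ (by positivity), mul_comm] at this
  have hη2 : 27 * R ^ 3 * η ≤ ε' / 2 := by
    have : η ≤ ε' / (54 * R ^ 3) := by rw [hηe]; exact min_le_right _ _
    rw [le_div_iff₀ (by positivity)] at this
    linarith
  have hη3 : η ≤ 1 := by nlinarith only [hη1, hR2, hη0]
  obtain ⟨θ, b0, hθ, hb0, HM⟩ := max_wrap hn hC hη0 hη3 (by linarith : 1 ≤ 9 * C)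
  obtain ⟨b1, hb1e⟩ : ∃ b1, b1 = min b0 (min (1 / 10 ^ 6 / C) (ε' / 2 / (10 ^ 7 * C * R ^ 3))) := ⟨_, rfl⟩
  have hb10 : 0 < b1 := by rw [hb1e]; positivity
  obtain ⟨k', hk'⟩ := exists_pow_lt_of_lt_one hb10 (by linarith : ρ1 < 1)
  obtain ⟨b, hbe⟩ : ∃ b, b = ρ1 ^ k' := ⟨_, rfl⟩
  rw [← hbe] at hk'
  have hbp : 0 < b := by rw [hbe]; positivity
  have hbb0 : b ≤ b0 := hk'.le.trans (by rw [hb1e]; exact min_le_left _ _)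
  have hb1 : C * b ≤ 1 / 10 ^ 6 := by
    have : b ≤ 1 / 10 ^ 6 / C := hk'.le.trans (by rw [hb1e]; exact (min_le_right _ _).trans (min_le_left _ _))
    rwa [le_div_iff₀ (by positivity), mul_comm] at this
  have hb2 : 10 ^ 7 * C * R ^ 3 * b ≤ ε' / 2 := by
    have : b ≤ ε' / 2 / (10 ^ 7 * C * R ^ 3) := hk'.le.trans (by rw [hb1e]; exact (min_le_right _ _).trans (min_le_right _ _))
    rwa [le_div_iff₀ (by positivity), mul_comm] at this
  obtain ⟨s, hs⟩ : ∃ s, s = b ^ 5 / 128 := ⟨_, rfl⟩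
  obtain ⟨d0, hd0, HL⟩ := HL k'
  rw [← hbe] at HL
  obtain ⟨m, hm⟩ := pow_unbounded_of_one_lt (9 * C / η) (by linarith : 1 < 1 + θ)
  obtain ⟨d, hde⟩ : ∃ d, d = min d0 (min 1 (ε' / 2)) := ⟨_, rfl⟩
  have hd : 0 < d := by rw [hde]; positivity
  have hdd0 : d ≤ d0 := by rw [hde]; exact min_le_left _ _
  have hd1 : d ≤ 1 := by rw [hde]; exact (min_le_right _ _).trans (min_le_left _ _)
  have hd2 : d ≤ ε' / 2 := by rw [hde]; exact (min_le_right _ _).trans (min_le_right _ _)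
  obtain ⟨N, hNe⟩ : ∃ N : ℝ, N = 4 * 2 ^ k + 4 / c ^ (m + 1) := ⟨_, rfl⟩
  have hcm : 1 ≤ 1 / c ^ (m + 1) := by
    rw [le_div_iff₀ (by positivity), one_mul]; exact pow_le_one₀ hc0.le hc1.le
  have h2k : (1:ℝ) ≤ 2 ^ k := one_le_pow₀ (by norm_num)
  have hN1 : 1 ≤ N := by rw [hNe, show 4 / c ^ (m + 1) = 4 * (1 / c ^ (m + 1)) by ring]; linarith
  have hN2 : 4 * 2 ^ k ≤ N ^ 2 := by
    have : N ≤ N ^ 2 := by nlinarith only [hN1]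
    have : 0 < 4 / c ^ (m + 1) := by positivity
    linarith
  have hN3 : 4 / c ^ (m + 1) ≤ N ^ 2 := by
    have : N ≤ N ^ 2 := by nlinarith only [hN1]
    linarith
  refine ⟨ε', N, d, c1, hε'0, by rw [hε']; exact min_le_left _ _, by linarith, hd, hd1, by linarith, hc10, hc12, ?_⟩
  intro U u hA hUb K hK r hr Hf x hx hx1
  have hΛ : exp d ≤ exp 2 * exp (-d) := by
    rw [← exp_add]; exact exp_le_exp.2 (by linarith)
  obtain ⟨T, hT⟩ : ∃ T, T = N ^ 2 * r ^ 2 := ⟨_, rfl⟩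
  obtain ⟨r1, hr1⟩ : ∃ r1, r1 = c1 * r := ⟨_, rfl⟩
  have hr10 : 0 < r1 := by rw [hr1]; positivity
  have hr1r : r1 ^ 2 ≤ r ^ 2 := by
    have : r1 ≤ r := by rw [hr1]; nlinarith only [hr, hc12]
    gcongr
  have hT0 : 0 < T := by rw [hT]; positivity
  rw [← hT] at hx1
  rw [← hr1] at Hf
  have hTr : ∀ q : ℝ, 0 ≤ q → 4 * q ≤ N ^ 2 → r1 ^ 2 * q ≤ T / 4 := by
    intro q hq h4
    calc r1 ^ 2 * q ≤ r ^ 2 * (N ^ 2 / 4) := by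
          apply mul_le_mul hr1r (by linarith) hq (by positivity)
      _ = T / 4 := by rw [hT]; ring
  have hxT : closure (Sec U u x T) ⊆ U := hx1.trans hK
  have hcT : N ^ 2 * r1 ^ 2 ≤ c * T := by
    rw [hr1, hT, show N ^ 2 * (c1 * r) ^ 2 = c1 ^ 2 * (N ^ 2 * r ^ 2) by ring]
    gcongr
    nlinarith only [hc10, hc12, hc1c]
  have flatD : ∀ y ∈ Sec U u x (T / 2), flat ε' U u y r1 := by
    intro y hy
    refine Hf y hy.1 ((closure_mono (Sec_mono hcT)).trans ?_)
    exact (HE U u _ _ hA hΛ hUb x y T hx hT0 hxT hy).trans (subset_closure.trans hx1)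
  have LPs : ∀ y ∈ U, ∀ A : EndE, A.det ^ 2 = 1 → (∀ z ∈ ball (0 : Euc n) 1, y + r1 • A z ∈ U) →
      St (fun z => r1⁻¹ ^ 2 * u (y + r1 • A z)) 0 ε' →
      ∀ p, ‖p‖ ≤ 1/2 → ∃ α l Q K, LP (fun z => r1⁻¹ ^ 2 * u (y + r1 • A z)) C b p α l Q K := by
    intro y hy A hAd hAU hS
    have hw := chart_adm hA hr10 hAd hAU
    refine HL _ ⟨hw.op, hw.cvx, hw.cw, hw.cd, exp_pos _, fun z hz => ⟨le_trans ?_ (hw.det z hz).1, (hw.det z hz).2.trans ?_⟩⟩ (St_mono hS le_rfl hε'1)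
    · exact exp_le_exp.2 (by linarith)
    · exact exp_le_exp.2 hdd0
  obtain ⟨A, hAd, hAU, hS⟩ := flatD x (mem_Sec_self hx (by linarith))
  have hε400 : ε' ≤ 1/400 := hε'1.trans hε01
  -- points of the enlarged chart
  have pts : ∀ z, ‖z‖ ≤ R + 1 → x + r1 • A z ∈ Sec U u x (T / 4) := by
    intro z hz
    obtain ⟨g, hg⟩ : ∃ g, g = (1 - e)⁻¹ ^ k := ⟨_, rfl⟩
    rw [← hg] at hk
    have hg0 : 0 < g := by linarith
    have h1 := flat_sec hA hx hr10 hε400 hAU hS (z := g⁻¹ • z) (by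
      rw [norm_smul, norm_of_nonneg (by positivity), inv_mul_le_iff₀ hg0]
      linarith)
    have h4 : closure (Sec U u x (T / 4)) ⊆ U := (closure_mono (Sec_mono (by linarith))).trans hxT
    have h2 := shrink_iter he0 he1 h4 (by linarith) (fun t' ht' hcl => HS U u _ _ hA hΛ x t' hx ht' (hUb.subset Sec_sub) hcl) k _
      (Sec_mono (by
        rw [le_div_iff₀ (by positivity)]
        exact hTr _ (by positivity) hN2) h1)
    rw [← hg, add_sub_cancel_left, map_smul, smul_comm r1, smul_smul, mul_inv_cancel₀ hg0.ne', one_smul] at h2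
    exact h2
  obtain ⟨α, l, Q, K', HP⟩ := LPs x hx A hAd hAU hS 0 (by simp)
  by_cases hall : ∀ z, ‖z‖ ≤ R → Bd U u r1 s (x + r1 • A z) η
  · subst hr1
    exact ext_flat hC hbp hb1 hs hr hc10 (by linarith) hR hη0.le hη1 (by linarith) hAd HP (fun z hz => (pts z hz).1) hall
  exfalso
  push Not at hall
  obtain ⟨z, hz, hnB⟩ := hall
  have iter : ∀ i ≤ m, ∃ y ∈ U, closure (Sec U u y (c ^ (i + 1) * (T / 2))) ⊆ Sec U u x (T / 2) ∧ ¬ Bd U u r1 s y ((1 + θ) ^ i * η) := by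
    intro i
    induction i with
    | zero =>
      intro _
      refine ⟨_, (pts z (by linarith)).1, ?_, by simpa using hnB⟩
      rw [zero_add, pow_one]
      refine HE U u _ _ hA hΛ hUb x _ (T / 2) hx (by linarith) ((closure_mono (Sec_mono (by linarith))).trans hxT) ?_
      rw [div_div]
      norm_num
      exact pts z (by linarith)
    | succ i ih =>
      intro him
      obtain ⟨y, hyU, hyc, hyB⟩ := ih (by omega)
      have hci : 0 < c ^ (i + 1) * (T / 2) := by positivity
      have hyD : y ∈ Sec U u x (T / 2) := hyc (subset_closure (mem_Sec_self hyU hci))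
      obtain ⟨A', hAd', hAU', hS'⟩ := flatD y hyD
      have h1 : η ≤ (1 + θ) ^ i * η := le_mul_of_one_le_left hη0.le (one_le_pow₀ (by linarith))
      obtain ⟨y', hy', hB'⟩ := grow hA hC hbp hb1 hs hr10 hε400 (HM b hbp hbb0) hyU hAd' hAU' hS' (LPs y hyU A' hAd' hAU' hS') h1 hyB
      refine ⟨y', hy'.1, ?_, by rw [pow_succ', mul_assoc]; exact hB'⟩
      have hrc : r1 ^ 2 ≤ c ^ (i + 1) * (T / 2) / 2 := by
        have h3 : 4 * (1 / c ^ (i + 1)) ≤ N ^ 2 := by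
          refine le_trans ?_ hN3
          rw [mul_one_div]
          apply div_le_div_of_nonneg_left (by norm_num) (by positivity)
          exact pow_le_pow_of_le_one hc0.le hc1.le (by omega)
        have := hTr _ (by positivity) h3
        rw [mul_one_div, div_le_iff₀ (by positivity)] at this
        linarith
      have h2 := HE U u _ _ hA hΛ hUb y y' _ hyU hci (hyc.trans Sec_sub) (Sec_mono hrc hy')
      rw [pow_succ', mul_assoc]
      exact h2.trans (subset_closure.trans hyc)
  obtain ⟨y, hyU, hyc, hyB⟩ := iter m le_rfl
  have hyD : y ∈ Sec U u x (T / 2) := hyc (subset_closure (mem_Sec_self hyU (by positivity)))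
  obtain ⟨A', hAd', hAU', hS'⟩ := flatD y hyD
  obtain ⟨α, l, Q, K', HP⟩ := LPs y hyU A' hAd' hAU' hS' 0 (by simp)
  refine hyB ((bd_always hA.cw hC hbp hb1 hs hr10 hyU hAd' HP).mono (by rw [hs]; positivity) ?_)
  rw [div_lt_iff₀ hη0] at hm
  exact hm.le

lemma taylor2 {H : BilE}
    (h1 : ∀ t ∈ Icc (0:ℝ) 1, ContDiffAt ℝ 2 v (x + t • y)) (h2 : ∀ t ∈ Icc (0:ℝ) 1, ‖D2 v (x + t • y) - H‖ ≤ τ) :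
    |v (x + y) - (v x + fderiv ℝ v x y + 1/2 * H y y)| ≤ τ * ‖y‖ ^ 2 := by
  have hD : ∀ t ∈ Icc (0:ℝ) 1, ‖D2 v (x + t • y) y y - H y y‖ ≤ τ * ‖y‖ ^ 2 := by
    intro t ht
    have := norm_bil (h2 t ht) y y
    rw [mul_assoc, ← sq] at this
    exact this
  have z0 : (0:ℝ) ∈ Icc (0:ℝ) 1 := by simp
  have g1 : ∀ t ∈ Icc (0:ℝ) 1, ‖fderiv ℝ v (x + t • y) y - (fderiv ℝ v x y + t * H y y)‖ ≤ τ * ‖y‖ ^ 2 := by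
    intro t ht
    have hd : ∀ s ∈ Icc (0:ℝ) 1, HasDerivWithinAt
        (fun s : ℝ => fderiv ℝ v (x + s • y) y - s * H y y) (D2 v (x + s • y) y y - H y y) (Icc 0 1) s := by
      intro s hs
      have := (hasDerivAt_line2 (u := v) (x := x) (h := y) y (h1 s hs)).fun_sub ((hasDerivAt_id' s).mul_const (H y y))
      rw [one_mul] at this
      exact this.hasDerivWithinAt
    have := (convex_Icc (0:ℝ) 1).norm_image_sub_le_of_norm_hasDerivWithin_le hd hD z0 ht
    simp only [zero_smul, add_zero, zero_mul, sub_zero] at this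
    have h3 : τ * ‖y‖ ^ 2 * ‖t‖ ≤ τ * ‖y‖ ^ 2 := by
      apply mul_le_of_le_one_right ((norm_nonneg _).trans (hD 0 z0))
      rw [norm_of_nonneg ht.1]; exact ht.2
    refine le_trans (le_of_eq ?_) (this.trans h3)
    congr 1; ring
  have hd : ∀ s ∈ Icc (0:ℝ) 1, HasDerivWithinAt
        (fun s : ℝ => v (x + s • y) - (s * fderiv ℝ v x y + s ^ 2 * (1/2 * H y y))) (fderiv ℝ v (x + s • y) y - (fderiv ℝ v x y + s * H y y)) (Icc 0 1) s := by
      intro s hs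
      have := (hasDerivAt_line (u := v) (x := x) (h := y) ((h1 s hs).differentiableAt (by norm_num))).fun_sub
        (((hasDerivAt_id' s).mul_const (fderiv ℝ v x y)).fun_add ((hasDerivAt_pow 2 s).mul_const (1/2 * H y y)))
      refine (this.congr_deriv ?_).hasDerivWithinAt
      norm_num
      ring
  have := (convex_Icc (0:ℝ) 1).norm_image_sub_le_of_norm_hasDerivWithin_le hd g1 z0 (right_mem_Icc.2 zero_le_one)
  simp only [zero_smul, add_zero, one_smul, sub_zero, norm_one, mul_one] at this
  rw [← norm_eq_abs]
  refine le_trans (le_of_eq ?_) this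
  congr 1; ring

lemma local_flat (hn : 1 ≤ n) {d ε : ℝ} (hd0 : 0 < d) (hd1 : d ≤ 1) (hd2 : 2 * d ≤ ε)
    (hA : Adm U u (exp (-d)) (exp d)) {x0 : Euc n} (hx0 : x0 ∈ U) :
    ∃ δ > 0, ∀ x ∈ ball x0 δ, ∀ r, 0 < r → r < δ → flat ε U u x r := by
  have hc := hA.cda hx0
  obtain ⟨D, hD⟩ : ∃ D, D = hessDet u x0 := ⟨_, rfl⟩
  have hDb := hA.det x0 hx0
  rw [← hD] at hDb
  have hD0 : 0 < D := (exp_pos _).trans_le hDb.1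
  have hpd := posDef_hess hA.op hA.cw hA.cd hx0 (by rw [← hD]; exact hD0)
  obtain ⟨B, -, hB, -, -⟩ := simdiag (D2_symm hc) (D2_symm hc) (fun x hx => posDef_matB_apply _ hpd x hx)
  have hBdet : B.det ^ 2 * D = 1 := by
    have := det_matB_comp (D2 u x0) (innerSL ℝ) B (fun x y => by rw [hB, innerSL_apply_apply])
    rw [matB_inner, ← hessianMatrix_eq, Matrix.det_one] at this
    rw [hD]; exact this.symm
  have hn0 : (0:ℝ) < n := by exact_mod_cast hn
  obtain ⟨μ, hμ⟩ : ∃ μ, μ = D ^ (1 / (n:ℝ)) := ⟨_, rfl⟩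
  have hμ0 : 0 < μ := by rw [hμ]; exact Real.rpow_pos_of_pos hD0 _
  have hμn : μ ^ n = D := by
    rw [hμ, ← Real.rpow_natCast, ← Real.rpow_mul hD0.le, one_div_mul_cancel hn0.ne', Real.rpow_one]
  have hμ1 : |μ - 1| ≤ 2 * d := by
    have hn1 : (1:ℝ) ≤ n := by exact_mod_cast hn
    have e1 : μ ≤ exp d := by
      refine le_of_pow_le_pow_left₀ (by omega : n ≠ 0) (exp_pos _).le ?_
      rw [hμn]
      exact hDb.2.trans (le_self_pow₀ (Real.one_le_exp hd0.le) (by omega))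
    have e2 : exp (-d) ≤ μ := by
      refine le_of_pow_le_pow_left₀ (by omega : n ≠ 0) hμ0.le ?_
      rw [hμn]
      refine le_trans ?_ hDb.1
      exact pow_le_of_le_one (exp_pos _).le (Real.exp_le_one_iff.2 (by linarith)) (by omega)
    have e3 : |exp d - 1| ≤ 2 * |d| := Real.abs_exp_sub_one_le (by rw [abs_of_pos hd0]; exact hd1)
    rw [abs_of_pos hd0] at e3
    have e4 := add_one_le_exp (-d)
    have e5 := (abs_le.1 e3).2
    exact abs_le.2 ⟨by linarith, by linarith⟩
  obtain ⟨A, hAe⟩ : ∃ A, A = √μ • B := ⟨_, rfl⟩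
  have hAdet : A.det ^ 2 = 1 := by
    have : A.det = √μ ^ n * B.det := by
      have : (√μ • B).det = LinearMap.det (√μ • (B : Euc n →ₗ[ℝ] Euc n)) := rfl
      rw [hAe, this, LinearMap.det_smul]
      simp
    rw [this, mul_pow, ← pow_mul, mul_comm n 2, pow_mul, sq_sqrt hμ0.le, hμn, mul_comm]
    exact hBdet
  have hAH : ∀ z, D2 u x0 (A z) (A z) = μ * ‖z‖ ^ 2 := by
    intro z
    have : A z = √μ • B z := by rw [hAe]; rfl
    rw [this]
    simp only [map_smul, _root_.smul_apply, smul_eq_mul, hB, real_inner_self_eq_norm_sq]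
    rw [← mul_assoc, Real.mul_self_sqrt hμ0.le]
  obtain ⟨τ, hτ⟩ : ∃ τ, τ = ε / (2 * (‖A‖ ^ 2 + 1)) := ⟨_, rfl⟩
  have hτ0 : 0 < τ := by rw [hτ]; have : 0 < ε := by linarith
                         positivity
  have hτA : τ * ‖A‖ ^ 2 ≤ ε / 2 := by
    have : τ * (‖A‖ ^ 2 + 1) = ε / 2 := by rw [hτ]; field_simp
    linarith
  have hcont : ContinuousAt (D2 u) x0 := by
    have := (hc.fderiv_right (m := 1) (by norm_num)).fderiv_right (m := 0) (by norm_num)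
    exact this.continuousAt
  have hev : ∀ᶠ y in 𝓝 x0, y ∈ U := hA.op.mem_nhds hx0
  obtain ⟨r0, hr0, hb⟩ := Metric.eventually_nhds_iff_ball.1 (hev.and (hcont.eventually (Metric.ball_mem_nhds _ hτ0)))
  refine ⟨r0 / (1 + ‖A‖), by positivity, fun x hx r hr hrδ => ?_⟩
  obtain ⟨δ, hδ⟩ : ∃ δ, δ = r0 / (1 + ‖A‖) := ⟨_, rfl⟩
  rw [← hδ] at hx hrδ
  have hδr : δ + δ * ‖A‖ = r0 := by rw [hδ]; field_simp
  have hmem : ∀ z ∈ ball (0 : Euc n) 1, ∀ t ∈ Icc (0:ℝ) 1, x + t • r • A z ∈ ball x0 r0 := by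
    intro z hz t ht
    rw [mem_ball_zero_iff] at hz
    rw [mem_ball_iff_norm] at hx ⊢
    rw [show x + t • r • A z - x0 = (x - x0) + t • r • A z by abel]
    refine (norm_add_le _ _).trans_lt ?_
    rw [← hδr]
    refine add_lt_add_of_lt_of_le hx ?_
    rw [norm_smul, norm_smul, norm_of_nonneg ht.1, norm_of_nonneg hr.le]
    calc t * (r * ‖A z‖) ≤ 1 * (δ * (‖A‖ * 1)) := by
          have := A.le_opNorm z
          gcongr
          · exact ht.2
          · linarith
          · exact this.trans (by gcongr)
      _ = _ := by ring
  refine ⟨A, hAdet, fun z hz => ?_, r⁻¹ ^ 2 * u x, (r⁻¹ ^ 2 * r) • (fderiv ℝ u x).comp A, 0, by simp, fun z hz => ?_⟩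
  · have := hmem z hz 1 (by simp)
    rw [one_smul] at this
    exact (hb _ this).1
  have ht := taylor2 (v := u) (x := x) (y := r • A z) (H := D2 u x0) (τ := τ) (fun t ht => hA.cda (hb _ (hmem z hz t ht)).1)
    (fun t ht => by have := (hb _ (hmem z hz t ht)).2; rw [dist_eq_norm] at this; exact this.le)
  simp only [map_smul, _root_.smul_apply, smul_eq_mul, hAH] at ht
  rw [norm_smul, norm_of_nonneg hr.le] at ht
  have hz1 : ‖z‖ ≤ 1 := by rw [mem_ball_zero_iff] at hz; exact hz.le
  have hAz : ‖A z‖ ≤ ‖A‖ := (A.le_opNorm z).trans (by nlinarith only [norm_nonneg A, hz1])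
  have e1 : ((r⁻¹ ^ 2 * r) • (fderiv ℝ u x).comp A) z = r⁻¹ ^ 2 * r * fderiv ℝ u x (A z) := rfl
  have e2 : (0 : Tri n) z z z = 0 := rfl
  rw [e1, e2]
  obtain ⟨X, hX⟩ : ∃ X, X = u (x + r • A z) - (u x + r * fderiv ℝ u x (A z) + 1/2 * (r * (r * (μ * ‖z‖ ^ 2)))) := ⟨_, rfl⟩
  rw [← hX] at ht
  have e : r⁻¹ ^ 2 * u (x + r • A z) - (r⁻¹ ^ 2 * u x + r⁻¹ ^ 2 * r * fderiv ℝ u x (A z) + ‖z‖ ^ 2 / 2 + 0) =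
      r⁻¹ ^ 2 * X + 1/2 * (μ - 1) * ‖z‖ ^ 2 := by
    rw [hX]; field_simp; ring
  rw [e]
  refine (abs_add_le _ _).trans ?_
  have b1 : |r⁻¹ ^ 2 * X| ≤ ε / 2 := by
    rw [abs_mul, abs_of_nonneg (by positivity)]
    calc r⁻¹ ^ 2 * |X| ≤ r⁻¹ ^ 2 * (τ * (r * ‖A‖) ^ 2) := by
          gcongr
          exact ht.trans (by gcongr)
      _ = τ * ‖A‖ ^ 2 := by field_simp
      _ ≤ _ := hτA
  have b2 : |1/2 * (μ - 1) * ‖z‖ ^ 2| ≤ d := by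
    rw [abs_mul, abs_mul, abs_of_nonneg (sq_nonneg ‖z‖), abs_of_pos (by norm_num : (0:ℝ) < 1/2)]
    calc 1/2 * |μ - 1| * ‖z‖ ^ 2 ≤ 1/2 * (2 * d) * 1 := by
          gcongr
          exact pow_le_one₀ (norm_nonneg _) hz1
      _ = d := by ring
  linarith

lemma flat.mono {ε ε' : ℝ} (h : flat ε U u x r) (he : ε ≤ ε') : flat ε' U u x r := by
  obtain ⟨A, h1, h2, h3⟩ := h
  exact ⟨A, h1, h2, St_mono h3 le_rfl he⟩

lemma stage2 (hn : 1 ≤ n) {ε : ℝ} (hε : 0 < ε) : ∃ N d : ℝ, 0 < N ∧ 0 < d ∧ d ≤ 1 ∧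
    ∀ (U : Set (Euc n)) (u : FunE), Adm U u (exp (-d)) (exp d) → Bornology.IsBounded U → ∀ x ∈ U, ∀ r, 0 < r →
    closure (Sec U u x (2 * (N ^ 2 * r ^ 2))) ⊆ U → flat ε U u x r := by
  obtain ⟨ε', N, d, c, hε'0, hε', hN, hd0, hd1, hd2, hc0, hc1, HS⟩ := step hn hε
  refine ⟨N, d, hN, hd0, hd1, fun U u hA hb xc hxc r hr hcl => ?_⟩
  obtain ⟨K, hK⟩ : ∃ K, K = Sec U u xc (2 * (N ^ 2 * r ^ 2)) := ⟨_, rfl⟩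
  have hKU : K ⊆ U := by rw [hK]; exact Sec_sub
  rw [← hK] at hcl
  have hcpt : IsCompact (closure K) := (hb.subset hKU).isCompact_closure
  obtain ⟨δ, hδ, Hδ⟩ : ∃ δ > 0, ∀ x ∈ closure K, ∀ r, 0 < r → r < δ → flat ε' U u x r := by
    refine hcpt.induction_on (p := fun S => ∃ δ > 0, ∀ x ∈ S, ∀ r, 0 < r → r < δ → flat ε' U u x r) ⟨1, one_pos, by simp⟩ ?_ ?_ ?_
    · rintro s t hst ⟨δ, h0, h⟩
      exact ⟨δ, h0, fun x hx => h x (hst hx)⟩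
    · rintro s t ⟨δ, h0, h⟩ ⟨δ', h0', h'⟩
      refine ⟨min δ δ', lt_min h0 h0', fun x hx r hr hrd => ?_⟩
      rcases hx with hx | hx
      · exact h x hx r hr (hrd.trans_le (min_le_left _ _))
      · exact h' x hx r hr (hrd.trans_le (min_le_right _ _))
    · intro x hx
      obtain ⟨δ, h0, h⟩ := local_flat hn hd0 hd1 hd2 hA (hcl hx)
      exact ⟨_, mem_nhdsWithin_of_mem_nhds (Metric.ball_mem_nhds x h0), δ, h0, h⟩
  have key : ∀ k : ℕ, ∀ r, 0 < r → c ^ k * r < δ → ∀ x ∈ U, closure (Sec U u x (N ^ 2 * r ^ 2)) ⊆ K → flat ε' U u x r := by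
    intro k
    induction k with
    | zero =>
      intro r hr hrd x hx hcl
      rw [pow_zero, one_mul] at hrd
      exact Hδ x (subset_closure (hcl (subset_closure (mem_Sec_self hx (by positivity))))) r hr hrd
    | succ k ih =>
      intro r hr hrd x hx hcl
      exact HS U u hA hb K hKU r hr (ih (c * r) (by positivity) (by rw [← mul_assoc, ← pow_succ]; exact hrd)) x hx hcl
  obtain ⟨k, hk⟩ := exists_pow_lt_of_lt_one (div_pos hδ hr) (by linarith : c < 1)
  rw [lt_div_iff₀ hr] at hk
  refine (key k r hr hk xc hxc ?_).mono hε'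
  rw [hK]
  have : 0 < N ^ 2 * r ^ 2 := by positivity
  exact sec_clos hA (by linarith) (by rw [← hK]; exact hcl)

lemma mod_le {F q : ℝ} (hb : ∀ z ∈ U, 1 ≤ f z ∧ f z ≤ F)
    (hx : x ∈ U) (hy : y ∈ U) (hd : dist x y ≤ q) : |f x - f y| ≤ modCont f U q := by
  refine le_csSup ⟨F, ?_⟩ ⟨x, hx, y, hy, hd, rfl⟩
  rintro _ ⟨a, ha, b, hb', -, rfl⟩
  have := hb a ha; have := hb b hb'
  rw [abs_le]; constructor <;> linarith

lemma mod_nonneg (f : FunE) (U : Set (Euc n)) (q : ℝ) : 0 ≤ modCont f U q := by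
  refine Real.sSup_nonneg ?_
  rintro _ ⟨a, -, b, -, -, rfl⟩; exact abs_nonneg _

lemma mod_mono {F s t : ℝ} (hb : ∀ z ∈ U, 1 ≤ f z ∧ f z ≤ F)
    (h : s ≤ t) : modCont f U s ≤ modCont f U t := by
  refine Real.sSup_le ?_ (mod_nonneg _ _ _)
  rintro _ ⟨a, ha, b, hb', hd, rfl⟩; exact mod_le hb ha hb' (hd.trans h)

lemma sum_dini {w : ℝ → ℝ} (hw : Monotone w) (h0 : ∀ s, 0 ≤ w s) {q : ℝ} (hq : 0 < q)
    (hi : IntegrableOn (fun s => w s / s) (Ioc 0 q)) (k : ℕ) :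
    ∑ j ∈ Finset.range k, w (q / 2 ^ (j + 1)) ≤ 2 * ∫ s in Ioc 0 q, w s / s := by
  have hs : ∀ k : ℕ, Ioc (q / 2 ^ k) q ⊆ Ioc 0 q := fun k => Ioc_subset_Ioc_left (by positivity)
  have H : ∑ j ∈ Finset.range k, w (q / 2 ^ (j + 1)) ≤ 2 * ∫ s in Ioc (q / 2 ^ k) q, w s / s := by
    induction k with
    | zero => simp
    | succ k ih =>
      have e : q / 2 ^ k = 2 * (q / 2 ^ (k + 1)) := by field_simp; ring
      obtain ⟨p, hp⟩ : ∃ p, p = q / 2 ^ (k + 1) := ⟨_, rfl⟩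
      have hp0 : 0 < p := by rw [hp]; positivity
      have hpq : 2 * p ≤ q := by rw [hp, ← e]; exact div_le_self hq.le (one_le_pow₀ (by norm_num))
      have h1 := hs k
      rw [e, ← hp] at ih h1
      have hsub : Ioc p (2 * p) ⊆ Ioc 0 q := Ioc_subset_Ioc hp0.le hpq
      rw [Finset.sum_range_succ, ← hp, ← Ioc_union_Ioc_eq_Ioc (by linarith : p ≤ 2 * p) hpq,
        setIntegral_union (Ioc_disjoint_Ioc_of_le le_rfl) measurableSet_Ioc (hi.mono_set hsub) (hi.mono_set h1)]
      have := setIntegral_ge_of_const_le_real (c := w p / (2 * p)) measurableSet_Ioc (by simp)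
        (fun s (hs : s ∈ Ioc p (2 * p)) => div_le_div₀ (h0 s) (hw hs.1.le) (hp0.trans hs.1) hs.2) (hi.mono_set hsub)
      rw [Real.volume_real_Ioc_of_le (by linarith)] at this
      have e2 : w p / (2 * p) * (2 * p - p) = w p / 2 := by field_simp; ring
      linarith
  refine H.trans (mul_le_mul_of_nonneg_left ?_ (by norm_num))
  exact setIntegral_mono_set hi ((ae_restrict_iff' measurableSet_Ioc).2
    (ae_of_all _ fun s hs => div_nonneg (h0 s) hs.1.le)) (ae_of_all _ (hs k))

lemma low_bd {L : EndE} {X : ℝ} (hX : 1 ≤ X) (hL : ‖L‖ ≤ X) (z : Euc n) :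
    |L.det| * ‖z‖ ≤ n * (n * (n.factorial * X ^ n)) * ‖L z‖ := by
  have hb : ∀ i : Fin n, ‖(bv i : Euc n)‖ = 1 := fun i => by simp [bv]
  have he : ∀ i j, |matL L i j| ≤ X := fun i j =>
    (coord_le_norm _ _).trans ((L.le_opNorm _).trans (by rw [hb]; linarith))
  have ha : ∀ i j, |(matL L).adjugate i j| ≤ n.factorial * X ^ n := by
    intro i j
    rw [Matrix.adjugate_apply]
    have := Matrix.det_le (abv := IsAbsoluteValue.toAbsoluteValue (abs : ℝ → ℝ)) (A := (matL L).updateRow j (Pi.single i 1)) (x := X) ?_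
    · simpa using this
    · intro a b
      by_cases h : a = j
      · subst h
        simp only [Matrix.updateRow_self, Pi.single_apply]
        split_ifs <;> simp <;> linarith
      · rw [Matrix.updateRow_ne h]; exact he a b
  have hv : ∀ i, L z i = ∑ j, matL L i j * z j := by
    intro i
    conv_lhs => rw [vec_eq_sum z]
    simp [matL, mul_comm]
  have hc : ∀ i, L.det * z i = ∑ j, (matL L).adjugate i j * L z j := by
    intro i
    have h1 := congrFun (congrArg (fun M => M.mulVec (fun j => z j)) (Matrix.adjugate_mul (matL L))) i
    simp only [← Matrix.mulVec_mulVec, Matrix.smul_mulVec, Matrix.one_mulVec, det_matL] at h1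
    simp only [Matrix.mulVec, dotProduct, Pi.smul_apply, smul_eq_mul, ← hv] at h1
    exact h1.symm
  calc |L.det| * ‖z‖ ≤ |L.det| * ∑ i, |z i| := mul_le_mul_of_nonneg_left (norm_le_sum_coord z) (abs_nonneg _)
    _ = ∑ i, |L.det * z i| := by rw [mul_sum]; simp only [abs_mul]
    _ ≤ ∑ _i : Fin n, ∑ _j : Fin n, n.factorial * X ^ n * ‖L z‖ := by
        refine sum_le_sum fun i _ => ?_
        rw [hc]
        refine (abs_sum_le_sum_abs _ _).trans (sum_le_sum fun j _ => ?_)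
        rw [abs_mul]
        exact mul_le_mul (ha i j) (coord_le_norm _ _) (abs_nonneg _) (by positivity)
    _ = _ := by simp; ring

lemma opnorm_bd {b : BilE} (hs : SymB b) (h0 : ∀ h, 0 ≤ b h h)
    (hc0 : 0 ≤ c) (hc : ∀ h, b h h ≤ c * ‖h‖ ^ 2) : matOpNorm (matB b) ≤ n * n * c := by
  have hb : ∀ i : Fin n, b (bv i) (bv i) ≤ c := fun i => by simpa [bv] using hc (bv i)
  have he : ∀ i j, |matB b i j| ≤ c := by
    intro i j
    have h1 := h0 (bv i + bv j); have h2 := h0 (bv i - bv j)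
    simp only [map_add, map_sub, _root_.add_apply, _root_.sub_apply] at h1 h2
    have := hs (bv i) (bv j); have := hb i; have := hb j
    change |b (bv i) (bv j)| ≤ c
    rw [abs_le]; constructor <;> linarith
  refine ContinuousLinearMap.opNorm_le_bound _ (by positivity) fun x => ?_
  refine (norm_le_sum_coord _).trans ?_
  calc _ ≤ ∑ _i : Fin n, ∑ _j : Fin n, c * ‖x‖ := by
        refine sum_le_sum fun i _ => ?_
        have : (Matrix.toEuclideanCLM (𝕜 := ℝ) (matB b) x) i = ∑ j, matB b i j * x j := by
          simp [Matrix.ofLp_toEuclideanCLM, Matrix.mulVec, dotProduct]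
        rw [this]
        refine (abs_sum_le_sum_abs _ _).trans (sum_le_sum fun j _ => ?_)
        rw [abs_mul]
        exact mul_le_mul (he i j) (coord_le_norm _ _) (abs_nonneg _) hc0
    _ = _ := by simp; ring

lemma ball_inner (ho : IsOpen Ω) (hx : x ∈ Ω) :
    ball x (Metric.infDist x (frontier Ω)) ⊆ Ω := by
  intro y hy
  by_contra hc
  have hd : ∀ z ∈ ball x (Metric.infDist x (frontier Ω)), z ∉ frontier Ω := fun z hz hf => by
    have := Metric.infDist_le_dist_of_mem hf (x := x)
    rw [mem_ball, dist_comm] at hz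
    linarith
  have hcl : ∀ z ∈ ball x (Metric.infDist x (frontier Ω)), z ∉ Ω → z ∉ closure Ω := fun z hz hn h =>
    hd z hz ⟨h, by rwa [ho.interior_eq]⟩
  obtain ⟨z, -, hz, hz'⟩ := (convex_ball x (Metric.infDist x (frontier Ω))).isPreconnected Ω (closure Ω)ᶜ ho
    isClosed_closure.isOpen_compl (fun z hz => (em (z ∈ Ω)).imp id (hcl z hz))
    ⟨x, Metric.mem_ball_self (dist_nonneg.trans_lt hy), hx⟩ ⟨y, hy, hcl y hy hc⟩
  exact hz' (subset_closure hz)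

lemma vlow (hn : 1 ≤ n) {lam Lam κ ρ : ℝ} (h : Dom Ω v lam Lam)
    (hΩ : Ω ⊆ ball 0 (n : ℝ)) (hκ : 0 < κ) (hκ1 : κ ≤ 1/2) (hκ2 : 4 * n * κ ≤ ρ)
    (hx : x ∈ innerSet Ω ρ) (hz : z ∈ Ω) : κ * -v z ≤ -v x := by
  have hk : 0 < 1 - κ := by linarith
  have hy : x + (κ / (1 - κ)) • (x - z) ∈ Ω := by
    refine ball_inner h.op hx.1 ?_
    have h1 := mem_ball_zero_iff.1 (hΩ hx.1); have h2 := mem_ball_zero_iff.1 (hΩ hz)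
    have h3 := norm_sub_le x z
    rw [mem_ball, dist_eq_norm, add_sub_cancel_left, norm_smul, norm_of_nonneg (by positivity)]
    refine lt_of_le_of_lt (le_trans ?_ hκ2) hx.2
    have : κ / (1 - κ) ≤ 2 * κ := by rw [div_le_iff₀ hk]; nlinarith only [hκ, hκ1]
    calc _ ≤ 2 * κ * (2 * n) := mul_le_mul this (by linarith) (norm_nonneg _) (by positivity)
      _ = _ := by ring
  have hc := h.cw.2 hy hz hk.le hκ.le (by ring)
  have e : (1 - κ) • (x + (κ / (1 - κ)) • (x - z)) + κ • z = x := by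
    rw [smul_add, smul_smul, mul_div_cancel₀ _ hk.ne']; module
  rw [e] at hc
  simp only [smul_eq_mul] at hc
  have := mul_nonpos_of_nonneg_of_nonpos hk.le (h.nonpos hn hy)
  linarith

lemma sec_t (hn : 1 ≤ n) {Θ : ℝ} (hΘ : 1 ≤ Θ) : ∃ m : ℕ, 1 ≤ m ∧ ∀ ρ : ℝ, 0 < ρ → ∃ t : ℝ, 0 < t ∧
    ∀ (Ω : Set (Euc n)) (v : FunE), Dom Ω v 1 Θ → ball 0 1 ⊆ Ω → Ω ⊆ ball 0 (n : ℝ) →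
    ∀ x ∈ innerSet Ω ρ, ∀ q, 0 < q → q ≤ ρ → Sec Ω v x (t * q ^ m) ⊆ closedBall x (q / 2) := by
  have hn0 : (0:ℝ) < n := by exact_mod_cast hn
  obtain ⟨c, hc0, hc1, HS⟩ := sec_shrink (n := n) hn hΘ
  obtain ⟨m, hm⟩ := exists_pow_lt_of_lt_one (by norm_num : (0:ℝ) < 1/2) (by linarith : 1 - c < 1)
  have hc : 0 < 1 - c := by linarith
  refine ⟨m, Nat.one_le_iff_ne_zero.2 fun h => by rw [h] at hm; norm_num at hm, fun ρ hρ => ?_⟩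
  obtain ⟨κ, hκ⟩ : ∃ κ, κ = min (1/2) (ρ / (4 * n)) := ⟨_, rfl⟩
  have hκ0 : 0 < κ := by rw [hκ]; positivity
  have hκ1 : κ ≤ 1/2 := hκ ▸ min_le_left _ _
  have hκ2 : 4 * n * κ ≤ ρ := by
    have : κ ≤ ρ / (4 * n) := hκ ▸ min_le_right _ _
    rw [le_div_iff₀ (by positivity)] at this; linarith
  obtain ⟨c', hc', HL⟩ := lemL_good (n := n) hn hΘ hκ0
  refine ⟨c' * (κ * (1/8)) * (1 - c) ^ m / (4 * n + ρ) ^ m, by positivity, ?_⟩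
  intro Ω v hD h1 hΩ x hx q hq hqρ
  have hv := fun z (hz : z ∈ Ω) => vlow hn hD hΩ hκ0 hκ1 hκ2 hx hz
  have hv0 : v 0 ≤ -1/8 := parab_bound hn (hD.cd.mono h1) (hD.cw.subset h1 (convex_ball _ _))
    (fun z hz => (hD.det z (h1 hz)).1) fun z hz => hD.nonpos hn (h1 hz)
  have hlow : κ * (1/8) ≤ -v x :=
    (mul_le_mul_of_nonneg_left (by linarith) hκ0.le).trans (hv 0 (h1 (Metric.mem_ball_self one_pos)))
  have hcl := HL Ω v 1 Θ (-v x / κ) (-v x) hD (by simp)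
    (fun z hz => by rw [le_div_iff₀ hκ0]; linarith [hv z hz]) (by linarith [mul_pos hκ0 (by norm_num : (0:ℝ) < 1/8)])
    (by rw [mul_div_cancel₀ _ hκ0.ne']) x hx.1 le_rfl (c' * (κ * (1/8))) (mul_le_mul_of_nonneg_left hlow hc'.le)
  obtain ⟨t, ht⟩ : ∃ t, t = c' * (κ * (1/8)) := ⟨_, rfl⟩
  rw [← ht] at hcl ⊢
  have ht0 : 0 < t := by rw [ht]; positivity
  obtain ⟨k, hk1, hk2⟩ := exists_nat_pow_near_of_lt_one (x := q / (4 * n + ρ)) (y := 1 - c) (by positivity)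
    (by rw [div_le_one (by positivity)]; linarith) hc (by linarith)
  have hle : t * (1 - c) ^ m / (4 * n + ρ) ^ m * q ^ m ≤ t / 2 ^ (k + 1) := by
    calc _ = t * ((1 - c) ^ m * (q / (4 * n + ρ)) ^ m) := by rw [div_pow]; ring
      _ ≤ t * ((1 - c) ^ m * ((1 - c) ^ k) ^ m) := by gcongr
      _ = t * ((1 - c) ^ m) ^ (k + 1) := by ring
      _ ≤ t * (1 / 2) ^ (k + 1) := by gcongr
      _ = _ := by rw [one_div, inv_pow]; rfl
  intro z hz
  have hz2 := shrink_iter hc0 hc1 hcl ht0 (fun t' ht' hg => HS Ω v 1 Θ hD.adm (by simp) x t' hx.1 ht'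
    (hD.bdd.subset Sec_sub) hg) (k + 1) z (Sec_mono hle hz)
  have h3 := mem_ball_zero_iff.1 (hΩ (Sec_sub hz2)); have h4 := mem_ball_zero_iff.1 (hΩ hx.1)
  have h5 := norm_sub_le (x + ((1 - c)⁻¹ ^ (k + 1)) • (z - x)) x
  have hp : 0 < (1 - c) ^ (k + 1) := by positivity
  rw [inv_pow] at h3
  rw [add_sub_cancel_left, norm_smul, norm_of_nonneg (by positivity), inv_pow, inv_mul_le_iff₀ hp] at h5
  rw [mem_closedBall, dist_eq_norm]
  calc ‖z - x‖ ≤ q / (4 * n + ρ) * (2 * n) := h5.trans (mul_le_mul hk1.le (by linarith) (by positivity) (by positivity))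
    _ ≤ q / (4 * n) * (2 * n) := by gcongr; linarith
    _ = _ := by field_simp; norm_num

lemma pow_ratio {a b e : ℝ} (ha : 1 ≤ a) (hb : 1 ≤ b) (h : |b - a| ≤ e) (n : ℕ) :
    exp (-(n * e)) * a ^ n ≤ b ^ n ∧ b ^ n ≤ exp (n * e) * a ^ n := by
  have he : 0 ≤ e := (abs_nonneg _).trans h
  have H : ∀ a b : ℝ, 1 ≤ a → 1 ≤ b → b - a ≤ e → b ^ n ≤ exp (n * e) * a ^ n := by
    intro a b ha hb h
    rw [exp_nat_mul, ← mul_pow]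
    have := mul_le_mul (add_one_le_exp e) (le_refl a) (by linarith) (exp_pos e).le
    exact pow_le_pow_left₀ (by linarith) (by nlinarith only [this, ha, he, h]) n
  have := abs_le.1 h
  refine ⟨?_, H a b ha hb this.2⟩
  rw [Real.exp_neg, inv_mul_le_iff₀ (exp_pos _)]
  exact H b a hb ha (by linarith)
end

/-- Main theorem, interior `C²` bound: if `f` is Dini continuous then
`sup_{Ω_ρ} |D²v| ≤ Q_in E₀` with `E₀ = exp(β ∫₀^{q_in} ω_f(q) dq/q)`. -/
theorem main_hessian_bound_dini (n : ℕ) (hn : 2 ≤ n) :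
    ∃ Cmc β : ℝ, 0 < Cmc ∧ 0 < β ∧
      ∀ fmax : ℝ, ∃ a : ℝ, 0 < a ∧
        ∀ ρ : ℝ, 0 < ρ → ∃ K : ℝ, 0 < K ∧
          ∀ (Ω : Set (Euc n)) (v f : Euc n → ℝ),
            IsOpen Ω → Convex ℝ Ω →
            Metric.ball 0 1 ⊆ Ω → Ω ⊆ Metric.ball 0 (n : ℝ) →
            ContDiffOn ℝ 2 v Ω → ContinuousOn v (closure Ω) → ConvexOn ℝ Ω v →
            (∀ z ∈ Ω, hessDet v z = f z ^ n) →
            (∀ z ∈ frontier Ω, v z = 0) →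
            (∀ z ∈ Ω, 1 ≤ f z ∧ f z ≤ fmax) →
            ∀ qin : ℝ, 0 < qin → qin ≤ ρ →
              modCont f (innerSet Ω (ρ - qin)) qin ≤ Cmc →
              IntegrableOn (fun q => modCont f Ω q / q) (Set.Ioc (0 : ℝ) qin) →
              ∀ x ∈ innerSet Ω ρ,
                matOpNorm (hessianMatrix v x) ≤
                  K * qin ^ (-a) *
                    Real.exp (β * ∫ q in Set.Ioc (0 : ℝ) qin, modCont f Ω q / q) := by
  have hn1 : 1 ≤ n := by omega
  have hn0 : (0:ℝ) < n := by exact_mod_cast hn1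
  obtain ⟨C3, ε2, hC3, hε2, H3⟩ := stage3 (n := n) hn1
  obtain ⟨N, d, hN, hd, -, H2⟩ := stage2 (n := n) hn1 hε2
  obtain ⟨c, hc⟩ : ∃ c, c = min d ε2 / n := ⟨_, rfl⟩
  have hc0 : 0 < c := by rw [hc]; positivity
  have hnc : n * c = min d ε2 := by rw [hc, mul_div_cancel₀ _ hn0.ne']
  refine ⟨c, 2 * n * C3 + 1, hc0, by positivity, fun fmax => ?_⟩
  obtain ⟨F, hF⟩ : ∃ F, F = max fmax 1 := ⟨_, rfl⟩
  have hF1 : 1 ≤ F := hF ▸ le_max_right _ _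
  have hF0 : 0 < F := by linarith
  obtain ⟨m, hm, Ht⟩ := sec_t (n := n) hn1 (one_le_pow₀ hF1 : 1 ≤ F ^ n)
  refine ⟨(m * (n - 1) : ℕ), by exact_mod_cast Nat.mul_pos hm (by omega), fun ρ hρ => ?_⟩
  obtain ⟨t, ht, Ht⟩ := Ht ρ hρ
  obtain ⟨k0, hk0⟩ : ∃ k0, k0 = t / (2 * F * N ^ 2) := ⟨_, rfl⟩
  have hk : 0 < k0 := by rw [hk0]; positivity
  obtain ⟨P, hP⟩ : ∃ P, P = n * (n * (n.factorial * (ρ + 1) ^ n)) := ⟨_, rfl⟩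
  have hP0 : 0 < P := by rw [hP]; positivity
  refine ⟨n * n * (4 * exp (C3 * (1 + n * c)) * (F * P ^ 2 / k0 ^ (n - 1))), by positivity, ?_⟩
  intro Ω v f ho hcx hB hΩ hcd hct hcv hdet hfr hf q hq hqρ hmc hint x hx
  have hfF : ∀ z ∈ Ω, f z ≤ F := fun z hz => (hf z hz).2.trans (hF ▸ le_max_left _ _)
  have hD : Dom Ω v 1 (F ^ n) := ⟨ho, hcx, Metric.isBounded_ball.subset hΩ, hcv, hcd, hct, hfr, one_pos,
    fun z hz => by
      rw [hdet z hz]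
      exact ⟨one_le_pow₀ (hf z hz).1, pow_le_pow_left₀ (by linarith [(hf z hz).1]) (hfF z hz) n⟩⟩
  have hsec := Ht Ω v hD hB hΩ x hx q hq hqρ
  have hx1 : 1 ≤ f x := (hf x hx.1).1
  have hfx : 0 < f x := by linarith
  have hU : closedBall x q ⊆ Ω := fun y hy =>
    ball_inner ho hx.1 (lt_of_le_of_lt (mem_closedBall.1 hy) (hqρ.trans_lt hx.2))
  have hU' : ball x q ⊆ Ω := ball_subset_closedBall.trans hU
  have hosc : ∀ y ∈ closedBall x q, |f y - f x| ≤ c := by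
    intro y hy
    have h1 := Metric.infDist_le_infDist_add_dist (x := x) (y := y) (s := frontier Ω)
    have hy' := mem_closedBall.1 hy
    have := hx.2
    refine (mod_le (fun z hz => hf z hz.1) (U := innerSet Ω (ρ - q)) ⟨hU hy, ?_⟩ ⟨hx.1, by linarith⟩ hy').trans hmc
    rw [dist_comm] at hy'; linarith
  -- Chart at scale r from the small-oscillation theory.
  obtain ⟨r, hr⟩ : ∃ r, r = √(k0 * q ^ m) := ⟨_, rfl⟩
  have hr0 : 0 < r := by rw [hr]; positivity
  have hr2 : r ^ 2 = k0 * q ^ m := by rw [hr, sq_sqrt (by positivity)]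
  have hadm : Adm (ball x q) (fun z => (f x)⁻¹ * v z) (exp (-d)) (exp d) := by
    refine ⟨isOpen_ball, convex_ball _ _, ?_, contDiffOn_const.mul (hcd.mono hU'), exp_pos _, ?_⟩
    · exact (hcv.subset hU' (convex_ball _ _)).smul (inv_pos.2 hfx).le
    · intro z hz
      have hz' := ball_subset_closedBall hz
      have h1 := pow_ratio hx1 (hf z (hU hz')).1 (hosc z hz') n
      have h2 : n * c ≤ d := hnc ▸ min_le_left _ _
      have hp : 0 < f x ^ n := by positivity
      rw [hessDet_const_mul, hdet z (hU hz'), inv_pow, le_inv_mul_iff₀ hp, inv_mul_le_iff₀ hp, mul_comm, mul_comm (f x ^ n)]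
      exact ⟨le_trans (by gcongr) h1.1, h1.2.trans (by gcongr)⟩
  have hfl := H2 _ _ hadm Metric.isBounded_ball x (Metric.mem_ball_self hq) r hr0 (by
    refine (closure_minimal (fun z hz => hsec ⟨hU' hz.1, ?_⟩) Metric.isClosed_closedBall).trans
      (Metric.closedBall_subset_ball (by linarith))
    have h1 := hz.2
    have e : Breg (fun z => (f x)⁻¹ * v z) x z = (f x)⁻¹ * Breg v x z := by
      rw [Breg, Breg, fderiv_const_mul ((hD.cda hx.1).differentiableAt two_ne_zero), _root_.smul_apply, smul_eq_mul]; ring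
    rw [e, inv_mul_lt_iff₀ hfx] at h1
    refine h1.trans_le ?_
    calc _ ≤ F * (2 * (N ^ 2 * r ^ 2)) := by gcongr; exact hfF x hx.1
      _ = _ := by rw [hr2, hk0]; field_simp)
  obtain ⟨A, hA, hAU, hSt⟩ := hfl
  obtain ⟨L, hL⟩ : ∃ L, L = r • A := ⟨_, rfl⟩
  have hLA : ∀ z, L z = r • A z := fun z => by rw [hL]; rfl
  have hLd : L.det ^ 2 = (r ^ n) ^ 2 := by rw [hL, det_smulL, mul_pow, hA, mul_one]
  have hLd' : |L.det| = r ^ n := by rw [← sq_eq_sq₀ (abs_nonneg _) (by positivity), sq_abs, hLd]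
  have hLq : ‖L‖ ≤ q := by
    refine ContinuousLinearMap.opNorm_le_of_unit_norm hq.le fun z hz => ?_
    by_contra hlt
    push Not at hlt
    have hpos := hq.trans hlt
    have := hAU ((q / ‖L z‖) • z) (by
      rw [mem_ball_zero_iff, norm_smul, hz, mul_one, norm_of_nonneg (by positivity), div_lt_one hpos]; exact hlt)
    rw [← hLA, map_smul, mem_ball, dist_eq_norm, add_sub_cancel_left, norm_smul,
      norm_of_nonneg (by positivity), div_mul_cancel₀ _ hpos.ne'] at this
    exact lt_irrefl _ this
  have hmono : Monotone (modCont f Ω) := fun s t h => mod_mono hf h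
  obtain ⟨I, hI⟩ : ∃ I, I = ∫ s in Ioc 0 q, modCont f Ω s / s := ⟨_, rfl⟩
  have hI0 : 0 ≤ I := by
    rw [hI]; exact setIntegral_nonneg measurableSet_Ioc fun s hs => div_nonneg (mod_nonneg _ _ _) hs.1.le
  have hsum := sum_dini hmono (mod_nonneg f Ω) hq hint
  rw [← hI] at hsum ⊢
  have hδ : ∀ s, 0 ≤ n * min c (modCont f Ω s) ∧ n * min c (modCont f Ω s) ≤ ε2 := fun s =>
    ⟨mul_nonneg hn0.le (le_min hc0.le (mod_nonneg _ _ _)),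
      (mul_le_mul_of_nonneg_left (min_le_left _ _) hn0.le).trans (hnc ▸ min_le_right _ _)⟩
  have key := H3 Ω v x (f x ^ n) q (r⁻¹ ^ 2 * (f x)⁻¹) (r ^ n / P) (n * c + n * (2 * I))
    (fun j => n * min c (modCont f Ω (q / 2 ^ j))) L ho hcv hcd (by positivity) (fun j => hδ _) (by
      intro k
      refine (Finset.sum_le_sum_of_subset_of_nonneg (Finset.range_mono k.le_succ) fun j _ _ => (hδ _).1).trans ?_
      rw [Finset.sum_range_succ', add_comm]
      refine add_le_add (mul_le_mul_of_nonneg_left (min_le_left _ _) hn0.le) ?_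
      rw [← mul_sum]
      exact mul_le_mul_of_nonneg_left ((sum_le_sum fun j _ => min_le_right _ _).trans (hsum k)) hn0.le) (by
      intro j y hy hyx
      rw [hdet y hy]
      refine pow_ratio hx1 (hf y hy).1 (le_min (hosc y ?_) (mod_le hf hy hx.1 (by rwa [dist_eq_norm]))) n
      rw [mem_closedBall, dist_eq_norm]
      exact hyx.trans (div_le_self hq.le (one_le_pow₀ (by norm_num)))) (by positivity) (by
      rw [hLd, mul_pow, ← pow_mul, ← pow_mul, mul_comm n 2, inv_pow, inv_pow]; field_simp) hLq
    (fun z hz => by rw [hLA]; exact hU' (hAU z hz)) (by positivity) (fun z => by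
      have := low_bd (X := ρ + 1) (by linarith) (hLq.trans (by linarith)) z
      rw [hLd', ← hP] at this
      rw [div_mul_eq_mul_div, div_le_iff₀ hP0]; linarith) (by
      convert hSt using 2 with z
      rw [hLA]; ring)
  have hs := D2_symm (hD.cda hx.1)
  rw [hessianMatrix_eq]
  refine (opnorm_bd hs (D2_nonneg ho hcv hcd hx.1) (by positivity) key).trans ?_
  have e1 : r⁻¹ ^ 2 * (f x)⁻¹ * (r ^ n / P) ^ 2 = k0 ^ (n - 1) * q ^ (m * (n - 1)) / (f x * P ^ 2) := by
    have : (r ^ n) ^ 2 = r ^ 2 * (r ^ 2) ^ (n - 1) := by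
      rw [← pow_succ', Nat.sub_add_cancel hn1, ← pow_mul, ← pow_mul, mul_comm]
    rw [div_pow, this, inv_pow, pow_mul, ← mul_pow, ← hr2]; field_simp
  have e2 : C3 * (1 + (n * c + n * (2 * I))) = C3 * (1 + n * c) + 2 * n * C3 * I := by ring
  rw [e1, e2, exp_add, Real.rpow_neg hq.le, Real.rpow_natCast]
  have hE : exp (2 * n * C3 * I) ≤ exp ((2 * n * C3 + 1) * I) := exp_le_exp.2 (by linarith)
  calc _ = n * n * (4 * exp (C3 * (1 + n * c)) * (f x * P ^ 2 / k0 ^ (n - 1))) * (q ^ (m * (n - 1)))⁻¹ *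
        exp (2 * n * C3 * I) := by field_simp
    _ ≤ _ := by gcongr; exact hfF x hx.1
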